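/- Let Ω be an n-connected quadrature domain of finite area with no degenerate boundary components. Then there exist points a, b ∈ Ω and Ahlfors maps f_a of Ω at a and f_b of Ω at b such that for every proper holomorphic map f of Ω onto the open unit disc 𝔻 there exist polynomials P, Q ∈ ℂ[X,Y] with z ↦ Q(f_a(z), f_b(z)) not identically zero on Ω and f(z)·Q(f_a(z), f_b(z)) = P(f_a(z), f_b(z)) for all z ∈ Ω; that is, every proper holomorphic map of Ω onto the unit disc is a rational combination of f_a and f_b. -/

import Mathlib

open MeasureTheory Complex ComplexConjugate Metric Set

noncomputable section

/-- `f` belongs to the Bergman space `A²(Ω)`. -/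
def BergmanFun (Ω : Set ℂ) (f : ℂ → ℂ) : Prop :=
  DifferentiableOn ℂ f Ω ∧ IntegrableOn (fun z => ‖f z‖ ^ 2) Ω volume

/-- `Ω` is a finitely connected domain none of whose complementary components is a point. -/
def IsFinConnDomain (Ω : Set ℂ) : Prop :=
  IsOpen Ω ∧ IsConnected Ω ∧
  {C : Set ℂ | ∃ x ∈ Ωᶜ, C = connectedComponentIn Ωᶜ x}.Finite ∧
  ∀ x ∈ Ωᶜ, ¬ (connectedComponentIn Ωᶜ x).Subsingleton

/-- `Ω` is a quadrature domain. -/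
def IsQuadratureDomain (Ω : Set ℂ) : Prop :=
  ∃ N : ℕ, 0 < N ∧ ∃ (w : Fin N → ℂ) (n : Fin N → ℕ) (c : Fin N → ℕ → ℂ),
    (∀ j, w j ∈ Ω) ∧
    ∀ f : ℂ → ℂ, BergmanFun Ω f →
      (∫ z in Ω, f z) =
        ∑ j, ∑ k ∈ Finset.range (n j + 1), c j k * iteratedDerivWithin k f Ω (w j)

/-- `fa` is an Ahlfors map of `Ω` at `a`. -/
def IsAhlforsMap (Ω : Set ℂ) (a : ℂ) (fa : ℂ → ℂ) : Prop :=
  DifferentiableOn ℂ fa Ω ∧ (∀ z ∈ Ω, ‖fa z‖ < 1) ∧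
  (deriv fa a).im = 0 ∧ 0 < (deriv fa a).re ∧
  ∀ g : ℂ → ℂ, DifferentiableOn ℂ g Ω → (∀ z ∈ Ω, ‖g z‖ < 1) →
    ‖deriv g a‖ ≤ (deriv fa a).re

/-- `Ω` is bounded with `C^∞` smooth boundary consisting of finitely many disjoint
simple closed curves. -/
def HasSmoothBoundary (Ω : Set ℂ) : Prop :=
  Bornology.IsBounded Ω ∧
  ∃ (n : ℕ) (γ : Fin n → ℝ → ℂ),
    (∀ i, ContDiff ℝ (⊤ : ℕ∞) (γ i)) ∧
    (∀ i, Function.Periodic (γ i) (2 * Real.pi)) ∧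
    (∀ i, InjOn (γ i) (Ico 0 (2 * Real.pi))) ∧
    (∀ i t, deriv (γ i) t ≠ 0) ∧
    (Pairwise fun i j => Disjoint (range (γ i)) (range (γ j))) ∧
    frontier Ω = ⋃ i, range (γ i)

/-- Partial derivative in the `x`-direction of a real-valued function on `ℂ`. -/
def pdx (u : ℂ → ℝ) (z : ℂ) : ℝ := deriv (fun t : ℝ => u (z + (t : ℂ))) 0

/-- Partial derivative in the `y`-direction of a real-valued function on `ℂ`. -/
def pdy (u : ℂ → ℝ) (z : ℂ) : ℝ := deriv (fun t : ℝ => u (z + (t : ℂ) * Complex.I)) 0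

/-- `f` is a proper holomorphic map of `Ω` onto the open unit disc. -/
def IsProperOntoDisc (Ω : Set ℂ) (f : ℂ → ℂ) : Prop :=
  DifferentiableOn ℂ f Ω ∧ f '' Ω = ball (0 : ℂ) 1 ∧
  ∀ L : Set ℂ, L ⊆ ball (0 : ℂ) 1 → IsCompact L → IsCompact (Ω ∩ f ⁻¹' L)

/-- `g` is `(m, δ)`-close to the identity on `closure Ω`. -/
def CloseToId (Ω : Set ℂ) (m : ℕ) (δ : ℝ) (g : ℂ → ℂ) : Prop :=
  ∀ k ≤ m, ∀ z ∈ closure Ω, ‖iteratedFDeriv ℝ k (fun w => g w - w) z‖ ≤ δ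

/-- `σ : [0,1] → ℂ` is a piecewise continuously differentiable curve. -/
def PiecewiseC1On01 (σ : ℝ → ℂ) : Prop :=
  ContinuousOn σ (Icc 0 1) ∧ ∃ s : Finset ℝ, ContDiffOn ℝ 1 σ (Icc (0 : ℝ) 1 \ s)

/-- `Ω` is a generalized quadrature domain. -/
def IsGenQuadratureDomain (Ω : Set ℂ) : Prop :=
  ∃ (N M : ℕ) (w : Fin N → ℂ) (n : Fin N → ℕ) (c : Fin N → ℕ → ℂ)
    (b : Fin M → ℂ) (σ : Fin M → ℝ → ℂ),
    (∀ j, w j ∈ Ω) ∧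
    (∀ m, PiecewiseC1On01 (σ m)) ∧
    (∀ m, ∀ t ∈ Icc (0 : ℝ) 1, σ m t ∈ Ω) ∧
    ∀ f : ℂ → ℂ, BergmanFun Ω f →
      (∫ z in Ω, f z) =
        (∑ j, ∑ k ∈ Finset.range (n j + 1), c j k * iteratedDerivWithin k f Ω (w j)) +
        ∑ m, b m * ∫ t in (0 : ℝ)..1, f (σ m t) * deriv (σ m) t

open Filter Topology
open scoped Real

theorem isOpen_diff_of_discrete {Ω C : Set ℂ} (hΩ : IsOpen Ω)
    (hC : ∀ z ∈ Ω, ∀ᶠ w in 𝓝[≠] z, w ∉ C) : IsOpen (Ω \ C) := by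
  refine isOpen_iff_mem_nhds.2 fun z hz => ?_
  filter_upwards [eventually_nhdsWithin_iff.1 (hC z hz.1), hΩ.mem_nhds hz.1] with w hw hwΩ
  refine ⟨hwΩ, ?_⟩
  rcases eq_or_ne w z with rfl | h
  exacts [hz.2, hw h]

theorem exists_holomorphic_extension {Ω C : Set ℂ} (hΩ : IsOpen Ω)
    (hC : ∀ z ∈ Ω, ∀ᶠ w in 𝓝[≠] z, w ∉ C) {f : ℂ → ℂ} (hf : DifferentiableOn ℂ f (Ω \ C))
    (ho : ∀ c ∈ Ω ∩ C, Tendsto (fun z => (z - c) * f z) (𝓝[≠] c) (𝓝 0)) :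
    ∃ F : ℂ → ℂ, DifferentiableOn ℂ F Ω ∧ EqOn F f (Ω \ C) := by
  have hd : ∀ z ∈ Ω \ C, DifferentiableAt ℂ f z := fun z hz =>
    hf.differentiableAt ((isOpen_diff_of_discrete hΩ hC).mem_nhds hz)
  have heq : EqOn (fun z => limUnder (𝓝[≠] z) f) f (Ω \ C) := fun z hz =>
    ((hd z hz).continuousAt.tendsto.mono_left nhdsWithin_le_nhds).limUnder_eq
  refine ⟨fun z => limUnder (𝓝[≠] z) f, fun z hz => ?_, heq⟩
  by_cases hzC : z ∈ C
  · obtain ⟨s, hs, hso, hzs⟩ := _root_.eventually_nhds_iff.1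
      ((eventually_nhdsWithin_iff.1 (hC z hz)).and (hΩ.mem_nhds hz))
    have hsub : s \ {z} ⊆ Ω \ C := fun w hw => ⟨(hs w hw.1).2, (hs w hw.1).1 hw.2⟩
    have := differentiableOn_update_limUnder_of_isLittleO (hso.mem_nhds hzs) (hf.mono hsub) (by
      have h1 : Tendsto (fun w => (w - z) * (f w - f z)) (𝓝[≠] z) (𝓝 0) := by
        have h2 : Tendsto (fun w => (w - z) * f z) (𝓝[≠] z) (𝓝 0) :=
          (Continuous.tendsto' (by fun_prop) _ _ (by simp)).mono_left nhdsWithin_le_nhds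
        simpa [mul_sub] using (ho z ⟨hz, hzC⟩).sub h2
      rw [Asymptotics.isLittleO_iff_tendsto']
      · refine h1.congr' ?_
        filter_upwards with w
        simp [div_eq_mul_inv, mul_comm]
      · filter_upwards [self_mem_nhdsWithin] with w hw h
        exact absurd h (inv_ne_zero (sub_ne_zero.2 hw)))
    refine ((this.differentiableAt (hso.mem_nhds hzs)).congr_of_eventuallyEq
      ?_).differentiableWithinAt
    filter_upwards [hso.mem_nhds hzs] with w hw
    rcases eq_or_ne w z with rfl | h
    · simp
    · rw [Function.update_of_ne h]; exact heq (hsub ⟨hw, h⟩)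
  · exact ((hd z ⟨hz, hzC⟩).congr_of_eventuallyEq (heq.eventuallyEq_of_mem
      ((isOpen_diff_of_discrete hΩ hC).mem_nhds ⟨hz, hzC⟩))).differentiableWithinAt

theorem diff_dense_of_discrete {Ω C : Set ℂ} (hΩ : IsOpen Ω)
    (hC : ∀ z ∈ Ω, ∀ᶠ w in 𝓝[≠] z, w ∉ C) {z : ℂ} (hz : z ∈ Ω) : z ∈ closure (Ω \ C) := by
  have h : ∀ᶠ w in 𝓝[≠] z, w ∈ Ω \ C := by
    filter_upwards [hC z hz, nhdsWithin_le_nhds (hΩ.mem_nhds hz)] with w h1 h2 using ⟨h2, h1⟩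
  rw [mem_closure_iff_frequently]
  exact h.frequently.filter_mono nhdsWithin_le_nhds

theorem isPreconnected_diff_of_discrete {Ω C : Set ℂ} (hΩ : IsOpen Ω) (hc : IsPreconnected Ω)
    (hC : ∀ z ∈ Ω, ∀ᶠ w in 𝓝[≠] z, w ∉ C) : IsPreconnected (Ω \ C) := by
  apply isPreconnected_of_forall_constant
  intro φ hφ
  have ho := isOpen_diff_of_discrete hΩ hC
  let f : ℂ → ℂ := fun z => if φ z then 1 else 0
  have hloc : ∀ z ∈ Ω \ C, ∀ᶠ w in 𝓝 z, f w = f z := by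
    intro z hz
    have : ContinuousAt φ z := hφ.continuousAt (ho.mem_nhds hz)
    have h2 : ∀ᶠ w in 𝓝 z, φ w = φ z := this ((isOpen_discrete {φ z}).mem_nhds rfl)
    filter_upwards [h2] with w hw
    simp [f, hw]
  have hfd : DifferentiableOn ℂ f (Ω \ C) := fun z hz =>
    ((differentiableAt_const (f z)).congr_of_eventuallyEq (hloc z hz)).differentiableWithinAt
  obtain ⟨F, hF, hFf⟩ := exists_holomorphic_extension hΩ hC hfd (by
    intro c hc
    have h2 : Tendsto (fun w => w - c) (𝓝[≠] c) (𝓝 0) :=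
      (Continuous.tendsto' (by fun_prop) _ _ (by simp)).mono_left nhdsWithin_le_nhds
    refine squeeze_zero_norm (a := fun w => ‖w - c‖) (fun w => ?_) (by simpa using h2.norm)
    simp only [f, norm_mul]
    split_ifs <;> simp)
  have hFan : AnalyticOnNhd ℂ F Ω := hF.analyticOnNhd hΩ
  intro x hx y hy
  have := hFan.eqOn_of_preconnected_of_eventuallyEq (g := fun _ => f x) analyticOnNhd_const hc hx.1
    (by filter_upwards [hloc x hx, ho.mem_nhds hx] with w h1 h2
        rw [hFf h2, h1])
  have h3 : f y = f x := by rw [← hFf hy]; exact this hy.1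
  simp only [f] at h3
  by_cases h1 : φ x = true <;> by_cases h2 : φ y = true <;> simp_all

theorem eventually_ne_zero_of_differentiableOn {Ω : Set ℂ} (hΩ : IsOpen Ω) (hc : IsPreconnected Ω)
    {g : ℂ → ℂ} (hg : DifferentiableOn ℂ g Ω) (hne : ∃ z ∈ Ω, g z ≠ 0) {z : ℂ} (hz : z ∈ Ω) :
    ∀ᶠ w in 𝓝[≠] z, g w ≠ 0 := by
  have han := hg.analyticOnNhd hΩ
  rcases (han z hz).eventually_eq_zero_or_eventually_ne_zero with h | h
  · obtain ⟨x, hx, hgx⟩ := hne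
    exact absurd (han.eqOn_zero_of_preconnected_of_eventuallyEq_zero hc hz h hx) hgx
  · exact h

theorem finite_zeros_of_differentiableOn {Ω : Set ℂ} (hΩ : IsOpen Ω) (hc : IsPreconnected Ω)
    {g : ℂ → ℂ} (hg : DifferentiableOn ℂ g Ω) (hne : ∃ z ∈ Ω, g z ≠ 0) {K : Set ℂ}
    (hK : IsCompact K) (hKΩ : K ⊆ Ω) : {z ∈ K | g z = 0}.Finite := by
  by_contra hinf
  obtain ⟨z, hz, hacc⟩ := Set.Infinite.exists_accPt_of_subset_isCompact hinf hK (fun z hz => hz.1)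
  have h := eventually_ne_zero_of_differentiableOn hΩ hc hg hne (hKΩ hz)
  rw [accPt_iff_frequently_nhdsNE] at hacc
  obtain ⟨w, h1, h2⟩ := (hacc.and_eventually h).exists
  exact h2 h1.2

theorem exists_factor_at {Ω : Set ℂ} (hΩ : IsOpen Ω) (hc : IsPreconnected Ω) {F : ℂ → ℂ}
    (hF : DifferentiableOn ℂ F Ω) (hne : ∃ z ∈ Ω, F z ≠ 0) {a : ℂ} (ha : a ∈ Ω) :
    ∃ (n : ℕ) (u : ℂ → ℂ), DifferentiableOn ℂ u Ω ∧ u a ≠ 0 ∧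
      ∀ z ∈ Ω, F z = (z - a) ^ n * u z := by
  have hnz : ¬ ∀ᶠ z in 𝓝 a, F z = 0 := fun h =>
    ((eventually_ne_zero_of_differentiableOn hΩ hc hF hne ha).and
      (nhdsWithin_le_nhds h)).exists.elim fun _ h => h.1 h.2
  obtain ⟨n, g, hg, hg0, hFg⟩ :=
    ((hF.analyticOnNhd hΩ a ha).exists_eventuallyEq_pow_smul_nonzero_iff).2 hnz
  refine ⟨n, fun z => if z = a then g a else F z / (z - a) ^ n, fun z hz => ?_, by simpa, ?_⟩
  · by_cases h : z = a
    · subst h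
      refine (hg.differentiableAt.congr_of_eventuallyEq ?_).differentiableWithinAt
      filter_upwards [hFg] with w hw
      by_cases hwz : w = z
      · simp [hwz]
      · have : (w - z) ^ n ≠ 0 := pow_ne_zero _ (sub_ne_zero.2 hwz)
        simp only [hwz, if_false, hw, smul_eq_mul]
        field_simp
    · have h1 : DifferentiableAt ℂ (fun z => F z / (z - a) ^ n) z :=
        (hF.differentiableAt (hΩ.mem_nhds hz)).div (by fun_prop)
          (pow_ne_zero _ (sub_ne_zero.2 h))
      refine (h1.congr_of_eventuallyEq ?_).differentiableWithinAt
      filter_upwards [isOpen_ne.mem_nhds h] with w hw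
      simp [show w ≠ a from hw]
  · intro z hz
    by_cases h : z = a
    · subst h; simpa using hFg.self_of_nhds
    · have : (z - a) ^ n ≠ 0 := pow_ne_zero _ (sub_ne_zero.2 h)
      simp only [h, if_false]
      field_simp

/-- `p` is a proper holomorphic map of the domain `Ω` onto the unit disc. -/
structure ProperDisc (Ω : Set ℂ) (p : ℂ → ℂ) : Prop where
  isOpen : IsOpen Ω
  preconn : IsPreconnected Ω
  diff : DifferentiableOn ℂ p Ω
  maps : ∀ z ∈ Ω, p z ∈ ball (0 : ℂ) 1
  surj : ∀ ζ ∈ ball (0 : ℂ) 1, ∃ z ∈ Ω, p z = ζ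
  proper : ∀ L : Set ℂ, L ⊆ ball (0 : ℂ) 1 → IsCompact L → IsCompact (Ω ∩ p ⁻¹' L)

/-- The fibre of `p` over `ζ` in `Ω`. -/
def fibre (Ω : Set ℂ) (p : ℂ → ℂ) (ζ : ℂ) : Set ℂ := Ω ∩ p ⁻¹' {ζ}

/-- The critical values of `p` on `Ω`. -/
def critVals (Ω : Set ℂ) (p : ℂ → ℂ) : Set ℂ := p '' {z ∈ Ω | deriv p z = 0}

/-- The trace of `F` along the fibres of `p`. -/
def trace (Ω : Set ℂ) (p F : ℂ → ℂ) (ζ : ℂ) : ℂ := ∑ᶠ z ∈ fibre Ω p ζ, F z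

namespace ProperDisc

variable {Ω : Set ℂ} {p : ℂ → ℂ} (hp : ProperDisc Ω p)
include hp

theorem exists_sub_ne_zero (ζ : ℂ) : ∃ z ∈ Ω, p z - ζ ≠ 0 := by
  by_contra! h
  obtain ⟨z, hz, h0⟩ := hp.surj 0 (by simp)
  obtain ⟨w, hw, h1⟩ := hp.surj (1 / 2) (by simp; norm_num)
  have a := h z hz
  have b := h w hw
  rw [h0] at a; rw [h1, ← a] at b
  norm_num at b

theorem finite_fibre {ζ : ℂ} (hζ : ζ ∈ ball (0 : ℂ) 1) : (fibre Ω p ζ).Finite := by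
  have hK := hp.proper {ζ} (by simpa using hζ) isCompact_singleton
  refine (finite_zeros_of_differentiableOn hp.isOpen hp.preconn
    (hp.diff.sub_const ζ) (hp.exists_sub_ne_zero ζ) hK inter_subset_left).subset ?_
  rintro z ⟨hz, hz'⟩
  exact ⟨⟨hz, hz'⟩, sub_eq_zero.2 hz'⟩

theorem exists_deriv_ne_zero : ∃ z ∈ Ω, deriv p z ≠ 0 := by
  by_contra! h
  obtain ⟨z, hz, h0⟩ := hp.surj 0 (by simp)
  obtain ⟨w, hw, h1⟩ := hp.exists_sub_ne_zero (p z)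
  exact h1 (sub_eq_zero.2 (hp.isOpen.is_const_of_deriv_eq_zero hp.preconn hp.diff
    (fun x hx => h x hx) hw hz))

theorem finite_crit {K : Set ℂ} (hK : IsCompact K) (hKΩ : K ⊆ Ω) :
    {z ∈ K | deriv p z = 0}.Finite :=
  finite_zeros_of_differentiableOn hp.isOpen hp.preconn (hp.diff.deriv hp.isOpen)
    hp.exists_deriv_ne_zero hK hKΩ

theorem finite_critVals {L : Set ℂ} (hL : IsCompact L) (hL1 : L ⊆ ball (0 : ℂ) 1) :
    (L ∩ critVals Ω p).Finite := by
  refine ((hp.finite_crit (hp.proper L hL1 hL) inter_subset_left).image p).subset ?_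
  rintro ζ ⟨h1, z, ⟨hz, hz'⟩, rfl⟩
  exact ⟨z, ⟨⟨hz, h1⟩, hz'⟩, rfl⟩

theorem discrete_critVals : ∀ ζ ∈ ball (0 : ℂ) 1, ∀ᶠ w in 𝓝[≠] ζ, w ∉ critVals Ω p := by
  intro ζ hζ
  obtain ⟨ε, hε, hsub⟩ := nhds_basis_closedBall.mem_iff.1 (isOpen_ball.mem_nhds hζ)
  have hfin := hp.finite_critVals (isCompact_closedBall ζ ε) hsub
  have h2 : ∀ᶠ w in 𝓝[≠] ζ, w ∉ (closedBall ζ ε ∩ critVals Ω p) \ {ζ} := by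
    have : ((closedBall ζ ε ∩ critVals Ω p) \ {ζ})ᶜ ∈ 𝓝 ζ :=
      (hfin.subset sdiff_subset).isClosed.isOpen_compl.mem_nhds (by simp)
    exact nhdsWithin_le_nhds this
  filter_upwards [h2, self_mem_nhdsWithin, nhdsWithin_le_nhds (closedBall_mem_nhds ζ hε)]
    with w h3 h4 h5 h6
  exact h3 ⟨⟨h5, h6⟩, h4⟩

theorem exists_localInverse {z : ℂ} (hz : z ∈ Ω) (hd : deriv p z ≠ 0) :
    ∃ w : ℂ → ℂ, w (p z) = z ∧ ContinuousAt w (p z) ∧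
      (∀ᶠ ζ in 𝓝 (p z), DifferentiableAt ℂ w ζ ∧ p (w ζ) = ζ ∧ w ζ ∈ Ω) ∧
      ∀ᶠ x in 𝓝 z, w (p x) = x := by
  have han : AnalyticAt ℂ p z := hp.diff.analyticOnNhd hp.isOpen z hz
  have hcd : ContDiffAt ℂ 1 p z := han.contDiffAt
  have hs : HasStrictFDerivAt p
      ((ContinuousLinearEquiv.unitsEquivAut ℂ (Units.mk0 _ hd) : ℂ ≃L[ℂ] ℂ) : ℂ →L[ℂ] ℂ) z :=
    (hcd.hasStrictDerivAt (by norm_num)).hasStrictFDerivAt_equiv hd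
  have hinv := hcd.to_localInverse (f' := ContinuousLinearEquiv.unitsEquivAut ℂ (Units.mk0 _ hd))
    hs.hasFDerivAt (by norm_num)
  set w := hcd.localInverse (f' := ContinuousLinearEquiv.unitsEquivAut ℂ (Units.mk0 _ hd))
    hs.hasFDerivAt (by norm_num) with hw
  have hw' : w = (hcd.hasStrictFDerivAt' hs.hasFDerivAt (by norm_num)).localInverse p _ z := rfl
  have hwz : w (p z) = z := by rw [hw']; exact HasStrictFDerivAt.localInverse_apply_image _
  refine ⟨w, hwz, hinv.continuousAt, ?_, ?_⟩
  · have h1 : ∀ᶠ ζ in 𝓝 (p z), DifferentiableAt ℂ w ζ := by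
      filter_upwards [hinv.eventually (by simp)] with ζ hζ
      exact hζ.differentiableAt (by norm_num)
    have h2 : ∀ᶠ ζ in 𝓝 (p z), p (w ζ) = ζ := by
      rw [hw']; exact HasStrictFDerivAt.eventually_right_inverse _
    have h3 : ∀ᶠ ζ in 𝓝 (p z), w ζ ∈ Ω :=
      hinv.continuousAt (hp.isOpen.mem_nhds (by rw [hwz]; exact hz))
    filter_upwards [h1, h2, h3] with ζ a b c using ⟨a, b, c⟩
  · rw [hw']; exact HasStrictFDerivAt.eventually_left_inverse _

theorem eventually_forall_fibre {c : ℂ} (hc : c ∈ ball (0 : ℂ) 1) {P : ℂ → Prop}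
    (h : ∀ z ∈ fibre Ω p c, ∀ᶠ x in 𝓝 z, P x) : ∀ᶠ ζ in 𝓝 c, ∀ x ∈ fibre Ω p ζ, P x := by
  obtain ⟨δ, hδ, hsub⟩ := nhds_basis_closedBall.mem_iff.1 (isOpen_ball.mem_nhds hc)
  have hcl : IsClosed (p '' ((Ω ∩ p ⁻¹' closedBall c δ) \ interior {x | P x})) :=
    (((hp.proper _ hsub (isCompact_closedBall c δ)).diff isOpen_interior).image_of_continuousOn
      (hp.diff.continuousOn.mono (sdiff_subset.trans inter_subset_left))).isClosed
  filter_upwards [hcl.isOpen_compl.mem_nhds fun ⟨z, hz, hzc⟩ =>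
    hz.2 (mem_interior_iff_mem_nhds.2 (h z ⟨hz.1.1, hzc⟩)), closedBall_mem_nhds c hδ]
    with ζ h1 h2 x hx
  by_contra hcon
  exact h1 ⟨x, ⟨⟨hx.1, by rwa [mem_preimage, show p x = ζ from hx.2]⟩,
    fun h => hcon (interior_subset h)⟩, hx.2⟩

theorem exists_branches {ζ₀ : ℂ} (hζ : ζ₀ ∈ ball (0 : ℂ) 1 \ critVals Ω p) :
    ∃ ε > 0, ball ζ₀ ε ⊆ ball (0 : ℂ) 1 \ critVals Ω p ∧ ∃ w : ℂ → ℂ → ℂ,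
      (∀ z ∈ fibre Ω p ζ₀, DifferentiableOn ℂ (w z) (ball ζ₀ ε) ∧ w z ζ₀ = z ∧
        ∀ ζ ∈ ball ζ₀ ε, w z ζ ∈ Ω ∧ p (w z ζ) = ζ) ∧
      ∀ ζ ∈ ball ζ₀ ε, InjOn (fun z => w z ζ) (fibre Ω p ζ₀) ∧
        fibre Ω p ζ = (fun z => w z ζ) '' fibre Ω p ζ₀ := by
  have hfin := hp.finite_fibre hζ.1
  have hex : ∀ z ∈ fibre Ω p ζ₀, ∃ w : ℂ → ℂ, w ζ₀ = z ∧ ContinuousAt w ζ₀ ∧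
      (∀ᶠ ζ in 𝓝 ζ₀, DifferentiableAt ℂ w ζ ∧ p (w ζ) = ζ ∧ w ζ ∈ Ω) ∧
      ∀ᶠ x in 𝓝 z, w (p x) = x := by
    intro z hz
    have h2 : p z = ζ₀ := hz.2
    have := hp.exists_localInverse hz.1 (fun h => hζ.2 ⟨z, ⟨hz.1, h⟩, h2⟩)
    rwa [h2] at this
  choose! w hw1 hw2 hw3 hw4 using hex
  have e1 : ∀ᶠ ζ in 𝓝 ζ₀, ∀ z ∈ fibre Ω p ζ₀,
      DifferentiableAt ℂ (w z) ζ ∧ p (w z ζ) = ζ ∧ w z ζ ∈ Ω :=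
    (hfin.eventually_all).2 (fun z hz => hw3 z hz)
  have e2 : ∀ᶠ ζ in 𝓝 ζ₀, InjOn (fun z => w z ζ) (fibre Ω p ζ₀) := by
    refine hfin.eventually_all.2 fun z hz => hfin.eventually_all.2 fun z' hz' => ?_
    by_cases h : z = z'
    · simp [h]
    · have hne : w z ζ₀ ≠ w z' ζ₀ := by rwa [hw1 z hz, hw1 z' hz']
      filter_upwards [((hw2 z hz).sub (hw2 z' hz')).eventually_ne (sub_ne_zero.2 hne)]
        with ζ h1 h2 using absurd h2 (sub_ne_zero.1 h1)
  have e3 : ∀ᶠ ζ in 𝓝 ζ₀, ∀ x ∈ fibre Ω p ζ, ∃ z ∈ fibre Ω p ζ₀, w z (p x) = x :=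
    hp.eventually_forall_fibre hζ.1 fun z hz => (hw4 z hz).mono fun x h => ⟨z, hz, h⟩
  have e4 : ∀ᶠ ζ in 𝓝 ζ₀, ζ ∈ ball (0 : ℂ) 1 \ critVals Ω p :=
    (isOpen_diff_of_discrete isOpen_ball hp.discrete_critVals).mem_nhds hζ
  obtain ⟨ε, hε, hball⟩ := Metric.eventually_nhds_iff_ball.1 (e1.and (e2.and (e3.and e4)))
  refine ⟨ε, hε, fun ζ h => (hball ζ h).2.2.2, w, fun z hz => ⟨fun ζ h =>
    (((hball ζ h).1 z hz).1).differentiableWithinAt, hw1 z hz, fun ζ h =>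
      ⟨((hball ζ h).1 z hz).2.2, ((hball ζ h).1 z hz).2.1⟩⟩, fun ζ h => ⟨(hball ζ h).2.1, ?_⟩⟩
  apply Subset.antisymm
  · rintro x ⟨hx, rfl⟩
    exact (hball _ h).2.2.1 x ⟨hx, rfl⟩
  · rintro _ ⟨z, hz, rfl⟩
    exact ⟨((hball ζ h).1 z hz).2.2, ((hball ζ h).1 z hz).2.1⟩

theorem exists_card_fibre : ∃ m : ℕ, 0 < m ∧ ∀ ζ ∈ ball (0 : ℂ) 1 \ critVals Ω p,
    (fibre Ω p ζ).ncard = m := by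
  have hpre := isPreconnected_diff_of_discrete isOpen_ball (convex_ball (0 : ℂ) 1).isPreconnected
    hp.discrete_critVals
  obtain ⟨ζ₀, h₀⟩ : (ball (0 : ℂ) 1 \ critVals Ω p).Nonempty := by
    have := diff_dense_of_discrete isOpen_ball hp.discrete_critVals (z := 0) (by simp)
    exact closure_nonempty_iff.1 ⟨0, this⟩
  refine ⟨(fibre Ω p ζ₀).ncard, ?_, fun ζ hζ => ?_⟩
  · rw [Set.ncard_pos (hp.finite_fibre h₀.1)]
    obtain ⟨z, hz, h⟩ := hp.surj ζ₀ h₀.1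
    exact ⟨z, hz, h⟩
  · refine hpre.constant (f := fun ζ => (fibre Ω p ζ).ncard) ?_ hζ h₀
    intro ζ hζ
    obtain ⟨ε, hε, -, w, hw, hfib⟩ := hp.exists_branches hζ
    refine ContinuousAt.continuousWithinAt ?_
    refine continuousAt_const.congr (f := fun _ => (fibre Ω p ζ).ncard) ?_
    filter_upwards [ball_mem_nhds ζ hε] with η hη
    rw [(hfib η hη).2, (hfib η hη).1.ncard_image]

/-- The number of sheets of `p`. -/
def degree : ℕ := hp.exists_card_fibre.choose

theorem degree_pos : 0 < hp.degree := hp.exists_card_fibre.choose_spec.1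

theorem ncard_fibre {ζ : ℂ} (hζ : ζ ∈ ball (0 : ℂ) 1 \ critVals Ω p) :
    (fibre Ω p ζ).ncard = hp.degree := hp.exists_card_fibre.choose_spec.2 ζ hζ

theorem trace_eq_sum {ζ : ℂ} (hζ : ζ ∈ ball (0 : ℂ) 1) (F : ℂ → ℂ) :
    trace Ω p F ζ = ∑ z ∈ (hp.finite_fibre hζ).toFinset, F z :=
  finsum_mem_eq_finite_toFinset_sum _ _

theorem norm_trace_le {ζ : ℂ} (hζ : ζ ∈ ball (0 : ℂ) 1 \ critVals Ω p) {F : ℂ → ℂ} {M : ℝ}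
    (hF : ∀ z ∈ fibre Ω p ζ, ‖F z‖ ≤ M) : ‖trace Ω p F ζ‖ ≤ hp.degree * M := by
  rw [hp.trace_eq_sum hζ.1, ← hp.ncard_fibre hζ, Set.ncard_eq_toFinset_card _ (hp.finite_fibre hζ.1),
    ← nsmul_eq_mul]
  exact (norm_sum_le _ _).trans (Finset.sum_le_card_nsmul _ _ _ fun z hz => hF z (by simpa using hz))

theorem differentiableOn_trace {F : ℂ → ℂ} {V : Set ℂ} (hV : IsOpen V)
    (hVs : V ⊆ ball (0 : ℂ) 1 \ critVals Ω p)
    (hF : DifferentiableOn ℂ F (Ω ∩ p ⁻¹' V)) : DifferentiableOn ℂ (trace Ω p F) V := by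
  intro ζ₀ h₀
  obtain ⟨ε, hε, hsub, w, hw, hfib⟩ := hp.exists_branches (hVs h₀)
  have hd : DifferentiableAt ℂ
      (fun ζ => ∑ z ∈ (hp.finite_fibre (hVs h₀).1).toFinset, F (w z ζ)) ζ₀ := by
    refine DifferentiableAt.fun_sum fun z hz => ?_
    have hz' : z ∈ fibre Ω p ζ₀ := by simpa using hz
    have h1 := (hw z hz').1.differentiableAt (ball_mem_nhds ζ₀ hε)
    have hop : IsOpen (Ω ∩ p ⁻¹' V) := hp.diff.continuousOn.isOpen_inter_preimage hp.isOpen hV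
    refine DifferentiableAt.comp (g := F) ζ₀ (hF.differentiableAt ?_) h1
    rw [(hw z hz').2.1]
    refine hop.mem_nhds ⟨hz'.1, ?_⟩
    rw [mem_preimage, show p z = ζ₀ from hz'.2]; exact h₀
  refine (hd.congr_of_eventuallyEq ?_).differentiableWithinAt
  filter_upwards [ball_mem_nhds ζ₀ hε] with ζ hζ
  rw [trace, (hfib ζ hζ).2, finsum_mem_image (hfib ζ hζ).1,
    finsum_mem_eq_finite_toFinset_sum _ (hp.finite_fibre (hVs h₀).1)]

theorem exists_trace_extension {F : ℂ → ℂ} {V : Set ℂ} (hV : IsOpen V) (hV1 : V ⊆ ball (0 : ℂ) 1)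
    (hF : DifferentiableOn ℂ F ((Ω ∩ p ⁻¹' V) \ {z | deriv p z = 0}))
    (hb : ∀ c ∈ Ω ∩ p ⁻¹' V, Tendsto (fun z => (p z - p c) * F z) (𝓝[≠] c) (𝓝 0)) :
    ∃ T : ℂ → ℂ, DifferentiableOn ℂ T V ∧ EqOn T (trace Ω p F) (V \ critVals Ω p) := by
  have hd : ∀ ζ ∈ V, ∀ᶠ w in 𝓝[≠] ζ, w ∉ critVals Ω p :=
    fun ζ hζ => hp.discrete_critVals ζ (hV1 hζ)
  refine exists_holomorphic_extension hV hd (hp.differentiableOn_trace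
    (isOpen_diff_of_discrete hV hd) (sdiff_subset_sdiff_left hV1) (hF.mono ?_)) ?_
  · rintro z ⟨h1, h2, h3⟩
    exact ⟨⟨h1, h2⟩, fun h => h3 ⟨z, ⟨h1, h⟩, rfl⟩⟩
  · intro c hc
    rw [Metric.tendsto_nhds]
    intro ε hε
    have hm : (0 : ℝ) < hp.degree := by exact_mod_cast hp.degree_pos
    have hN : ∀ᶠ ζ in 𝓝 c, ∀ x ∈ fibre Ω p ζ, p x ≠ c →
        ‖(p x - c) * F x‖ ≤ ε / 2 / hp.degree := by
      refine hp.eventually_forall_fibre (hV1 hc.1) fun z ⟨hz, (hzc : p z = c)⟩ => ?_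
      have h1 := hb z ⟨hz, by rw [mem_preimage, hzc]; exact hc.1⟩
      rw [hzc, Metric.tendsto_nhds] at h1
      filter_upwards [eventually_nhdsWithin_iff.1 (h1 (ε / 2 / hp.degree) (by positivity))]
        with x hx hxc
      simpa using (hx fun h => hxc (by rw [h, hzc])).le
    filter_upwards [nhdsWithin_le_nhds hN, hd c hc.1, self_mem_nhdsWithin,
      nhdsWithin_le_nhds (hV.mem_nhds hc.1)] with ζ h1 h3 h4 h5
    have hb2 : ∀ x ∈ fibre Ω p ζ, ‖(ζ - c) * F x‖ ≤ ε / 2 / hp.degree := by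
      rintro x ⟨hx, rfl⟩
      exact h1 x ⟨hx, rfl⟩ h4
    have heq : (ζ - c) * trace Ω p F ζ = trace Ω p (fun x => (ζ - c) * F x) ζ := by
      rw [hp.trace_eq_sum (hV1 h5), hp.trace_eq_sum (hV1 h5), Finset.mul_sum]
    rw [dist_zero_right, heq]
    calc _ ≤ hp.degree * (ε / 2 / hp.degree) := hp.norm_trace_le ⟨hV1 h5, h3⟩ hb2
      _ = ε / 2 := by field_simp
      _ < ε := by linarith

theorem exists_trace_extension_of_differentiableOn {F : ℂ → ℂ} {V : Set ℂ} (hV : IsOpen V)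
    (hV1 : V ⊆ ball (0 : ℂ) 1) (hF : DifferentiableOn ℂ F (Ω ∩ p ⁻¹' V)) :
    ∃ T : ℂ → ℂ, DifferentiableOn ℂ T V ∧ EqOn T (trace Ω p F) (V \ critVals Ω p) := by
  have hop : IsOpen (Ω ∩ p ⁻¹' V) := hp.diff.continuousOn.isOpen_inter_preimage hp.isOpen hV
  refine hp.exists_trace_extension hV hV1 (hF.mono fun z hz => hz.1) fun c hc => ?_
  have h1 := ((hp.diff.differentiableAt (hp.isOpen.mem_nhds hc.1)).continuousAt.sub
    (continuousAt_const (y := p c))).mul (hF.differentiableAt (hop.mem_nhds hc)).continuousAt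
  have h2 : Tendsto (fun z => (p z - p c) * F z) (𝓝[≠] c) (𝓝 ((p c - p c) * F c)) :=
    h1.tendsto.mono_left nhdsWithin_le_nhds
  simpa using h2

theorem exists_trace_div_deriv_extension {F : ℂ → ℂ} {V : Set ℂ} (hV : IsOpen V)
    (hV1 : V ⊆ ball (0 : ℂ) 1) (hF : DifferentiableOn ℂ F (Ω ∩ p ⁻¹' V)) :
    ∃ T : ℂ → ℂ, DifferentiableOn ℂ T V ∧
      EqOn T (trace Ω p (fun z => F z / deriv p z)) (V \ critVals Ω p) := by
  have hop : IsOpen (Ω ∩ p ⁻¹' V) := hp.diff.continuousOn.isOpen_inter_preimage hp.isOpen hV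
  refine hp.exists_trace_extension hV hV1 ?_ fun c hc => ?_
  · exact (hF.mono sdiff_subset).div (((hp.diff.deriv hp.isOpen)).mono
      (sdiff_subset.trans inter_subset_left)) fun z hz => hz.2
  · have key : Tendsto (fun z => (p z - p c) / deriv p z) (𝓝[≠] c) (𝓝 0) := by
      obtain ⟨n, g, hg, hg0, hpg⟩ := exists_factor_at hp.isOpen hp.preconn
        (hp.diff.sub_const (p c)) (hp.exists_sub_ne_zero (p c)) hc.1
      obtain ⟨k, rfl⟩ : ∃ k, n = k + 1 := by
        refine Nat.exists_eq_succ_of_ne_zero ?_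
        rintro rfl
        exact hg0 (by simpa using (hpg c hc.1).symm)
      have hd : ∀ z ∈ Ω, deriv p z = (z - c) ^ k * ((k + 1) * g z + (z - c) * deriv g z) := by
        intro z hz
        have hΩ := hp.isOpen.mem_nhds hz
        have h3 : HasDerivAt (fun z => (z - c) ^ (k + 1) * g z) _ z :=
          (((hasDerivAt_id z).sub_const c).pow (k + 1)).mul (hg.differentiableAt hΩ).hasDerivAt
        have h4 := (h3.congr_of_eventuallyEq (by filter_upwards [hΩ] using hpg)).deriv
        rw [deriv_sub_const] at h4
        rw [h4]
        simp
        ring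
      have hlim : Tendsto (fun z => (z - c) * g z / ((k + 1) * g z + (z - c) * deriv g z))
          (𝓝 c) (𝓝 0) := by
        have hga := hg.analyticOnNhd hp.isOpen c hc.1
        have hgc := hga.continuousAt
        have hgd := hga.deriv.continuousAt
        have h0 : ((k : ℂ) + 1) * g c + (c - c) * deriv g c ≠ 0 := by
          simp only [sub_self, zero_mul, add_zero]
          exact mul_ne_zero (by exact_mod_cast k.succ_ne_zero) hg0
        have : ContinuousAt (fun z => (z - c) * g z / ((k + 1) * g z + (z - c) * deriv g z)) c := by
          fun_prop (disch := exact h0)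
        simpa using this.tendsto
      refine (hlim.mono_left nhdsWithin_le_nhds).congr' ?_
      filter_upwards [nhdsWithin_le_nhds (hp.isOpen.mem_nhds hc.1), self_mem_nhdsWithin]
        with z h1 h2
      rw [hpg z h1, hd z h1, pow_succ, mul_assoc,
        mul_div_mul_left _ _ (pow_ne_zero k (sub_ne_zero.2 h2))]
    have h1 := (hF.differentiableAt (hop.mem_nhds hc)).continuousAt.tendsto.mono_left
      (nhdsWithin_le_nhds (s := {c}ᶜ))
    have := key.mul h1
    rw [zero_mul] at this
    refine this.congr fun z => ?_
    ring

end ProperDisc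

theorem exists_factor {Ω : Set ℂ} (hΩ : IsOpen Ω) (hc : IsPreconnected Ω) {F : ℂ → ℂ}
    (hF : DifferentiableOn ℂ F Ω) (hne : ∃ z ∈ Ω, F z ≠ 0) {A : Set ℂ} (hA : A.Finite)
    (hAΩ : A ⊆ Ω) :
    ∃ (Z : Multiset ℂ) (u : ℂ → ℂ), (∀ a ∈ Z, a ∈ A) ∧ DifferentiableOn ℂ u Ω ∧
      (∀ a ∈ A, u a ≠ 0) ∧ ∀ z ∈ Ω, F z = (Z.map fun a => z - a).prod * u z := by
  induction A, hA using Set.Finite.induction_on with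
  | empty => exact ⟨0, F, by simp, hF, by simp, by simp⟩
  | @insert a A haA hA ih =>
    obtain ⟨Z, u, hZ, hu, hu0, hFu⟩ := ih ((subset_insert a A).trans hAΩ)
    have hune : ∃ z ∈ Ω, u z ≠ 0 := by
      obtain ⟨z, hz, h⟩ := hne
      exact ⟨z, hz, fun h0 => h (by rw [hFu z hz, h0, mul_zero])⟩
    obtain ⟨n, v, hv, hva, huv⟩ := exists_factor_at hΩ hc hu hune (hAΩ (mem_insert a A))
    refine ⟨Multiset.replicate n a + Z, v, fun b hb => ?_, hv, ?_, fun z hz => ?_⟩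
    · rcases Multiset.mem_add.1 hb with h | h
      · exact Or.inl (Multiset.eq_of_mem_replicate h)
      · exact Or.inr (hZ b h)
    · rintro b (rfl | hb) h
      · exact hva h
      · exact hu0 b hb (by rw [huv b (hAΩ (mem_insert_of_mem a hb)), h, mul_zero])
    · rw [hFu z hz, huv z hz, Multiset.map_add, Multiset.map_replicate, Multiset.prod_add,
        Multiset.prod_replicate]
      ring

theorem exists_polynomial_of_circleIntegral_eq_zero {f : ℂ → ℂ} {R : ℝ} (hR : 1 / 2 < R)
    (hf : DifferentiableOn ℂ f (ball 0 R)) {d : ℕ}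
    (h0 : ∀ n > d, (∮ z in C(0, 1 / 2), (z ^ (n + 1))⁻¹ * f z) = 0) :
    ∃ P : Polynomial ℂ, ∀ z ∈ ball (0 : ℂ) R, f z = P.eval z := by
  have hps : HasFPowerSeriesOnBall f (cauchyPowerSeries f 0 (1 / 2)) 0 (1 / 2 : NNReal) := by
    have := (hf.mono (closedBall_subset_ball (x := (0 : ℂ)) (ε₁ := ((1 / 2 : NNReal) : ℝ))
      (by simpa using hR))).hasFPowerSeriesOnBall (by norm_num)
    simpa using this
  let a : ℕ → ℂ := fun n => (2 * π * I)⁻¹ * ∮ z in C(0, 1 / 2), (z ^ (n + 1))⁻¹ * f z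
  have hcoef : ∀ n w, (cauchyPowerSeries f 0 (1 / 2) n fun _ => w) = w ^ n * a n := by
    intro n w
    rw [cauchyPowerSeries_apply]
    simp only [a, smul_eq_mul, sub_zero]
    rw [mul_left_comm]
    congr 1
    rw [← circleIntegral.integral_const_mul (w ^ n)]
    congr 1
    funext z
    rw [div_pow, pow_succ, mul_inv]
    ring
  let P : Polynomial ℂ := ∑ n ∈ Finset.range (d + 1), Polynomial.C (a n) * Polynomial.X ^ n
  refine ⟨P, ?_⟩
  have hfan := hf.analyticOnNhd isOpen_ball
  have hPan : AnalyticOnNhd ℂ (fun z => P.eval z) (ball 0 R) :=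
    (P.differentiable.differentiableOn).analyticOnNhd isOpen_ball
  refine hfan.eqOn_of_preconnected_of_eventuallyEq hPan (convex_ball _ _).isPreconnected
    (z₀ := 0) (by simp; linarith) ?_
  filter_upwards [ball_mem_nhds (0 : ℂ) (show (0 : ℝ) < 1 / 2 by norm_num)] with w hw
  have hs := hps.hasSum (y := w) (by
    rw [Metric.mem_eball, edist_zero_right]
    have : ‖w‖ < 1 / 2 := by simpa using hw
    rw [← ofReal_norm, ENNReal.ofReal_lt_iff_lt_toReal (norm_nonneg _) (by simp)]
    simpa using this)
  rw [zero_add] at hs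
  simp only [hcoef] at hs
  have hs2 : HasSum (fun n => w ^ n * a n) (∑ n ∈ Finset.range (d + 1), w ^ n * a n) :=
    hasSum_sum_of_ne_finset_zero fun n hn => by
      rw [show a n = 0 by simp only [a]; rw [h0 n (by simpa [Nat.lt_succ_iff] using hn), mul_zero],
        mul_zero]
  rw [hs.unique hs2]
  simp only [P, Polynomial.eval_finsetSum, Polynomial.eval_mul, Polynomial.eval_C,
    Polynomial.eval_pow, Polynomial.eval_X]
  exact Finset.sum_congr rfl fun n _ => mul_comm _ _

theorem circleIntegral_conj_mul_inv_pow {T : ℂ → ℂ} {r : ℝ} (hr : 0 < r)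
    (hT : DifferentiableOn ℂ T (closedBall 0 r)) (n : ℕ) :
    (∮ z in C(0, r), (z ^ (n + 2))⁻¹ * conj (T z)) = 0 := by
  have h1 : (∮ z in C(0, r), z ^ n * T z) = 0 :=
    (((differentiable_pow n).differentiableOn.mul hT).diffContOnCl_ball
      subset_rfl).circleIntegral_eq_zero hr.le
  have h2 : (∮ z in C(0, r), (z ^ (n + 2))⁻¹ * conj (T z)) =
      -((r : ℂ) ^ (2 * n + 2))⁻¹ * conj (∮ z in C(0, r), z ^ n * T z) := by
    simp only [circleIntegral, deriv_circleMap, smul_eq_mul]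
    rw [← intervalIntegral.intervalIntegral_conj, ← intervalIntegral.integral_const_mul]
    congr 1
    funext θ
    have hne : circleMap 0 r θ ≠ 0 := by simpa using hr.ne'
    have hcc : conj (circleMap 0 r θ) = (r : ℂ) ^ 2 / circleMap 0 r θ := by
      rw [eq_div_iff hne, mul_comm, Complex.mul_conj]
      simp [Complex.normSq_eq_norm_sq]
    simp only [map_mul, map_pow, hcc, conj_I, div_pow]
    have hr' : (r : ℂ) ≠ 0 := by exact_mod_cast hr.ne'
    field_simp
    ring
  rw [h2, h1]; simp

theorem differentiableOn_intervalIntegral {U : Set ℂ} (hU : IsOpen U) {F : ℂ → ℝ → ℂ}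
    (hc : ContinuousOn (Function.uncurry F) (U ×ˢ univ))
    (hd : ∀ t, DifferentiableOn ℂ (fun z => F z t) U) (a b : ℝ) :
    DifferentiableOn ℂ (fun z => ∫ t in a..b, F z t) U := by
  intro z hz
  obtain ⟨δ, hδ, hδU⟩ := Metric.isOpen_iff.1 hU z hz
  have hb2 : closedBall z (δ / 2) ⊆ U := (closedBall_subset_ball (by linarith)).trans hδU
  have hcomp : IsCompact (closedBall z (δ / 2) ×ˢ uIcc a b) :=
    (isCompact_closedBall _ _).prod isCompact_uIcc
  obtain ⟨C, hC⟩ := hcomp.exists_bound_of_continuousOn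
    (hc.mono (prod_mono hb2 (subset_univ _)))
  have hcz : ∀ x ∈ U, Continuous (F x) := fun x hx => by
    have h1 : ContinuousOn (fun t : ℝ => Function.uncurry F (x, t)) univ :=
      hc.comp (by fun_prop) fun t _ => ⟨hx, mem_univ _⟩
    exact continuousOn_univ.1 h1
  have hderiv : ∀ t, HasDerivAt (fun z => F z t) (deriv (fun z => F z t) z) z := fun t =>
    ((hd t).differentiableAt (hU.mem_nhds hz)).hasDerivAt
  have hmeas : AEStronglyMeasurable (fun t => deriv (fun z => F z t) z)
      (volume.restrict (uIoc a b)) := by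
    classical
    refine aestronglyMeasurable_of_tendsto_ae (𝓝[≠] z)
      (f := fun x t => if x ∈ U then slope (fun z => F z t) z x else 0) (fun x => ?_)
      (Eventually.of_forall fun t => (hasDerivAt_iff_tendsto_slope.1 (hderiv t)).congr' ?_)
    · by_cases hx : x ∈ U
      · simp only [if_pos hx]
        exact (((hcz x hx).sub (hcz z hz)).const_smul (x - z)⁻¹).aestronglyMeasurable
      · simpa [hx] using aestronglyMeasurable_const
    · filter_upwards [nhdsWithin_le_nhds (hU.mem_nhds hz)] with x hx
      simp [hx]
  have hC0 : ∀ᵐ t ∂(volume : Measure ℝ), t ∈ uIoc a b →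
      LipschitzOnWith (Real.nnabs (C / (δ / 4))) (fun z => F z t) (ball z (δ / 4)) := by
    refine Eventually.of_forall fun t ht => ?_
    refine (convex_ball _ _).lipschitzOnWith_of_nnnorm_deriv_le (𝕜 := ℂ) (fun x hx => ?_)
      fun x hx => ?_
    · exact (hd t).differentiableAt (hU.mem_nhds (hb2 (ball_subset_closedBall
        (ball_subset_ball (by linarith) hx))))
    · have hsub : closedBall x (δ / 4) ⊆ closedBall z (δ / 2) := by
        apply closedBall_subset_closedBall'
        have := mem_ball.1 hx
        linarith
      have h1 := Complex.norm_deriv_le_of_forall_mem_sphere_norm_le (c := x) (R := δ / 4)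
        (f := fun z => F z t) (C := C) (by linarith)
        (((hd t).mono (hsub.trans hb2)).diffContOnCl_ball subset_rfl) fun w hw =>
          hC (w, t) ⟨hsub (sphere_subset_closedBall hw), uIoc_subset_uIcc ht⟩
      rw [← NNReal.coe_le_coe, coe_nnnorm, Real.coe_nnabs]
      exact h1.trans (le_abs_self _)
  have key := intervalIntegral.hasDerivAt_integral_of_dominated_loc_of_lip (μ := volume)
    (𝕜 := ℂ) (F := F) (F' := fun t => deriv (fun z => F z t) z) (x₀ := z) (a := a) (b := b)
    (bound := fun _ => C / (δ / 4)) (ball_mem_nhds z (by linarith : 0 < δ / 4))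
    (by
      filter_upwards [hU.mem_nhds hz] with x hx
      exact (hcz x hx).aestronglyMeasurable)
    ((hcz z hz).intervalIntegrable _ _) hmeas hC0 intervalIntegrable_const
    (Eventually.of_forall fun t _ => hderiv t)
  exact key.2.differentiableAt.differentiableWithinAt

theorem differentiableOn_circleIntegral {U : Set ℂ} (hU : IsOpen U) {F : ℂ → ℂ → ℂ} {t : ℝ}
    (ht : 0 ≤ t) (hc : ContinuousOn (Function.uncurry F) (U ×ˢ sphere 0 t))
    (hd : ∀ w ∈ sphere (0 : ℂ) t, DifferentiableOn ℂ (fun z => F z w) U) :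
    DifferentiableOn ℂ (fun z => ∮ w in C(0, t), F z w) U := by
  unfold circleIntegral
  refine differentiableOn_intervalIntegral hU (F := fun z θ => deriv (circleMap 0 t) θ •
    F z (circleMap 0 t θ)) ?_ (fun θ => ?_) _ _
  rotate_left
  · exact (hd _ (circleMap_mem_sphere 0 ht θ)).const_smul (deriv (circleMap 0 t) θ)
  have h1 : ContinuousOn (fun x : ℂ × ℝ => Function.uncurry F (x.1, circleMap 0 t x.2))
      (U ×ˢ univ) := hc.comp (by fun_prop) fun x hx => ⟨hx.1, circleMap_mem_sphere 0 ht _⟩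
  simp only [deriv_circleMap]
  have h2 : ContinuousOn (fun x : ℂ × ℝ => circleMap 0 t x.2 * I) (U ×ˢ univ) := by fun_prop
  exact ContinuousOn.smul h2 h1

theorem continuousOn_circleIntegral {X : Type*} [TopologicalSpace X] [FirstCountableTopology X]
    {U : Set X} {F : X → ℂ → ℂ} {t : ℝ}
    (ht : 0 ≤ t) (hc : ContinuousOn (Function.uncurry F) (U ×ˢ sphere 0 t)) :
    ContinuousOn (fun z => ∮ w in C(0, t), F z w) U := by
  rw [continuousOn_iff_continuous_domRestrict]
  unfold circleIntegral
  have h1 : Continuous (fun x : U × ℝ => Function.uncurry F (x.1.1, circleMap 0 t x.2)) :=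
    hc.comp_continuous (by fun_prop) fun x => ⟨x.1.2, circleMap_mem_sphere 0 ht _⟩
  refine intervalIntegral.continuous_parametric_intervalIntegral_of_continuous' ?_ 0 (2 * π)
  simp only [deriv_circleMap]
  have h2 : Continuous fun x : U × ℝ => circleMap 0 t x.2 * I := by fun_prop
  exact Continuous.smul h2 h1

theorem circleIntegral_circleIntegral_swap {F : ℂ → ℂ → ℂ} {s t : ℝ} (hs : 0 ≤ s) (ht : 0 ≤ t)
    (hc : ContinuousOn (Function.uncurry F) (sphere 0 s ×ˢ sphere 0 t)) :
    (∮ z in C(0, s), ∮ w in C(0, t), F z w) = ∮ w in C(0, t), ∮ z in C(0, s), F z w := by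
  have h1 : Continuous (fun x : ℝ × ℝ => Function.uncurry F (circleMap 0 s x.1, circleMap 0 t x.2)) :=
    hc.comp_continuous (by fun_prop) fun x => ⟨circleMap_mem_sphere 0 hs _,
      circleMap_mem_sphere 0 ht _⟩
  simp only [circleIntegral, ← intervalIntegral.integral_smul, deriv_circleMap]
  rw [intervalIntegral_intervalIntegral_swap]
  · refine intervalIntegral.integral_congr fun θ _ => intervalIntegral.integral_congr fun φ _ => ?_
    simp only [smul_eq_mul]
    ring
  · have h2 : Continuous fun x : ℝ × ℝ => (circleMap 0 s x.1 * I) • (circleMap 0 t x.2 * I) •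
        F (circleMap 0 s x.1) (circleMap 0 t x.2) := by
      have h3 : Continuous fun x : ℝ × ℝ => circleMap 0 s x.1 * I := by fun_prop
      have h4 : Continuous fun x : ℝ × ℝ => circleMap 0 t x.2 * I := by fun_prop
      exact h3.smul (h4.smul h1)
    refine (h2.continuousOn.integrableOn_compact (isCompact_uIcc.prod isCompact_uIcc)).mono_set
      (prod_mono uIoc_subset_uIcc uIoc_subset_uIcc)

def annulus (r R : ℝ) : Set ℂ := {w | r < ‖w‖ ∧ ‖w‖ < R}

theorem isOpen_annulus (r R : ℝ) : IsOpen (annulus r R) :=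
  (isOpen_lt continuous_const continuous_norm).inter (isOpen_lt continuous_norm continuous_const)

theorem preimage_norm_eq_exp_image {S : Set ℝ} (hpos : ∀ x ∈ S, 0 < x) :
    (fun w : ℂ => ‖w‖) ⁻¹' S = exp '' (re ⁻¹' (Real.exp ⁻¹' S)) := by
  ext w
  refine ⟨fun hw => ?_, ?_⟩
  · have hw0 : w ≠ 0 := norm_pos_iff.1 (hpos _ hw)
    refine ⟨log w, ?_, exp_log hw0⟩
    rwa [mem_preimage, mem_preimage, ← norm_exp, exp_log hw0]
  · rintro ⟨u, hu, rfl⟩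
    rwa [mem_preimage, norm_exp]

theorem convex_preimage_exp_re {S : Set ℝ} (hS : S.OrdConnected) :
    Convex ℝ (re ⁻¹' (Real.exp ⁻¹' S) : Set ℂ) :=
  (hS.preimage_mono Real.exp_monotone).convex.linear_preimage reLm

theorem isPreconnected_preimage_norm {S : Set ℝ} (hS : S.OrdConnected) (hpos : ∀ x ∈ S, 0 < x) :
    IsPreconnected ((fun w : ℂ => ‖w‖) ⁻¹' S) := by
  rw [preimage_norm_eq_exp_image hpos]
  exact (convex_preimage_exp_re hS).isPreconnected.image _ continuous_exp.continuousOn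

theorem isPreconnected_annulus {r : ℝ} (hr : 0 ≤ r) (R : ℝ) : IsPreconnected (annulus r R) :=
  isPreconnected_preimage_norm ordConnected_Ioo fun _ hx => hr.trans_lt hx.1

theorem sphere_subset_annulus {r R t : ℝ} (h1 : r < t) (h2 : t < R) :
    sphere (0 : ℂ) t ⊆ annulus r R := fun w hw => by
  rw [mem_sphere_zero_iff_norm] at hw
  exact ⟨hw ▸ h1, hw ▸ h2⟩

theorem annulus_mono {r R r' R' : ℝ} (h1 : r ≤ r') (h2 : R' ≤ R) : annulus r' R' ⊆ annulus r R :=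
  fun _ hw => ⟨h1.trans_lt hw.1, hw.2.trans_le h2⟩

theorem circleIntegral_eq_of_differentiableOn_annulus {f : ℂ → ℂ} {r R s t : ℝ} (hr : 0 ≤ r)
    (hf : DifferentiableOn ℂ f (annulus r R)) (hs : r < s) (hsR : s < R) (ht : r < t)
    (htR : t < R) : (∮ w in C(0, s), f w) = ∮ w in C(0, t), f w := by
  wlog h : t ≤ s generalizing s t
  · exact (this ht htR hs hsR (le_of_not_ge h)).symm
  have hsub : closedBall (0 : ℂ) s \ ball 0 t ⊆ annulus r R := by
    rintro z ⟨h1, h2⟩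
    simp only [mem_closedBall, dist_zero_right, mem_ball, not_lt] at h1 h2
    exact ⟨ht.trans_le h2, h1.trans_lt hsR⟩
  refine Complex.circleIntegral_eq_of_differentiable_on_annulus_off_countable (hr.trans_lt ht) h
    countable_empty (hf.continuousOn.mono hsub) fun z hz => ?_
  exact hf.differentiableAt ((isOpen_annulus r R).mem_nhds (hsub ⟨ball_subset_closedBall hz.1.1,
    fun h => hz.1.2 (ball_subset_closedBall h)⟩))

theorem differentiableOn_dslope_of_isOpen {U : Set ℂ} (hU : IsOpen U) {f : ℂ → ℂ}
    (hf : DifferentiableOn ℂ f U) {w : ℂ} (hw : w ∈ U) : DifferentiableOn ℂ (dslope f w) U :=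
  (differentiableOn_dslope (hU.mem_nhds hw)).2 hf

theorem continuousOn_div_sub {f : ℂ → ℂ} {t : ℝ} {w : ℂ} (hf : ContinuousOn f (sphere 0 t))
    (hw : ‖w‖ ≠ t) : ContinuousOn (fun ξ => f ξ / (ξ - w)) (sphere 0 t) := by
  refine hf.div (by fun_prop) fun ξ hξ h => hw ?_
  rw [← sub_eq_zero.1 h]
  exact mem_sphere_zero_iff_norm.1 hξ

theorem circleIntegral_sub_inv_of_lt {t : ℝ} {w : ℂ} (hw : t < ‖w‖) (ht : 0 ≤ t) :
    (∮ ξ in C(0, t), (ξ - w)⁻¹) = 0 := by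
  have hd : DifferentiableOn ℂ (fun ξ => (ξ - w)⁻¹) (closedBall 0 t) := fun z hz => by
    have : z - w ≠ 0 := fun h => by
      rw [mem_closedBall_zero_iff, sub_eq_zero.1 h] at hz
      linarith
    fun_prop (disch := assumption)
  exact (hd.diffContOnCl_ball subset_rfl).circleIntegral_eq_zero ht

theorem circleIntegral_div_sub_annulus {f : ℂ → ℂ} {r R s t : ℝ} {w : ℂ} (hr : 0 ≤ r)
    (hf : DifferentiableOn ℂ f (annulus r R)) (hs : r < s) (hsw : s < ‖w‖) (hwt : ‖w‖ < t)
    (htR : t < R) :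
    (∮ ξ in C(0, t), f ξ / (ξ - w)) - (∮ ξ in C(0, s), f ξ / (ξ - w)) = 2 * π * I * f w := by
  have hwm : w ∈ annulus r R := ⟨by linarith, by linarith⟩
  have h1 := circleIntegral_eq_of_differentiableOn_annulus hr
    (differentiableOn_dslope_of_isOpen (isOpen_annulus r R) hf hwm) (s := t) (t := s) (by linarith)
    htR hs (by linarith)
  have h2 : ∀ τ : ℝ, r < τ → τ < R → ‖w‖ ≠ τ → (∮ ξ in C(0, τ), f ξ / (ξ - w)) =
      (∮ ξ in C(0, τ), dslope f w ξ) + f w * ∮ ξ in C(0, τ), (ξ - w)⁻¹ := by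
    intro τ h1 h2 h3
    have hτ : 0 ≤ τ := by linarith
    have hc := hf.continuousOn.mono (sphere_subset_annulus h1 h2)
    rw [← circleIntegral.integral_const_mul, ← circleIntegral.integral_add]
    · refine circleIntegral.integral_congr hτ fun ξ hξ => ?_
      have hne : ξ ≠ w := fun h => h3 (h ▸ mem_sphere_zero_iff_norm.1 hξ)
      have := sub_ne_zero.2 hne
      simp only [dslope_of_ne _ hne, slope, vsub_eq_sub, smul_eq_mul]
      field_simp
      ring
    · exact ((differentiableOn_dslope_of_isOpen (isOpen_annulus r R) hf hwm).continuousOn.mono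
        (sphere_subset_annulus h1 h2)).circleIntegrable hτ
    · refine ContinuousOn.circleIntegrable hτ ?_
      have := continuousOn_div_sub (f := fun _ => f w) (t := τ) continuousOn_const h3
      simpa only [div_eq_mul_inv] using this
  rw [h2 t (by linarith) htR hwt.ne, h2 s hs (by linarith) hsw.ne',
    circleIntegral_sub_inv_of_lt hsw (by linarith),
    circleIntegral.integral_sub_inv_of_mem_ball (by simpa using hwt), h1]
  ring

theorem dslope_ne_zero_of_injOn {U : Set ℂ} {f : ℂ → ℂ} (hi : InjOn f U)
    (hd : ∀ z ∈ U, deriv f z ≠ 0) {w z : ℂ} (hw : w ∈ U) (hz : z ∈ U) : dslope f w z ≠ 0 := by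
  by_cases h : z = w
  · rw [h, dslope_same]; exact hd w hw
  · rw [dslope_of_ne _ h, slope_def_field]
    exact div_ne_zero (sub_ne_zero.2 fun e => h (hi hz hw e)) (sub_ne_zero.2 h)

theorem circleIntegral_div_sub_injOn {f ψ : ℂ → ℂ} {r R s t : ℝ} {w : ℂ} (hr : 0 ≤ r)
    (hf : DifferentiableOn ℂ f (annulus r R)) (hψ : DifferentiableOn ℂ ψ (annulus r R))
    (hi : InjOn ψ (annulus r R)) (hd : ∀ z ∈ annulus r R, deriv ψ z ≠ 0)
    (hs : r < s) (hsw : s < ‖w‖) (hwt : ‖w‖ < t) (htR : t < R) :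
    (∮ ξ in C(0, t), f ξ / (ψ ξ - ψ w)) - (∮ ξ in C(0, s), f ξ / (ψ ξ - ψ w)) =
      2 * π * I * (f w / deriv ψ w) := by
  have hwm : w ∈ annulus r R := ⟨by linarith, by linarith⟩
  have h := circleIntegral_div_sub_annulus hr (hf.div
    (differentiableOn_dslope_of_isOpen (isOpen_annulus r R) hψ hwm)
    fun z hz => dslope_ne_zero_of_injOn hi hd hwm hz) hs hsw hwt htR
  simp only [Pi.div_apply, dslope_same] at h
  rw [← h]
  have h2 : ∀ τ : ℝ, r < τ → τ < R → ‖w‖ ≠ τ → (∮ ξ in C(0, τ), f ξ / (ψ ξ - ψ w)) =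
      ∮ ξ in C(0, τ), f ξ / dslope ψ w ξ / (ξ - w) := by
    intro τ h1 h2 h3
    refine circleIntegral.integral_congr (by linarith) fun ξ hξ => ?_
    have hne : ξ ≠ w := fun h => h3 (h ▸ mem_sphere_zero_iff_norm.1 hξ)
    have hs := sub_ne_zero.2 hne
    have hψn : ψ ξ - ψ w ≠ 0 := sub_ne_zero.2 fun e =>
      hne (hi (sphere_subset_annulus h1 h2 hξ) hwm e)
    simp only [dslope_of_ne _ hne, slope_def_field]
    field_simp
  rw [h2 t (by linarith) htR hwt.ne, h2 s hs (by linarith) hsw.ne']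

/-- `F` has modulus close to one wherever `g` does. -/
def BdryUnimodular (Ω : Set ℂ) (g F : ℂ → ℂ) : Prop :=
  ∀ ε > 0, ∃ r < 1, ∀ z ∈ Ω, r < ‖g z‖ → 1 - ε < ‖F z‖

theorem eventually_norm_of_forall_sphere {p : ℂ → Prop}
    (h : ∀ w ∈ sphere (0 : ℂ) 1, ∀ᶠ v in 𝓝 w, p v) :
    ∃ t < 1, ∀ w : ℂ, t < ‖w‖ → ‖w‖ < 1 → p w := by
  obtain ⟨δ, hδ, hsub⟩ := (isCompact_sphere (0 : ℂ) 1).exists_thickening_subset_open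
    (isOpen_interior (s := {v | p v})) fun w hw => mem_interior_iff_mem_nhds.2 (h w hw)
  refine ⟨max (1 - δ) 0, by simp [hδ], fun w h1 h2 => ?_⟩
  have hw0 : 0 < ‖w‖ := (le_max_right _ _).trans_lt h1
  have hw1 : 1 - δ < ‖w‖ := (le_max_left _ _).trans_lt h1
  refine interior_subset (hsub (mem_thickening_iff.2 ⟨(‖w‖⁻¹ : ℝ) * w, ?_, ?_⟩))
  · rw [mem_sphere_zero_iff_norm, norm_mul, norm_real, norm_inv, norm_norm, inv_mul_cancel₀ hw0.ne']
  · have : w - (‖w‖⁻¹ : ℝ) * w = ((1 - ‖w‖⁻¹ : ℝ) : ℂ) * w := by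
      push_cast
      ring
    rw [dist_eq_norm, this, norm_mul, norm_real, Real.norm_eq_abs,
      abs_of_nonpos (sub_nonpos.2 ((one_le_inv₀ hw0).2 h2.le)), neg_sub, sub_mul,
      inv_mul_cancel₀ hw0.ne', one_mul]
    linarith

theorem norm_prod_map_sub_le (Z : Multiset ℂ) {f : ℂ → ℂ} {ζ : ℂ} (hζ : ‖ζ‖ ≤ 1)
    (hZ : ∀ a ∈ Z, ‖f a‖ ≤ 1) : ‖(Z.map fun a => ζ - f a).prod‖ ≤ 2 ^ Multiset.card Z := by
  induction Z using Multiset.induction_on with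
  | empty => simp
  | cons a Z ih =>
    rw [Multiset.map_cons, Multiset.prod_cons, norm_mul, Multiset.card_cons, pow_succ']
    refine mul_le_mul ?_ (ih fun b hb => hZ b (Multiset.mem_cons_of_mem hb)) (norm_nonneg _)
      (by norm_num)
    have := hZ a (Multiset.mem_cons_self a Z)
    calc ‖ζ - f a‖ ≤ ‖ζ‖ + ‖f a‖ := norm_sub_le _ _
      _ ≤ 2 := by linarith

theorem tendsto_reflected_prod (Z : Multiset ℂ) (f : ℂ → ℂ)
    {ε : ℝ} (hε : 0 < ε) : ∃ r < 1, ∀ ζ : ℂ, r < ‖ζ‖ → ‖ζ‖ < 1 →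
      ‖(Z.map fun a => 1 - conj (f a) * ζ).prod -
        ζ ^ Multiset.card Z * conj (Z.map fun a => ζ - f a).prod‖ < ε := by
  have hφ : Continuous fun ζ : ℂ => ‖(Z.map fun a => 1 - conj (f a) * ζ).prod -
      ζ ^ Multiset.card Z * conj (Z.map fun a => ζ - f a).prod‖ := by
    have h1 : Continuous fun ζ : ℂ => (Z.map fun a => 1 - conj (f a) * ζ).prod :=
      continuous_multiset_prod _ fun a _ => by fun_prop
    have h2 : Continuous fun ζ : ℂ => (Z.map fun a => ζ - f a).prod :=
      continuous_multiset_prod _ fun a _ => by fun_prop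
    exact (h1.sub ((continuous_pow _).mul (Complex.continuous_conj.comp h2))).norm
  refine eventually_norm_of_forall_sphere fun ζ hζ => hφ.continuousAt.eventually_lt_const ?_
  suffices h : (Z.map fun a => 1 - conj (f a) * ζ).prod =
      ζ ^ Multiset.card Z * conj (Z.map fun a => ζ - f a).prod by simpa [h]
  have : ζ * conj ζ = 1 := by
    rw [mul_conj, normSq_eq_norm_sq, mem_sphere_zero_iff_norm.1 hζ]; simp
  clear hφ
  induction Z using Multiset.induction_on with
  | empty => simp
  | cons a Z ih =>
    rw [Multiset.map_cons, Multiset.prod_cons, Multiset.card_cons, Multiset.map_cons,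
      Multiset.prod_cons, map_mul, pow_succ, ih, map_sub]
    linear_combination (- ζ ^ Multiset.card Z * conj (Z.map fun a => ζ - f a).prod) * this

theorem ProperDisc.trace_sub_mul {Ω : Set ℂ} {p : ℂ → ℂ} (hp : ProperDisc Ω p) {ζ : ℂ}
    (hζ : ζ ∈ ball (0 : ℂ) 1) (F G : ℂ → ℂ) (c d : ℂ) :
    trace Ω p F ζ * c - d * conj (trace Ω p G ζ) =
      trace Ω p (fun z => F z * c - d * conj (G z)) ζ := by
  simp only [hp.trace_eq_sum hζ, map_sum, Finset.mul_sum, Finset.sum_mul, Finset.sum_sub_distrib]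

/-- The trace of a bounded holomorphic function with unimodular boundary values is rational. -/
theorem ProperDisc.exists_rational_trace {Ω : Set ℂ} {g F : ℂ → ℂ} (hg : ProperDisc Ω g)
    (hF : DifferentiableOn ℂ F Ω) (hF1 : ∀ z ∈ Ω, ‖F z‖ ≤ 1) (hu : BdryUnimodular Ω g F) :
    ∃ A D : Polynomial ℂ, D ≠ 0 ∧ ∀ ζ ∈ ball (0 : ℂ) 1 \ critVals Ω g,
      trace Ω g F ζ * D.eval ζ = A.eval ζ := by
  obtain ⟨r₀, hr₀, hur₀⟩ := hu (1 / 2) (by norm_num)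
  have hF0 : ∀ z ∈ Ω, r₀ < ‖g z‖ → F z ≠ 0 := fun z hz h h0 => by
    have := hur₀ z hz h
    norm_num [h0] at this
  have hne : ∃ z ∈ Ω, F z ≠ 0 := by
    obtain ⟨t, ht1, ht2⟩ := exists_between (max_lt hr₀ zero_lt_one)
    have ht0 : 0 ≤ t := ((le_max_right r₀ 0).trans_lt ht1).le
    obtain ⟨z, hz, hgz⟩ := hg.surj (t : ℂ) (by simpa [abs_of_nonneg ht0] using ht2)
    refine ⟨z, hz, hF0 z hz ?_⟩
    rw [hgz, norm_real, Real.norm_of_nonneg ht0]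
    exact (le_max_left _ _).trans_lt ht1
  have hK : IsCompact (Ω ∩ g ⁻¹' closedBall 0 r₀) :=
    hg.proper _ (closedBall_subset_ball hr₀) (isCompact_closedBall _ _)
  have hfin := finite_zeros_of_differentiableOn hg.isOpen hg.preconn hF hne hK inter_subset_left
  obtain ⟨Z, u, hZ, hud, hu0, hFu⟩ := exists_factor hg.isOpen hg.preconn hF hne hfin
    fun z hz => hz.1.1
  have hZΩ : ∀ a ∈ Z, a ∈ Ω := fun a ha => (hZ a ha).1.1
  have hgZ : ∀ a ∈ Z, ‖g a‖ ≤ 1 := fun a ha => by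
    have := hg.maps a (hZΩ a ha); rw [mem_ball_zero_iff] at this; exact this.le
  have hunz : ∀ z ∈ Ω, u z ≠ 0 := by
    intro z hz h0
    have h : F z = 0 := by rw [hFu z hz, h0, mul_zero]
    exact hu0 z ⟨⟨hz, by_contra fun hcon => hF0 z hz (by simpa using hcon) h⟩, h⟩ h0
  set d := Multiset.card Z with hd
  let D0 : ℂ → ℂ := fun ζ => (Z.map fun a => ζ - g a).prod
  let D1 : Polynomial ℂ := (Z.map fun a => 1 - Polynomial.C (conj (g a)) * Polynomial.X).prod
  have hD1 : ∀ ζ, D1.eval ζ = (Z.map fun a => 1 - conj (g a) * ζ).prod := by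
    intro ζ
    simp [D1, Polynomial.eval_multiset_prod, Multiset.map_map]
  let G : ℂ → ℂ := fun z => (Z.map fun a => dslope g a z).prod / u z
  have hGF : ∀ z ∈ Ω, G z * F z = D0 (g z) := by
    intro z hz
    have h1 : D0 (g z) = (Z.map fun a => z - a).prod * (Z.map fun a => dslope g a z).prod := by
      rw [← Multiset.prod_map_mul]
      simp only [D0]
      congr 1
      refine Multiset.map_congr rfl fun a _ => ?_
      rw [← smul_eq_mul, sub_smul_dslope]
    simp only [G]
    rw [h1, hFu z hz]
    have := hunz z hz
    field_simp
  have hGd : DifferentiableOn ℂ G Ω := by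
    refine DifferentiableOn.div ?_ hud hunz
    have : ∀ Y : Multiset ℂ, (∀ a ∈ Y, a ∈ Ω) →
        DifferentiableOn ℂ (fun z => (Y.map fun a => dslope g a z).prod) Ω := by
      intro Y
      induction Y using Multiset.induction_on with
      | empty => intro _; simp
      | cons a Y ih =>
        intro hY
        simp only [Multiset.map_cons, Multiset.prod_cons]
        exact ((differentiableOn_dslope (hg.isOpen.mem_nhds (hY a (Multiset.mem_cons_self a Y)))).2
          hg.diff).mul (ih fun b hb => hY b (Multiset.mem_cons_of_mem hb))
    exact this Z hZΩ
  obtain ⟨H, hHd, hH⟩ := hg.exists_trace_extension_of_differentiableOn isOpen_ball Subset.rfl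
    (hF.mono inter_subset_left)
  obtain ⟨T, hTd, hT⟩ := hg.exists_trace_extension_of_differentiableOn isOpen_ball Subset.rfl
    (hGd.mono inter_subset_left)
  have hD1ne : D1 ≠ 0 := by
    intro h
    have := hD1 0
    simp [h] at this
  have hreg : ∀ ε > 0, ∃ r < (1 : ℝ), ∀ ζ ∈ ball (0 : ℂ) 1 \ critVals Ω g, r < ‖ζ‖ →
      ‖H ζ * D1.eval ζ - ζ ^ d * conj (T ζ)‖ ≤ hg.degree * ε := by
    intro ε hε
    obtain ⟨δ, hδ, hδ2, hδ3⟩ : ∃ δ > 0, δ ≤ 1 / 2 ∧ δ + 2 ^ (d + 2) * δ ≤ ε := by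
      refine ⟨min (1 / 2) (ε / (1 + 2 ^ (d + 2))), by positivity, min_le_left _ _, ?_⟩
      have := min_le_right (1 / 2) (ε / (1 + 2 ^ (d + 2)))
      rw [le_div_iff₀ (by positivity)] at this
      linarith
    obtain ⟨r₁, hr₁, h₁⟩ := tendsto_reflected_prod Z g hδ
    obtain ⟨r₂, hr₂, h₂⟩ := hu δ hδ
    refine ⟨max r₁ r₂, max_lt hr₁ hr₂, fun ζ hζ hrζ => ?_⟩
    have hζ1 : ‖ζ‖ < 1 := by simpa using hζ.1
    rw [hH hζ, hT hζ, hg.trace_sub_mul hζ.1]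
    refine hg.norm_trace_le hζ fun z hz => ?_
    obtain ⟨hzΩ, hgz⟩ := hz
    have hgz : g z = ζ := hgz
    have hFl : 1 - δ < ‖F z‖ := h₂ z hzΩ (by rw [hgz]; exact (le_max_right _ _).trans_lt hrζ)
    have hFu1 := hF1 z hzΩ
    have hk := h₁ ζ ((le_max_left _ _).trans_lt hrζ) hζ1
    rw [← hD1] at hk
    have hgf := hGF z hzΩ
    rw [hgz] at hgf
    have hD0 : ‖D0 ζ‖ ≤ 2 ^ d := norm_prod_map_sub_le Z hζ1.le hgZ
    have hGn : ‖G z‖ ≤ 2 ^ (d + 1) := by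
      have h3 : ‖G z‖ * ‖F z‖ ≤ 2 ^ d := by rw [← norm_mul, hgf]; exact hD0
      rw [pow_succ]
      nlinarith [norm_nonneg (G z)]
    have hFF : F z * conj (F z) = ((‖F z‖ ^ 2 : ℝ) : ℂ) := by
      rw [Complex.mul_conj, Complex.normSq_eq_norm_sq]
    have heq : F z * D1.eval ζ - ζ ^ d * conj (G z) =
        F z * (D1.eval ζ - ζ ^ d * conj (D0 ζ)) +
          ζ ^ d * conj (G z) * (((‖F z‖ ^ 2 - 1 : ℝ) : ℂ)) := by
      rw [← hgf, map_mul]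
      push_cast at hFF ⊢
      linear_combination (ζ ^ d * conj (G z)) * hFF
    rw [heq]
    calc _ ≤ ‖F z‖ * ‖D1.eval ζ - ζ ^ d * conj (D0 ζ)‖ +
          ‖ζ‖ ^ d * ‖G z‖ * |‖F z‖ ^ 2 - 1| := by
            refine (norm_add_le _ _).trans_eq ?_
            rw [norm_mul, norm_mul, norm_mul, norm_pow, Complex.norm_real, Real.norm_eq_abs,
              Complex.norm_conj]
      _ ≤ 1 * δ + 1 * 2 ^ (d + 1) * (2 * δ) := by
            have h5 : |‖F z‖ ^ 2 - 1| ≤ 2 * δ := by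
              rw [abs_le]; constructor <;> nlinarith [norm_nonneg (F z)]
            have h6 : ‖ζ‖ ^ d ≤ 1 := pow_le_one₀ (norm_nonneg _) hζ1.le
            gcongr
      _ ≤ ε := by
            have : (2 : ℝ) ^ (d + 2) = 2 ^ (d + 1) * 2 := by ring
            rw [this] at hδ3; linarith
  have hall : ∀ ε > 0, ∃ r < (1 : ℝ), ∀ ζ ∈ ball (0 : ℂ) 1, r < ‖ζ‖ →
      ‖H ζ * D1.eval ζ - ζ ^ d * conj (T ζ)‖ ≤ hg.degree * ε := by
    intro ε hε
    obtain ⟨r, hr, h⟩ := hreg ε hε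
    refine ⟨r, hr, fun ζ hζ hrζ => ?_⟩
    have hct : ContinuousAt (fun ζ => ‖H ζ * D1.eval ζ - ζ ^ d * conj (T ζ)‖) ζ := by
      have hm := isOpen_ball.mem_nhds hζ
      have c1 := (hHd.differentiableAt hm).continuousAt
      have c2 := (hTd.differentiableAt hm).continuousAt
      have c3 := Complex.continuous_conj.continuousAt.comp c2
      exact ((c1.mul D1.continuous.continuousAt).sub ((continuousAt_id.pow d).mul c3)).norm
    exact le_of_tendsto_of_frequently hct.tendsto (((mem_closure_iff_frequently.1
      (diff_dense_of_discrete isOpen_ball hg.discrete_critVals hζ)).and_eventually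
      (continuous_norm.continuousAt.eventually (lt_mem_nhds hrζ))).mono fun w hw => h w hw.1 hw.2)
  have hHD : DifferentiableOn ℂ (fun ζ => H ζ * D1.eval ζ) (ball 0 1) :=
    hHd.mul D1.differentiable.differentiableOn
  obtain ⟨A, hA⟩ := exists_polynomial_of_circleIntegral_eq_zero (d := d) (R := 1) (by norm_num) hHD
    (by
      intro n hn
      rw [← norm_le_zero_iff]
      refine le_of_forall_pos_le_add fun η hη => ?_
      set C : ℝ := 2 * π * 2 ^ (n + 1) * hg.degree with hC
      have hCpos : 0 < C := by
        have : (0 : ℝ) < hg.degree := by exact_mod_cast hg.degree_pos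
        positivity
      obtain ⟨r, hr, h⟩ := hall (η / C) (by positivity)
      obtain ⟨s, hs1, hs2⟩ := exists_between (max_lt hr (show (1 / 2 : ℝ) < 1 by norm_num))
      have hrs : r < s := (le_max_left _ _).trans_lt hs1
      have hhs : 1 / 2 < s := (le_max_right _ _).trans_lt hs1
      have hs0 : 0 < s := by linarith
      have hdd : DifferentiableOn ℂ (fun z => (z ^ (n + 1))⁻¹ * (H z * D1.eval z))
          (annulus 0 1) :=
        DifferentiableOn.mul (DifferentiableOn.inv (by fun_prop)
          fun z hz => pow_ne_zero _ (norm_pos_iff.1 hz.1)) (hHD.mono fun z hz => by simpa using hz.2)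
      rw [circleIntegral_eq_of_differentiableOn_annulus le_rfl hdd (by norm_num) (by norm_num) hs0 hs2]
      have hTs := circleIntegral_conj_mul_inv_pow hs0
        (hTd.mono (closedBall_subset_ball hs2)) (n - d - 1)
      have hci1 : CircleIntegrable (fun z => (z ^ (n + 1))⁻¹ * (H z * D1.eval z)) 0 s :=
        (hdd.continuousOn.mono (sphere_subset_annulus hs0 hs2)).circleIntegrable hs0.le
      have hci2 : CircleIntegrable (fun z => (z ^ (n - d - 1 + 2))⁻¹ * conj (T z)) 0 s := by
        refine ContinuousOn.circleIntegrable hs0.le ?_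
        refine ContinuousOn.mul (ContinuousOn.inv₀ (by fun_prop) fun z hz => ?_)
          (Complex.continuous_conj.comp_continuousOn (hTd.continuousOn.mono
            (sphere_subset_closedBall.trans (closedBall_subset_ball hs2))))
        exact pow_ne_zero _ (ne_of_mem_sphere hz hs0.ne')
      have hsplit : (∮ z in C(0, s), (z ^ (n + 1))⁻¹ * (H z * D1.eval z)) =
          ∮ z in C(0, s), (z ^ (n + 1))⁻¹ * (H z * D1.eval z - z ^ d * conj (T z)) := by
        have := circleIntegral.integral_sub hci1 hci2
        rw [hTs, sub_zero] at this
        rw [← this]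
        refine circleIntegral.integral_congr hs0.le fun z hz => ?_
        have hz0 : z ≠ 0 := ne_of_mem_sphere hz hs0.ne'
        have he : z ^ (n + 1) = z ^ (n - d - 1 + 2) * z ^ d := by
          rw [← pow_add]; congr 1; omega
        simp only [he]
        field_simp
      rw [hsplit]
      have hbd : ∀ z ∈ sphere (0 : ℂ) s,
          ‖(z ^ (n + 1))⁻¹ * (H z * D1.eval z - z ^ d * conj (T z))‖ ≤
            2 ^ (n + 1) * (hg.degree * (η / C)) := by
        intro z hz
        have hzs : ‖z‖ = s := by simpa using hz
        rw [norm_mul, norm_inv, norm_pow, hzs]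
        refine mul_le_mul ?_ (h z (by simp [hzs, hs2]) (by rw [hzs]; exact hrs)) (norm_nonneg _)
          (by positivity)
        rw [← inv_pow]
        refine pow_le_pow_left₀ (by positivity) ?_ _
        rw [inv_le_comm₀ hs0 (by norm_num)]
        linarith
      refine (circleIntegral.norm_integral_le_of_norm_le_const hs0.le hbd).trans ?_
      have : 2 * π * s * (2 ^ (n + 1) * (hg.degree * (η / C))) = s * η := by
        have : (C * (η / C)) = η := by field_simp
        calc _ = s * (C * (η / C)) := by rw [hC]; ring
          _ = _ := by rw [this]
      rw [this]
      nlinarith)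
  refine ⟨A, D1, hD1ne, fun ζ hζ => ?_⟩
  rw [← hH hζ]
  exact hA ζ hζ.1

theorem BdryUnimodular.one {Ω : Set ℂ} {g : ℂ → ℂ} : BdryUnimodular Ω g fun _ => 1 :=
  fun ε hε => ⟨0, zero_lt_one, fun z _ _ => by simpa using hε⟩

theorem BdryUnimodular.mul {Ω : Set ℂ} {g F G : ℂ → ℂ} (hF : BdryUnimodular Ω g F)
    (hG : BdryUnimodular Ω g G) : BdryUnimodular Ω g fun z => F z * G z := by
  intro ε hε
  obtain ⟨δ, hδ, hδ1, hδε⟩ : ∃ δ > 0, δ ≤ 1 ∧ 2 * δ ≤ ε :=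
    ⟨min 1 (ε / 2), by positivity, min_le_left _ _, by linarith [min_le_right 1 (ε / 2)]⟩
  obtain ⟨r, hr, h⟩ := hF δ hδ
  obtain ⟨s, hs, k⟩ := hG δ hδ
  refine ⟨max r s, max_lt hr hs, fun z hz hrs => ?_⟩
  have h1 := h z hz ((le_max_left _ _).trans_lt hrs)
  have h2 := k z hz ((le_max_right _ _).trans_lt hrs)
  rw [norm_mul]
  have h3 : (1 - δ) * (1 - δ) ≤ ‖F z‖ * ‖G z‖ :=
    mul_le_mul h1.le h2.le (by linarith) (norm_nonneg _)
  nlinarith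

theorem BdryUnimodular.pow {Ω : Set ℂ} {g F : ℂ → ℂ} (hF : BdryUnimodular Ω g F) (n : ℕ) :
    BdryUnimodular Ω g fun z => F z ^ n := by
  induction n with
  | zero => simpa using BdryUnimodular.one
  | succ n ih => simpa [pow_succ] using ih.mul hF

theorem ProperDisc.discrete_preimage_critVals {Ω : Set ℂ} {p : ℂ → ℂ} (hp : ProperDisc Ω p) :
    ∀ z ∈ Ω, ∀ᶠ w in 𝓝[≠] z, w ∉ p ⁻¹' critVals Ω p := by
  intro z hz
  have h1 := eventually_ne_zero_of_differentiableOn hp.isOpen hp.preconn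
    (hp.diff.sub_const (p z)) (hp.exists_sub_ne_zero (p z)) hz
  have h2 : Tendsto p (𝓝[≠] z) (𝓝[≠] (p z)) := by
    refine tendsto_nhdsWithin_iff.2 ⟨?_, h1.mono fun w hw => sub_ne_zero.1 hw⟩
    exact ((hp.diff.differentiableAt (hp.isOpen.mem_nhds hz)).continuousAt).mono_left
      nhdsWithin_le_nhds
  exact h2.eventually (hp.discrete_critVals (p z) (hp.maps z hz))

theorem mul_det_eq_sum_adjugate {m : ℕ} (x v : Fin m → ℂ) (d : ℂ)
    (M : Matrix (Fin m) (Fin m) ℂ) (hM : ∀ k l, M k l = d * ∑ i, x i ^ ((k : ℕ) + (l : ℕ)))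
    (b : Fin m → ℂ) (hb : ∀ l, b l = d * ∑ i, v i * x i ^ (l : ℕ)) (i : Fin m) :
    v i * M.det = ∑ k : Fin m, ∑ l : Fin m, x i ^ (k : ℕ) * M.adjugate k l * b l := by
  let V : Matrix (Fin m) (Fin m) ℂ := Matrix.vandermonde x
  have hMV : M = d • (V.transpose * V) := by
    ext k l
    rw [hM]
    simp [V, Matrix.mul_apply, Matrix.vandermonde_apply, pow_add]
  have hbV : b = d • (V.transpose.mulVec v) := by
    ext l
    rw [hb]
    simp [V, Matrix.mulVec, dotProduct, Matrix.vandermonde_apply, mul_comm]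
  have hm : 0 < m := i.pos
  have key : V.mulVec (M.adjugate.mulVec b) = M.det • v := by
    rw [hMV, hbV, Matrix.adjugate_smul, Matrix.adjugate_mul_distrib, Matrix.det_smul,
      Matrix.mulVec_smul, Matrix.mulVec_smul, Matrix.mulVec_mulVec, Matrix.mulVec_mulVec]
    have : V * d ^ (Fintype.card (Fin m) - 1) • (V.adjugate * V.transpose.adjugate) *
        V.transpose = (d ^ (Fintype.card (Fin m) - 1) * (V.det * V.det)) • 1 := by
      rw [Matrix.mul_smul, Matrix.smul_mul, ← Matrix.mul_assoc V, Matrix.mul_adjugate,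
        Matrix.mul_assoc, Matrix.adjugate_mul, Matrix.det_transpose]
      simp [smul_smul]
    rw [this, Matrix.smul_mulVec, Matrix.one_mulVec, smul_smul]
    congr 1
    rw [Matrix.det_mul, Matrix.det_transpose, Fintype.card_fin]
    obtain ⟨n, rfl⟩ : ∃ n, m = n + 1 := ⟨m - 1, by omega⟩
    simp only [Nat.add_sub_cancel]
    ring
  have := congrFun key i
  simp only [Matrix.mulVec, dotProduct, Pi.smul_apply, smul_eq_mul, V,
    Matrix.vandermonde_apply] at this
  rw [mul_comm, ← this]
  refine Finset.sum_congr rfl fun k _ => ?_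
  rw [Finset.mul_sum]
  exact Finset.sum_congr rfl fun l _ => by ring

theorem exists_common_denominator {ι : Type*} (s : Finset ι) (A D : ι → Polynomial ℂ)
    (hD : ∀ i, D i ≠ 0) : ∃ (E : Polynomial ℂ) (B : ι → Polynomial ℂ), E ≠ 0 ∧
      ∀ i ∈ s, ∀ t ζ : ℂ, t * (D i).eval ζ = (A i).eval ζ → E.eval ζ * t = (B i).eval ζ := by
  classical
  refine ⟨∏ i ∈ s, D i, fun i => A i * ∏ j ∈ s.erase i, D j,
    Finset.prod_ne_zero_iff.2 fun i _ => hD i, fun i hi t ζ h => ?_⟩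
  rw [← Finset.mul_prod_erase s D hi, Polynomial.eval_mul, Polynomial.eval_mul, ← h]
  ring

/-- A function with unimodular boundary values is a rational combination of a proper map and a
second such function separating a regular fibre. -/
theorem ProperDisc.exists_rational_combination {Ω : Set ℂ} {g h f : ℂ → ℂ}
    (hg : ProperDisc Ω g) (hh : DifferentiableOn ℂ h Ω) (hh1 : ∀ z ∈ Ω, ‖h z‖ ≤ 1)
    (hhu : BdryUnimodular Ω g h) (hf : DifferentiableOn ℂ f Ω) (hf1 : ∀ z ∈ Ω, ‖f z‖ ≤ 1)
    (hfu : BdryUnimodular Ω g f)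
    (hsep : ∃ ζ ∈ ball (0 : ℂ) 1 \ critVals Ω g, InjOn h (fibre Ω g ζ)) :
    ∃ P Q : MvPolynomial (Fin 2) ℂ, (∃ z ∈ Ω, MvPolynomial.eval ![g z, h z] Q ≠ 0) ∧
      ∀ z ∈ Ω, f z * MvPolynomial.eval ![g z, h z] Q = MvPolynomial.eval ![g z, h z] P := by
  set m := hg.degree with hm
  have hpow1 : ∀ k, ∀ z ∈ Ω, ‖h z ^ k‖ ≤ 1 := fun k z hz => by
    rw [norm_pow]; exact pow_le_one₀ (norm_nonneg _) (hh1 z hz)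
  have h1 : ∀ k : ℕ, ∃ A D : Polynomial ℂ, D ≠ 0 ∧ ∀ ζ ∈ ball (0 : ℂ) 1 \ critVals Ω g,
      trace Ω g (fun z => h z ^ k) ζ * D.eval ζ = A.eval ζ := fun k =>
    hg.exists_rational_trace (hh.pow k) (hpow1 k) (hhu.pow k)
  have h2 : ∀ k : ℕ, ∃ A D : Polynomial ℂ, D ≠ 0 ∧ ∀ ζ ∈ ball (0 : ℂ) 1 \ critVals Ω g,
      trace Ω g (fun z => f z * h z ^ k) ζ * D.eval ζ = A.eval ζ := fun k =>
    hg.exists_rational_trace (hf.mul (hh.pow k)) (fun z hz => by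
      rw [norm_mul]; exact mul_le_one₀ (hf1 z hz) (norm_nonneg _) (hpow1 k z hz))
      (hfu.mul (hhu.pow k))
  choose A₁ D₁ hD₁ hA₁ using h1
  choose A₂ D₂ hD₂ hA₂ using h2
  obtain ⟨E, B, hE, hB⟩ := exists_common_denominator
    ((Finset.range (2 * m)).disjSum (Finset.range m)) (Sum.elim A₁ A₂) (Sum.elim D₁ D₂)
    (by rintro (k | k); exacts [hD₁ k, hD₂ k])
  let MM : Matrix (Fin m) (Fin m) (Polynomial ℂ) := fun k l => B (Sum.inl ((k : ℕ) + (l : ℕ)))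
  let Me : ℂ → Matrix (Fin m) (Fin m) ℂ := fun ζ => (Polynomial.evalRingHom ζ).mapMatrix MM
  have hMe : ∀ ζ ∈ ball (0 : ℂ) 1 \ critVals Ω g, ∀ k l : Fin m, Me ζ k l =
      E.eval ζ * trace Ω g (fun z => h z ^ ((k : ℕ) + (l : ℕ))) ζ := by
    intro ζ hζ k l
    have : Sum.inl ((k : ℕ) + (l : ℕ)) ∈
        (Finset.range (2 * m)).disjSum (Finset.range m) := by
      simp only [Finset.inl_mem_disjSum, Finset.mem_range]; omega
    rw [hB _ this _ ζ (hA₁ _ ζ hζ)]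
    rfl
  have hBe : ∀ ζ ∈ ball (0 : ℂ) 1 \ critVals Ω g, ∀ l : Fin m, (B (Sum.inr (l : ℕ))).eval ζ =
      E.eval ζ * trace Ω g (fun z => f z * h z ^ (l : ℕ)) ζ := by
    intro ζ hζ l
    have : Sum.inr (l : ℕ) ∈ (Finset.range (2 * m)).disjSum (Finset.range m) := by
      simp
    rw [hB _ this _ ζ (hA₂ _ ζ hζ)]
  have hdet : ∀ ζ, MM.det.eval ζ = (Me ζ).det := fun ζ =>
    RingHom.map_det (Polynomial.evalRingHom ζ) MM
  have hadj : ∀ ζ k l, (MM.adjugate k l).eval ζ = (Me ζ).adjugate k l := fun ζ k l => by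
    have := RingHom.map_adjugate (Polynomial.evalRingHom ζ) MM
    exact congrFun (congrFun this k) l
  have henum : ∀ ζ ∈ ball (0 : ℂ) 1 \ critVals Ω g, ∃ e : Fin m → ℂ, Function.Injective e ∧
      range e = fibre Ω g ζ ∧ ∀ F : ℂ → ℂ, trace Ω g F ζ = ∑ i, F (e i) := by
    intro ζ hζ
    have hfin := hg.finite_fibre hζ.1
    have hcard : hfin.toFinset.card = m := by
      rw [← Set.ncard_eq_toFinset_card _ hfin, hg.ncard_fibre hζ]
    let e := (hfin.toFinset.equivFinOfCardEq hcard).symm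
    refine ⟨fun i => e i, Subtype.val_injective.comp e.injective, ?_, fun F => ?_⟩
    · ext z
      constructor
      · rintro ⟨i, rfl⟩
        exact hfin.mem_toFinset.1 (e i).2
      · intro hz
        exact ⟨e.symm ⟨z, hfin.mem_toFinset.2 hz⟩, by simp⟩
    · rw [hg.trace_eq_sum hζ.1, ← Finset.sum_coe_sort]
      exact (e.sum_comp fun z => F z).symm
  have hdetne : MM.det ≠ 0 := by
    intro h0
    obtain ⟨ζ₀, hζ₀, hinj⟩ := hsep
    let N : ℂ → Matrix (Fin m) (Fin m) ℂ := fun ζ k l =>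
      trace Ω g (fun z => h z ^ ((k : ℕ) + (l : ℕ))) ζ
    have hreg := isOpen_diff_of_discrete isOpen_ball hg.discrete_critVals
    have hNc : ContinuousAt (fun ζ => (N ζ).det) ζ₀ := by
      have : ContinuousAt N ζ₀ := by
        refine continuousAt_pi.2 fun k => continuousAt_pi.2 fun l => ?_
        exact ((hg.differentiableOn_trace hreg Subset.rfl
          ((hh.pow _).mono inter_subset_left)).differentiableAt (hreg.mem_nhds hζ₀)).continuousAt
      exact (Continuous.matrix_det continuous_id).continuousAt.comp this
    have hN0 : ∀ᶠ ζ in 𝓝[≠] ζ₀, (N ζ).det = 0 := by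
      have hEne : ∀ᶠ ζ in 𝓝[≠] ζ₀, E.eval ζ ≠ 0 :=
        eventually_ne_zero_of_differentiableOn isOpen_univ isPreconnected_univ
          E.differentiable.differentiableOn (by
            by_contra! hcon
            exact hE (Polynomial.funext fun ζ => by simpa using hcon ζ (mem_univ ζ))) (mem_univ ζ₀)
      filter_upwards [hEne, nhdsWithin_le_nhds (hreg.mem_nhds hζ₀)] with ζ hE1 hζ
      have h3 : Me ζ = E.eval ζ • N ζ := by
        ext k l; rw [hMe ζ hζ]; rfl
      have h4 := hdet ζ
      rw [h0, h3, Matrix.det_smul, Polynomial.eval_zero] at h4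
      have h5 : E.eval ζ ^ Fintype.card (Fin m) ≠ 0 := pow_ne_zero _ hE1
      exact (mul_eq_zero.1 h4.symm).resolve_left h5
    have hN1 : (N ζ₀).det = 0 :=
      tendsto_nhds_unique (hNc.tendsto.mono_left nhdsWithin_le_nhds)
        (tendsto_const_nhds.congr' (hN0.mono fun _ h => h.symm))
    obtain ⟨e, he, her, hetr⟩ := henum ζ₀ hζ₀
    have hV : N ζ₀ = (Matrix.vandermonde fun i => h (e i)).transpose *
        Matrix.vandermonde fun i => h (e i) := by
      ext k l
      simp only [N]
      rw [hetr]
      simp [Matrix.mul_apply, Matrix.vandermonde_apply, pow_add]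
    rw [hV, Matrix.det_mul, Matrix.det_transpose, mul_self_eq_zero] at hN1
    refine Matrix.det_vandermonde_ne_zero_iff.2 (fun i j hij => he ?_) hN1
    exact hinj (her ▸ mem_range_self i) (her ▸ mem_range_self j) hij
  let toX : Polynomial ℂ → MvPolynomial (Fin 2) ℂ := Polynomial.aeval (MvPolynomial.X 0)
  have htoX : ∀ (p : Polynomial ℂ) (x y : ℂ), MvPolynomial.eval ![x, y] (toX p) = p.eval x := by
    intro p x y
    simp only [toX]
    rw [Polynomial.aeval_def, Polynomial.hom_eval₂]
    simp only [MvPolynomial.eval_X, Matrix.cons_val_zero]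
    have : (MvPolynomial.eval ![x, y]).comp (algebraMap ℂ (MvPolynomial (Fin 2) ℂ)) =
        RingHom.id ℂ := by ext; simp [MvPolynomial.algebraMap_eq]
    rw [this, Polynomial.eval₂_id]
  refine ⟨∑ k : Fin m, ∑ l : Fin m, MvPolynomial.X 1 ^ (k : ℕ) * toX (MM.adjugate k l) *
    toX (B (Sum.inr (l : ℕ))), toX MM.det, ?_, ?_⟩
  · have : ∃ ζ ∈ ball (0 : ℂ) 1, MM.det.eval ζ ≠ 0 := by
      by_contra! hcon
      refine hdetne (Polynomial.eq_zero_of_infinite_isRoot _ ?_)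
      refine Set.Infinite.mono (s := ball (0 : ℂ) 1) (fun ζ hζ => hcon ζ hζ) ?_
      exact infinite_of_mem_nhds 0 (ball_mem_nhds 0 one_pos)
    obtain ⟨ζ, hζ, hne⟩ := this
    obtain ⟨z, hz, hgz⟩ := hg.surj ζ hζ
    exact ⟨z, hz, by rw [htoX, hgz]; exact hne⟩
  · simp only [map_sum, map_mul, map_pow, htoX, MvPolynomial.eval_X, Matrix.cons_val_one,
      Matrix.cons_val_zero]
    have hreg : ∀ z ∈ Ω \ g ⁻¹' critVals Ω g, f z * MM.det.eval (g z) = ∑ k : Fin m, ∑ l : Fin m,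
        h z ^ (k : ℕ) * (MM.adjugate k l).eval (g z) * (B (Sum.inr (l : ℕ))).eval (g z) := by
      intro z hz
      have hζ : g z ∈ ball (0 : ℂ) 1 \ critVals Ω g := ⟨hg.maps z hz.1, hz.2⟩
      obtain ⟨e, he, her, hetr⟩ := henum _ hζ
      obtain ⟨i, rfl⟩ : z ∈ range e := by rw [her]; exact ⟨hz.1, rfl⟩
      simp only [hdet, hadj]
      exact mul_det_eq_sum_adjugate (fun i => h (e i)) (fun i => f (e i)) (E.eval (g (e i)))
        (Me (g (e i))) (fun k l => by rw [hMe _ hζ, hetr])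
        (fun l : Fin m => (B (Sum.inr (l : ℕ))).eval (g (e i))) (fun l => by rw [hBe _ hζ, hetr]) i
    intro z hz
    have hcl := diff_dense_of_discrete hg.isOpen hg.discrete_preimage_critVals hz
    have hfr : ∃ᶠ w in 𝓝 z, w ∈ Ω \ g ⁻¹' critVals Ω g := mem_closure_iff_frequently.1 hcl
    have hmem := hg.isOpen.mem_nhds hz
    have cf := (hf.differentiableAt hmem).continuousAt
    have ch := (hh.differentiableAt hmem).continuousAt
    have cg := (hg.diff.differentiableAt hmem).continuousAt
    have cp : ∀ p : Polynomial ℂ, ContinuousAt (fun w => p.eval (g w)) z := fun p =>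
      ContinuousAt.comp (g := fun x => p.eval x) p.continuous.continuousAt cg
    have c1 : ContinuousAt (fun z => f z * MM.det.eval (g z) - ∑ k : Fin m, ∑ l : Fin m,
        h z ^ (k : ℕ) * (MM.adjugate k l).eval (g z) * (B (Sum.inr (l : ℕ))).eval (g z)) z := by
      refine (cf.mul (cp _)).sub ?_
      refine tendsto_finsetSum _ fun k _ => tendsto_finsetSum _ fun l _ => ?_
      exact ((ch.pow _).mul (cp _)).mul (cp _)
    have hcl0 : IsClosed ({0} : Set ℂ) := isClosed_singleton
    have := hcl0.mem_of_frequently_of_tendsto (hfr.mono fun w hw => sub_eq_zero.2 (hreg w hw))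
      c1.tendsto
    exact sub_eq_zero.1 this

theorem exists_solution_of_skew_kernel {X : Type*} [TopologicalSpace X] [CompactSpace X]
    [SecondCountableTopology X] [MeasurableSpace X] [BorelSpace X] (μ : Measure X)
    [IsFiniteMeasure μ] (K : C(X × X, ℂ)) (hK : ∀ x y, conj (K (y, x)) = -K (x, y))
    (k : C(X, ℂ)) : ∃ g : C(X, ℂ), ∀ x, g x = k x + ∫ y, K (x, y) * g y ∂μ := by
  let φ : C(X, Lp ℂ 2 μ) :=
    ⟨fun x => ContinuousMap.toLp 2 μ ℂ (ContinuousMap.curry (star K) x),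
      (ContinuousMap.toLp (E := ℂ) 2 μ ℂ).continuous.comp (ContinuousMap.curry (star K)).continuous⟩
  have hinner : ∀ x (u : Lp ℂ 2 μ), inner ℂ (φ x) u = ∫ y, K (x, y) * u y ∂μ := by
    intro x u
    rw [L2.inner_def]
    refine integral_congr_ae ?_
    filter_upwards [ContinuousMap.coeFn_toLp (p := 2) (𝕜 := ℂ) μ
      (ContinuousMap.curry (star K) x)] with y hy
    change inner ℂ ((ContinuousMap.toLp 2 μ ℂ (ContinuousMap.curry (star K) x) : Lp ℂ 2 μ) y) (u y) = _
    rw [hy]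
    simp [mul_comm]
  let T : Lp ℂ 2 μ →L[ℂ] C(X, ℂ) := LinearMap.mkContinuous
    { toFun := fun u => ⟨fun x => inner ℂ (φ x) u, by fun_prop⟩
      map_add' := fun u v => by ext x; simp [inner_add_right]
      map_smul' := fun c u => by ext x; simp [inner_smul_right] } ‖φ‖ (fun u => by
        refine (ContinuousMap.norm_le _ (by positivity)).2 fun x => ?_
        exact (norm_inner_le_norm _ _).trans
          (mul_le_mul_of_nonneg_right (φ.norm_coe_le_norm x) (norm_nonneg _)))
  have hT : ∀ u x, T u x = ∫ y, K (x, y) * u y ∂μ := fun u x => hinner x u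
  let B : Lp ℂ 2 μ →L[ℂ] Lp ℂ 2 μ := (ContinuousMap.toLp 2 μ ℂ).comp T
  obtain ⟨C, hC⟩ : ∃ C, ∀ p, ‖K p‖ ≤ C := ⟨‖K‖, K.norm_coe_le_norm⟩
  have hL1 : ∀ u : Lp ℂ 2 μ, Integrable (fun y => u y) μ := fun u =>
    (Lp.memLp u).integrable (by norm_num)
  have hB : ∀ u v, inner ℂ v (B u) = ∫ x, ∫ y, conj (v x) * (K (x, y) * u y) ∂μ ∂μ := by
    intro u v
    rw [L2.inner_def]
    refine integral_congr_ae ?_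
    filter_upwards [ContinuousMap.coeFn_toLp (p := 2) (𝕜 := ℂ) μ (T u)] with x hx
    change inner ℂ (v x) ((ContinuousMap.toLp 2 μ ℂ (T u) : Lp ℂ 2 μ) x) = _
    rw [hx, hT, integral_const_mul]
    simp [mul_comm]
  have hInt : ∀ u v : Lp ℂ 2 μ, Integrable (Function.uncurry fun x y => conj (v x) * (K (x, y) * u y))
      (μ.prod μ) := by
    intro u v
    have h1 : Integrable (fun x => conj (v x)) μ :=
      ((hL1 v).norm).mono' (continuous_conj.comp_aestronglyMeasurable (hL1 v).1)
        (Eventually.of_forall fun x => by simp)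
    have h2 := (h1.mul_prod (hL1 u)).bdd_mul (f := fun p => K p) (c := C)
      K.continuous.aestronglyMeasurable (Eventually.of_forall hC)
    refine h2.congr (Eventually.of_forall fun p => ?_)
    simp only [Function.uncurry]
    ring
  have hskew : ∀ u, inner ℂ u (B u) = -conj (inner ℂ u (B u)) := by
    intro u
    have h1 : inner ℂ u (B u) = ∫ y, ∫ x, conj (u x) * (K (x, y) * u y) ∂μ ∂μ := by
      rw [hB, integral_integral_swap (hInt u u)]
    refine (hB u u).trans ?_
    rw [h1, ← integral_conj, ← integral_neg]
    refine integral_congr_ae (Eventually.of_forall fun y => ?_)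
    simp only
    rw [← integral_conj, ← integral_neg]
    refine integral_congr_ae (Eventually.of_forall fun x => ?_)
    simp only [map_mul, conj_conj, hK]
    ring
  have hunit : IsUnit ((1 : Lp ℂ 2 μ →L[ℂ] Lp ℂ 2 μ) - B) := by
    refine ContinuousLinearMap.isUnit_of_forall_le_norm_inner_map _ (c := 1) one_pos fun u => ?_
    rw [NNReal.coe_one, mul_one]
    refine le_trans ?_ (Complex.re_le_norm _)
    have h1 : (inner ℂ (B u) u).re = 0 := by
      rw [← inner_conj_symm, conj_re]
      have := congrArg Complex.re (hskew u)
      rw [neg_re, conj_re] at this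
      linarith
    have h2 := inner_self_eq_norm_sq (𝕜 := ℂ) u
    simp only [_root_.sub_apply, one_apply_eq_self, inner_sub_left, sub_re, h1]
    rw [sub_zero]
    exact h2.ge
  obtain ⟨u, hu⟩ := (ContinuousLinearMap.isUnit_iff_bijective.1 hunit).2 (ContinuousMap.toLp 2 μ ℂ k)
  refine ⟨k + T u, fun x => ?_⟩
  have hae : (fun y => u y) =ᵐ[μ] fun y => (k + T u) y := by
    have h1 : u = ContinuousMap.toLp 2 μ ℂ (k + T u) := by
      rw [map_add, ← hu]
      change u = (u - B u) + B u
      abel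
    have h2 := ContinuousMap.coeFn_toLp (p := 2) (𝕜 := ℂ) μ (k + T u)
    rw [← h1] at h2
    exact h2
  have h3 : ∫ y, K (x, y) * (k + T u) y ∂μ = ∫ y, K (x, y) * u y ∂μ := by
    refine integral_congr_ae ?_
    filter_upwards [hae] with y hy
    rw [hy]
  rw [h3, ← hT]
  rfl

theorem exists_solution_of_skew_kernel_circle {J : Type*} [Fintype J] (K : J → J → ℂ → ℂ → ℂ)
    (hKc : ∀ i j, ContinuousOn (Function.uncurry (K i j)) (sphere 0 1 ×ˢ sphere 0 1))
    (hK : ∀ i j, ∀ w ∈ sphere (0 : ℂ) 1, ∀ w' ∈ sphere (0 : ℂ) 1,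
      conj (K j i w' w) = -K i j w w')
    (k : J → ℂ → ℂ) (hk : ∀ i, ContinuousOn (k i) (sphere 0 1)) :
    ∃ g : J → ℂ → ℂ, (∀ i, ContinuousOn (g i) (sphere 0 1)) ∧
      ∀ i, ∀ w ∈ sphere (0 : ℂ) 1, g i w = k i w + ∑ j, (2 * π : ℂ)⁻¹ *
        ∫ θ in 0..2 * π, K i j w (circleMap 0 1 θ) * g j (circleMap 0 1 θ) := by
  classical
  let _ : TopologicalSpace J := ⊥
  have _ : DiscreteTopology J := ⟨rfl⟩
  let _ : MeasurableSpace J := ⊤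
  have _ : BorelSpace J := ⟨by
    rw [borel_eq_top_of_discrete]⟩
  have _ : Fact (0 < 2 * π) := ⟨by positivity⟩
  let e : AddCircle (2 * π) → ℂ := fun x => (AddCircle.toCircle x : ℂ)
  have he : Continuous e := continuous_subtype_val.comp AddCircle.continuous_toCircle
  have hes : ∀ x, e x ∈ sphere (0 : ℂ) 1 := fun x => by
    rw [mem_sphere_zero_iff_norm]; exact Circle.norm_coe _
  have hec : ∀ θ : ℝ, e (θ : AddCircle (2 * π)) = circleMap 0 1 θ := fun θ => by
    have : 2 * π / (2 * π) * θ = θ := by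
      rw [div_self (by positivity), one_mul]
    simp only [e, AddCircle.toCircle_apply_mk, this, Circle.coe_exp, circleMap, ofReal_one]
    simp
  have hesurj : ∀ w ∈ sphere (0 : ℂ) 1, ∃ x, e x = w := fun w hw => by
    refine ⟨((Complex.arg w : ℝ) : AddCircle (2 * π)), ?_⟩
    rw [hec, circleMap]
    have := Complex.norm_mul_exp_arg_mul_I w
    rw [mem_sphere_zero_iff_norm.1 hw] at this
    simpa using this
  let μ : Measure (J × AddCircle (2 * π)) := Measure.count.prod volume
  let δ : J → (J × AddCircle (2 * π)) → ℂ := fun i x => if x.1 = i then 1 else 0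
  have hδ : ∀ i, Continuous (δ i) := fun i =>
    (continuous_of_discreteTopology (f := fun a : J => if a = i then (1 : ℂ) else 0)).comp
      continuous_fst
  let KK : C((J × AddCircle (2 * π)) × (J × AddCircle (2 * π)), ℂ) := ⟨fun p => ∑ i, ∑ j, δ i p.1 * δ j p.2 * ((2 * π : ℂ)⁻¹ *
    K i j (e p.1.2) (e p.2.2)), by
      refine continuous_finsetSum _ fun i _ => continuous_finsetSum _ fun j _ => ?_
      refine ((hδ i).comp continuous_fst).mul ((hδ j).comp continuous_snd) |>.mul ?_
      refine continuous_const.mul ?_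
      exact (hKc i j).comp_continuous (f := fun p : (J × AddCircle (2 * π)) × (J × AddCircle (2 * π)) => (e p.1.2, e p.2.2))
        (by fun_prop) fun p => ⟨hes _, hes _⟩⟩
  have hKK : ∀ p, KK p = (2 * π : ℂ)⁻¹ * K p.1.1 p.2.1 (e p.1.2) (e p.2.2) := fun p => by
    simp [KK, δ]
  let kk : C((J × AddCircle (2 * π)), ℂ) := ⟨fun x => ∑ i, δ i x * k i (e x.2), by
    refine continuous_finsetSum _ fun i _ => (hδ i).mul ?_
    exact (hk i).comp_continuous (f := fun x : (J × AddCircle (2 * π)) => e x.2) (by fun_prop) fun p => hes _⟩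
  have hkk : ∀ x, kk x = k x.1 (e x.2) := fun x => by simp [kk, δ]
  obtain ⟨g, hg⟩ := exists_solution_of_skew_kernel μ KK (fun x y => by
    simp only [hKK, map_mul, hK _ _ _ (hes _) _ (hes _)]
    simp [Complex.conj_ofNat]) kk
  let ι : ℂ → AddCircle (2 * π) := fun w => ((Complex.arg w : ℝ) : AddCircle (2 * π))
  have hι : ∀ x, ι (e x) = x := by
    intro x
    apply AddCircle.injective_toCircle (by positivity : 2 * π ≠ 0)
    apply Subtype.ext
    change e (ι (e x)) = e x
    rw [hec, circleMap]
    have := Complex.norm_mul_exp_arg_mul_I (e x)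
    rw [mem_sphere_zero_iff_norm.1 (hes x)] at this
    simpa using this
  refine ⟨fun i w => g (i, ι w), fun i => ?_, fun i w hw => ?_⟩
  · have hq : IsQuotientMap (fun x => (⟨e x, hes x⟩ : sphere (0 : ℂ) 1)) := by
      refine IsQuotientMap.of_surjective_continuous (X := AddCircle (2 * π)) ?_ ?_
      · rintro ⟨w, hw⟩
        obtain ⟨x, hx⟩ := hesurj w hw
        exact ⟨x, Subtype.ext hx⟩
      · exact he.subtype_mk _
    rw [continuousOn_iff_continuous_domRestrict, hq.continuous_iff]
    have : (sphere (0 : ℂ) 1).domRestrict (fun w => g (i, ι w)) ∘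
        (fun x => (⟨e x, hes x⟩ : sphere (0 : ℂ) 1)) = fun x => g (i, x) := by
      ext x
      simp [domRestrict, hι]
    rw [this]
    fun_prop
  · obtain ⟨x, rfl⟩ := hesurj w hw
    simp only [hι]
    rw [hg, hkk, integral_prod]
    · congr 1
      rw [integral_fintype]
      · refine Finset.sum_congr rfl fun j _ => ?_
        simp only [measureReal_def, Measure.count_singleton, ENNReal.toReal_one, one_smul, hKK]
        have h1 := AddCircle.intervalIntegral_preimage (2 * π) 0
          (fun y => (2 * π : ℂ)⁻¹ * K i j (e x) (e y) * g (j, y))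
        rw [← h1, zero_add, ← intervalIntegral.integral_const_mul]
        refine intervalIntegral.integral_congr fun θ _ => ?_
        simp only [← hec, hι]
        ring
      · exact Integrable.of_finite
    · refine Continuous.integrable_of_hasCompactSupport ?_ (HasCompactSupport.of_compactSpace _)
      fun_prop

/-- The region consisting of `K` and of the parts of the collars `ψ j` of radius below `t`. -/
def reg {J : Type*} (K : Set ℂ) (ρ : ℝ) (ψ : J → ℂ → ℂ) (t : ℝ) : Set ℂ :=
  K ∪ ⋃ j, ψ j '' annulus ρ t

/-- Analytic collars `ψ j` of the annulus `ρ < |w| < ρ⁻¹`, attached to `K` from outside, whose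
core curves bound the region `reg K ρ ψ 1`. -/
structure Collared {J : Type*} [Fintype J] (K : Set ℂ) (ρ : ℝ) (ψ : J → ℂ → ℂ) : Prop where
  pos : 0 < ρ
  lt_one : ρ < 1
  diff : ∀ j, DifferentiableOn ℂ (ψ j) (annulus ρ ρ⁻¹)
  deriv_ne : ∀ j, ∀ w ∈ annulus ρ ρ⁻¹, deriv (ψ j) w ≠ 0
  inj : ∀ i j, ∀ w ∈ annulus ρ ρ⁻¹, ∀ w' ∈ annulus ρ ρ⁻¹, ψ i w = ψ j w' → i = j ∧ w = w'
  notMem : ∀ j, ∀ w ∈ annulus ρ ρ⁻¹, ψ j w ∉ K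
  isCompact : ∀ t, ρ < t → t < ρ⁻¹ → IsCompact (K ∪ ⋃ j, ψ j '' {w | ρ < ‖w‖ ∧ ‖w‖ ≤ t})
  isOpen : ∀ t, ρ < t → t ≤ ρ⁻¹ → IsOpen (reg K ρ ψ t)
  preconn : ∀ t, ρ < t → t ≤ ρ⁻¹ → IsPreconnected (reg K ρ ψ t)
  cauchy : ∀ t t', ρ < t → t < t' → t' ≤ ρ⁻¹ → ∀ F, DifferentiableOn ℂ F (reg K ρ ψ t') →
    ∑ j, ∮ w in C(0, t), F (ψ j w) * deriv (ψ j) w = 0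
  index : ∀ t, ρ < t → t < ρ⁻¹ → ∀ z ∈ reg K ρ ψ t,
    ∑ j, ∮ w in C(0, t), deriv (ψ j) w / (ψ j w - z) = 2 * π * I

/-- The Cauchy transform of the half-order density `g` on the curves of radius `t`. -/
def cauchyTransform {J : Type*} [Fintype J] (ψ σ g : J → ℂ → ℂ) (t : ℝ) (z : ℂ) : ℂ :=
  (2 * π * I)⁻¹ * ∑ j, ∮ w in C(0, t), g j w * σ j w / (ψ j w - z)

/-- Half-order densities for the collars `ψ`. -/
structure HalfDensity {J : Type*} (ρ : ℝ) (ψ σ : J → ℂ → ℂ) : Prop where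
  diff : ∀ j, DifferentiableOn ℂ (σ j) (annulus ρ ρ⁻¹)
  sq : ∀ j, ∀ w ∈ annulus ρ ρ⁻¹, σ j w ^ 2 = deriv (ψ j) w

theorem reg_mono {J : Type*} (K : Set ℂ) (ρ : ℝ) (ψ : J → ℂ → ℂ) {t t' : ℝ} (h : t ≤ t') :
    reg K ρ ψ t ⊆ reg K ρ ψ t' :=
  union_subset_union_right _ (iUnion_mono fun _ => image_mono (annulus_mono le_rfl h))

theorem mem_reg_of_mem {J : Type*} {K : Set ℂ} {ρ : ℝ} {ψ : J → ℂ → ℂ} {t : ℝ} {j : J} {w : ℂ}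
    (h1 : ρ < ‖w‖) (h2 : ‖w‖ < t) : ψ j w ∈ reg K ρ ψ t :=
  Or.inr (mem_iUnion.2 ⟨j, w, ⟨h1, h2⟩, rfl⟩)

/-- The half-order Cauchy kernel in collar coordinates. -/
def collarKernel {J : Type*} (ψ σ : J → ℂ → ℂ) (i j : J) (w w' : ℂ) : ℂ :=
  σ i w * σ j w' / (ψ j w' - ψ i w)

/-- The regular part of `collarKernel` on the annulus `r < |w| < r⁻¹`. -/
def regularKernel {J : Type*} (ψ σ : J → ℂ → ℂ) (r : ℝ) (i j : J) (w w' : ℂ) : ℂ :=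
  (2 * π * I)⁻¹ * ((∮ ξ in C(0, r⁻¹), collarKernel ψ σ i j ξ w' / (ξ - w)) -
    ∮ ξ in C(0, r), collarKernel ψ σ i j ξ w' / (ξ - w))

/-- The reflection of a half-order density in the unit circle. -/
def reflect (f : ℂ → ℂ) (w : ℂ) : ℂ := w⁻¹ * conj (f (conj w)⁻¹)

theorem inv_conj_mem_annulus {r : ℝ} (hr : 0 < r) {w : ℂ} (hw : w ∈ annulus r r⁻¹) :
    (conj w)⁻¹ ∈ annulus r r⁻¹ := by
  have h0 : 0 < ‖w‖ := hr.trans hw.1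
  refine ⟨?_, ?_⟩
  · rw [norm_inv, RCLike.norm_conj]
    exact (lt_inv_comm₀ h0 hr).1 hw.2
  · rw [norm_inv, RCLike.norm_conj]
    have := hw.1
    gcongr

theorem ne_zero_of_mem_annulus {r R : ℝ} (hr : 0 ≤ r) {w : ℂ} (hw : w ∈ annulus r R) : w ≠ 0 :=
  norm_pos_iff.1 (hr.trans_lt hw.1)

theorem differentiableOn_conj_inv {f : ℂ → ℂ} {r : ℝ} (hr : 0 < r)
    (hf : DifferentiableOn ℂ f (annulus r r⁻¹)) :
    DifferentiableOn ℂ (fun w => conj (f (conj w)⁻¹)) (annulus r r⁻¹) := by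
  intro w hw
  have h0 := ne_zero_of_mem_annulus hr.le hw
  have h1 : DifferentiableAt ℂ (fun v => f v⁻¹) (conj w) :=
    DifferentiableAt.comp (g := f) (f := fun v : ℂ => v⁻¹) (conj w)
      (hf.differentiableAt ((isOpen_annulus _ _).mem_nhds (inv_conj_mem_annulus hr hw)))
      (differentiableAt_inv (by simpa using h0))
  have := differentiableAt_conj_conj_iff.2 h1
  exact this.differentiableWithinAt

theorem differentiableOn_reflect {f : ℂ → ℂ} {r : ℝ} (hr : 0 < r)
    (hf : DifferentiableOn ℂ f (annulus r r⁻¹)) : DifferentiableOn ℂ (reflect f) (annulus r r⁻¹) :=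
  (differentiableOn_inv.mono fun _ hw => ne_zero_of_mem_annulus hr.le hw).mul
    (differentiableOn_conj_inv hr hf)

theorem reflect_reflect (f : ℂ → ℂ) {w : ℂ} (hw : w ≠ 0) : reflect (reflect f) w = f w := by
  simp only [reflect, map_mul, map_inv₀, conj_conj, inv_inv]
  rw [← mul_assoc, inv_mul_cancel₀ hw, one_mul]

theorem inv_conj_of_mem_sphere {w : ℂ} (hw : w ∈ sphere (0 : ℂ) 1) : (conj w)⁻¹ = w := by
  rw [← map_inv₀, inv_eq_conj (mem_sphere_zero_iff_norm.1 hw), conj_conj]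

theorem reflect_of_mem_sphere (f : ℂ → ℂ) {w : ℂ} (hw : w ∈ sphere (0 : ℂ) 1) :
    reflect f w = conj w * conj (f w) := by
  rw [reflect, inv_conj_of_mem_sphere hw, inv_eq_conj (mem_sphere_zero_iff_norm.1 hw)]

theorem reflect_cauchy (g : ℂ → ℂ) {r : ℝ} (hr : 0 < r) {w : ℂ} (hw : w ∈ annulus r r⁻¹) :
    reflect (fun v => (2 * π * I)⁻¹ * ∮ ξ in C(0, r⁻¹), reflect g ξ / (ξ - v)) w =
      -((2 * π * I)⁻¹ * ∮ ξ in C(0, r), g ξ / (ξ - w)) := by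
  have h0 := ne_zero_of_mem_annulus hr.le hw
  simp only [reflect, map_mul, circleIntegral, ← intervalIntegral.intervalIntegral_conj,
    ← intervalIntegral.integral_const_mul, ← intervalIntegral.integral_neg]
  refine intervalIntegral.integral_congr fun θ _ => ?_
  have hc : (conj (circleMap 0 r⁻¹ θ))⁻¹ = circleMap 0 r θ := by
    simp only [circleMap, zero_add, map_mul, conj_ofReal, ofReal_inv, ← exp_conj, mul_inv,
      map_inv₀, inv_inv, conj_I, mul_neg, exp_neg]
  have hc' : conj (circleMap 0 r⁻¹ θ) = (circleMap 0 r θ)⁻¹ := by rw [← hc, inv_inv]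
  have hn : circleMap 0 r θ ≠ 0 := by
    rw [← norm_pos_iff]; simp [circleMap, hr.ne']
  have hn2 : circleMap 0 r θ - w ≠ 0 := fun h => by
    have := hw.1
    rw [← sub_eq_zero.1 h] at this
    simp [circleMap, abs_of_pos hr] at this
  have hpi : (π : ℂ) ≠ 0 := ofReal_ne_zero.2 Real.pi_ne_zero
  simp only [deriv_circleMap, smul_eq_mul, map_mul, map_div₀, map_sub, map_inv₀, hc', inv_inv,
    conj_conj, conj_I, conj_ofReal, map_ofNat]
  have hn3 : (circleMap 0 r θ)⁻¹ - w⁻¹ ≠ 0 := fun h => hn2 (by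
    rw [inv_injective (sub_eq_zero.1 h), sub_self])
  have e : (circleMap 0 r θ)⁻¹ - w⁻¹ = -(circleMap 0 r θ - w) * ((circleMap 0 r θ)⁻¹ * w⁻¹) := by
    field_simp; ring
  rw [e]
  have hI := I_ne_zero
  field_simp

theorem eqOn_zero_of_eqOn_sphere {f : ℂ → ℂ} {r R : ℝ} (hr : 0 ≤ r) (hr1 : r < 1) (hR : 1 < R)
    (hf : DifferentiableOn ℂ f (annulus r R)) (h : ∀ w ∈ sphere (0 : ℂ) 1, f w = 0) :
    EqOn f 0 (annulus r R) := by
  refine (hf.analyticOnNhd (isOpen_annulus r R)).eqOn_zero_of_preconnected_of_mem_closure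
    (isPreconnected_annulus hr R) (z₀ := circleMap 0 1 0)
    (sphere_subset_annulus hr1 hR (circleMap_mem_sphere 0 zero_le_one 0)) ?_
  have h1 := (hasDerivAt_circleMap 0 1 0).eventually_ne (c := circleMap 0 1 0) (by simp [circleMap])
  have h2 : Tendsto (circleMap 0 1) (𝓝[≠] 0) (𝓝 (circleMap 0 1 0)) :=
    (continuous_circleMap 0 1).continuousAt.tendsto.mono_left nhdsWithin_le_nhds
  refine mem_closure_of_tendsto h2 ?_
  filter_upwards [h1] with θ hθ
  exact ⟨h _ (circleMap_mem_sphere 0 zero_le_one θ), hθ⟩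

/-- The integral operator on the unit circle defined by `regularKernel`. -/
def regularOp {J : Type*} [Fintype J] (ψ σ : J → ℂ → ℂ) (r : ℝ) (h : J → ℂ → ℂ) (i : J) (w : ℂ) :
    ℂ :=
  (2 * π * I)⁻¹ * ∑ j, ∮ ξ in C(0, 1), regularKernel ψ σ r i j w ξ * h j ξ

/-- `S` is the Szegő kernel at `a`, and `(z - a)⁻¹ + M z` the Garabedian kernel, of the region
bounded by the core curves of the collars `ψ`. -/
structure IsSzegoPair {J : Type*} (K : Set ℂ) (ρ : ℝ) (ψ σ : J → ℂ → ℂ) (a : ℂ) (R : ℝ)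
    (S M : ℂ → ℂ) : Prop where
  one_lt : 1 < R
  lt : R < ρ⁻¹
  diff : DifferentiableOn ℂ S (reg K ρ ψ R)
  diff' : DifferentiableOn ℂ M (reg K ρ ψ R)
  reflect_eq : ∀ j, ∀ w ∈ annulus R⁻¹ R, reflect (fun v => σ j v * S (ψ j v)) w =
    σ j w * ((ψ j w - a)⁻¹ + M (ψ j w))

/-- The winding number about `0` of the image under `f` of the circle of radius `t`. -/
def wind (f : ℂ → ℂ) (t : ℝ) : ℂ :=
  (2 * π * I)⁻¹ * ∮ w in C(0, t), logDeriv f w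

theorem two_pi_I_mul_wind (f : ℂ → ℂ) (t : ℝ) :
    2 * π * I * wind f t = ∮ w in C(0, t), logDeriv f w := by
  rw [wind, ← mul_assoc, mul_inv_cancel₀ two_pi_I_ne_zero, one_mul]

section

variable {f g : ℂ → ℂ} {r R t : ℝ} (hr : 0 ≤ r) (hf : DifferentiableOn ℂ f (annulus r R))
  (ht : r < t) (htR : t < R) (h0 : ∀ w ∈ sphere (0 : ℂ) t, f w ≠ 0)

include hf ht htR h0 in
theorem continuousOn_logDeriv_sphere : ContinuousOn (logDeriv f) (sphere 0 t) := by
  have hs := sphere_subset_annulus ht htR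
  exact ((hf.deriv (isOpen_annulus r R)).continuousOn.mono hs).div (hf.continuousOn.mono hs) h0

include hr hf ht htR h0

theorem circleIntegrable_logDeriv : CircleIntegrable (logDeriv f) 0 t :=
  (continuousOn_logDeriv_sphere hf ht htR h0).circleIntegrable (hr.trans ht.le)

theorem exists_log_lift : ∃ ℓ : ℝ → ℂ, Continuous ℓ ∧ (∀ θ, exp (ℓ θ) = f (circleMap 0 t θ)) ∧
    ℓ (2 * π) - ℓ 0 = 2 * π * I * wind f t := by
  have hs := sphere_subset_annulus ht htR
  have hm : ∀ θ, circleMap 0 t θ ∈ sphere (0 : ℂ) t := circleMap_mem_sphere 0 (hr.trans ht.le)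
  set φ : ℝ → ℂ := fun θ => deriv (circleMap 0 t) θ * logDeriv f (circleMap 0 t θ) with hφ
  have hφc : Continuous φ := by
    have h1 : Continuous fun θ => logDeriv f (circleMap 0 t θ) :=
      (continuousOn_logDeriv_sphere hf ht htR h0).comp_continuous (continuous_circleMap 0 t) hm
    have h2 : Continuous (deriv (circleMap 0 t)) := by
      simp only [funext (deriv_circleMap 0 t)]
      fun_prop
    exact h2.mul h1
  set ℓ : ℝ → ℂ := fun θ => log (f (circleMap 0 t 0)) + ∫ x in 0..θ, φ x with hℓ
  have hℓd : ∀ θ, HasDerivAt ℓ (φ θ) θ := fun θ =>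
    (hφc.integral_hasStrictDerivAt 0 θ).hasDerivAt.const_add _
  have hfd : ∀ θ : ℝ, HasDerivAt (fun x : ℝ => f (circleMap 0 t x))
      (deriv f (circleMap 0 t θ) * deriv (circleMap 0 t) θ) θ := fun θ => by
    have h1 : HasDerivAt f (deriv f (circleMap 0 t θ)) (circleMap 0 t θ) :=
      (hf.differentiableAt ((isOpen_annulus r R).mem_nhds (hs (hm θ)))).hasDerivAt
    have h2 := hasDerivAt_circleMap 0 t θ
    rw [deriv_circleMap]
    exact h1.comp θ h2
  have hG : ∀ θ, HasDerivAt (fun x => exp (-ℓ x) * f (circleMap 0 t x)) 0 θ := fun θ => by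
    have h := ((hℓd θ).neg.cexp).mul (hfd θ)
    refine h.congr_deriv ?_
    have h1 := h0 _ (hm θ)
    have h2 : φ θ * f (circleMap 0 t θ) =
        deriv f (circleMap 0 t θ) * deriv (circleMap 0 t) θ := by
      simp only [hφ, logDeriv, Pi.div_apply]
      field_simp
    simp only [Pi.neg_apply]
    linear_combination -exp (-ℓ θ) * h2
  have hc : ∀ θ, exp (-ℓ θ) * f (circleMap 0 t θ) = 1 := fun θ => by
    rw [is_const_of_deriv_eq_zero (fun x => (hG x).differentiableAt) (fun x => (hG x).deriv) θ 0]
    have h1 : ℓ 0 = log (f (circleMap 0 t 0)) := by simp [hℓ]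
    rw [h1, exp_neg, exp_log (h0 _ (hm 0)), inv_mul_cancel₀ (h0 _ (hm 0))]
  refine ⟨ℓ, continuous_iff_continuousAt.2 fun θ => (hℓd θ).continuousAt, fun θ => ?_, ?_⟩
  · have := hc θ
    rw [exp_neg] at this
    have h2 := exp_ne_zero (ℓ θ)
    field_simp at this
    exact this.symm
  · rw [two_pi_I_mul_wind]
    simp [hℓ, hφ, circleIntegral]

theorem wind_eq_of_exp {ℓ : ℝ → ℂ} (hℓ : Continuous ℓ)
    (he : ∀ θ, exp (ℓ θ) = f (circleMap 0 t θ)) :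
    ℓ (2 * π) - ℓ 0 = 2 * π * I * wind f t := by
  obtain ⟨ℓ', hℓ', he', h⟩ := exists_log_lift hr hf ht htR h0
  rw [← h]
  have h1 : ∀ θ, ∃ n : ℤ, ℓ θ - ℓ' θ = n * (2 * π * I) := fun θ => by
    rw [← exp_eq_one_iff, exp_sub, he, he', div_self]
    exact h0 _ (circleMap_mem_sphere 0 (hr.trans ht.le) θ)
  choose n hn using h1
  have hnc : Continuous n := by
    rw [Int.isClosedEmbedding_coe_real.isEmbedding.continuous_iff]
    have : ((↑) ∘ n : ℝ → ℝ) = fun θ => ((ℓ θ - ℓ' θ) / (2 * π * I)).re := by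
      funext θ
      rw [hn, mul_div_cancel_right₀ _ two_pi_I_ne_zero]
      simp
    rw [this]
    fun_prop
  have h2 := PreconnectedSpace.constant inferInstance hnc (x := 2 * π) (y := 0)
  have h3 := hn (2 * π)
  rw [h2, ← hn 0] at h3
  linear_combination h3

theorem exists_int_wind : ∃ n : ℤ, wind f t = n := by
  obtain ⟨ℓ, -, he, h⟩ := exists_log_lift hr hf ht htR h0
  have h1 : exp (ℓ (2 * π) - ℓ 0) = 1 := by
    have h2 : circleMap (0 : ℂ) t (2 * π) = circleMap 0 t 0 := by simp [circleMap]
    rw [exp_sub, he, he, h2, div_self]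
    exact h0 _ (circleMap_mem_sphere 0 (hr.trans ht.le) 0)
  obtain ⟨n, hn⟩ := exp_eq_one_iff.1 h1
  refine ⟨n, mul_left_cancel₀ two_pi_I_ne_zero ?_⟩
  rw [← h, hn]
  ring

theorem wind_mul (hg : DifferentiableOn ℂ g (annulus r R))
    (hg0 : ∀ w ∈ sphere (0 : ℂ) t, g w ≠ 0) :
    wind (fun w => f w * g w) t = wind f t + wind g t := by
  have hs := sphere_subset_annulus ht htR
  have ho := isOpen_annulus r R
  rw [wind, wind, wind, ← mul_add, ← circleIntegral.integral_add
    (circleIntegrable_logDeriv hr hf ht htR h0) (circleIntegrable_logDeriv hr hg ht htR hg0)]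
  congr 1
  exact circleIntegral.integral_congr (hr.trans ht.le) fun w hw => logDeriv_mul w (h0 w hw)
    (hg0 w hw) (hf.differentiableAt (ho.mem_nhds (hs hw)))
    (hg.differentiableAt (ho.mem_nhds (hs hw)))

end

theorem wind_const_mul (f : ℂ → ℂ) {c : ℂ} (hc : c ≠ 0) (t : ℝ) :
    wind (fun w => c * f w) t = wind f t := by
  have : logDeriv (fun w => c * f w) = logDeriv f := by
    funext w
    simp only [logDeriv, Pi.div_apply, deriv_const_mul_field]
    exact mul_div_mul_left _ _ hc
  rw [wind, this, wind]

theorem wind_congr {f g : ℂ → ℂ} {r R t : ℝ} (hr : 0 ≤ r) (ht : r < t) (htR : t < R)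
    (h : EqOn f g (annulus r R)) : wind f t = wind g t := by
  rw [wind, wind]
  congr 1
  refine circleIntegral.integral_congr (hr.trans ht.le) fun w hw => ?_
  have hw' := sphere_subset_annulus ht htR hw
  simp only [logDeriv, Pi.div_apply, h hw',
    (h.eventuallyEq_of_mem ((isOpen_annulus r R).mem_nhds hw')).deriv_eq]

theorem wind_sub_const (a : ℂ) {t : ℝ} (ht : 0 ≤ t) :
    (‖a‖ < t → wind (fun w => w - a) t = 1) ∧ (t < ‖a‖ → wind (fun w => w - a) t = 0) := by
  have h : logDeriv (fun w => w - a) = fun w => (w - a)⁻¹ := by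
    funext w
    simp [logDeriv]
  refine ⟨fun h1 => ?_, fun h1 => ?_⟩
  · rw [wind, h, circleIntegral.integral_sub_inv_of_mem_ball (by simpa using h1),
      inv_mul_cancel₀ two_pi_I_ne_zero]
  · rw [wind, h, circleIntegral_sub_inv_of_lt h1 ht, mul_zero]

theorem wind_reflect {f : ℂ → ℂ} {r t : ℝ} (hr : 0 < r)
    (hf : DifferentiableOn ℂ f (annulus r r⁻¹)) (ht : r < t) (htr : t < r⁻¹)
    (h0 : ∀ w ∈ sphere (0 : ℂ) t⁻¹, f w ≠ 0) :
    (∀ w ∈ sphere (0 : ℂ) t, reflect f w ≠ 0) ∧ wind (reflect f) t = -1 - wind f t⁻¹ := by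
  have htp := hr.trans ht
  have h1 : r < t⁻¹ := (lt_inv_comm₀ htp hr).1 htr
  have h2 : t⁻¹ < r⁻¹ := by gcongr
  have hz : ∀ w ∈ sphere (0 : ℂ) t, reflect f w ≠ 0 := fun w hw => by
    have hw' := mem_sphere_zero_iff_norm.1 hw
    refine mul_ne_zero (inv_ne_zero (norm_pos_iff.1 (hw' ▸ htp))) ?_
    rw [map_ne_zero]
    exact h0 _ (by simp [hw'])
  refine ⟨hz, mul_left_cancel₀ two_pi_I_ne_zero ?_⟩
  obtain ⟨ℓ, hℓ, he, h⟩ := exists_log_lift hr.le hf h1 h2 h0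
  obtain ⟨n, hn⟩ := exists_int_wind hr.le hf h1 h2 h0
  rw [hn] at h ⊢
  have hw := wind_eq_of_exp hr.le (differentiableOn_reflect hr hf) ht htr hz
    (ℓ := fun θ => conj (ℓ θ) - (Real.log t + θ * I)) (by fun_prop) fun θ => by
      rw [exp_sub, exp_conj, he, exp_add, ← ofReal_exp, Real.exp_log htp]
      have : (conj (circleMap 0 t θ))⁻¹ = circleMap 0 t⁻¹ θ := by
        simp only [circleMap, zero_add, map_mul, conj_ofReal, ← exp_conj, conj_I, mul_inv,
          ofReal_inv, ← exp_neg]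
        congr 2
        ring
      rw [reflect, this, ← circleMap_zero, div_eq_inv_mul]
  rw [← hw]
  have h3 : conj (ℓ (2 * π)) = conj (ℓ 0) - 2 * π * I * n := by
    have := congrArg conj h
    simp only [map_sub, map_mul, conj_I, conj_ofReal, map_ofNat, map_intCast] at this
    linear_combination this
  simp only [h3]
  push_cast
  ring

/-- The winding number does not decrease with the radius. -/
theorem exists_wind_eq_add {f : ℂ → ℂ} {r R s t : ℝ} (hr : 0 ≤ r)
    (hf : DifferentiableOn ℂ f (annulus r R)) (hs : r < s) (hst : s ≤ t) (htR : t < R)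
    (h0 : ∀ w ∈ sphere (0 : ℂ) s, f w ≠ 0) (h1 : ∀ w ∈ sphere (0 : ℂ) t, f w ≠ 0) :
    ∃ N : ℕ, wind f t = wind f s + N := by
  have hs0 := hr.trans_lt hs
  have hA : closedBall (0 : ℂ) t \ ball 0 s ⊆ annulus r R := fun w hw => by
    have h2 := hw.1
    have h3 := hw.2
    rw [mem_closedBall_zero_iff] at h2
    rw [mem_ball_zero_iff, not_lt] at h3
    exact ⟨by linarith, by linarith⟩
  have hp := circleMap_mem_sphere (0 : ℂ) hs0.le 0
  have hfin := finite_zeros_of_differentiableOn (isOpen_annulus r R) (isPreconnected_annulus hr R)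
    hf ⟨_, sphere_subset_annulus hs (by linarith) hp, h0 _ hp⟩
    ((isCompact_closedBall (0 : ℂ) t).diff isOpen_ball) hA
  obtain ⟨Z, u, hZ, hu, hu0, hfu⟩ := exists_factor (isOpen_annulus r R)
    (isPreconnected_annulus hr R) hf ⟨_, sphere_subset_annulus hs (by linarith) hp, h0 _ hp⟩ hfin
    fun w hw => hA hw.1
  have hue : ∀ w ∈ closedBall (0 : ℂ) t \ ball 0 s, u w ≠ 0 := fun w hw h => by
    have hw0 : f w = 0 := by rw [hfu w (hA hw), h, mul_zero]
    exact hu0 w ⟨hw, hw0⟩ h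
  have hwu : wind u t = wind u s := by
    rw [wind, wind, circleIntegral_eq_of_differentiable_on_annulus_off_countable hs0 hst
      countable_empty]
    · exact ((hu.deriv (isOpen_annulus r R)).continuousOn.mono hA).div (hu.continuousOn.mono hA) hue
    · rintro w ⟨⟨h2, h3⟩, -⟩
      have hw : w ∈ closedBall (0 : ℂ) t \ ball 0 s :=
        ⟨ball_subset_closedBall h2, fun h => h3 (ball_subset_closedBall h)⟩
      have hn := (isOpen_annulus r R).mem_nhds (hA hw)
      exact ((hu.deriv (isOpen_annulus r R)).differentiableAt hn).div (hu.differentiableAt hn)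
        (hue w hw)
  have hsub : sphere (0 : ℂ) s ⊆ closedBall (0 : ℂ) t \ ball 0 s := fun w hw => by
    rw [mem_sphere_zero_iff_norm] at hw
    simp [hw, hst]
  have htub : sphere (0 : ℂ) t ⊆ closedBall (0 : ℂ) t \ ball 0 s := fun w hw => by
    rw [mem_sphere_zero_iff_norm] at hw
    simp [hw, hst]
  have hZ' : ∀ a ∈ Z, s < ‖a‖ ∧ ‖a‖ < t := fun a ha => by
    obtain ⟨⟨h2, h3⟩, h4⟩ := hZ a ha
    rw [mem_closedBall_zero_iff] at h2
    rw [mem_ball_zero_iff, not_lt] at h3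
    exact ⟨h3.lt_of_ne fun h => h0 a (by simp [h]) h4, h2.lt_of_ne fun h => h1 a (by simp [h]) h4⟩
  have key : ∀ x, (x = s ∨ x = t) → wind f x = (Z.map fun a => wind (fun w => w - a) x).sum +
      wind u x := by
    intro x hx
    have hxr : r < x := by rcases hx with rfl | rfl <;> linarith
    have hxR : x < R := by rcases hx with rfl | rfl <;> linarith
    have hux : ∀ w ∈ sphere (0 : ℂ) x, u w ≠ 0 := by
      rcases hx with rfl | rfl
      · exact fun w hw => hue w (hsub hw)
      · exact fun w hw => hue w (htub hw)
    have hZx : ∀ a ∈ Z, ‖a‖ ≠ x := fun a ha => by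
      rcases hx with rfl | rfl
      · exact (hZ' a ha).1.ne'
      · exact (hZ' a ha).2.ne
    rw [wind_congr hr hxr hxR hfu]
    clear hZ hfu hZ'
    induction Z using Multiset.induction_on with
    | empty => simp
    | cons a Z ih =>
      have ha : ∀ w ∈ sphere (0 : ℂ) x, w - a ≠ 0 := fun w hw h => by
        rw [sub_eq_zero] at h
        exact hZx a (Multiset.mem_cons_self a Z) (h ▸ mem_sphere_zero_iff_norm.1 hw)
      have hd : DifferentiableOn ℂ (fun w => (Z.map fun a => w - a).prod * u w) (annulus r R) := by
        refine DifferentiableOn.fun_mul ?_ hu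
        have := Differentiable.differentiableOn (𝕜 := ℂ) (s := annulus r R)
          (f := fun w => (Z.map fun a => w - a).prod) ?_
        · exact this
        · clear ih hZx
          induction Z using Multiset.induction_on with
          | empty => simp
          | cons b Z ih => simp only [Multiset.map_cons, Multiset.prod_cons]; fun_prop
      have hne : ∀ w ∈ sphere (0 : ℂ) x, (Z.map fun a => w - a).prod * u w ≠ 0 := fun w hw => by
        refine mul_ne_zero (fun h => ?_) (hux w hw)
        obtain ⟨b, hb, hb'⟩ := Multiset.mem_map.1 (Multiset.prod_eq_zero_iff.1 h)
        rw [sub_eq_zero] at hb'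
        exact hZx b (Multiset.mem_cons_of_mem hb) (hb' ▸ mem_sphere_zero_iff_norm.1 hw)
      simp only [Multiset.map_cons, Multiset.prod_cons, Multiset.sum_cons, mul_assoc]
      rw [wind_mul hr (by fun_prop) hxr hxR ha hd hne,
        ih fun b hb => hZx b (Multiset.mem_cons_of_mem hb), add_assoc]
  refine ⟨Multiset.card Z, ?_⟩
  rw [key t (Or.inr rfl), key s (Or.inl rfl), hwu]
  have e1 : (Z.map fun a => wind (fun w => w - a) t) = Z.map fun _ => 1 :=
    Multiset.map_congr rfl fun a ha => (wind_sub_const a (by linarith)).1 (hZ' a ha).2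
  have e2 : (Z.map fun a => wind (fun w => w - a) s) = Z.map fun _ => 0 :=
    Multiset.map_congr rfl fun a ha => (wind_sub_const a (by linarith)).2 (hZ' a ha).1
  rw [e1, e2]
  simp
  ring

theorem eq_of_exp_eq_one {X : Type*} [TopologicalSpace X] {s : Set X} (hs : IsPreconnected s)
    {d : X → ℂ} (hd : ContinuousOn d s) (h1 : ∀ x ∈ s, exp (d x) = 1) {x y : X} (hx : x ∈ s)
    (hy : y ∈ s) : d x = d y := by
  have h2 : ∀ x : s, ∃ n : ℤ, d x = n * (2 * π * I) := fun x =>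
    exp_eq_one_iff.1 (h1 x x.2)
  choose n hn using h2
  have hnc : Continuous n := by
    rw [Int.isClosedEmbedding_coe_real.isEmbedding.continuous_iff]
    have : ((↑) ∘ n : s → ℝ) = fun x : s => (d x / (2 * π * I)).re := by
      funext x
      rw [hn, mul_div_cancel_right₀ _ two_pi_I_ne_zero]
      simp
    rw [this]
    exact continuous_re.comp ((continuousOn_iff_continuous_domRestrict.1 hd).div_const _)
  have := isPreconnected_iff_preconnectedSpace.1 hs
  have h3 := PreconnectedSpace.constant inferInstance hnc (x := ⟨x, hx⟩) (y := ⟨y, hy⟩)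
  have h4 := hn ⟨x, hx⟩
  rw [h3, ← hn ⟨y, hy⟩] at h4
  exact h4

theorem continuousOn_dslope_prod {U : Set ℂ} (hU : IsOpen U) {f : ℂ → ℂ}
    (hf : DifferentiableOn ℂ f U) :
    ContinuousOn (fun p : ℂ × ℂ => dslope f p.2 p.1) (U ×ˢ U) := by
  rintro ⟨x, y⟩ ⟨hx, hy⟩
  refine ContinuousAt.continuousWithinAt ?_
  have hxa := hf.analyticAt (hU.mem_nhds hx)
  by_cases hxy : x = y
  · subst hxy
    have h1 : Tendsto (fun p : ℂ × ℂ => deriv f p.2) (𝓝 (x, x)) (𝓝 (deriv f x)) :=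
      hxa.deriv.continuousAt.tendsto.comp (continuous_snd.tendsto (x, x))
    rw [Metric.continuousAt_iff']
    intro ε hε
    simp only [dslope_same]
    have h2 := hxa.hasStrictDerivAt.isLittleO.def (half_pos hε)
    filter_upwards [h2, Metric.tendsto_nhds.1 h1 ε hε] with p hp hp1
    by_cases h : p.1 = p.2
    · rw [h, dslope_same]
      exact hp1
    · have hn : p.1 - p.2 ≠ 0 := sub_ne_zero.2 h
      rw [dslope_of_ne _ h, slope_def_field, dist_eq_norm]
      have e : (f p.1 - f p.2) / (p.1 - p.2) - deriv f x =
          (f p.1 - f p.2 - (p.1 - p.2) * deriv f x) / (p.1 - p.2) := by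
        field_simp
      rw [e, norm_div, div_lt_iff₀ (norm_pos_iff.2 hn)]
      simp only [ContinuousLinearMap.toSpanSingleton_apply, smul_eq_mul] at hp
      have := norm_pos_iff.2 hn
      nlinarith
  · have h1 : ∀ᶠ p : ℂ × ℂ in 𝓝 (x, y), p.1 ≠ p.2 :=
      (isClosed_eq continuous_fst continuous_snd).isOpen_compl.mem_nhds hxy
    have hya := hf.analyticAt (hU.mem_nhds hy)
    have h2 : ContinuousAt (fun p : ℂ × ℂ => (f p.1 - f p.2) / (p.1 - p.2)) (x, y) := by
      refine ContinuousAt.div (ContinuousAt.sub ?_ ?_) (by fun_prop) (sub_ne_zero.2 hxy)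
      · exact ContinuousAt.comp (g := f) (f := Prod.fst) hxa.continuousAt continuous_fst.continuousAt
      · exact ContinuousAt.comp (g := f) (f := Prod.snd) hya.continuousAt continuous_snd.continuousAt
    refine h2.congr ?_
    filter_upwards [h1] with p hp
    rw [dslope_of_ne _ hp, slope_def_field]

theorem differentiableOn_of_sq_eq {U : Set ℂ} (hU : IsOpen U) {σ h : ℂ → ℂ}
    (hσ : ContinuousOn σ U) (hh : DifferentiableOn ℂ h U) (hsq : ∀ w ∈ U, σ w ^ 2 = h w)
    (h0 : ∀ w ∈ U, h w ≠ 0) : DifferentiableOn ℂ σ U := by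
  intro w hw
  have hσ0 : σ w ≠ 0 := fun h => h0 w hw (by rw [← hsq w hw, h]; simp)
  have hn := hU.mem_nhds hw
  have hc := hσ.continuousAt hn
  have h1 := hasDerivAt_iff_tendsto_slope.1 (hh.differentiableAt hn).hasDerivAt
  have hsum : σ w + σ w ≠ 0 := by
    rw [← two_mul]
    exact mul_ne_zero two_ne_zero hσ0
  have hc2 : Tendsto (fun z => σ z + σ w) (𝓝[≠] w) (𝓝 (σ w + σ w)) :=
    (hc.tendsto.mono_left nhdsWithin_le_nhds).add_const _
  have h2 : HasDerivAt σ (deriv h w / (σ w + σ w)) w := by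
    rw [hasDerivAt_iff_tendsto_slope]
    refine (h1.div hc2 hsum).congr' ?_
    filter_upwards [hc2.eventually_ne hsum, nhdsWithin_le_nhds hn, self_mem_nhdsWithin] with z hz hzU
      hzw
    have : z - w ≠ 0 := sub_ne_zero.2 hzw
    rw [Pi.div_apply, slope_def_field, slope_def_field, ← hsq z hzU, ← hsq w hw]
    field_simp
    ring
  exact h2.differentiableAt.differentiableWithinAt

/-- The derivative of an injective holomorphic function on an annulus has a square root. -/
theorem exists_sqrt_deriv {ψ : ℂ → ℂ} {ρ R : ℝ} (hρ : 0 < ρ)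
    (hψ : DifferentiableOn ℂ ψ (annulus ρ R)) (hi : InjOn ψ (annulus ρ R))
    (hd : ∀ w ∈ annulus ρ R, deriv ψ w ≠ 0) :
    ∃ σ : ℂ → ℂ, DifferentiableOn ℂ σ (annulus ρ R) ∧ (∀ w ∈ annulus ρ R, σ w ^ 2 = deriv ψ w) ∧
      ∀ t, ρ < t → t < R → ∀ w' ∈ annulus ρ t, wind (fun w => ψ w - ψ w') t = 1 + wind σ t := by
  rcases le_or_gt R ρ with hRρ | hRρ
  · exact ⟨0, fun w hw => absurd (hw.1.trans hw.2) (not_lt.2 hRρ),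
      fun w hw => absurd (hw.1.trans hw.2) (not_lt.2 hRρ), fun t h1 h2 => by linarith⟩
  set A : Set ℂ := re ⁻¹' (Real.exp ⁻¹' Ioo ρ R) with hA
  have hAo : IsOpen A := (isOpen_Ioo.preimage Real.continuous_exp).preimage continuous_re
  have hAc : Convex ℝ A := convex_preimage_exp_re ordConnected_Ioo
  have hexp : ∀ u, u ∈ A ↔ exp u ∈ annulus ρ R := fun u => by
    simp [hA, annulus, norm_exp]
  have ho := isOpen_annulus ρ R
  obtain ⟨t₀, ht₀, ht₀R⟩ := exists_between hRρ
  have hne : A.Nonempty := ⟨Real.log t₀, by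
    simp only [hA, mem_preimage, ofReal_re, Real.exp_log (hρ.trans ht₀)]
    exact ⟨ht₀, ht₀R⟩⟩
  have hdc := continuousOn_dslope_prod ho hψ
  have hgc : ContinuousOn (fun p : ℂ × ℂ => dslope ψ (exp p.2) (exp p.1)) (A ×ˢ A) :=
    hdc.comp (f := fun p : ℂ × ℂ => (exp p.1, exp p.2)) (by fun_prop)
      fun p hp => ⟨(hexp _).1 hp.1, (hexp _).1 hp.2⟩
  have hsc : IsSimplyConnected (A ×ˢ A) := by
    have := (hAc.prod hAc).contractibleSpace (hne.prod hne)
    exact (inferInstance : SimplyConnectedSpace (A ×ˢ A : Set (ℂ × ℂ)))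
  obtain ⟨ℓ, hℓc, hℓ⟩ := exists_continuousOn_eqOn_exp_comp hsc (hAo.prod hAo) hgc (by
    rintro ⟨p, hp, h⟩
    exact dslope_ne_zero_of_injOn hi hd ((hexp _).1 hp.2) ((hexp _).1 hp.1) h)
  have hℓe : ∀ u ∈ A, ∀ v ∈ A, exp (ℓ (u, v)) = dslope ψ (exp v) (exp u) := fun u hu v hv =>
    hℓ (x := (u, v)) ⟨hu, hv⟩
  have hpc : IsPreconnected (A ×ˢ A) := (hAc.prod hAc).isPreconnected
  obtain ⟨u₀, hu₀⟩ := hne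
  have hshift : ∀ u ∈ A, u + 2 * π * I ∈ A := fun u hu => by
    rw [hexp, exp_periodic u]
    exact (hexp u).1 hu
  have hsymm : ∀ u ∈ A, ∀ v ∈ A, ℓ (u, v) = ℓ (v, u) := by
    intro u hu v hv
    have := eq_of_exp_eq_one hpc (d := fun p => ℓ p - ℓ p.swap)
      (hℓc.sub (hℓc.comp continuous_swap.continuousOn fun p hp => ⟨hp.2, hp.1⟩)) (fun p hp => by
        have h1 := dslope_ne_zero_of_injOn hi hd ((hexp _).1 hp.1) ((hexp _).1 hp.2)
        rw [exp_sub, Prod.swap, hℓe p.2 hp.2 p.1 hp.1, ← Prod.mk.eta (p := p),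
          hℓe p.1 hp.1 p.2 hp.2]
        by_cases h : exp p.1 = exp p.2
        · simp only [h] at h1 ⊢
          exact div_self h1
        · rw [dslope_of_ne _ (Ne.symm h)] at h1
          rw [dslope_of_ne _ h, dslope_of_ne _ (Ne.symm h), slope_comm]
          exact div_self h1) (x := (u, v)) (y := (u, u)) ⟨hu, hv⟩ ⟨hu, hu⟩
    simp only [Prod.swap] at this
    linear_combination this
  set p : ℂ := ℓ (u₀ + 2 * π * I, u₀) - ℓ (u₀, u₀) with hp
  have hper : ∀ u ∈ A, ∀ v ∈ A, ℓ (u + 2 * π * I, v) = ℓ (u, v) + p := by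
    intro u hu v hv
    have := eq_of_exp_eq_one hpc (d := fun p => ℓ (p.1 + 2 * π * I, p.2) - ℓ p)
      ((hℓc.comp (by fun_prop) fun p hp => ⟨hshift _ hp.1, hp.2⟩).sub hℓc) (fun p hp => by
        rw [exp_sub, hℓe _ (hshift _ hp.1) _ hp.2, exp_periodic p.1, ← Prod.mk.eta (p := p),
          hℓe p.1 hp.1 p.2 hp.2]
        exact div_self (dslope_ne_zero_of_injOn hi hd ((hexp _).1 hp.2) ((hexp _).1 hp.1)))
      (x := (u, v)) (y := (u₀, u₀)) ⟨hu, hv⟩ ⟨hu₀, hu₀⟩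
    simp only at this
    linear_combination this
  have hp1 : exp p = 1 := by
    rw [hp, exp_sub, hℓe _ (hshift _ hu₀) _ hu₀, exp_periodic u₀, hℓe _ hu₀ _ hu₀]
    exact div_self (dslope_ne_zero_of_injOn hi hd ((hexp _).1 hu₀) ((hexp _).1 hu₀))
  have hdiag : ∀ u ∈ A, ℓ (u + 2 * π * I, u + 2 * π * I) = ℓ (u, u) + 2 * p := by
    intro u hu
    rw [hper u hu _ (hshift u hu), hsymm u hu _ (hshift u hu), hper u hu u hu]
    ring
  set h : ℂ → ℂ := fun u => exp (ℓ (u, u) / 2) with hh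
  have hhp : ∀ u ∈ A, h (u + 2 * π * I) = h u := fun u hu => by
    simp only [hh, hdiag u hu]
    rw [show (ℓ (u, u) + 2 * p) / 2 = ℓ (u, u) / 2 + p by ring, exp_add, hp1, mul_one]
  have hhn : ∀ n : ℕ, ∀ u ∈ A, u + n * (2 * π * I) ∈ A ∧ h (u + n * (2 * π * I)) = h u := by
    intro n u hu
    induction n with
    | zero => simpa using hu
    | succ n ih =>
      have e : u + (n + 1 : ℕ) * (2 * π * I) =
          u + n * (2 * π * I) + 2 * π * I := by
        push_cast
        ring
      rw [e]
      exact ⟨hshift _ ih.1, (hhp _ ih.1).trans ih.2⟩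
  have hheq : ∀ u ∈ A, ∀ v ∈ A, exp u = exp v → h u = h v := by
    intro u hu v hv huv
    obtain ⟨n, hn⟩ := exp_eq_exp_iff_exists_int.1 huv
    obtain ⟨m, rfl | rfl⟩ := n.eq_nat_or_neg
    · rw [hn]
      exact_mod_cast (hhn m v hv).2
    · have : v = u + m * (2 * π * I) := by
        rw [hn]
        push_cast
        ring
      rw [this]
      exact (hhn m u hu).2.symm
  have hhc : ContinuousOn h A :=
    continuous_exp.comp_continuousOn
      ((hℓc.comp (f := fun u : ℂ => (u, u)) (by fun_prop) fun u hu => ⟨hu, hu⟩).div_const 2)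
  have hσe : ∀ u ∈ A, h (log (exp u)) = h u := fun u hu =>
    hheq _ (by rw [hexp, exp_log (exp_ne_zero u)]; exact (hexp u).1 hu) _ hu
      (exp_log (exp_ne_zero u))
  have hσsq : ∀ w ∈ annulus ρ R, h (log w) ^ 2 = deriv ψ w := by
    intro w hw
    have hw0 := ne_zero_of_mem_annulus hρ.le hw
    have hl : log w ∈ A := by rwa [hexp, exp_log hw0]
    simp only [hh]
    rw [← exp_nat_mul, Nat.cast_ofNat, mul_div_cancel₀ _ two_ne_zero, hℓe _ hl _ hl, exp_log hw0,
      dslope_same]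
  have hσc : ContinuousOn (fun w => h (log w)) (annulus ρ R) := by
    intro w hw
    have hw0 := ne_zero_of_mem_annulus hρ.le hw
    have hl : log w ∈ A := by rwa [hexp, exp_log hw0]
    refine ContinuousAt.continuousWithinAt ?_
    have h1 : ContinuousAt (fun z => log (z / w) + log w) w := by
      refine ContinuousAt.add (ContinuousAt.clog (by fun_prop) ?_) continuousAt_const
      rw [div_self hw0]
      exact one_mem_slitPlane
    have h2 : log (w / w) + log w = log w := by simp [div_self hw0]
    have h3 : ContinuousAt (fun z => h (log (z / w) + log w)) w := by
      refine ContinuousAt.comp (g := h) (f := fun z => log (z / w) + log w) ?_ h1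
      rw [h2]
      exact hhc.continuousAt (hAo.mem_nhds hl)
    refine h3.congr ?_
    filter_upwards [ho.mem_nhds hw] with z hz
    have hz0 := ne_zero_of_mem_annulus hρ.le hz
    have e : exp (log (z / w) + log w) = z := by
      rw [exp_add, exp_log (div_ne_zero hz0 hw0), exp_log hw0, div_mul_cancel₀ _ hw0]
    have := hσe (log (z / w) + log w) (by rwa [hexp, e])
    rw [e] at this
    exact this.symm
  have hσd : DifferentiableOn ℂ (fun w => h (log w)) (annulus ρ R) :=
    differentiableOn_of_sq_eq ho hσc (hψ.deriv ho) hσsq hd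
  refine ⟨fun w => h (log w), hσd, hσsq, fun t ht htR w' hw' => ?_⟩
  have ht0 := hρ.trans ht
  have hwR : w' ∈ annulus ρ R := ⟨hw'.1, hw'.2.trans htR⟩
  set e : ℝ → ℂ := fun θ => Real.log t + θ * I with he
  have hee : ∀ θ, exp (e θ) = circleMap 0 t θ := fun θ => by
    rw [he, exp_add, ← ofReal_exp, Real.exp_log ht0, circleMap_zero]
  have heA : ∀ θ, e θ ∈ A := fun θ => by
    rw [hexp, hee]
    exact sphere_subset_annulus ht htR (circleMap_mem_sphere 0 ht0.le θ)
  have hec : Continuous e := by fun_prop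
  have he2 : e (2 * π) = e 0 + 2 * π * I := by
    simp only [he]
    push_cast
    ring
  have hσ0 : ∀ w ∈ sphere (0 : ℂ) t, h (log w) ≠ 0 := fun w _ => exp_ne_zero _
  have w1 := wind_eq_of_exp hρ.le hσd ht htR hσ0 (ℓ := fun θ => ℓ (e θ, e θ) / 2)
    ((hℓc.comp_continuous (f := fun θ : ℝ => (e θ, e θ)) (by fun_prop)
      fun θ => ⟨heA θ, heA θ⟩).div_const 2) fun θ => by
      rw [← hee, hσe _ (heA θ)]
  simp only [he2, hdiag _ (heA 0)] at w1
  have hv0 := ne_zero_of_mem_annulus hρ.le hwR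
  have hv : log w' ∈ A := by rwa [hexp, exp_log hv0]
  have hD := differentiableOn_dslope_of_isOpen ho hψ hwR
  have hD0 : ∀ w ∈ sphere (0 : ℂ) t, dslope ψ w' w ≠ 0 := fun w hw =>
    dslope_ne_zero_of_injOn hi hd hwR (sphere_subset_annulus ht htR hw)
  have w2 := wind_eq_of_exp hρ.le hD ht htR hD0 (ℓ := fun θ => ℓ (e θ, log w'))
    (hℓc.comp_continuous (f := fun θ : ℝ => (e θ, log w')) (by fun_prop)
      fun θ => ⟨heA θ, hv⟩) fun θ => by
      rw [hℓe _ (heA θ) _ hv, exp_log hv0, hee]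
  simp only [he2, hper _ (heA 0) _ hv] at w2
  have w3 : wind (fun w => ψ w - ψ w') t = wind (fun w => (w - w') * dslope ψ w' w) t :=
    wind_congr hρ.le ht htR fun w _ => (sub_smul_dslope ψ w' w).symm
  have w4 : wind (dslope ψ w') t = wind (fun w => h (log w)) t :=
    mul_left_cancel₀ two_pi_I_ne_zero (by linear_combination w1 - w2)
  rw [w3, wind_mul (f := fun w => w - w') hρ.le (by fun_prop) ht htR (fun w hw h => by
    rw [sub_eq_zero] at h
    exact hw'.2.ne (h ▸ mem_sphere_zero_iff_norm.1 hw)) hD hD0,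
    (wind_sub_const w' ht0.le).1 hw'.2, w4]

/-- The inner product of two families of functions on the unit circle. -/
def hardyInner {J : Type*} [Fintype J] (x y : J → ℂ → ℂ) : ℂ :=
  (2 * π : ℂ)⁻¹ *
    ∑ j, ∫ θ in (0 : ℝ)..2 * π, x j (circleMap 0 1 θ) * conj (y j (circleMap 0 1 θ))

section HardyInner

variable {J : Type*} [Fintype J] {x y z : J → ℂ → ℂ}

theorem continuous_comp_circleMap {f : ℂ → ℂ} (hf : ContinuousOn f (sphere 0 1)) :
    Continuous fun θ : ℝ => f (circleMap 0 1 θ) :=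
  hf.comp_continuous (continuous_circleMap 0 1) fun θ => circleMap_mem_sphere 0 zero_le_one θ

theorem conj_hardyInner (x y : J → ℂ → ℂ) : conj (hardyInner x y) = hardyInner y x := by
  unfold hardyInner
  rw [map_mul, map_sum]
  congr 1
  · rw [← ofReal_ofNat, ← ofReal_mul, ← ofReal_inv, conj_ofReal]
  · refine Finset.sum_congr rfl fun j _ => ?_
    rw [← intervalIntegral.intervalIntegral_conj]
    simp [mul_comm]

theorem hardyInner_self (x : J → ℂ → ℂ) : hardyInner x x =
    (((2 * π)⁻¹ * ∑ j, ∫ θ in (0 : ℝ)..2 * π, ‖x j (circleMap 0 1 θ)‖ ^ 2 : ℝ) : ℂ) := by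
  unfold hardyInner
  push_cast
  congr 1
  refine Finset.sum_congr rfl fun j _ => ?_
  rw [← intervalIntegral.integral_ofReal]
  simp [Complex.mul_conj, Complex.normSq_eq_norm_sq]

theorem hardyInner_self_re_nonneg (x : J → ℂ → ℂ) : 0 ≤ (hardyInner x x).re := by
  rw [hardyInner_self, ofReal_re]
  refine mul_nonneg (by positivity) (Finset.sum_nonneg fun j _ => ?_)
  exact intervalIntegral.integral_nonneg (by positivity) fun θ _ => by positivity

theorem hardyInner_self_im (x : J → ℂ → ℂ) : (hardyInner x x).im = 0 := by
  rw [hardyInner_self, ofReal_im]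

theorem hardyInner_sub_smul (hx : ∀ j, ContinuousOn (x j) (sphere 0 1))
    (hy : ∀ j, ContinuousOn (y j) (sphere 0 1)) (hz : ∀ j, ContinuousOn (z j) (sphere 0 1)) (c : ℂ) :
    hardyInner (fun j w => x j w - c * y j w) z = hardyInner x z - c * hardyInner y z := by
  unfold hardyInner
  have hi : ∀ {x : J → ℂ → ℂ}, (∀ j, ContinuousOn (x j) (sphere 0 1)) → ∀ j, IntervalIntegrable
      (fun θ : ℝ => x j (circleMap 0 1 θ) * conj (z j (circleMap 0 1 θ))) volume 0 (2 * π) :=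
    fun hx j => ((continuous_comp_circleMap (hx j)).mul
      (continuous_conj.comp (continuous_comp_circleMap (hz j)))).intervalIntegrable _ _
  have : ∀ j, (∫ θ in (0 : ℝ)..2 * π, (x j (circleMap 0 1 θ) - c * y j (circleMap 0 1 θ)) *
      conj (z j (circleMap 0 1 θ))) = (∫ θ in (0 : ℝ)..2 * π, x j (circleMap 0 1 θ) *
      conj (z j (circleMap 0 1 θ))) - c * ∫ θ in (0 : ℝ)..2 * π, y j (circleMap 0 1 θ) *
      conj (z j (circleMap 0 1 θ)) := fun j => by
    rw [← intervalIntegral.integral_const_mul, ← intervalIntegral.integral_sub (hi hx j)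
      ((hi hy j).const_mul c)]
    congr 1
    funext θ
    ring
  simp only [this, Finset.sum_sub_distrib, ← Finset.mul_sum]
  ring

theorem hardyInner_sub_smul_self (hx : ∀ j, ContinuousOn (x j) (sphere 0 1))
    (hy : ∀ j, ContinuousOn (y j) (sphere 0 1)) (c : ℂ) :
    0 ≤ (hardyInner x x).re - 2 * (conj c * hardyInner x y).re +
      ‖c‖ ^ 2 * (hardyInner y y).re := by
  have hs : ∀ j, ContinuousOn (fun w => x j w - c * y j w) (sphere 0 1) := fun j =>
    (hx j).sub (continuousOn_const.mul (hy j))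
  have h := hardyInner_self_re_nonneg (fun j w => x j w - c * y j w)
  have e1 : hardyInner x (fun j w => x j w - c * y j w) =
      hardyInner x x - conj c * hardyInner x y := by
    rw [← conj_hardyInner, hardyInner_sub_smul hx hy hx, map_sub, map_mul, conj_hardyInner,
      conj_hardyInner]
  have e2 : hardyInner y (fun j w => x j w - c * y j w) =
      conj (hardyInner x y) - conj c * hardyInner y y := by
    rw [← conj_hardyInner, hardyInner_sub_smul hx hy hy, map_sub, map_mul, conj_hardyInner y y]
  rw [hardyInner_sub_smul hx hy hs, e1, e2] at h
  refine h.trans_eq ?_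
  have := hardyInner_self_im y
  rw [← normSq_eq_norm_sq, normSq_apply]
  simp [this]
  ring

end HardyInner

theorem wind_one (t : ℝ) : wind (fun _ => (1 : ℂ)) t = 0 := by
  have : logDeriv (fun _ : ℂ => (1 : ℂ)) = fun _ => 0 := by
    funext w
    simp [logDeriv]
  simp [wind, this, circleIntegral]

/-- A holomorphic function on a symmetric annulus and its reflection have asymptotically the same
absolute value at the unit circle. -/
theorem eventually_norm_reflect_le {x : ℂ → ℂ} {r : ℝ} (hr : 0 ≤ r) (hr1 : r < 1)
    (hx : DifferentiableOn ℂ x (annulus r r⁻¹)) (hne : ∃ w ∈ annulus r r⁻¹, x w ≠ 0) {w₀ : ℂ}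
    (hw₀ : w₀ ∈ sphere (0 : ℂ) 1) {c : ℝ} (hc : c < 1) :
    ∀ᶠ w in 𝓝 w₀, c * ‖reflect x w‖ ≤ ‖x w‖ := by
  rcases hr.eq_or_lt with rfl | hr0
  · obtain ⟨w, ⟨h1, h2⟩, -⟩ := hne
    simp at h2
    linarith
  have hmem : w₀ ∈ annulus r r⁻¹ :=
    sphere_subset_annulus hr1 ((one_lt_inv₀ hr0).2 hr1) hw₀
  have ho := isOpen_annulus r r⁻¹
  obtain ⟨n, u, hu, hu0, hxu⟩ := exists_factor_at ho (isPreconnected_annulus hr _) hx hne hmem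
  have hn : ‖w₀‖ = 1 := mem_sphere_zero_iff_norm.1 hw₀
  have h0 : w₀ ≠ 0 := by
    rintro rfl
    simp at hn
  have hcu : ContinuousAt u w₀ := (hu.continuousOn).continuousAt (ho.mem_nhds hmem)
  have hinv : ContinuousAt (fun w : ℂ => (conj w)⁻¹) w₀ :=
    (continuous_conj.continuousAt).inv₀ (by simpa using h0)
  have hcu2 : ContinuousAt (fun w : ℂ => u (conj w)⁻¹) w₀ := by
    refine ContinuousAt.comp (g := u) (f := fun w : ℂ => (conj w)⁻¹) ?_ hinv
    rwa [inv_conj_of_mem_sphere hw₀]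
  have h1 : ContinuousAt (fun w : ℂ => ‖w‖ ^ (n + 1) * ‖u w‖ - c * ‖u (conj w)⁻¹‖) w₀ :=
    ((continuous_norm.continuousAt.pow _).mul hcu.norm).sub (continuousAt_const.mul hcu2.norm)
  have h2 : 0 < ‖w₀‖ ^ (n + 1) * ‖u w₀‖ - c * ‖u (conj w₀)⁻¹‖ := by
    rw [hn, one_pow, one_mul, inv_conj_of_mem_sphere hw₀, ← one_sub_mul]
    exact mul_pos (by linarith) (norm_pos_iff.2 hu0)
  filter_upwards [h1.eventually_const_lt h2, ho.mem_nhds hmem] with w hw hwm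
  have hw0 := ne_zero_of_mem_annulus hr hwm
  have hwp : 0 < ‖w‖ := norm_pos_iff.2 hw0
  have hwm2 : (conj w)⁻¹ ∈ annulus r r⁻¹ := inv_conj_mem_annulus hr0 hwm
  have e : ‖(conj w)⁻¹ - w₀‖ = ‖w - w₀‖ / ‖w‖ := by
    have h3 : (conj w)⁻¹ - w₀ = (conj w)⁻¹ * (w₀ * conj (w₀ - w)) := by
      have h4 : conj w ≠ 0 := by simpa using hw0
      have h5 : w₀ * conj w₀ = 1 := by
        rw [mul_conj, normSq_eq_norm_sq, hn]
        simp
      rw [map_sub, mul_sub, h5]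
      field_simp
    rw [h3, norm_mul, norm_mul, hn, norm_inv, RCLike.norm_conj, RCLike.norm_conj, norm_sub_rev]
    field_simp
  rw [reflect, hxu w hwm, hxu _ hwm2, norm_mul, norm_inv, RCLike.norm_conj, norm_mul, norm_mul,
    norm_pow, norm_pow, e, div_pow]
  have h6 : c * (‖w‖⁻¹ * (‖w - w₀‖ ^ n / ‖w‖ ^ n * ‖u (conj w)⁻¹‖)) =
      ‖w - w₀‖ ^ n * (c * ‖u (conj w)⁻¹‖ / ‖w‖ ^ (n + 1)) := by
    rw [pow_succ]
    field_simp
  rw [h6]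
  refine mul_le_mul_of_nonneg_left ?_ (by positivity)
  rw [div_le_iff₀ (by positivity)]
  linarith

theorem reflect_sub_const_mul {x : ℂ → ℂ} {y : ℂ → ℂ} {c w : ℂ} (hc : ‖c‖ = 1)
    (hxy : reflect x w = y w) (hyx : reflect y w = x w) :
    reflect (fun v => x v - c * y v) w = -conj c * (x w - c * y w) := by
  have h : conj c * c = 1 := by
    rw [← normSq_eq_conj_mul_self, normSq_eq_norm_sq, hc]
    simp
  simp only [reflect] at hxy hyx ⊢
  rw [map_sub, map_mul]
  linear_combination hxy - conj c * hyx - y w * h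

/-- A difference quotient bound for Blaschke factors. -/
theorem norm_sub_le_norm_one_sub_conj_mul {a b : ℂ} (ha : ‖a‖ ≤ 1) (hb : ‖b‖ ≤ 1) :
    ‖b - a‖ ≤ ‖1 - conj a * b‖ := by
  have h : ‖1 - conj a * b‖ ^ 2 - ‖b - a‖ ^ 2 = (1 - ‖a‖ ^ 2) * (1 - ‖b‖ ^ 2) := by
    simp only [← normSq_eq_norm_sq, normSq_apply, sub_re, sub_im, one_re, one_im, mul_re, mul_im,
      conj_re, conj_im]
    ring
  have h1 : 0 ≤ (1 - ‖a‖ ^ 2) * (1 - ‖b‖ ^ 2) :=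
    mul_nonneg (by nlinarith [norm_nonneg a]) (by nlinarith [norm_nonneg b])
  exact le_of_sq_le_sq (by linarith) (norm_nonneg _)

theorem exists_fin_prod_eq {α : Type*} {m : ℕ} (Z : Multiset α) (hZ : Z.card ≤ m) (d : α) :
    ∃ ζ : Fin m → α, (∀ l, ζ l ∈ Z ∨ ζ l = d) ∧
      ∀ g : α → ℝ, g d = 1 → ∏ l, g (ζ l) = (Z.map g).prod := by
  obtain ⟨k, rfl⟩ := Nat.exists_eq_add_of_le hZ
  set L : List α := Z.toList ++ List.replicate k d with hL
  have hlen : L.length = Z.card + k := by simp [hL]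
  refine ⟨fun l => L.get (l.cast hlen.symm), fun l => ?_, fun g hg => ?_⟩
  · have := L.get_mem (l.cast hlen.symm)
    simp only [hL, List.mem_append, Multiset.mem_toList, List.mem_replicate] at this
    exact this.imp_right fun h => h.2
  · have h1 : ∏ l : Fin (Z.card + k), g (L.get (l.cast hlen.symm)) = ∏ l, g (L.get l) :=
      Equiv.prod_comp (finCongr hlen.symm) fun l => g (L.get l)
    rw [h1]
    have h2 : ∏ l, g (L.get l) = (L.map g).prod := Fin.prod_univ_fun_getElem L g
    rw [h2, hL, List.map_append, List.prod_append, List.map_replicate, hg, List.prod_replicate,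
      one_pow, mul_one, ← Multiset.prod_coe, ← Multiset.map_coe, Multiset.coe_toList]

/-- The quotient of the Szegő and Garabedian kernels. -/
def szegoQuotient (a : ℂ) (S M : ℂ → ℂ) (z : ℂ) : ℂ := (z - a) * S z / (1 + (z - a) * M z)

namespace Collared

variable {J : Type*} [Fintype J] {K : Set ℂ} {ρ : ℝ} {ψ σ : J → ℂ → ℂ} (hC : Collared K ρ ψ)
include hC

theorem injOn (j : J) : InjOn (ψ j) (annulus ρ ρ⁻¹) :=
  fun _ hw _ hw' h => (hC.inj j j _ hw _ hw' h).2

theorem one_lt : 1 < ρ⁻¹ := (one_lt_inv₀ hC.pos).2 hC.lt_one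

theorem differentiableOn_deriv (j : J) : DifferentiableOn ℂ (deriv (ψ j)) (annulus ρ ρ⁻¹) :=
  (hC.diff j).deriv (isOpen_annulus _ _)

theorem exists_lt_avoid {t : ℝ} (ht : ρ < t) (ht' : t ≤ ρ⁻¹) {z : ℂ} (hz : z ∈ reg K ρ ψ t) :
    ∃ r, ρ ≤ r ∧ r < t ∧ ∀ j, ∀ w ∈ annulus r ρ⁻¹, ψ j w ≠ z := by
  rcases hz with hz | hz
  · exact ⟨ρ, le_rfl, ht, fun j w hw h => hC.notMem j w hw (h ▸ hz)⟩
  · obtain ⟨i, w₀, ⟨h1, h2⟩, rfl⟩ := mem_iUnion.1 hz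
    refine ⟨‖w₀‖, h1.le, h2, fun j w hw h => ?_⟩
    have := (hC.inj j i w ⟨h1.trans hw.1, hw.2⟩ w₀ ⟨h1, h2.trans_le ht'⟩ h).2
    exact absurd hw.1 (by rw [this]; exact lt_irrefl _)

theorem ne_of_norm_le {t : ℝ} (ht' : t ≤ ρ⁻¹) {z : ℂ} (hz : z ∈ reg K ρ ψ t) {j : J}
    {w : ℂ} (hw : w ∈ annulus ρ ρ⁻¹) (htw : t ≤ ‖w‖) : ψ j w ≠ z := by
  rintro rfl
  rcases hz with hz | hz
  · exact hC.notMem j w hw hz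
  · obtain ⟨i, w₀, ⟨h1, h2⟩, h⟩ := mem_iUnion.1 hz
    have := (hC.inj i j w₀ ⟨h1, h2.trans_le ht'⟩ w hw h).2
    rw [this] at h2
    linarith

theorem differentiableOn_cauchyTransform (hσ : HalfDensity ρ ψ σ) {g : J → ℂ → ℂ} {t : ℝ}
    (ht : ρ < t) (ht' : t < ρ⁻¹) (hg : ∀ j, ContinuousOn (g j) (sphere 0 t)) :
    DifferentiableOn ℂ (cauchyTransform ψ σ g t) (reg K ρ ψ t) := by
  have hs := sphere_subset_annulus ht ht'
  refine DifferentiableOn.const_mul (DifferentiableOn.fun_sum fun j _ => ?_) _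
  refine differentiableOn_circleIntegral (hC.isOpen t ht ht'.le) (hC.pos.trans ht).le
    (F := fun z w => g j w * σ j w / (ψ j w - z)) ?_ fun w hw => ?_
  · have h1 : ContinuousOn (fun w => g j w * σ j w) (sphere 0 t) :=
      (hg j).mul ((hσ.diff j).continuousOn.mono hs)
    refine ContinuousOn.div (f := fun p : ℂ × ℂ => g j p.2 * σ j p.2)
      (g := fun p : ℂ × ℂ => ψ j p.2 - p.1)
      (h1.comp continuousOn_snd fun p hp => hp.2) ?_ ?_
    · exact (((hC.diff j).continuousOn.mono hs).comp continuousOn_snd fun p hp => hp.2).sub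
        continuousOn_fst
    · rintro ⟨z, w⟩ ⟨hz, hw⟩
      exact sub_ne_zero.2 (hC.ne_of_norm_le ht'.le hz (hs hw)
        (mem_sphere_zero_iff_norm.1 hw).ge)
  · refine DifferentiableOn.div (by fun_prop) (by fun_prop) fun z hz => ?_
    exact sub_ne_zero.2 (hC.ne_of_norm_le ht'.le hz (hs hw) (mem_sphere_zero_iff_norm.1 hw).ge)

theorem cauchyTransform_eq (hσ : HalfDensity ρ ψ σ) {g : J → ℂ → ℂ} {r R t t' : ℝ}
    (hr : ρ ≤ r) (hR : R ≤ ρ⁻¹) (hg : ∀ j, DifferentiableOn ℂ (g j) (annulus r R))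
    (ht : r < t) (htt : t ≤ t') (htR : t' < R) {z : ℂ} (hz : z ∈ reg K ρ ψ t) :
    cauchyTransform ψ σ g t z = cauchyTransform ψ σ g t' z := by
  obtain ⟨r', h1, h2, h3⟩ := hC.exists_lt_avoid (hr.trans_lt ht) (by linarith) hz
  unfold cauchyTransform
  congr 1
  refine Finset.sum_congr rfl fun j _ => ?_
  refine circleIntegral_eq_of_differentiableOn_annulus (r := max r r') (R := R)
    (le_max_of_le_right (hC.pos.le.trans h1)) ?_ (max_lt ht h2) (by linarith)
    (max_lt (by linarith) (by linarith)) htR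
  have hsub : annulus (max r r') R ⊆ annulus ρ ρ⁻¹ :=
    annulus_mono (h1.trans (le_max_right _ _)) hR
  refine DifferentiableOn.div (((hg j).mono (annulus_mono (le_max_left _ _) le_rfl)).mul
    ((hσ.diff j).mono hsub)) (((hC.diff j).mono hsub).sub_const z) fun w hw => ?_
  exact sub_ne_zero.2 (h3 j w ⟨(le_max_right _ _).trans_lt hw.1, hw.2.trans_le hR⟩)

theorem cauchyTransform_comp (hσ : HalfDensity ρ ψ σ) {F : ℂ → ℂ} {t t' : ℝ}
    (ht : ρ < t) (htt : t < t') (ht' : t' ≤ ρ⁻¹) (hF : DifferentiableOn ℂ F (reg K ρ ψ t'))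
    {z : ℂ} (hz : z ∈ reg K ρ ψ t) :
    cauchyTransform ψ σ (fun j w => σ j w * F (ψ j w)) t z = F z := by
  have hz' := reg_mono K ρ ψ htt.le hz
  have hs := sphere_subset_annulus ht (htt.trans_le ht')
  have h1 := hC.cauchy t t' ht htt ht' _
    (differentiableOn_dslope_of_isOpen (hC.isOpen t' (ht.trans htt) ht') hF hz')
  have h2 := hC.index t ht (htt.trans_le ht') z hz
  have hne : ∀ j, ∀ w ∈ sphere (0 : ℂ) t, ψ j w - z ≠ 0 := fun j w hw =>
    sub_ne_zero.2 (hC.ne_of_norm_le (htt.le.trans ht') hz (hs hw)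
      (mem_sphere_zero_iff_norm.1 hw).ge)
  have hψc : ∀ j, ContinuousOn (ψ j) (sphere 0 t) := fun j => (hC.diff j).continuousOn.mono hs
  have hdc : ∀ j, ContinuousOn (deriv (ψ j)) (sphere 0 t) := fun j =>
    (hC.differentiableOn_deriv j).continuousOn.mono hs
  have hFc : ∀ j, ContinuousOn (fun w => F (ψ j w)) (sphere 0 t) := fun j =>
    hF.continuousOn.comp (hψc j) fun w hw => mem_reg_of_mem (hs hw).1
      ((mem_sphere_zero_iff_norm.1 hw).trans_lt htt)
  have ht0 : 0 ≤ t := (hC.pos.trans ht).le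
  have h3 : ∀ j, (∮ w in C(0, t), dslope F z (ψ j w) * deriv (ψ j) w) =
      (∮ w in C(0, t), σ j w * F (ψ j w) * σ j w / (ψ j w - z)) -
        F z * ∮ w in C(0, t), deriv (ψ j) w / (ψ j w - z) := by
    intro j
    rw [← circleIntegral.integral_const_mul, ← circleIntegral.integral_sub]
    · refine circleIntegral.integral_congr ht0 fun w hw => ?_
      have := hne j w hw
      rw [dslope_of_ne _ (sub_ne_zero.1 this), slope_def_field, ← hσ.sq j w (hs hw)]
      field_simp
    · refine ContinuousOn.circleIntegrable ht0 (ContinuousOn.div ?_ ((hψc j).sub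
        continuousOn_const) (hne j))
      have := (hσ.diff j).continuousOn.mono hs
      exact (this.mul (hFc j)).mul this
    · exact ContinuousOn.circleIntegrable ht0 (continuousOn_const.mul ((hdc j).div ((hψc j).sub
        continuousOn_const) (hne j)))
  simp only [h3, Finset.sum_sub_distrib, ← Finset.mul_sum, h2] at h1
  unfold cauchyTransform
  rw [sub_eq_zero.1 h1]
  have : (2 * π * I : ℂ) ≠ 0 := two_pi_I_ne_zero
  field_simp

theorem cauchyTransform_jump (hσ : HalfDensity ρ ψ σ) {g : J → ℂ → ℂ} {r R s t : ℝ}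
    (hr : ρ ≤ r) (hR : R ≤ ρ⁻¹) (hg : ∀ j, DifferentiableOn ℂ (g j) (annulus r R)) {i : J} {w : ℂ}
    (hs : r < s) (hsw : s < ‖w‖) (hwt : ‖w‖ < t) (htR : t < R) :
    σ i w * (cauchyTransform ψ σ g t (ψ i w) - cauchyTransform ψ σ g s (ψ i w)) = g i w := by
  classical
  have hsub : annulus r R ⊆ annulus ρ ρ⁻¹ := annulus_mono hr hR
  have hr0 : 0 ≤ r := hC.pos.le.trans hr
  have hwm : w ∈ annulus r R := ⟨by linarith, by linarith⟩
  unfold cauchyTransform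
  rw [← mul_sub, ← Finset.sum_sub_distrib, Finset.sum_eq_single i]
  · rw [circleIntegral_div_sub_injOn hr0 ((hg i).fun_mul ((hσ.diff i).mono hsub))
      ((hC.diff i).mono hsub) ((hC.injOn i).mono hsub) (fun z hz => hC.deriv_ne i z (hsub hz))
      hs hsw hwt htR]
    have h1 := hC.deriv_ne i w (hsub hwm)
    rw [← hσ.sq i w (hsub hwm)] at h1 ⊢
    have h2 : σ i w ≠ 0 := fun h => h1 (by rw [h]; simp)
    have : (2 * π * I : ℂ) ≠ 0 := two_pi_I_ne_zero
    field_simp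
  · intro j _ hj
    rw [sub_eq_zero]
    refine (circleIntegral_eq_of_differentiableOn_annulus hr0 ?_ hs (by linarith) (by linarith)
      htR).symm
    refine DifferentiableOn.div ((hg j).mul ((hσ.diff j).mono hsub))
      (((hC.diff j).mono hsub).sub_const _) fun w' hw' h => hj ?_
    exact (hC.inj j i w' (hsub hw') w (hsub hwm) (sub_eq_zero.1 h)).1
  · simp

theorem sum_circleIntegral_mul_eq_zero (hσ : HalfDensity ρ ψ σ) {u v : J → ℂ → ℂ} {r R : ℝ}
    (hr : ρ ≤ r) (hr1 : r < 1) (hR1 : 1 < R) (hR : R ≤ ρ⁻¹)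
    (hu : ∀ j, DifferentiableOn ℂ (u j) (annulus r R))
    (hv : ∀ j, DifferentiableOn ℂ (v j) (annulus r R))
    (hu0 : ∀ t, r < t → t < R → ∀ j, ∀ w ∈ annulus r t, cauchyTransform ψ σ u t (ψ j w) = 0)
    (hv0 : ∀ t, r < t → t < R → ∀ j, ∀ w ∈ annulus r t, cauchyTransform ψ σ v t (ψ j w) = 0) :
    ∑ j, ∮ w in C(0, 1), u j w * v j w = 0 := by
  obtain ⟨s, hs, hs1⟩ := exists_between hr1
  obtain ⟨t, ht1, ht⟩ := exists_between hR1
  have hsub : annulus r R ⊆ annulus ρ ρ⁻¹ := annulus_mono hr hR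
  have hss := sphere_subset_annulus hs (hs1.trans hR1)
  have h1s := sphere_subset_annulus hr1 hR1
  have hs0 : 0 ≤ s := hC.pos.le.trans (hr.trans hs.le)
  let k : J → J → ℂ → ℂ → ℂ := fun i j w w' =>
    v i w * σ i w * (u j w' * σ j w') / (ψ j w' - ψ i w)
  have hk : ∀ i j, ContinuousOn (Function.uncurry (k i j)) (sphere 0 1 ×ˢ sphere 0 s) := by
    intro i j
    have hfst : ∀ {f : ℂ → ℂ}, DifferentiableOn ℂ f (annulus r R) →
        ContinuousOn (fun p : ℂ × ℂ => f p.1) (sphere 0 1 ×ˢ sphere 0 s) := fun hf =>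
      (hf.continuousOn.mono h1s).comp continuousOn_fst fun p hp => hp.1
    have hsnd : ∀ {f : ℂ → ℂ}, DifferentiableOn ℂ f (annulus r R) →
        ContinuousOn (fun p : ℂ × ℂ => f p.2) (sphere 0 1 ×ˢ sphere 0 s) := fun hf =>
      (hf.continuousOn.mono hss).comp continuousOn_snd fun p hp => hp.2
    refine ContinuousOn.div ((hfst ((hv i).mul ((hσ.diff i).mono hsub))).mul
      (hsnd ((hu j).mul ((hσ.diff j).mono hsub))))
      ((hsnd ((hC.diff j).mono hsub)).sub (hfst ((hC.diff i).mono hsub))) ?_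
    rintro ⟨w, w'⟩ ⟨hw, hw'⟩ h
    have := (hC.inj j i w' (hsub (hss hw')) w (hsub (h1s hw)) (sub_eq_zero.1 h)).2
    rw [mem_sphere_zero_iff_norm] at hw hw'
    rw [this] at hw'
    linarith
  have h1 : ∀ i, (∮ w in C(0, 1), u i w * v i w) =
      -(2 * π * I)⁻¹ * ∑ j, ∮ w in C(0, 1), ∮ w' in C(0, s), k i j w w' := by
    intro i
    rw [← circleIntegral.integral_fun_sum, ← circleIntegral.integral_const_mul]
    · refine circleIntegral.integral_congr zero_le_one fun w hw => ?_
      have hw1 := mem_sphere_zero_iff_norm.1 hw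
      have h := hC.cauchyTransform_jump hσ hr hR hu (i := i) hs (hw1 ▸ hs1) (hw1 ▸ ht1) ht
      rw [hu0 t (by linarith) ht i w ⟨by linarith, by linarith⟩] at h
      rw [← h, cauchyTransform]
      simp only [k, mul_div_assoc, circleIntegral.integral_const_mul, ← Finset.mul_sum]
      ring
    · intro j _
      exact ContinuousOn.circleIntegrable zero_le_one (continuousOn_circleIntegral hs0 (hk i j))
  simp only [h1, ← Finset.mul_sum]
  rw [Finset.sum_comm]
  have h2 : ∀ j, ∑ i, (∮ w in C(0, 1), ∮ w' in C(0, s), k i j w w') = 0 := by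
    intro j
    simp only [fun i => circleIntegral_circleIntegral_swap zero_le_one hs0 (hk i j)]
    rw [← circleIntegral.integral_fun_sum]
    · have : ∀ w' ∈ sphere (0 : ℂ) s, ∑ i, (∮ w in C(0, 1), k i j w w') = 0 := by
        intro w' hw'
        have hw1 := mem_sphere_zero_iff_norm.1 hw'
        have h := hv0 1 hr1 hR1 j w' ⟨by linarith, by linarith⟩
        rw [cauchyTransform] at h
        have h3 := (mul_eq_zero.1 h).resolve_left (inv_ne_zero two_pi_I_ne_zero)
        have h4 : ∀ i, (∮ w in C(0, 1), k i j w w') = -(u j w' * σ j w') *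
            ∮ w in C(0, 1), v i w * σ i w / (ψ i w - ψ j w') := by
          intro i
          rw [← circleIntegral.integral_const_mul]
          refine circleIntegral.integral_congr zero_le_one fun w hw => ?_
          simp only [k]
          rw [← neg_sub (ψ i w), div_neg]
          ring
        simp only [h4, ← Finset.mul_sum, h3, mul_zero]
      rw [circleIntegral.integral_congr hs0 this]
      simp [circleIntegral]
    · intro i _
      refine ContinuousOn.circleIntegrable hs0 (continuousOn_circleIntegral
        (F := fun w' w => k i j w w') zero_le_one ?_)
      exact ContinuousOn.comp (g := Function.uncurry (k i j)) (f := Prod.swap)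
        (t := sphere 0 1 ×ˢ sphere 0 s) (hk i j) continuous_swap.continuousOn
        fun p hp => ⟨hp.2, hp.1⟩
  simp [h2]

/-- The compact region bounded by the curves of radius `t`. -/
theorem reg_subset_isCompact {t : ℝ} (ht : ρ < t) (ht' : t < ρ⁻¹) :
    ∃ C, IsCompact C ∧ reg K ρ ψ t ⊆ C ∧
      (∀ z ∈ C, z ∉ reg K ρ ψ t → ∃ j, ∃ w ∈ sphere (0 : ℂ) t, ψ j w = z) ∧
      ∀ t', t < t' → C ⊆ reg K ρ ψ t' := by
  refine ⟨_, hC.isCompact t ht ht', ?_, ?_, ?_⟩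
  · exact union_subset_union_right _ (iUnion_mono fun _ => image_mono fun w hw => ⟨hw.1, hw.2.le⟩)
  · rintro z (hz | hz) hn
    · exact absurd (Or.inl hz) hn
    · obtain ⟨j, w, hw, rfl⟩ := mem_iUnion.1 hz
      refine ⟨j, w, ?_, rfl⟩
      rw [mem_sphere_zero_iff_norm]
      exact hw.2.antisymm (not_lt.1 fun h => hn (mem_reg_of_mem hw.1 h))
  · intro t' h
    exact union_subset_union_right _ (iUnion_mono fun _ => image_mono fun w hw =>
      ⟨hw.1, hw.2.trans_lt h⟩)

omit [Fintype J] hC in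
theorem eventually_mem_reg {z : ℂ} (hz : z ∈ reg K ρ ψ 1) :
    ∀ᶠ t in 𝓝[<] (1 : ℝ), z ∈ reg K ρ ψ t := by
  rcases hz with hz | hz
  · exact Eventually.of_forall fun t => Or.inl hz
  · obtain ⟨j, w, ⟨h1, h2⟩, rfl⟩ := mem_iUnion.1 hz
    filter_upwards [Ioo_mem_nhdsLT h2] with t ht
    exact mem_reg_of_mem h1 ht.1

theorem sum_wind_sub {t : ℝ} (ht : ρ < t) (ht' : t < ρ⁻¹) {a : ℂ} (ha : a ∈ reg K ρ ψ t) :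
    ∑ j, wind (fun w => ψ j w - a) t = 1 := by
  have h := hC.index t ht ht' a ha
  have : ∀ j, wind (fun w => ψ j w - a) t =
      (2 * π * I)⁻¹ * ∮ w in C(0, t), deriv (ψ j) w / (ψ j w - a) := fun j => by
    rw [wind]
    congr 2
    funext w
    simp [logDeriv]
  simp only [this, ← Finset.mul_sum, h]
  exact inv_mul_cancel₀ two_pi_I_ne_zero

theorem sub_ne_zero_of_mem_sphere {t : ℝ} (ht : ρ < t) (ht' : t < ρ⁻¹) {a : ℂ}
    (ha : a ∈ reg K ρ ψ t) (j : J) {w : ℂ} (hw : w ∈ sphere (0 : ℂ) t) : ψ j w - a ≠ 0 :=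
  sub_ne_zero.2 (hC.ne_of_norm_le ht'.le ha (sphere_subset_annulus ht ht' hw)
    (mem_sphere_zero_iff_norm.1 hw).ge)

theorem sum_wind_prod {t : ℝ} (ht : ρ < t) (ht' : t < ρ⁻¹) (Z : Multiset ℂ)
    (hZ : ∀ a ∈ Z, a ∈ reg K ρ ψ t) :
    ∑ j, wind (fun w => (Z.map fun a => ψ j w - a).prod) t = Z.card := by
  induction Z using Multiset.induction_on with
  | empty => simp [wind_one]
  | cons a Z ih =>
    have hZ' : ∀ b ∈ Z, b ∈ reg K ρ ψ t := fun b hb => hZ b (Multiset.mem_cons_of_mem hb)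
    have h : ∀ j, wind (fun w => ((a ::ₘ Z).map fun a => ψ j w - a).prod) t =
        wind (fun w => ψ j w - a) t + wind (fun w => (Z.map fun a => ψ j w - a).prod) t := by
      intro j
      simp only [Multiset.map_cons, Multiset.prod_cons]
      refine wind_mul hC.pos.le ((hC.diff j).sub_const a) ht ht' (fun w hw =>
        hC.sub_ne_zero_of_mem_sphere ht ht' (hZ a (Multiset.mem_cons_self _ _)) j hw) ?_
        fun w hw => ?_
      · clear ih hZ hZ'
        induction Z using Multiset.induction_on with
        | empty => simp
        | cons b Z ih =>
          simp only [Multiset.map_cons, Multiset.prod_cons]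
          exact ((hC.diff j).sub_const b).mul ih
      · refine Multiset.prod_ne_zero fun h => ?_
        obtain ⟨b, hb, h⟩ := Multiset.mem_map.1 h
        exact hC.sub_ne_zero_of_mem_sphere ht ht' (hZ' b hb) j hw h
    simp only [h, Finset.sum_add_distrib, ih hZ', hC.sum_wind_sub ht ht'
      (hZ a (Multiset.mem_cons_self _ _)), Multiset.card_cons]
    push_cast
    ring

/-- The argument principle for the region `reg K ρ ψ 1`. -/
theorem exists_zeros {t' : ℝ} (h1 : 1 < t') (ht' : t' ≤ ρ⁻¹) {F : ℂ → ℂ}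
    (hF : DifferentiableOn ℂ F (reg K ρ ψ t')) (hne : ∃ z ∈ reg K ρ ψ t', F z ≠ 0) :
    ∃ (Z : Multiset ℂ) (u : ℂ → ℂ), (∀ a ∈ Z, a ∈ reg K ρ ψ 1 ∧ F a = 0) ∧
      DifferentiableOn ℂ u (reg K ρ ψ t') ∧ (∀ z ∈ reg K ρ ψ 1, u z ≠ 0) ∧
      (∀ z ∈ reg K ρ ψ t', F z = (Z.map fun a => z - a).prod * u z) ∧
      ∀ᶠ t in 𝓝[<] (1 : ℝ), (∀ j, ∀ w ∈ sphere (0 : ℂ) t, F (ψ j w) ≠ 0) ∧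
        ∑ j, wind (fun w => F (ψ j w)) t = Z.card := by
  have hρ1 := hC.lt_one
  have hsub := reg_mono K ρ ψ h1.le
  obtain ⟨C, hCc, hC1, -, hC3⟩ := hC.reg_subset_isCompact hC.lt_one hC.one_lt
  have hA : {z ∈ reg K ρ ψ 1 | F z = 0}.Finite :=
    (finite_zeros_of_differentiableOn (hC.isOpen _ (by linarith) ht')
      (hC.preconn _ (by linarith) ht') hF hne hCc (hC3 t' h1)).subset
      fun z hz => ⟨hC1 hz.1, hz.2⟩
  obtain ⟨Z, u, hZ, hu, hu0, hFu⟩ := exists_factor (hC.isOpen _ (by linarith) ht')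
    (hC.preconn _ (by linarith) ht') hF hne hA fun z hz => hsub hz.1
  have hu1 : ∀ z ∈ reg K ρ ψ 1, u z ≠ 0 := fun z hz h => by
    by_cases h0 : F z = 0
    · exact hu0 z ⟨hz, h0⟩ h
    · exact h0 (by rw [hFu z (hsub hz), h, mul_zero])
  refine ⟨Z, u, hZ, hu, hu1, hFu, ?_⟩
  have hev : ∀ᶠ t in 𝓝[<] (1 : ℝ), ∀ a ∈ {z ∈ reg K ρ ψ 1 | F z = 0}, a ∈ reg K ρ ψ t :=
    (hA.eventually_all).2 fun a ha => eventually_mem_reg ha.1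
  filter_upwards [hev, Ioo_mem_nhdsLT hC.lt_one] with t ht htt
  have htρ : t < ρ⁻¹ := htt.2.trans hC.one_lt
  have hs := sphere_subset_annulus htt.1 htt.2
  have hs1 : ∀ j, ∀ w ∈ annulus ρ 1, ψ j w ∈ reg K ρ ψ 1 := fun j w hw =>
    mem_reg_of_mem hw.1 hw.2
  have hZt : ∀ a ∈ Z, a ∈ reg K ρ ψ t := fun a ha => ht a (hZ a ha)
  have hprod : ∀ j, ∀ w ∈ sphere (0 : ℂ) t, (Z.map fun a => ψ j w - a).prod ≠ 0 := by
    intro j w hw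
    refine Multiset.prod_ne_zero fun h => ?_
    obtain ⟨b, hb, h⟩ := Multiset.mem_map.1 h
    exact hC.sub_ne_zero_of_mem_sphere htt.1 htρ (hZt b hb) j hw h
  refine ⟨fun j w hw => ?_, ?_⟩
  · rw [hFu _ (hsub (hs1 j w (hs hw)))]
    exact mul_ne_zero (hprod j w hw) (hu1 _ (hs1 j w (hs hw)))
  have hd : ∀ j, DifferentiableOn ℂ (ψ j) (annulus ρ 1) := fun j =>
    (hC.diff j).mono (annulus_mono le_rfl hC.one_lt.le)
  have e : ∀ j, wind (fun w => F (ψ j w)) t =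
      wind (fun w => (Z.map fun a => ψ j w - a).prod) t + wind (fun w => u (ψ j w)) t := by
    intro j
    rw [← wind_mul hC.pos.le ?_ htt.1 htt.2 (hprod j) (g := fun w => u (ψ j w)) (hu.comp (hd j) fun w hw =>
      hsub (hs1 j w hw)) fun w hw => hu1 _ (hs1 j w (hs hw))]
    · exact wind_congr hC.pos.le htt.1 htt.2 fun w hw => hFu _ (hsub (hs1 j w hw))
    · clear hFu hZ hprod hZt
      induction Z using Multiset.induction_on with
      | empty => simp
      | cons b Z ih =>
        simp only [Multiset.map_cons, Multiset.prod_cons]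
        exact ((hd j).sub_const b).mul ih
  have e2 : ∑ j, wind (fun w => u (ψ j w)) t = 0 := by
    have hL : DifferentiableOn ℂ (logDeriv u) (reg K ρ ψ 1) :=
      ((hu.mono hsub).deriv (hC.isOpen 1 hC.lt_one hC.one_lt.le)).div (hu.mono hsub) hu1
    have h := hC.cauchy t 1 htt.1 htt.2 hC.one_lt.le _ hL
    simp only [wind, ← Finset.mul_sum]
    rw [mul_eq_zero]
    right
    refine Eq.trans ?_ h
    refine Finset.sum_congr rfl fun j _ => ?_
    refine circleIntegral.integral_congr (hC.pos.trans htt.1).le fun w hw => ?_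
    have h3 := hs1 j w (hs hw)
    have := logDeriv_comp (f := u) (g := ψ j) (x := w)
      (hu.differentiableAt ((hC.isOpen t' (by linarith) ht').mem_nhds (hsub h3)))
      ((hd j).differentiableAt ((isOpen_annulus _ _).mem_nhds (hs hw)))
    exact this
  simp only [e, Finset.sum_add_distrib, e2, add_zero, hC.sum_wind_prod htt.1 htρ Z hZt]

theorem exists_halfDensity (hK : K.Nonempty) : ∃ σ, HalfDensity ρ ψ σ ∧
      ∀ t, ρ < t → t < ρ⁻¹ → ∑ j, (1 + wind (σ j) t) = 1 := by
  choose σ hσd hσsq hσw using fun j =>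
    exists_sqrt_deriv hC.pos (hC.diff j) (hC.injOn j) (hC.deriv_ne j)
  refine ⟨σ, ⟨hσd, hσsq⟩, fun t ht htρ => ?_⟩
  have hs := sphere_subset_annulus ht htρ
  have ht0 := hC.pos.trans ht
  obtain ⟨a, ha⟩ := hK
  obtain ⟨s, hs1, hs2⟩ := exists_between ht
  have hw' : (s : ℂ) ∈ annulus ρ t := by
    have : ‖(s : ℂ)‖ = s := by simp [(hC.pos.trans hs1).le]
    exact ⟨by rw [this]; exact hs1, by rw [this]; exact hs2⟩
  have haW : a ∈ reg K ρ ψ t := Or.inl ha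
  have hlog : ∀ j z, logDeriv (fun w => ψ j w - z) = fun w => deriv (ψ j) w / (ψ j w - z) :=
    fun j z => by
      funext w
      simp [logDeriv]
  have hconst : ∀ j, ∀ z ∈ reg K ρ ψ t,
      (∮ w in C(0, t), deriv (ψ j) w / (ψ j w - z)) =
        ∮ w in C(0, t), deriv (ψ j) w / (ψ j w - a) := by
    intro j z hz
    refine eq_of_exp_eq_one (hC.preconn t ht htρ.le)
      (d := fun z => ∮ w in C(0, t), deriv (ψ j) w / (ψ j w - z)) ?_ (fun z hz => ?_) hz haW
    · refine continuousOn_circleIntegral ht0.le (F := fun z w => deriv (ψ j) w / (ψ j w - z)) ?_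
      refine ContinuousOn.div ?_ (ContinuousOn.sub ?_ continuousOn_fst) ?_
      · exact ((hC.differentiableOn_deriv j).continuousOn.mono hs).comp continuousOn_snd
          fun p hp => hp.2
      · exact ((hC.diff j).continuousOn.mono hs).comp continuousOn_snd fun p hp => hp.2
      · rintro ⟨z, w⟩ ⟨hz, hw⟩
        exact sub_ne_zero.2 (hC.ne_of_norm_le htρ.le hz (hs hw) (mem_sphere_zero_iff_norm.1 hw).ge)
    · obtain ⟨n, hn⟩ := exists_int_wind hC.pos.le ((hC.diff j).sub_const z) ht htρ fun w hw =>
        sub_ne_zero.2 (hC.ne_of_norm_le htρ.le hz (hs hw) (mem_sphere_zero_iff_norm.1 hw).ge)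
      have := two_pi_I_mul_wind (fun w => ψ j w - z) t
      rw [hn, hlog] at this
      rw [← this, exp_eq_one_iff]
      exact ⟨n, by ring⟩
  have h1 := hC.index t ht htρ a haW
  have h2 : ∀ j, (∮ w in C(0, t), deriv (ψ j) w / (ψ j w - a)) =
      2 * π * I * (1 + wind (σ j) t) := fun j => by
    rw [← hσw j t ht htρ s hw', two_pi_I_mul_wind, hlog]
    exact (hconst j _ (mem_reg_of_mem hw'.1 hw'.2)).symm
  simp only [h2, ← Finset.mul_sum] at h1
  exact mul_left_cancel₀ two_pi_I_ne_zero (h1.trans (mul_one _).symm)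

variable (hσ : HalfDensity ρ ψ σ)
include hσ

section

variable {r : ℝ} (hr : ρ < r) (hr1 : r < 1)
include hr hr1

theorem annulus_inv_subset : annulus r r⁻¹ ⊆ annulus ρ ρ⁻¹ := by
  refine annulus_mono hr.le ?_
  have := hC.pos
  gcongr

theorem regularKernel_of_ne_index {i j : J} (hij : i ≠ j) {w w' : ℂ} (hw : w ∈ annulus r r⁻¹)
    (hw' : w' ∈ annulus r r⁻¹) : regularKernel ψ σ r i j w w' = collarKernel ψ σ i j w w' := by
  have hsub := hC.annulus_inv_subset hσ hr hr1
  have hr0 := hC.pos.trans hr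
  have h : DifferentiableOn ℂ (fun ξ => collarKernel ψ σ i j ξ w') (annulus ρ ρ⁻¹) := by
    refine DifferentiableOn.div ((hσ.diff i).mul_const _) ((hC.diff i).const_sub _) ?_
    intro ξ hξ h
    exact hij (hC.inj j i w' (hsub hw') ξ hξ (sub_eq_zero.1 h)).1.symm
  rw [regularKernel, circleIntegral_div_sub_annulus hC.pos.le h hr hw.1 hw.2
    (by have := hC.pos; gcongr)]
  have : (2 * π * I : ℂ) ≠ 0 := two_pi_I_ne_zero
  field_simp

theorem regularKernel_of_ne {i : J} {w w' : ℂ} (hne : w ≠ w') (hw : w ∈ annulus r r⁻¹)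
    (hw' : w' ∈ annulus r r⁻¹) :
    regularKernel ψ σ r i i w w' = collarKernel ψ σ i i w w' - (w' - w)⁻¹ := by
  have hsub := hC.annulus_inv_subset hσ hr hr1
  have hr0 := hC.pos.trans hr
  have hrR : r⁻¹ < ρ⁻¹ := by have := hC.pos; gcongr
  have hd := fun ξ (hξ : ξ ∈ annulus ρ ρ⁻¹) =>
    dslope_ne_zero_of_injOn (hC.injOn i) (hC.deriv_ne i) (hsub hw') hξ
  let M : ℂ → ℂ := fun ξ => σ i ξ * σ i w' / dslope (ψ i) w' ξ
  have hM : DifferentiableOn ℂ M (annulus ρ ρ⁻¹) :=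
    ((hσ.diff i).mul_const _).div (differentiableOn_dslope_of_isOpen (isOpen_annulus _ _)
      (hC.diff i) (hsub hw')) hd
  have hMw' : M w' = 1 := by
    have := hC.deriv_ne i w' (hsub hw')
    simp only [M, dslope_same, ← hσ.sq i w' (hsub hw')] at this ⊢
    rw [← pow_two, div_self this]
  have key : ∀ t, ρ < t → t < ρ⁻¹ → t ≠ ‖w‖ → t ≠ ‖w'‖ →
      (∮ ξ in C(0, t), collarKernel ψ σ i i ξ w' / (ξ - w)) =
      -(w - w')⁻¹ * ((∮ ξ in C(0, t), M ξ / (ξ - w)) - ∮ ξ in C(0, t), M ξ / (ξ - w')) := by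
    intro t h1 h2 h3 h4
    have ht0 := (hC.pos.trans h1).le
    have hs := sphere_subset_annulus h1 h2
    have hMc := hM.continuousOn.mono hs
    rw [← circleIntegral.integral_sub
      ((continuousOn_div_sub hMc h3.symm).circleIntegrable ht0)
      ((continuousOn_div_sub hMc h4.symm).circleIntegrable ht0), ← circleIntegral.integral_const_mul]
    refine circleIntegral.integral_congr ht0 fun ξ hξ => ?_
    have hξt := mem_sphere_zero_iff_norm.1 hξ
    have e1 : ξ - w ≠ 0 := sub_ne_zero.2 fun h => h3 (by rw [← h, hξt])
    have e2 : ξ ≠ w' := fun h => h4 (by rw [← h, hξt])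
    have e3 : ξ - w' ≠ 0 := sub_ne_zero.2 e2
    have e4 : w - w' ≠ 0 := sub_ne_zero.2 hne
    have e5 := hd ξ (hs hξ)
    simp only [collarKernel, M]
    rw [dslope_of_ne _ e2, slope_def_field] at e5 ⊢
    have e6 : ψ i ξ - ψ i w' ≠ 0 := fun h => e5 (by rw [h, zero_div])
    have e7 : ψ i w' - ψ i ξ = -(ψ i ξ - ψ i w') := by ring
    rw [e7]
    field_simp
    ring
  rw [regularKernel, key r hr (by linarith [hC.one_lt]) hw.1.ne hw'.1.ne,
    key _ (hr.trans (hr1.trans ((one_lt_inv₀ hr0).2 hr1))) hrR hw.2.ne' hw'.2.ne']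
  have i1 := circleIntegral_div_sub_annulus hC.pos.le hM hr hw.1 hw.2 hrR
  have i2 := circleIntegral_div_sub_annulus hC.pos.le hM hr hw'.1 hw'.2 hrR
  have e4 : w - w' ≠ 0 := sub_ne_zero.2 hne
  have hpi : (2 * π * I : ℂ) ≠ 0 := two_pi_I_ne_zero
  have h : collarKernel ψ σ i i w w' = -(w - w')⁻¹ * M w := by
    have e5 := hd w (hsub hw)
    simp only [collarKernel, M]
    rw [dslope_of_ne _ hne, slope_def_field] at e5 ⊢
    have e6 : ψ i w - ψ i w' ≠ 0 := fun h => e5 (by rw [h, zero_div])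
    rw [← neg_sub (ψ i w)]
    field_simp
  rw [h, ← mul_sub, show ∀ a b c d : ℂ, a - b - (c - d) = (a - c) - (b - d) by intros; ring, i1, i2,
    hMw', ← neg_sub w w', inv_neg]
  field_simp
  ring

theorem continuousOn_regularKernel (i j : J) :
    ContinuousOn (Function.uncurry (regularKernel ψ σ r i j))
      (annulus r r⁻¹ ×ˢ annulus r r⁻¹) := by
  have hsub := hC.annulus_inv_subset hσ hr hr1
  have hr0 := hC.pos.trans hr
  have hrR : r⁻¹ < ρ⁻¹ := by have := hC.pos; gcongr
  have hrr : r < r⁻¹ := hr1.trans ((one_lt_inv₀ hr0).2 hr1)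
  have key : ∀ t, (t = r ∨ t = r⁻¹) → ContinuousOn (fun p : ℂ × ℂ =>
      ∮ ξ in C(0, t), collarKernel ψ σ i j ξ p.2 / (ξ - p.1)) (annulus r r⁻¹ ×ˢ annulus r r⁻¹) := by
    intro t ht
    have ht1 : ρ < t := by rcases ht with rfl | rfl <;> linarith
    have ht2 : t < ρ⁻¹ := by rcases ht with rfl | rfl <;> linarith
    have hs := sphere_subset_annulus ht1 ht2
    have hne : ∀ ξ ∈ sphere (0 : ℂ) t, ∀ w ∈ annulus r r⁻¹, ξ ≠ w := by
      rintro ξ hξ w hw rfl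
      rw [mem_sphere_zero_iff_norm] at hξ
      rcases ht with rfl | rfl
      · exact hw.1.ne hξ.symm
      · exact hw.2.ne hξ
    refine continuousOn_circleIntegral (hC.pos.trans ht1).le (F := fun (p : ℂ × ℂ) ξ =>
      collarKernel ψ σ i j ξ p.2 / (ξ - p.1)) ?_
    have h2 : ∀ {f : ℂ → ℂ}, DifferentiableOn ℂ f (annulus ρ ρ⁻¹) → ContinuousOn
        (fun q : (ℂ × ℂ) × ℂ => f q.2) ((annulus r r⁻¹ ×ˢ annulus r r⁻¹) ×ˢ sphere 0 t) :=
      fun hf => (hf.continuousOn.mono hs).comp continuousOn_snd fun p hp => hp.2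
    have h12 : ∀ {f : ℂ → ℂ}, DifferentiableOn ℂ f (annulus ρ ρ⁻¹) → ContinuousOn
        (fun q : (ℂ × ℂ) × ℂ => f q.1.2) ((annulus r r⁻¹ ×ˢ annulus r r⁻¹) ×ˢ sphere 0 t) :=
      fun hf => (hf.continuousOn.mono hsub).comp (by fun_prop) fun p hp => hp.1.2
    refine ContinuousOn.div (ContinuousOn.div ((h2 (hσ.diff i)).mul (h12 (hσ.diff j)))
      ((h12 (hC.diff j)).sub (h2 (hC.diff i))) ?_) (by fun_prop) ?_
    · rintro ⟨⟨w, w'⟩, ξ⟩ ⟨⟨-, hw'⟩, hξ⟩ h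
      exact hne ξ hξ w' hw' (hC.inj j i w' (hsub hw') ξ (hs hξ) (sub_eq_zero.1 h)).2.symm
    · rintro ⟨⟨w, w'⟩, ξ⟩ ⟨⟨hw, -⟩, hξ⟩
      exact sub_ne_zero.2 (hne ξ hξ w hw)
  exact continuousOn_const.mul ((key _ (Or.inr rfl)).sub (key _ (Or.inl rfl)))

theorem differentiableOn_regularKernel (i j : J) {w' : ℂ} (hw' : w' ∈ annulus r r⁻¹) :
    DifferentiableOn ℂ (fun w => regularKernel ψ σ r i j w w') (annulus r r⁻¹) := by
  have hsub := hC.annulus_inv_subset hσ hr hr1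
  have hr0 := hC.pos.trans hr
  have hrR : r⁻¹ < ρ⁻¹ := by have := hC.pos; gcongr
  have hrr : r < r⁻¹ := hr1.trans ((one_lt_inv₀ hr0).2 hr1)
  have key : ∀ t, (t = r ∨ t = r⁻¹) → DifferentiableOn ℂ (fun w =>
      ∮ ξ in C(0, t), collarKernel ψ σ i j ξ w' / (ξ - w)) (annulus r r⁻¹) := by
    intro t ht
    have ht1 : ρ < t := by rcases ht with rfl | rfl <;> linarith
    have ht2 : t < ρ⁻¹ := by rcases ht with rfl | rfl <;> linarith
    have hs := sphere_subset_annulus ht1 ht2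
    have hne : ∀ ξ ∈ sphere (0 : ℂ) t, ∀ w ∈ annulus r r⁻¹, ξ ≠ w := by
      rintro ξ hξ w hw rfl
      rw [mem_sphere_zero_iff_norm] at hξ
      rcases ht with rfl | rfl
      · exact hw.1.ne hξ.symm
      · exact hw.2.ne hξ
    have hk : ContinuousOn (fun ξ => collarKernel ψ σ i j ξ w') (sphere 0 t) := by
      refine ContinuousOn.div ((((hσ.diff i).continuousOn).mono hs).mul continuousOn_const)
        (continuousOn_const.sub (((hC.diff i).continuousOn).mono hs)) fun ξ hξ h => ?_
      exact hne ξ hξ w' hw' (hC.inj j i w' (hsub hw') ξ (hs hξ) (sub_eq_zero.1 h)).2.symm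
    refine differentiableOn_circleIntegral (isOpen_annulus _ _) (hC.pos.trans ht1).le
      (F := fun w ξ => collarKernel ψ σ i j ξ w' / (ξ - w)) ?_ fun ξ hξ => ?_
    · refine ContinuousOn.div (f := fun p : ℂ × ℂ => collarKernel ψ σ i j p.2 w')
        (g := fun p : ℂ × ℂ => p.2 - p.1) (hk.comp continuousOn_snd fun p hp => hp.2)
        (by fun_prop) ?_
      rintro ⟨w, ξ⟩ ⟨hw, hξ⟩
      exact sub_ne_zero.2 (hne ξ hξ w hw)
    · exact DifferentiableOn.div (by fun_prop) (by fun_prop) fun w hw =>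
        sub_ne_zero.2 (hne ξ hξ w hw)
  exact ((key _ (Or.inr rfl)).sub (key _ (Or.inl rfl))).const_mul _

theorem regularKernel_swap (i j : J) {w w' : ℂ} (hw : w ∈ annulus r r⁻¹)
    (hw' : w' ∈ annulus r r⁻¹) :
    regularKernel ψ σ r j i w' w = -regularKernel ψ σ r i j w w' := by
  have hk : collarKernel ψ σ j i w' w = -collarKernel ψ σ i j w w' := by
    simp only [collarKernel]
    rw [← neg_sub (ψ j w'), div_neg, mul_comm]
  by_cases hij : i = j
  · subst hij
    by_cases hne : w = w'
    · subst hne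
      have hc : ContinuousOn (fun v => regularKernel ψ σ r i i v w + regularKernel ψ σ r i i w v)
          (annulus r r⁻¹) := by
        have h := hC.continuousOn_regularKernel hσ hr hr1 i i
        exact (h.comp (f := fun v => (v, w)) (by fun_prop) fun v hv => ⟨hv, hw⟩).add
          (h.comp (f := fun v => (w, v)) (by fun_prop) fun v hv => ⟨hw, hv⟩)
      have h1 := (hc.continuousAt ((isOpen_annulus _ _).mem_nhds hw)).tendsto.mono_left
        (nhdsWithin_le_nhds (s := {w}ᶜ))
      have h2 : (fun v => regularKernel ψ σ r i i v w + regularKernel ψ σ r i i w v)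
          =ᶠ[𝓝[≠] w] fun _ => 0 := by
        filter_upwards [self_mem_nhdsWithin,
          nhdsWithin_le_nhds ((isOpen_annulus r r⁻¹).mem_nhds hw)] with v hv hvA
        rw [hC.regularKernel_of_ne hσ hr hr1 hv hvA hw,
          hC.regularKernel_of_ne hσ hr hr1 (Ne.symm hv) hw hvA]
        simp only [collarKernel]
        rw [← neg_sub (ψ i w) (ψ i v), ← neg_sub w v, div_neg, inv_neg]
        ring
      have h3 := tendsto_nhds_unique (h1.congr' h2) tendsto_const_nhds
      linear_combination h3
    · rw [hC.regularKernel_of_ne hσ hr hr1 (Ne.symm hne) hw' hw,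
        hC.regularKernel_of_ne hσ hr hr1 hne hw hw', hk, ← neg_sub w' w, inv_neg]
      ring
  · rw [hC.regularKernel_of_ne_index hσ hr hr1 (Ne.symm hij) hw' hw,
      hC.regularKernel_of_ne_index hσ hr hr1 hij hw hw', hk]

theorem differentiableOn_regularKernel_right (i j : J) {w : ℂ} (hw : w ∈ annulus r r⁻¹) :
    DifferentiableOn ℂ (fun w' => regularKernel ψ σ r i j w w') (annulus r r⁻¹) :=
  (hC.differentiableOn_regularKernel hσ hr hr1 j i hw).neg.congr fun _ hw' =>
    hC.regularKernel_swap hσ hr hr1 j i hw' hw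

end

theorem cauchyTransform_sub {g h : J → ℂ → ℂ} {t : ℝ} (ht : ρ < t) (ht' : t < ρ⁻¹)
    (hg : ∀ j, ContinuousOn (g j) (sphere 0 t)) (hh : ∀ j, ContinuousOn (h j) (sphere 0 t))
    {z : ℂ} (hz : z ∈ reg K ρ ψ t) :
    cauchyTransform ψ σ (fun j w => g j w - h j w) t z =
      cauchyTransform ψ σ g t z - cauchyTransform ψ σ h t z := by
  have hs := sphere_subset_annulus ht ht'
  have ht0 := (hC.pos.trans ht).le
  have hi : ∀ {f : J → ℂ → ℂ} (_ : ∀ j, ContinuousOn (f j) (sphere 0 t)) (j : J),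
      CircleIntegrable (fun w => f j w * σ j w / (ψ j w - z)) 0 t := fun hf j => by
    refine ContinuousOn.circleIntegrable ht0 (((hf j).mul ((hσ.diff j).continuousOn.mono hs)).div
      (((hC.diff j).continuousOn.mono hs).sub continuousOn_const) fun w hw => ?_)
    exact sub_ne_zero.2 (hC.ne_of_norm_le ht'.le hz (hs hw) (mem_sphere_zero_iff_norm.1 hw).ge)
  unfold cauchyTransform
  rw [← mul_sub, ← Finset.sum_sub_distrib]
  congr 1
  refine Finset.sum_congr rfl fun j _ => ?_
  rw [← circleIntegral.integral_sub (hi hg j) (hi hh j)]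
  refine circleIntegral.integral_congr ht0 fun w _ => ?_
  ring

theorem cauchyTransform_pole {a : ℂ} {t : ℝ} (ht : ρ < t) (ht' : t < ρ⁻¹) (ha : a ∈ reg K ρ ψ t)
    {z : ℂ} (hz : z ∈ reg K ρ ψ t) (hza : z ≠ a) :
    cauchyTransform ψ σ (fun j w => σ j w * (ψ j w - a)⁻¹) t z = 0 := by
  have hs := sphere_subset_annulus ht ht'
  have ht0 := (hC.pos.trans ht).le
  have hne : ∀ x ∈ reg K ρ ψ t, ∀ j, ∀ w ∈ sphere (0 : ℂ) t, ψ j w - x ≠ 0 := fun x hx j w hw =>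
    sub_ne_zero.2 (hC.ne_of_norm_le ht'.le hx (hs hw) (mem_sphere_zero_iff_norm.1 hw).ge)
  have hi : ∀ x ∈ reg K ρ ψ t, ∀ j,
      CircleIntegrable (fun w => deriv (ψ j) w / (ψ j w - x)) 0 t := fun x hx j =>
    ContinuousOn.circleIntegrable ht0 (((hC.differentiableOn_deriv j).continuousOn.mono hs).div
      (((hC.diff j).continuousOn.mono hs).sub continuousOn_const) (hne x hx j))
  have key : ∀ j, (∮ w in C(0, t), σ j w * (ψ j w - a)⁻¹ * σ j w / (ψ j w - z)) =
      (a - z)⁻¹ * ((∮ w in C(0, t), deriv (ψ j) w / (ψ j w - a)) -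
        ∮ w in C(0, t), deriv (ψ j) w / (ψ j w - z)) := by
    intro j
    rw [← circleIntegral.integral_sub (hi a ha j) (hi z hz j), ← circleIntegral.integral_const_mul]
    refine circleIntegral.integral_congr ht0 fun w hw => ?_
    have h1 := hne a ha j w hw
    have h2 := hne z hz j w hw
    have h3 : a - z ≠ 0 := sub_ne_zero.2 hza.symm
    simp only [← hσ.sq j w (hs hw)]
    field_simp
    ring
  unfold cauchyTransform
  simp only [key, ← Finset.mul_sum, Finset.sum_sub_distrib, hC.index t ht ht' a ha,
    hC.index t ht ht' z hz, sub_self, mul_zero]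

theorem differentiableOn_regularOp {r : ℝ} (hr : ρ < r) (hr1 : r < 1) {h : J → ℂ → ℂ}
    (hh : ∀ j, ContinuousOn (h j) (sphere 0 1)) (i : J) :
    DifferentiableOn ℂ (regularOp ψ σ r h i) (annulus r r⁻¹) := by
  have hs := sphere_subset_annulus hr1 ((one_lt_inv₀ (hC.pos.trans hr)).2 hr1)
  refine DifferentiableOn.const_mul (DifferentiableOn.fun_sum fun j _ => ?_) _
  refine differentiableOn_circleIntegral (isOpen_annulus _ _) zero_le_one
    (F := fun w ξ => regularKernel ψ σ r i j w ξ * h j ξ) ?_ fun ξ hξ => ?_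
  · exact ((hC.continuousOn_regularKernel hσ hr hr1 i j).mono (prod_mono le_rfl hs)).mul
      ((hh j).comp continuousOn_snd fun p hp => hp.2)
  · exact (hC.differentiableOn_regularKernel hσ hr hr1 i j (hs hξ)).mul_const _

theorem regularOp_eq {r s : ℝ} (hr : ρ < r) (hr1 : r < 1) (hs1 : 1 ≤ s) (hsr : s < r⁻¹)
    {h : J → ℂ → ℂ} (hh : ∀ j, DifferentiableOn ℂ (h j) (annulus r r⁻¹)) (i : J) {w : ℂ}
    (hw : r < ‖w‖) (hws : ‖w‖ < s) :
    regularOp ψ σ r h i w = σ i w * cauchyTransform ψ σ h s (ψ i w) -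
      (2 * π * I)⁻¹ * ∮ ξ in C(0, s), h i ξ / (ξ - w) := by
  classical
  have hr0 := hC.pos.trans hr
  have hrR : r⁻¹ < ρ⁻¹ := by have := hC.pos; gcongr
  have hwm : w ∈ annulus r r⁻¹ := ⟨hw, hws.trans hsr⟩
  have hsub := hC.annulus_inv_subset hσ hr hr1
  have hs' : sphere (0 : ℂ) s ⊆ annulus r r⁻¹ := sphere_subset_annulus (hr1.trans_le hs1) hsr
  have hs0 : 0 ≤ s := zero_le_one.trans hs1
  have hne : ∀ ξ ∈ sphere (0 : ℂ) s, ξ ≠ w := by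
    rintro ξ hξ rfl
    exact hws.ne (mem_sphere_zero_iff_norm.1 hξ)
  have hne2 : ∀ j, ∀ ξ ∈ sphere (0 : ℂ) s, ψ j ξ - ψ i w ≠ 0 := fun j ξ hξ =>
    sub_ne_zero.2 fun h => hne ξ hξ (hC.inj j i ξ (hsub (hs' hξ)) w (hsub hwm) h).2
  have i1 : ∀ j, CircleIntegrable (fun ξ => σ i w * (h j ξ * σ j ξ / (ψ j ξ - ψ i w))) 0 s :=
    fun j => ContinuousOn.circleIntegrable hs0 (continuousOn_const.mul
      ((((hh j).continuousOn.mono hs').mul ((hσ.diff j).continuousOn.mono (hs'.trans hsub))).div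
      (((hC.diff j).continuousOn.mono (hs'.trans hsub)).sub continuousOn_const) (hne2 j)))
  have i2 : CircleIntegrable (fun ξ => h i ξ / (ξ - w)) 0 s :=
    ContinuousOn.circleIntegrable hs0 (((hh i).continuousOn.mono hs').div (by fun_prop)
      fun ξ hξ => sub_ne_zero.2 (hne ξ hξ))
  have key : ∀ j, (∮ ξ in C(0, 1), regularKernel ψ σ r i j w ξ * h j ξ) =
      σ i w * (∮ ξ in C(0, s), h j ξ * σ j ξ / (ψ j ξ - ψ i w)) -
        if j = i then ∮ ξ in C(0, s), h i ξ / (ξ - w) else 0 := by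
    intro j
    rw [circleIntegral_eq_of_differentiableOn_annulus hr0.le
      ((hC.differentiableOn_regularKernel_right hσ hr hr1 i j hwm).fun_mul (hh j)) hr1
      ((one_lt_inv₀ hr0).2 hr1) (hr1.trans_le hs1) hsr, ← circleIntegral.integral_const_mul]
    split_ifs with hji
    · subst hji
      rw [← circleIntegral.integral_sub (i1 j) i2]
      refine circleIntegral.integral_congr hs0 fun ξ hξ => ?_
      simp only [hC.regularKernel_of_ne hσ hr hr1 (hne ξ hξ).symm hwm (hs' hξ), collarKernel]
      ring
    · rw [sub_zero]
      refine circleIntegral.integral_congr hs0 fun ξ hξ => ?_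
      simp only [hC.regularKernel_of_ne_index hσ hr hr1 (Ne.symm hji) hwm (hs' hξ), collarKernel]
      ring
  simp only [regularOp, key, Finset.sum_sub_distrib, ← Finset.mul_sum, Finset.sum_ite_eq',
    Finset.mem_univ, if_true, cauchyTransform]
  ring

theorem exists_reflect_eq {r : ℝ} (hr : ρ < r) (hr1 : r < 1) {ℓ : J → ℂ → ℂ}
    (hℓ : ∀ j, DifferentiableOn ℂ (ℓ j) (annulus r r⁻¹)) :
    ∃ g : J → ℂ → ℂ, (∀ j, DifferentiableOn ℂ (g j) (annulus r r⁻¹)) ∧ ∀ i, ∀ w ∈ annulus r r⁻¹,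
      g i w = reflect (ℓ i) w + regularOp ψ σ r g i w +
        reflect (regularOp ψ σ r (fun j => reflect (g j)) i) w := by
  have hr0 := hC.pos.trans hr
  have hs := sphere_subset_annulus hr1 ((one_lt_inv₀ hr0).2 hr1)
  have hcj : ContinuousOn (conj : ℂ → ℂ) (sphere 0 1) := continuous_conj.continuousOn
  obtain ⟨g₀, hg₀, h⟩ := exists_solution_of_skew_kernel_circle
    (fun i j w w' => regularKernel ψ σ r i j w w' * w' +
      conj (regularKernel ψ σ r i j w w') * conj w) (fun i j => by
      have h1 : ContinuousOn (Function.uncurry (regularKernel ψ σ r i j))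
        (sphere 0 1 ×ˢ sphere 0 1) :=
        (hC.continuousOn_regularKernel hσ hr hr1 i j).mono (prod_mono hs hs)
      exact (h1.mul continuousOn_snd).add ((continuous_conj.comp_continuousOn h1).mul
        (continuous_conj.comp_continuousOn continuousOn_fst))) (fun i j w hw w' hw' => by
      simp only [hC.regularKernel_swap hσ hr hr1 i j (hs hw) (hs hw'), map_add, map_mul, map_neg,
        conj_conj]
      ring) (fun i => reflect (ℓ i))
    (fun i => ((differentiableOn_reflect hr0 (hℓ i)).continuousOn).mono hs)
  let g : J → ℂ → ℂ := fun i w => reflect (ℓ i) w + regularOp ψ σ r g₀ i w +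
        reflect (regularOp ψ σ r (fun j w => conj w * conj (g₀ j w)) i) w
  have hgd : ∀ i, DifferentiableOn ℂ (g i) (annulus r r⁻¹) := fun i =>
    ((differentiableOn_reflect hr0 (hℓ i)).add
      (hC.differentiableOn_regularOp hσ hr hr1 hg₀ i)).add (differentiableOn_reflect hr0
      (hC.differentiableOn_regularOp hσ hr hr1
        (fun j => hcj.mul (continuous_conj.comp_continuousOn (hg₀ j))) i))
  have hKc : ∀ i j, ∀ w ∈ sphere (0 : ℂ) 1,
      Continuous fun θ : ℝ => regularKernel ψ σ r i j w (circleMap 0 1 θ) := fun i j w hw =>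
    (hC.differentiableOn_regularKernel_right hσ hr hr1 i j (hs hw)).continuousOn.comp_continuous
      (continuous_circleMap 0 1) fun θ => hs (circleMap_mem_sphere 0 zero_le_one θ)
  have hgc : ∀ j, Continuous fun θ : ℝ => g₀ j (circleMap 0 1 θ) := fun j =>
    (hg₀ j).comp_continuous (continuous_circleMap 0 1) (circleMap_mem_sphere 0 zero_le_one)
  have hcc : Continuous (circleMap 0 1) := continuous_circleMap 0 1
  have hgg : ∀ i, ∀ w ∈ sphere (0 : ℂ) 1, g i w = g₀ i w := by
    intro i w hw
    rw [h i w hw]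
    simp only [g, reflect_of_mem_sphere (regularOp ψ σ r _ i) hw]
    rw [add_assoc]
    congr 1
    simp only [regularOp, map_mul, map_sum, Finset.mul_sum, ← Finset.sum_add_distrib]
    refine Finset.sum_congr rfl fun j _ => ?_
    simp only [circleIntegral, ← intervalIntegral.intervalIntegral_conj,
      ← intervalIntegral.integral_const_mul]
    have hc1 := hKc i j w hw
    have hc2 := hgc j
    have hc3 := continuous_conj.comp hc2
    have hc4 := continuous_conj.comp hcc
    simp only [Function.comp_def] at hc3 hc4
    rw [← intervalIntegral.integral_add]
    · refine intervalIntegral.integral_congr fun θ _ => ?_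
      have h1 : conj (circleMap 0 1 θ) * circleMap 0 1 θ = 1 := by
        rw [← normSq_eq_conj_mul_self, normSq_eq_norm_sq,
          mem_sphere_zero_iff_norm.1 (circleMap_mem_sphere 0 zero_le_one θ)]
        simp
      simp only [deriv_circleMap, smul_eq_mul, map_mul, conj_conj, map_inv₀, conj_I, conj_ofReal,
        map_ofNat]
      have hI := I_ne_zero
      have hpi : (π : ℂ) ≠ 0 := ofReal_ne_zero.2 Real.pi_ne_zero
      field_simp
      linear_combination (conj w * conj (regularKernel ψ σ r i j w (circleMap 0 1 θ)) *
        g₀ j (circleMap 0 1 θ)) * h1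
    · refine (?_ : Continuous _).intervalIntegrable _ _
      simp only [deriv_circleMap, smul_eq_mul]
      exact continuous_const.mul ((hcc.mul continuous_const).mul (hc1.mul hc2))
    · refine (?_ : Continuous _).intervalIntegrable _ _
      simp only [deriv_circleMap]
      exact continuous_const.mul (continuous_const.mul (continuous_conj.comp (by fun_prop)))
  refine ⟨g, hgd, fun i w hw => ?_⟩
  have e1 : regularOp ψ σ r g = regularOp ψ σ r g₀ := by
    funext i w
    simp only [regularOp]
    congr 1
    refine Finset.sum_congr rfl fun j _ => circleIntegral.integral_congr zero_le_one fun ξ hξ => ?_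
    simp only [hgg j ξ hξ]
  have e2 : regularOp ψ σ r (fun j => reflect (g j)) =
      regularOp ψ σ r (fun j w => conj w * conj (g₀ j w)) := by
    funext i w
    simp only [regularOp]
    congr 1
    refine Finset.sum_congr rfl fun j _ => circleIntegral.integral_congr zero_le_one fun ξ hξ => ?_
    simp only [reflect_of_mem_sphere _ hξ, hgg j ξ hξ]
  rw [e1, e2]

/-- Densities `y` with vanishing Cauchy transform whose reflection also has vanishing Cauchy
transform are zero. -/
theorem eq_zero_of_cauchyTransform {r : ℝ} (hr : ρ < r) (hr1 : r < 1) {y : J → ℂ → ℂ}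
    (hy : ∀ j, DifferentiableOn ℂ (y j) (annulus r r⁻¹))
    (h1 : ∀ t, r < t → t < r⁻¹ → ∀ j, ∀ w ∈ annulus r t, cauchyTransform ψ σ y t (ψ j w) = 0)
    (h2 : ∀ t, r < t → t < r⁻¹ → ∀ j, ∀ w ∈ annulus r t,
      cauchyTransform ψ σ (fun j => reflect (y j)) t (ψ j w) = 0) (i : J) {w : ℂ}
    (hw : w ∈ annulus r r⁻¹) : y i w = 0 := by
  have hr0 := hC.pos.trans hr
  have hR : 1 < r⁻¹ := (one_lt_inv₀ hr0).2 hr1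
  have hrR : r⁻¹ ≤ ρ⁻¹ := by have := hC.pos; gcongr
  have hs := sphere_subset_annulus hr1 hR
  have h := hC.sum_circleIntegral_mul_eq_zero hσ hr.le hr1 hR hrR hy
    (fun j => differentiableOn_reflect hr0 (hy j)) h1 h2
  have hyc : ∀ j, Continuous fun θ : ℝ => y j (circleMap 0 1 θ) := fun j =>
    ((hy j).continuousOn.mono hs).comp_continuous (continuous_circleMap 0 1)
      (circleMap_mem_sphere 0 zero_le_one)
  have h3 : ∀ j, (∮ w in C(0, 1), y j w * reflect (y j) w) =
      I * ((∫ θ in 0..2 * π, ‖y j (circleMap 0 1 θ)‖ ^ 2 : ℝ) : ℂ) := by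
    intro j
    rw [← intervalIntegral.integral_ofReal, ← intervalIntegral.integral_const_mul, circleIntegral]
    refine intervalIntegral.integral_congr fun θ _ => ?_
    have hm := circleMap_mem_sphere (0 : ℂ) zero_le_one θ
    have h1 : circleMap 0 1 θ * conj (circleMap 0 1 θ) = 1 := by
      rw [mul_conj, normSq_eq_norm_sq, mem_sphere_zero_iff_norm.1 hm]
      simp
    simp only [deriv_circleMap, smul_eq_mul, reflect_of_mem_sphere _ hm, ofReal_pow]
    rw [← mul_conj']
    linear_combination (I * (y j (circleMap 0 1 θ) * conj (y j (circleMap 0 1 θ)))) * h1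
  simp only [h3, ← Finset.mul_sum, ← ofReal_sum] at h
  have h4 := ofReal_eq_zero.1 ((mul_eq_zero.1 h).resolve_left I_ne_zero)
  have hnn : ∀ j, 0 ≤ ∫ θ in 0..2 * π, ‖y j (circleMap 0 1 θ)‖ ^ 2 := fun j =>
    intervalIntegral.integral_nonneg (by positivity) fun θ _ => by positivity
  have h5 := (Finset.sum_eq_zero_iff_of_nonneg fun j _ => hnn j).1 h4 i (Finset.mem_univ i)
  refine eqOn_zero_of_eqOn_sphere hr0.le hr1 hR (hy i) (fun v hv => ?_) hw
  have h6 : ∀ θ ∈ Icc 0 (2 * π), y i (circleMap 0 1 θ) = 0 := by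
    by_contra! hcon
    obtain ⟨θ, hθ, hne⟩ := hcon
    have := intervalIntegral.integral_pos (f := fun θ => ‖y i (circleMap 0 1 θ)‖ ^ 2)
      (a := 0) (b := 2 * π) (by positivity) ((hyc i).norm.pow 2).continuousOn
      (fun x _ => by positivity) ⟨θ, hθ, by positivity⟩
    exact this.ne' h5
  have hv' : v ∈ circleMap 0 1 '' Ioc 0 (2 * π) := by
    rw [image_circleMap_Ioc]
    simpa using hv
  obtain ⟨θ, hθ, rfl⟩ := hv'
  exact h6 θ ⟨hθ.1.le, hθ.2⟩

theorem differentiableOn_comp_of_reg {R : ℝ} (hR : R ≤ ρ⁻¹) {F : ℂ → ℂ}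
    (hF : DifferentiableOn ℂ F (reg K ρ ψ R)) (j : J) :
    DifferentiableOn ℂ (fun w => σ j w * F (ψ j w)) (annulus ρ R) :=
  ((hσ.diff j).mono (annulus_mono le_rfl hR)).mul
    (hF.comp ((hC.diff j).mono (annulus_mono le_rfl hR)) fun _ hw => mem_reg_of_mem hw.1 hw.2)

/-- The part of a density left after subtracting its Cauchy transform is annihilated by the
Cauchy transform. -/
theorem cauchyTransform_sub_cauchyTransform {g : J → ℂ → ℂ} {r R R' t : ℝ} (hr : ρ ≤ r)
    (hR : R < R') (hR' : R' ≤ ρ⁻¹) (hg : ∀ j, DifferentiableOn ℂ (g j) (annulus r R'))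
    (hrt : r < t) (htR : t < R) {z : ℂ} (hz : z ∈ reg K ρ ψ t) :
    cauchyTransform ψ σ (fun j w => g j w - σ j w * cauchyTransform ψ σ g R (ψ j w)) t z = 0 := by
  have hρt := hr.trans_lt hrt
  have hρR := hρt.trans htR
  have hRρ := hR.trans_le hR'
  have hcont : ∀ s, r < s → s < R' → ∀ j, ContinuousOn (g j) (sphere 0 s) := fun s h1 h2 j =>
    (hg j).continuousOn.mono (sphere_subset_annulus h1 h2)
  have hd := hC.differentiableOn_cauchyTransform hσ hρR hRρ (hcont R (hrt.trans htR) hR)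
  rw [hC.cauchyTransform_sub hσ hρt (htR.trans hRρ) (hcont t hrt (htR.trans hR)) (fun j =>
    (hC.differentiableOn_comp_of_reg hσ hRρ.le hd j).continuousOn.mono
      (sphere_subset_annulus hρt htR)) hz, hC.cauchyTransform_comp hσ hρt htR hRρ.le hd hz,
    hC.cauchyTransform_eq hσ hr hR' hg hrt htR.le hR hz, sub_self]

theorem exists_isSzegoPair {a : ℂ} (ha : a ∈ K) : ∃ R S M, IsSzegoPair K ρ ψ σ a R S M := by
  obtain ⟨r, hr, hr1⟩ := exists_between hC.lt_one
  obtain ⟨r₁, hrr, hr1'⟩ := exists_between hr1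
  have hr0 := hC.pos.trans hr
  have hr10 := hr0.trans hrr
  have hR1 : 1 < r₁⁻¹ := (one_lt_inv₀ hr10).2 hr1'
  have hRr : r₁⁻¹ < r⁻¹ := by gcongr
  have hrρ : r⁻¹ < ρ⁻¹ := by have := hC.pos; gcongr
  have hsub := hC.annulus_inv_subset hσ hr hr1
  have hsub1 : annulus r₁ r₁⁻¹ ⊆ annulus r r⁻¹ := annulus_mono hrr.le hRr.le
  have hrR : ρ < r₁⁻¹ := by linarith
  have hna : ∀ j, ∀ w ∈ annulus ρ ρ⁻¹, ψ j w - a ≠ 0 := fun j w hw h =>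
    hC.notMem j w hw (by rw [sub_eq_zero.1 h]; exact ha)
  have hℓ : ∀ j, DifferentiableOn ℂ (fun w => σ j w * (ψ j w - a)⁻¹) (annulus ρ ρ⁻¹) := fun j =>
    (hσ.diff j).mul (((hC.diff j).sub_const a).inv (hna j))
  obtain ⟨g, hg, hgeq⟩ := hC.exists_reflect_eq hσ hr hr1 fun j => (hℓ j).mono hsub
  have hg' : ∀ j, DifferentiableOn ℂ (reflect (g j)) (annulus r r⁻¹) := fun j =>
    differentiableOn_reflect hr0 (hg j)
  have hRs := sphere_subset_annulus (hrr.trans (hr1'.trans hR1)) hRr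
  set S := cauchyTransform ψ σ g r₁⁻¹ with hS
  set M := cauchyTransform ψ σ (fun j => reflect (g j)) r₁⁻¹ with hM
  have hSd : DifferentiableOn ℂ S (reg K ρ ψ r₁⁻¹) :=
    hC.differentiableOn_cauchyTransform hσ hrR (hRr.trans hrρ)
      fun j => (hg j).continuousOn.mono hRs
  have hMd : DifferentiableOn ℂ M (reg K ρ ψ r₁⁻¹) :=
    hC.differentiableOn_cauchyTransform hσ hrR (hRr.trans hrρ)
      fun j => (hg' j).continuousOn.mono hRs
  let y : J → ℂ → ℂ := fun j w => g j w - σ j w * S (ψ j w)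
  have hcomp : ∀ {F : ℂ → ℂ}, DifferentiableOn ℂ F (reg K ρ ψ r₁⁻¹) → ∀ j,
      DifferentiableOn ℂ (fun w => σ j w * F (ψ j w)) (annulus r₁ r₁⁻¹) := fun hF j =>
    (hC.differentiableOn_comp_of_reg hσ (hRr.trans hrρ).le hF j).mono
      (annulus_mono (hr.trans hrr).le le_rfl)
  have hy : ∀ j, DifferentiableOn ℂ (y j) (annulus r₁ r₁⁻¹) := fun j =>
    ((hg j).mono hsub1).sub (hcomp hSd j)
  have hyeq : ∀ j, ∀ w ∈ annulus r₁ r₁⁻¹, y j w = reflect (fun v => σ j v * (ψ j v - a)⁻¹ -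
      (reflect (g j) v - σ j v * M (ψ j v))) w := by
    intro j w hw
    have h0 := ne_zero_of_mem_annulus hr10.le hw
    have h1 := hgeq j w (hsub1 hw)
    have hw' := inv_conj_mem_annulus hr10 hw
    rw [hC.regularOp_eq hσ hr hr1 hR1.le hRr hg j (hrr.trans hw.1) hw.2] at h1
    have h2 : reflect (regularOp ψ σ r (fun j => reflect (g j)) j) w =
        reflect (fun v => σ j v * M (ψ j v)) w -
          reflect (fun v => (2 * π * I)⁻¹ * ∮ ξ in C(0, r₁⁻¹), reflect (g j) ξ / (ξ - v)) w := by
      simp only [reflect]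
      rw [hC.regularOp_eq hσ hr hr1 hR1.le hRr hg' j (hrr.trans hw'.1) hw'.2, map_sub, mul_sub]
      simp only [hM, reflect]
    rw [h2, reflect_cauchy (g j) hr10 hw] at h1
    have h3 := circleIntegral_div_sub_annulus hr0.le (hg j) hrr hw.1 hw.2 hRr
    have h4 : reflect (fun v => σ j v * (ψ j v - a)⁻¹ - (reflect (g j) v - σ j v * M (ψ j v))) w =
        reflect (fun v => σ j v * (ψ j v - a)⁻¹) w - (g j w - reflect (fun v => σ j v * M (ψ j v)) w) := by
      rw [← reflect_reflect (g j) h0]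
      simp only [reflect, map_sub, mul_sub]
    rw [h4]
    simp only [y, ← hS] at h1 ⊢
    have h5 : (2 * π * I)⁻¹ * ((∮ ξ in C(0, r₁⁻¹), g j ξ / (ξ - w)) -
        ∮ ξ in C(0, r₁), g j ξ / (ξ - w)) = g j w := by
      rw [h3, ← mul_assoc, inv_mul_cancel₀ two_pi_I_ne_zero, one_mul]
    linear_combination h1 - h5
  have hyz : ∀ j, ∀ w ∈ annulus r₁ r₁⁻¹, y j w = 0 := by
    intro i w hw
    refine hC.eq_zero_of_cauchyTransform hσ (hr.trans hrr) hr1' hy (fun t ht1 ht2 j w hw => ?_)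
      (fun t ht1 ht2 j w hw => ?_) i hw
    · exact hC.cauchyTransform_sub_cauchyTransform hσ hr.le hRr hrρ.le hg (hrr.trans ht1) ht2
        (mem_reg_of_mem ((hr.trans hrr).trans hw.1) hw.2)
    · have hwm : ψ j w ∈ reg K ρ ψ t := mem_reg_of_mem ((hr.trans hrr).trans hw.1) hw.2
      have hwρ : w ∈ annulus ρ ρ⁻¹ := ⟨(hr.trans hrr).trans hw.1, by linarith [hw.2]⟩
      have hρt : ρ < t := by linarith
      have htρ : t < ρ⁻¹ := by linarith
      have hs := sphere_subset_annulus ht1 ht2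
      have e : cauchyTransform ψ σ (fun j => reflect (y j)) t (ψ j w) =
          cauchyTransform ψ σ (fun j v => σ j v * (ψ j v - a)⁻¹ -
            (reflect (g j) v - σ j v * M (ψ j v))) t (ψ j w) := by
        unfold cauchyTransform
        congr 1
        refine Finset.sum_congr rfl fun k _ => circleIntegral.integral_congr (by linarith)
          fun v hv => ?_
        have : reflect (y k) v = σ k v * (ψ k v - a)⁻¹ - (reflect (g k) v - σ k v * M (ψ k v)) := by
          have h1 := hyeq k _ (inv_conj_mem_annulus hr10 (hs hv))
          rw [reflect, h1]
          exact reflect_reflect (fun v => σ k v * (ψ k v - a)⁻¹ -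
            (reflect (g k) v - σ k v * M (ψ k v))) (ne_zero_of_mem_annulus hr10.le (hs hv))
        simp only [this]
      rw [e, hC.cauchyTransform_sub hσ hρt htρ
        (h := fun k v => reflect (g k) v - σ k v * M (ψ k v))
        (fun k => (hℓ k).continuousOn.mono (sphere_subset_annulus hρt htρ))
        (fun k => (((hg' k).mono hsub1).sub (hcomp hMd k)).continuousOn.mono hs) hwm,
        hC.cauchyTransform_pole hσ hρt htρ (Or.inl ha) hwm (sub_ne_zero.1 (hna j w hwρ)),
        hC.cauchyTransform_sub_cauchyTransform hσ hr.le hRr hrρ.le hg' (hrr.trans ht1) ht2 hwm,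
        sub_zero]
  refine ⟨r₁⁻¹, S, M, hR1, hRr.trans hrρ, hSd, hMd, fun j w hw => ?_⟩
  rw [inv_inv] at hw
  have hw' := inv_conj_mem_annulus hr10 hw
  have h1 : reflect (fun v => σ j v * S (ψ j v)) w = reflect (g j) w := by
    rw [reflect, reflect, sub_eq_zero.1 (hyz j _ hw')]
  have h2 := hyeq j _ hw'
  rw [hyz j _ hw'] at h2
  have h3 := reflect_reflect (fun v => σ j v * (ψ j v - a)⁻¹ -
      (reflect (g j) v - σ j v * M (ψ j v))) (ne_zero_of_mem_annulus hr10.le hw)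
  rw [reflect, ← h2, map_zero, mul_zero] at h3
  rw [h1]
  linear_combination h3

theorem continuousOn_comp_sphere {t : ℝ} (h1 : 1 < t) (ht : t ≤ ρ⁻¹) {F : ℂ → ℂ}
    (hF : DifferentiableOn ℂ F (reg K ρ ψ t)) (j : J) :
    ContinuousOn (fun w => σ j w * F (ψ j w)) (sphere 0 1) :=
  (hC.differentiableOn_comp_of_reg hσ ht hF j).continuousOn.mono
    (sphere_subset_annulus hC.lt_one h1)

/-- The Cauchy formula for `F` at `a`, in terms of the Garabedian kernel. -/
theorem sum_circleIntegral_garabedian {t : ℝ} (h1 : 1 < t) (ht : t ≤ ρ⁻¹) {F G : ℂ → ℂ} {a : ℂ}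
    (ha : a ∈ K) (hF : DifferentiableOn ℂ F (reg K ρ ψ t)) (hG : DifferentiableOn ℂ G (reg K ρ ψ t)) :
    ∑ j, ∮ w in C(0, 1), σ j w * F (ψ j w) * (σ j w * (ψ j w - a)⁻¹) +
      G (ψ j w) * deriv (ψ j) w = 2 * π * I * F a := by
  have h := hC.cauchyTransform_comp hσ hC.lt_one h1 ht hF (z := a) (Or.inl ha)
  have h2 := hC.cauchy 1 t hC.lt_one h1 ht G hG
  rw [cauchyTransform, inv_mul_eq_iff_eq_mul₀ two_pi_I_ne_zero] at h
  refine Eq.trans ?_ ((congrArg₂ (· + ·) h h2).trans (add_zero _))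
  rw [← Finset.sum_add_distrib]
  have hs := sphere_subset_annulus hC.lt_one hC.one_lt
  refine Finset.sum_congr rfl fun j _ => ?_
  rw [← circleIntegral.integral_add]
  · refine circleIntegral.integral_congr zero_le_one fun w _ => ?_
    rw [← mul_assoc, div_eq_mul_inv]
  · refine ContinuousOn.circleIntegrable zero_le_one (ContinuousOn.div
      ((hC.continuousOn_comp_sphere hσ h1 ht hF j).mul ((hσ.diff j).continuousOn.mono hs))
      (((hC.diff j).continuousOn.mono hs).sub continuousOn_const) fun w hw h => ?_)
    exact hC.notMem j w (hs hw) (by rwa [sub_eq_zero.1 h])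
  · refine ContinuousOn.circleIntegrable zero_le_one (ContinuousOn.mul ?_
      ((hC.differentiableOn_deriv j).continuousOn.mono hs))
    exact (hG.continuousOn.comp ((hC.diff j).continuousOn.mono hs) fun w hw =>
      mem_reg_of_mem (hs hw).1 ((mem_sphere_zero_iff_norm.1 hw).trans_lt h1))

theorem halfDensity_ne_zero {j : J} {w : ℂ} (h : w ∈ annulus ρ ρ⁻¹) : σ j w ≠ 0 := fun h0 =>
  hC.deriv_ne j w h (by rw [← hσ.sq j w h, h0]; simp)

variable (hw : ∀ t, ρ < t → t < ρ⁻¹ → ∑ j, (1 + wind (σ j) t) = 1)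
  {a : ℂ} {R : ℝ} {S M : ℂ → ℂ} (hp : IsSzegoPair K ρ ψ σ a R S M) (ha : a ∈ K)
include hp

omit [Fintype J] hC hσ in
theorem conj_mul_szego {j : J} {w : ℂ} (hw : w ∈ sphere (0 : ℂ) 1) :
    conj w * conj (σ j w * S (ψ j w)) = σ j w * ((ψ j w - a)⁻¹ + M (ψ j w)) := by
  have hR : R⁻¹ < 1 := inv_lt_one_of_one_lt₀ hp.one_lt
  rw [← hp.reflect_eq j w (sphere_subset_annulus hR hp.one_lt hw)]
  exact (reflect_of_mem_sphere (fun v => σ j v * S (ψ j v)) hw).symm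

include ha

theorem hardyInner_szego {t : ℝ} (h1 : 1 < t) (ht : t ≤ ρ⁻¹) {F : ℂ → ℂ}
    (hF : DifferentiableOn ℂ F (reg K ρ ψ t)) :
    hardyInner (fun j w => σ j w * F (ψ j w)) (fun j w => σ j w * S (ψ j w)) = F a := by
  have hs := sphere_subset_annulus hC.lt_one hC.one_lt
  have h := hC.sum_circleIntegral_garabedian hσ (t := min t R) (lt_min h1 hp.one_lt)
    ((min_le_left _ _).trans ht) ha (hF.mono (reg_mono _ _ _ (min_le_left _ _)))
    ((hF.mono (reg_mono _ _ _ (min_le_left _ _))).mul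
      (hp.diff'.mono (reg_mono _ _ _ (min_le_right _ _))))
  have h2 : ∀ j, (∮ w in C(0, 1), σ j w * F (ψ j w) * (σ j w * (ψ j w - a)⁻¹) +
      (F * M) (ψ j w) * deriv (ψ j) w) = I * ∫ θ in (0 : ℝ)..2 * π,
      σ j (circleMap 0 1 θ) * F (ψ j (circleMap 0 1 θ)) *
        conj (σ j (circleMap 0 1 θ) * S (ψ j (circleMap 0 1 θ))) := by
    intro j
    rw [circleIntegral, ← intervalIntegral.integral_const_mul]
    refine intervalIntegral.integral_congr fun θ _ => ?_
    have hw : circleMap 0 1 θ ∈ sphere (0 : ℂ) 1 := circleMap_mem_sphere 0 zero_le_one θ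
    have e := conj_mul_szego hp (j := j) hw
    have e2 : circleMap 0 1 θ * conj (circleMap 0 1 θ) = 1 := by
      rw [mul_conj, normSq_eq_norm_sq, mem_sphere_zero_iff_norm.1 hw]
      simp
    simp only [deriv_circleMap, smul_eq_mul, Pi.mul_apply]
    rw [← hσ.sq j _ (hs hw)]
    generalize circleMap 0 1 θ = w at *
    linear_combination (-(w * I * (σ j w * F (ψ j w)))) * e +
      (I * (σ j w * F (ψ j w)) * conj (σ j w * S (ψ j w))) * e2
  simp only [h2, ← Finset.mul_sum] at h
  unfold hardyInner
  have h3 := Real.pi_ne_zero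
  rw [inv_mul_eq_iff_eq_mul₀ (by simp [h3])]
  exact mul_left_cancel₀ I_ne_zero (h.trans (by ring))

theorem hardyInner_szego_self :
    hardyInner (fun j w => σ j w * S (ψ j w)) (fun j w => σ j w * S (ψ j w)) = S a :=
  hC.hardyInner_szego hσ hp ha hp.one_lt hp.lt.le hp.diff

theorem szego_im : (S a).im = 0 := by
  rw [← hC.hardyInner_szego_self hσ hp ha, hardyInner_self_im]

theorem szego_re_pos : 0 < (S a).re := by
  have hn : 0 ≤ (S a).re := by
    rw [← hC.hardyInner_szego_self hσ hp ha]
    exact hardyInner_self_re_nonneg _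
  refine hn.lt_of_ne' fun h0 => ?_
  have hd : DifferentiableOn ℂ (fun _ : ℂ => (1 : ℂ)) (reg K ρ ψ R) := differentiableOn_const 1
  have key := fun c : ℝ => hardyInner_sub_smul_self
    (hC.continuousOn_comp_sphere hσ hp.one_lt hp.lt.le hd)
    (hC.continuousOn_comp_sphere hσ hp.one_lt hp.lt.le hp.diff) (c : ℂ)
  rw [hC.hardyInner_szego hσ hp ha hp.one_lt hp.lt.le hd, hC.hardyInner_szego_self hσ hp ha] at key
  set A := (hardyInner (fun j w => σ j w * 1) fun j w => σ j w * (1 : ℂ)).re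
  have := key (A + 1)
  have h2 := key 0
  simp [h0] at this h2
  linarith

/-- The Cauchy-Schwarz inequality for the evaluation at `a`. -/
theorem norm_sq_le {t : ℝ} (h1 : 1 < t) (ht : t ≤ ρ⁻¹) {F : ℂ → ℂ}
    (hF : DifferentiableOn ℂ F (reg K ρ ψ t)) :
    ‖F a‖ ^ 2 ≤ (S a).re *
      (hardyInner (fun j w => σ j w * F (ψ j w)) (fun j w => σ j w * F (ψ j w))).re := by
  have hpos := hC.szego_re_pos hσ hp ha
  have key := hardyInner_sub_smul_self
    (hC.continuousOn_comp_sphere hσ h1 ht hF)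
    (hC.continuousOn_comp_sphere hσ hp.one_lt hp.lt.le hp.diff) (F a / (S a).re)
  rw [hC.hardyInner_szego hσ hp ha h1 ht hF, hC.hardyInner_szego_self hσ hp ha] at key
  have e : (conj (F a / (S a).re) * F a).re = ‖F a‖ ^ 2 / (S a).re := by
    rw [map_div₀, conj_ofReal, div_mul_eq_mul_div, ← normSq_eq_conj_mul_self, ← ofReal_div,
      ofReal_re, normSq_eq_norm_sq]
  rw [e, norm_div, norm_real, Real.norm_of_nonneg hpos.le] at key
  set A := (hardyInner (fun j w => σ j w * F (ψ j w)) fun j w => σ j w * F (ψ j w)).re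
  have : ‖F a‖ ^ 2 / (S a).re ≤ A := by
    have e2 : (‖F a‖ / (S a).re) ^ 2 * (S a).re = ‖F a‖ ^ 2 / (S a).re := by
      field_simp
    linarith
  rwa [div_le_iff₀ hpos, mul_comm] at this

/-- The Szegő kernel bounds the derivative at `a` of bounded functions. -/
theorem norm_deriv_le_szego {t : ℝ} (h1 : 1 < t) (ht : t ≤ ρ⁻¹) {g : ℂ → ℂ}
    (hg : DifferentiableOn ℂ g (reg K ρ ψ t)) (hg1 : ∀ z ∈ reg K ρ ψ t, ‖g z‖ ≤ 1) (hga : g a = 0) :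
    ‖deriv g a‖ ≤ (S a).re := by
  have hs := sphere_subset_annulus hC.lt_one hC.one_lt
  have hta : a ∈ reg K ρ ψ t := Or.inl ha
  have hq := differentiableOn_dslope_of_isOpen (hC.isOpen t (hC.lt_one.trans h1) ht) hg hta
  set h := dslope g a with hh
  have hl : t ⊓ R ≤ t := min_le_left _ _
  have hr : t ⊓ R ≤ R := min_le_right _ _
  have hM := hp.diff'.mono (reg_mono K ρ ψ hr)
  have hq' := hq.mono (reg_mono K ρ ψ hl)
  have hg' := hg.mono (reg_mono K ρ ψ hl)
  have h2 := hC.sum_circleIntegral_garabedian hσ (t := t ⊓ R) (lt_min h1 hp.one_lt)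
    (hl.trans ht) ha hq' (G := fun z => 2 * h z * M z + g z * M z ^ 2)
    (((hq'.const_mul 2).mul hM).add (hg'.mul (hM.pow 2)))
  have e : ∀ j, ∀ w ∈ sphere (0 : ℂ) 1, σ j w * h (ψ j w) * (σ j w * (ψ j w - a)⁻¹) +
      (2 * h (ψ j w) * M (ψ j w) + g (ψ j w) * M (ψ j w) ^ 2) * deriv (ψ j) w =
      g (ψ j w) * (conj w * conj (σ j w * S (ψ j w))) ^ 2 := by
    intro j w hw
    have hne : ψ j w - a ≠ 0 := fun h => hC.notMem j w (hs hw) (by rwa [sub_eq_zero.1 h])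
    have hgh : g (ψ j w) = (ψ j w - a) * h (ψ j w) := by
      have := sub_smul_dslope g a (ψ j w)
      rw [hga, sub_zero] at this
      exact this.symm
    rw [conj_mul_szego hp hw, ← hσ.sq j _ (hs hw), hgh]
    field_simp
    ring
  have h3 : ∀ j, ‖∮ w in C(0, 1), σ j w * h (ψ j w) * (σ j w * (ψ j w - a)⁻¹) +
      (2 * h (ψ j w) * M (ψ j w) + g (ψ j w) * M (ψ j w) ^ 2) * deriv (ψ j) w‖ ≤
      ∫ θ in (0 : ℝ)..2 * π, ‖σ j (circleMap 0 1 θ) * S (ψ j (circleMap 0 1 θ))‖ ^ 2 := by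
    intro j
    rw [circleIntegral.integral_congr zero_le_one (e j), circleIntegral]
    have hc := continuous_comp_circleMap (hC.continuousOn_comp_sphere hσ hp.one_lt hp.lt.le hp.diff j)
    refine intervalIntegral.norm_integral_le_of_norm_le (by positivity) ?_
      ((hc.norm.pow 2).intervalIntegrable _ _)
    refine Eventually.of_forall fun θ _ => ?_
    have hw : circleMap 0 1 θ ∈ sphere (0 : ℂ) 1 := circleMap_mem_sphere 0 zero_le_one θ
    have hw1 := mem_sphere_zero_iff_norm.1 hw
    have := hg1 (ψ j (circleMap 0 1 θ)) (mem_reg_of_mem (hs hw).1 (hw1.trans_lt h1))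
    simp only [deriv_circleMap, norm_smul, norm_mul, norm_pow, RCLike.norm_conj, hw1, norm_I, one_mul]
    exact mul_le_of_le_one_left (by positivity) this
  have hda : h a = deriv g a := dslope_same g a
  have h4 : ‖2 * π * I * h a‖ ≤ 2 * π * (S a).re := by
    rw [← h2]
    refine (norm_sum_le _ _).trans ((Finset.sum_le_sum fun j _ => h3 j).trans_eq ?_)
    rw [← hC.hardyInner_szego_self hσ hp ha, hardyInner_self, ofReal_re, mul_inv_cancel_left₀]
    have := Real.pi_ne_zero
    positivity
  have h5 : ‖(2 * π * I : ℂ)‖ = 2 * π := by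
    simp [abs_of_pos Real.pi_pos]
  rw [norm_mul, h5, hda] at h4
  exact le_of_mul_le_mul_left h4 (by positivity)

theorem szego_symm {b : ℂ} {R' : ℝ} {S' M' : ℂ → ℂ} (hp' : IsSzegoPair K ρ ψ σ b R' S' M')
    (hb : b ∈ K) : S b = conj (S' a) := by
  rw [← hC.hardyInner_szego hσ hp' hb hp.one_lt hp.lt.le hp.diff,
    ← hC.hardyInner_szego hσ hp ha hp'.one_lt hp'.lt.le hp'.diff, conj_hardyInner]

theorem norm_szego_sq_le {b : ℂ} {R' : ℝ} {S' M' : ℂ → ℂ} (hp' : IsSzegoPair K ρ ψ σ b R' S' M')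
    (hb : b ∈ K) : ‖S b‖ ^ 2 ≤ (S a).re * (S' b).re := by
  have := hC.norm_sq_le hσ hp' hb hp.one_lt hp.lt.le hp.diff
  rwa [hC.hardyInner_szego_self hσ hp ha, mul_comm] at this

/-- The densities of the Szegő and Garabedian kernels in a common annulus, exchanged by
reflection. -/
theorem exists_density : ∃ r, ρ < r ∧ r < 1 ∧ r⁻¹ ≤ R ∧ ∃ x y : J → ℂ → ℂ,
    (∀ j, DifferentiableOn ℂ (x j) (annulus r r⁻¹)) ∧
    (∀ j, DifferentiableOn ℂ (y j) (annulus r r⁻¹)) ∧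
    (∀ j, ∀ w ∈ annulus r r⁻¹, reflect (x j) w = y j w ∧ reflect (y j) w = x j w) ∧
    (∀ j w, x j w = σ j w * S (ψ j w)) ∧
    (∀ j, ∀ w ∈ annulus r r⁻¹, y j w * (ψ j w - a) = σ j w * (1 + (ψ j w - a) * M (ψ j w))) := by
  have hR0 : 0 < R := one_pos.trans hp.one_lt
  have hρR : ρ < R⁻¹ := (lt_inv_comm₀ hC.pos hR0).2 hp.lt
  have hR1 : R⁻¹ < 1 := inv_lt_one_of_one_lt₀ hp.one_lt
  have hx : ∀ j, DifferentiableOn ℂ (fun w => σ j w * S (ψ j w)) (annulus R⁻¹ R⁻¹⁻¹) := fun j => by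
    rw [inv_inv]
    exact (hC.differentiableOn_comp_of_reg hσ hp.lt.le hp.diff j).mono
      (annulus_mono hρR.le le_rfl)
  refine ⟨R⁻¹, hρR, hR1, (inv_inv R).le, fun j w => σ j w * S (ψ j w),
    fun j => reflect (fun w => σ j w * S (ψ j w)), hx, fun j =>
    differentiableOn_reflect (inv_pos.2 hR0) (hx j), fun j w hw => ⟨rfl, reflect_reflect _
      (ne_zero_of_mem_annulus (inv_pos.2 hR0).le hw)⟩, fun j w => rfl, fun j w hw => ?_⟩
  rw [inv_inv] at hw
  have h := hp.reflect_eq j w hw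
  have hne : ψ j w - a ≠ 0 := fun h' => hC.notMem j w ⟨hρR.trans hw.1, hw.2.trans hp.lt⟩
    (by rwa [sub_eq_zero.1 h'])
  simp only [h]
  field_simp

include hw

theorem garabedian_sub_ne_zero {c : ℂ} (hc : ‖c‖ = 1) {z : ℂ} (hz : z ∈ reg K ρ ψ 1) :
    (z - a) * S z - c * (1 + (z - a) * M z) ≠ 0 := by
  set Q : ℂ → ℂ := fun z => (z - a) * S z - c * (1 + (z - a) * M z) with hQdef
  have hQ : DifferentiableOn ℂ Q (reg K ρ ψ R) :=
    ((differentiableOn_id.sub_const a).mul hp.diff).sub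
      ((((differentiableOn_id.sub_const a).mul hp.diff').const_add 1).const_mul c)
  have hc0 : c ≠ 0 := fun h => by simp [h] at hc
  obtain ⟨Z, u, hZ, hu, hu1, hQu, hev⟩ := hC.exists_zeros hp.one_lt hp.lt.le hQ
    ⟨a, Or.inl ha, by simp [hQdef, hc0]⟩
  obtain ⟨r, hr, hr1, hrR, x, y, hx, hy, hxy, hxS, hyM⟩ := hC.exists_density hσ hp ha
  obtain ⟨t, ⟨hQt, hcount⟩, htr, ht1⟩ := (hev.and (Ioo_mem_nhdsLT hr1)).exists
  have hr0 := hC.pos.trans hr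
  have ht0 := hr0.trans htr
  have htr' : t < r⁻¹ := ht1.trans ((one_lt_inv₀ hr0).2 hr1)
  have htρ : ρ < t := hr.trans htr
  have htρ' : t < ρ⁻¹ := ht1.trans hC.one_lt
  have hrρ : annulus r r⁻¹ ⊆ annulus ρ ρ⁻¹ :=
    annulus_mono hr.le (hrR.trans hp.lt.le)
  have hs := sphere_subset_annulus htr htr'
  have hq : ∀ j, DifferentiableOn ℂ (fun w => x j w - c * y j w) (annulus r r⁻¹) := fun j =>
    (hx j).sub ((hy j).const_mul c)
  have hqQ : ∀ j, ∀ w ∈ annulus r r⁻¹, (x j w - c * y j w) * (ψ j w - a) = σ j w * Q (ψ j w) := by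
    intro j w hw
    have := hyM j w hw
    rw [hxS]
    simp only [hQdef]
    linear_combination (-c) * this
  have hq0 : ∀ j, ∀ w ∈ sphere (0 : ℂ) t, x j w - c * y j w ≠ 0 := by
    intro j w hw h
    have := hqQ j w (hs hw)
    rw [h, zero_mul] at this
    exact mul_ne_zero (hC.halfDensity_ne_zero hσ (hrρ (hs hw))) (hQt j w hw) this.symm
  have hwind : ∀ j, ∃ n : ℕ, wind (fun w => x j w - c * y j w) t = -1 - n := by
    intro j
    have hcc : -conj c ≠ 0 := by simpa using hc0
    have htr2 : r < t⁻¹ := (lt_inv_comm₀ ht0 hr0).1 htr'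
    have htr3 : t⁻¹ < r⁻¹ := by gcongr
    have ht1' : 1 < t⁻¹ := (one_lt_inv₀ ht0).2 ht1
    obtain ⟨h1, h2⟩ := wind_reflect hr0 (hq j) (t := t⁻¹) htr2 htr3 (by
      rw [inv_inv]
      exact hq0 j)
    have he : EqOn (reflect fun w => x j w - c * y j w)
        (fun w => -conj c * (x j w - c * y j w)) (annulus r r⁻¹) := fun w hw =>
      reflect_sub_const_mul hc (hxy j w hw).1 (hxy j w hw).2
    rw [wind_congr hr0.le htr2 htr3 he, wind_const_mul _ hcc, inv_inv] at h2
    have h3 : ∀ w ∈ sphere (0 : ℂ) t⁻¹, x j w - c * y j w ≠ 0 := fun w hw h => by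
      refine h1 w hw ?_
      rw [he (sphere_subset_annulus htr2 htr3 hw)]
      simp only [h, mul_zero]
    obtain ⟨N, hN⟩ := exists_wind_eq_add hr0.le (hq j) htr (by linarith : t ≤ t⁻¹) htr3 (hq0 j) h3
    obtain ⟨n, hn⟩ := exists_int_wind hr0.le (hq j) htr htr' (hq0 j)
    rw [hn] at hN h2 ⊢
    rw [hN] at h2
    have h4 : n + N = -1 - n := by exact_mod_cast h2
    have h5 : n ≤ -1 := by omega
    obtain ⟨k, hk⟩ := Int.eq_ofNat_of_zero_le (show 0 ≤ -1 - n by omega)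
    refine ⟨k, ?_⟩
    have : n = -1 - (k : ℤ) := by omega
    rw [this]
    push_cast
    ring
  choose n hn using hwind
  have hsum : ∀ j, wind (fun w => Q (ψ j w)) t =
      (-1 - n j) + wind (fun w => ψ j w - a) t - wind (σ j) t := by
    intro j
    have hψa : ∀ w ∈ sphere (0 : ℂ) t, ψ j w - a ≠ 0 := fun w hw =>
      hC.sub_ne_zero_of_mem_sphere htρ htρ' (Or.inl ha) j hw
    have h1 := wind_mul hr0.le (hq j) htr htr' (hq0 j) (g := fun w => ψ j w - a)
      (((hC.diff j).mono hrρ).sub_const a) hψa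
    have hQd : DifferentiableOn ℂ (fun w => Q (ψ j w)) (annulus r r⁻¹) :=
      hQ.comp ((hC.diff j).mono hrρ) fun w hw => mem_reg_of_mem (hrρ hw).1 (hw.2.trans_le hrR)
    have h2 := wind_mul hr0.le ((hσ.diff j).mono hrρ) htr htr' (fun w hw =>
      hC.halfDensity_ne_zero hσ (hrρ (hs hw))) hQd (hQt j)
    rw [wind_congr hr0.le htr htr' (hqQ j), h2, hn] at h1
    linear_combination h1
  have h1 := hC.sum_wind_sub htρ htρ' (Or.inl ha)
  have h2 := hw t htρ htρ'
  simp only [hsum, Finset.sum_sub_distrib, Finset.sum_add_distrib, h1] at hcount h2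
  have h3 : (Z.card : ℂ) + ∑ j, (n j : ℂ) = 0 := by
    simp only [Finset.sum_neg_distrib] at hcount
    linear_combination -hcount - h2
  have h4 : Z.card = 0 := by
    have : Z.card + ∑ j, n j = 0 := by exact_mod_cast h3
    omega
  rw [Multiset.card_eq_zero] at h4
  have h5 := hQu z (reg_mono K ρ ψ hp.one_lt.le hz)
  rw [h4] at h5
  change Q z ≠ 0
  rw [h5]
  simpa using hu1 z hz

theorem norm_szego_lt {z : ℂ} (hz : z ∈ reg K ρ ψ 1) :
    ‖(z - a) * S z‖ < ‖1 + (z - a) * M z‖ := by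
  have hsub := reg_mono K ρ ψ hp.one_lt.le
  have hne : ∀ z ∈ reg K ρ ψ 1, ‖1 + (z - a) * M z‖ - ‖(z - a) * S z‖ ≠ 0 := by
    intro z hz h
    by_cases hD : 1 + (z - a) * M z = 0
    · refine hC.garabedian_sub_ne_zero hσ hw hp ha (c := 1) (by simp) hz ?_
      rw [hD, norm_zero, zero_sub, neg_eq_zero, norm_eq_zero] at h
      rw [hD, h]
      simp
    · refine hC.garabedian_sub_ne_zero hσ hw hp ha
        (c := (z - a) * S z / (1 + (z - a) * M z)) ?_ hz ?_
      · rw [norm_div, ← sub_eq_zero.1 h, div_self (norm_ne_zero_iff.2 hD)]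
      · rw [div_mul_cancel₀ _ hD, sub_self]
  have hcont : ContinuousOn (fun z => ‖1 + (z - a) * M z‖ - ‖(z - a) * S z‖) (reg K ρ ψ 1) := by
    have h1 := (hp.diff.mono hsub).continuousOn
    have h2 := (hp.diff'.mono hsub).continuousOn
    have h3 : ContinuousOn (fun z : ℂ => z - a) (reg K ρ ψ 1) := by fun_prop
    exact (continuousOn_const.add (h3.mul h2)).norm.sub (h3.mul h1).norm
  by_contra hle
  obtain ⟨v, hv, h0⟩ := (hC.preconn 1 hC.lt_one hC.one_lt.le).intermediate_value hz
    (Or.inl ha : a ∈ reg K ρ ψ 1) hcont (show (0 : ℝ) ∈ Icc _ _ from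
      ⟨by simpa using sub_nonpos.2 (not_lt.1 hle), by simp⟩)
  exact hne v hv h0

theorem garabedian_ne_zero {z : ℂ} (hz : z ∈ reg K ρ ψ 1) : 1 + (z - a) * M z ≠ 0 :=
  norm_pos_iff.1 ((norm_nonneg _).trans_lt (hC.norm_szego_lt hσ hw hp ha hz))

/-- The Szegő kernel has fewer zeros than there are boundary curves. -/
theorem exists_zeros_szego : ∃ (Z : Multiset ℂ) (u : ℂ → ℂ), Z.card < Fintype.card J ∧
    (∀ b ∈ Z, b ∈ reg K ρ ψ 1) ∧ DifferentiableOn ℂ u (reg K ρ ψ R) ∧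
    (∀ z ∈ reg K ρ ψ 1, u z ≠ 0) ∧
    ∀ z ∈ reg K ρ ψ R, S z = (Z.map fun b => z - b).prod * u z := by
  have hSa : S a ≠ 0 := fun h => by
    have := hC.szego_re_pos hσ hp ha
    simp [h] at this
  have hdD : DifferentiableOn ℂ (fun z => 1 + (z - a) * M z) (reg K ρ ψ R) :=
    ((differentiableOn_id.sub_const a).mul hp.diff').const_add 1
  obtain ⟨Z, u, hZ, hu, hu1, hSu, hevS⟩ := hC.exists_zeros hp.one_lt hp.lt.le hp.diff
    ⟨a, Or.inl ha, hSa⟩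
  obtain ⟨Z', u', hZ', -, -, -, hevD⟩ := hC.exists_zeros hp.one_lt hp.lt.le hdD
    ⟨a, Or.inl ha, by simp⟩
  have hZ0 : Z' = 0 := by
    refine Multiset.eq_zero_of_forall_notMem fun b hb => ?_
    exact hC.garabedian_ne_zero hσ hw hp ha (hZ' b hb).1 (hZ' b hb).2
  refine ⟨Z, u, ?_, fun b hb => (hZ b hb).1, hu, hu1, hSu⟩
  obtain ⟨r, hr, hr1, hrR, x, y, hx, hy, hxy, hxS, hyM⟩ := hC.exists_density hσ hp ha
  obtain ⟨t, ⟨⟨hSt, hcS⟩, hDt, hcD⟩, htr, ht1⟩ :=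
    ((hevS.and hevD).and (Ioo_mem_nhdsLT hr1)).exists
  have hr0 := hC.pos.trans hr
  have ht0 := hr0.trans htr
  have ht1' : 1 < t⁻¹ := (one_lt_inv₀ ht0).2 ht1
  have htr' : t < r⁻¹ := ht1.trans ((one_lt_inv₀ hr0).2 hr1)
  have htr2 : r < t⁻¹ := (lt_inv_comm₀ ht0 hr0).1 htr'
  have htr3 : t⁻¹ < r⁻¹ := by gcongr
  have htρ : ρ < t := hr.trans htr
  have htρ' : t < ρ⁻¹ := ht1.trans hC.one_lt
  have hrρ : annulus r r⁻¹ ⊆ annulus ρ ρ⁻¹ :=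
    annulus_mono hr.le (hrR.trans hp.lt.le)
  have hs := sphere_subset_annulus htr htr'
  have hσ0 : ∀ j, ∀ w ∈ sphere (0 : ℂ) t, σ j w ≠ 0 := fun j w hw =>
    hC.halfDensity_ne_zero hσ (hrρ (hs hw))
  have hcomp : ∀ {F : ℂ → ℂ}, DifferentiableOn ℂ F (reg K ρ ψ R) → ∀ j,
      DifferentiableOn ℂ (fun w => F (ψ j w)) (annulus r r⁻¹) := fun hF j =>
    hF.comp ((hC.diff j).mono hrρ) fun w hw => mem_reg_of_mem (hrρ hw).1 (hw.2.trans_le hrR)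
  have hx0 : ∀ j, ∀ w ∈ sphere (0 : ℂ) t, x j w ≠ 0 := fun j w hw => by
    rw [hxS]
    exact mul_ne_zero (hσ0 j w hw) (hSt j w hw)
  have hy0 : ∀ j, ∀ w ∈ sphere (0 : ℂ) t, y j w ≠ 0 := fun j w hw h => by
    have := hyM j w (hs hw)
    rw [h, zero_mul] at this
    exact mul_ne_zero (hσ0 j w hw) (hDt j w hw) this.symm
  have hψa : ∀ j, ∀ w ∈ sphere (0 : ℂ) t, ψ j w - a ≠ 0 := fun j w hw =>
    hC.sub_ne_zero_of_mem_sphere htρ htρ' (Or.inl ha) j hw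
  have hwx : ∀ j, wind (x j) t = wind (σ j) t + wind (fun w => S (ψ j w)) t := fun j => by
    rw [← wind_mul hr0.le ((hσ.diff j).mono hrρ) htr htr' (hσ0 j) (hcomp hp.diff j) (hSt j)]
    exact wind_congr hr0.le htr htr' fun w _ => hxS j w
  have hwy : ∀ j, wind (y j) t = wind (σ j) t + wind (fun w => 1 + (ψ j w - a) * M (ψ j w)) t -
      wind (fun w => ψ j w - a) t := fun j => by
    rw [eq_sub_iff_add_eq, ← wind_mul hr0.le ((hσ.diff j).mono hrρ) htr htr' (hσ0 j)
      (hcomp hdD j) (hDt j), ← wind_mul hr0.le (hy j) htr htr' (hy0 j)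
      (((hC.diff j).mono hrρ).sub_const a) (hψa j)]
    exact wind_congr hr0.le htr htr' fun w hw => hyM j w hw
  have hN : ∀ j, ∃ N : ℕ, -1 - wind (y j) t = wind (x j) t + N := fun j => by
    obtain ⟨h1, h2⟩ := wind_reflect hr0 (hy j) (t := t⁻¹) htr2 htr3 (by
      rw [inv_inv]
      exact hy0 j)
    have he : EqOn (reflect (y j)) (x j) (annulus r r⁻¹) := fun w hw => (hxy j w hw).2
    rw [wind_congr hr0.le htr2 htr3 he, inv_inv] at h2
    rw [← h2]
    refine exists_wind_eq_add hr0.le (hx j) htr (by linarith) htr3 (hx0 j) fun w hw => ?_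
    rw [← he (sphere_subset_annulus htr2 htr3 hw)]
    exact h1 w hw
  choose N hN using hN
  have h1 := hC.sum_wind_sub htρ htρ' (Or.inl ha)
  have h2 := hw t htρ htρ'
  have h3 : ∑ j, (-1 - wind (y j) t) = ∑ j, (wind (x j) t + N j) :=
    Finset.sum_congr rfl fun j _ => hN j
  simp only [hwx, hwy, Finset.sum_sub_distrib, Finset.sum_add_distrib, h1, hcS, hcD, hZ0,
    Multiset.card_zero, Finset.sum_const, Finset.card_univ, nsmul_eq_mul] at h2 h3
  have h4 : ((Z.card + ∑ j, N j + 1 : ℕ) : ℂ) = (Fintype.card J : ℂ) := by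
    push_cast at h3 ⊢
    linear_combination -h3 - 2 * h2
  have h5 : Z.card + ∑ j, N j + 1 = Fintype.card J := by exact_mod_cast h4
  omega

theorem differentiableOn_szegoQuotient :
    DifferentiableOn ℂ (szegoQuotient a S M) (reg K ρ ψ 1) := by
  have hs := reg_mono K ρ ψ hp.one_lt.le
  exact ((differentiableOn_id.sub_const a).mul (hp.diff.mono hs)).div
    (((differentiableOn_id.sub_const a).mul (hp.diff'.mono hs)).const_add 1)
    fun z hz => hC.garabedian_ne_zero hσ hw hp ha hz

theorem norm_szegoQuotient_lt {z : ℂ} (hz : z ∈ reg K ρ ψ 1) : ‖szegoQuotient a S M z‖ < 1 := by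
  rw [szegoQuotient, norm_div, div_lt_one (norm_pos_iff.2 (hC.garabedian_ne_zero hσ hw hp ha hz))]
  exact hC.norm_szego_lt hσ hw hp ha hz

omit hσ hw in
theorem deriv_szegoQuotient : deriv (szegoQuotient a S M) a = S a := by
  have ho := hC.isOpen R (hC.lt_one.trans hp.one_lt) hp.lt.le
  have hn := ho.mem_nhds (show a ∈ reg K ρ ψ R from Or.inl ha)
  have h1 := ((hasDerivAt_id a).sub_const a).mul (hp.diff.differentiableAt hn).hasDerivAt
  have h2 := (((hasDerivAt_id a).sub_const a).mul
    (hp.diff'.differentiableAt hn).hasDerivAt).const_add 1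
  have h3 := h1.div h2 (by simp)
  refine (h3.congr_deriv ?_).deriv
  simp

theorem exists_le_norm_szegoQuotient {c : ℝ} (hc : c < 1) : ∃ t, ρ < t ∧ t < 1 ∧
    ∀ j w, t < ‖w‖ → ‖w‖ < 1 → c ≤ ‖szegoQuotient a S M (ψ j w)‖ := by
  have hSa : S a ≠ 0 := fun h => by
    have := hC.szego_re_pos hσ hp ha
    simp [h] at this
  obtain ⟨r, hr, hr1, hrR, x, y, hx, hy, hxy, hxS, hyM⟩ := hC.exists_density hσ hp ha
  have hr0 := hC.pos.trans hr
  obtain ⟨_, _, -, -, -, -, hev⟩ := hC.exists_zeros hp.one_lt hp.lt.le hp.diff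
    ⟨a, Or.inl ha, hSa⟩
  obtain ⟨s, ⟨hs, -⟩, hrs, hs1⟩ := (hev.and (Ioo_mem_nhdsLT hr1)).exists
  have hrρ : annulus r r⁻¹ ⊆ annulus ρ ρ⁻¹ := annulus_mono hr.le (hrR.trans hp.lt.le)
  have hsa := sphere_subset_annulus hrs (hs1.trans ((one_lt_inv₀ hr0).2 hr1))
  have hne : ∀ j, ∃ w ∈ annulus r r⁻¹, x j w ≠ 0 := fun j => by
    have hm : (s : ℂ) ∈ sphere (0 : ℂ) s := by
      simp [abs_of_pos (hr0.trans hrs)]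
    refine ⟨s, hsa hm, ?_⟩
    rw [hxS]
    exact mul_ne_zero (hC.halfDensity_ne_zero hσ (hrρ (hsa hm))) (hs j _ hm)
  obtain ⟨t, ht1, ht⟩ := eventually_norm_of_forall_sphere fun w hw =>
    eventually_all.2 fun j => eventually_norm_reflect_le hr0.le hr1 (hx j) (hne j) hw hc
  refine ⟨max t r, hr.trans_le (le_max_right _ _), max_lt ht1 hr1, fun j w h1 h2 => ?_⟩
  have hw' : w ∈ annulus r r⁻¹ := ⟨(le_max_right _ _).trans_lt h1,
    h2.trans ((one_lt_inv₀ hr0).2 hr1)⟩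
  have h3 := ht w ((le_max_left _ _).trans_lt h1) h2 j
  rw [(hxy j w hw').1, hxS, norm_mul] at h3
  have hD := norm_pos_iff.2 (hC.garabedian_ne_zero hσ hw hp ha (mem_reg_of_mem (j := j) (hrρ hw').1 h2))
  have h4 := congrArg norm (hyM j w hw')
  rw [norm_mul, norm_mul] at h4
  rw [szegoQuotient, norm_div, norm_mul, le_div_iff₀ hD]
  refine le_of_mul_le_mul_left ?_ (norm_pos_iff.2 (hC.halfDensity_ne_zero (j := j) hσ (hrρ hw')))
  calc ‖σ j w‖ * (c * ‖1 + (ψ j w - a) * M (ψ j w)‖)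
      = c * ‖y j w‖ * ‖ψ j w - a‖ := by linear_combination -c * h4
    _ ≤ ‖σ j w‖ * ‖S (ψ j w)‖ * ‖ψ j w - a‖ := by gcongr
    _ = _ := by ring

omit hσ hw hp ha in
/-- The maximum principle up to the outer boundary of the collars. -/
theorem norm_le_of_eventually_le {h : ℂ → ℂ} (hh : DifferentiableOn ℂ h (reg K ρ ψ 1)) {B t : ℝ}
    (ht : t < 1) (hB : ∀ j w, t < ‖w‖ → ‖w‖ < 1 → ‖h (ψ j w)‖ ≤ B) {z : ℂ}
    (hz : z ∈ reg K ρ ψ 1) : ‖h z‖ ≤ B := by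
  obtain ⟨s, hzs, hs, hs1⟩ := ((eventually_mem_reg hz).and
    (Ioo_mem_nhdsLT (max_lt ht hC.lt_one))).exists
  have hs2 : ρ < s := (le_max_right _ _).trans_lt hs
  have hs3 : t < s := (le_max_left _ _).trans_lt hs
  have hsρ := hs1.trans hC.one_lt
  have ho := hC.isOpen s hs2 hsρ.le
  obtain ⟨C, hCc, hC1, hC2, hC3⟩ := hC.reg_subset_isCompact hs2 hsρ
  have hcl : closure (reg K ρ ψ s) ⊆ C := closure_minimal hC1 hCc.isClosed
  refine Complex.norm_le_of_forall_mem_frontier_norm_le (hCc.isBounded.subset hC1)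
    (DifferentiableOn.diffContOnCl (hh.mono (hcl.trans (hC3 1 hs1)))) (fun w hw' => ?_)
    (subset_closure hzs)
  obtain ⟨j, v, hv, rfl⟩ := hC2 w (hcl hw'.1) (by rw [← ho.interior_eq]; exact hw'.2)
  rw [mem_sphere_zero_iff_norm] at hv
  exact hB j v (hv ▸ hs3) (hv ▸ hs1)

/-- The quotient of the kernels is bounded below by a Blaschke product in any given function. -/
theorem exists_blaschke_le {P : ℂ → ℂ} (hP : DifferentiableOn ℂ P (reg K ρ ψ 1))
    (hP1 : ∀ z ∈ reg K ρ ψ 1, ‖P z‖ < 1) {m : ℕ} (hm : Fintype.card J ≤ m) :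
    ∃ ζ : Fin m → ℂ, (∀ l, ‖ζ l‖ ≤ 1) ∧ ∀ z ∈ reg K ρ ψ 1,
      ∏ l, ‖P z - ζ l‖ ≤ ‖szegoQuotient a S M z‖ * ∏ l, ‖1 - conj (ζ l) * P z‖ := by
  obtain ⟨Z, u, hZc, hZ, hu, hu0, hSu⟩ := hC.exists_zeros_szego hσ hw hp ha
  have ho := hC.isOpen 1 hC.lt_one hC.one_lt.le
  have hs := reg_mono K ρ ψ hp.one_lt.le
  have ha1 : a ∈ reg K ρ ψ 1 := Or.inl ha
  have hZ' : ∀ b ∈ a ::ₘ Z, b ∈ reg K ρ ψ 1 := fun b hb => by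
    rcases Multiset.mem_cons.1 hb with rfl | hb
    exacts [ha1, hZ b hb]
  obtain ⟨ζ, hζ, hprod⟩ := exists_fin_prod_eq (m := m) ((a ::ₘ Z).map P) (by
    rw [Multiset.card_map, Multiset.card_cons]
    omega) 1
  have hζ1 : ∀ l, ‖ζ l‖ ≤ 1 := fun l => by
    rcases hζ l with h | h
    · obtain ⟨b, hb, hbl⟩ := Multiset.mem_map.1 h
      rw [← hbl]
      exact (hP1 b (hZ' b hb)).le
    · simp [h]
  have hne : ∀ {c : ℂ}, ‖c‖ ≤ 1 → ∀ z ∈ reg K ρ ψ 1, 1 - conj c * P z ≠ 0 := fun {c} hc z hz h => by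
    have h1 : ‖conj c * P z‖ = 1 := by rw [← sub_eq_zero.1 h, norm_one]
    rw [norm_mul, norm_conj] at h1
    nlinarith [hP1 z hz, norm_nonneg (P z)]
  refine ⟨ζ, hζ1, fun z hz => ?_⟩
  set q : ℂ → ℂ → ℂ := fun b z => dslope P b z / (1 - conj (P b) * P z) with hq
  set h : ℂ → ℂ := fun z => ((a ::ₘ Z).map fun b => q b z).prod * (1 + (z - a) * M z) / u z
    with hh
  have hqd : ∀ b ∈ reg K ρ ψ 1, DifferentiableOn ℂ (q b) (reg K ρ ψ 1) := fun b hb =>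
    (differentiableOn_dslope_of_isOpen ho hP hb).div ((hP.const_mul _).const_sub 1)
      (hne (hP1 b hb).le)
  have hhd : DifferentiableOn ℂ h (reg K ρ ψ 1) := by
    refine (DifferentiableOn.mul ?_ (((differentiableOn_id.sub_const a).mul
      (hp.diff'.mono hs)).const_add 1)).div (hu.mono hs) hu0
    have : ∀ L : Multiset ℂ, (∀ b ∈ L, b ∈ reg K ρ ψ 1) →
        DifferentiableOn ℂ (fun z => (L.map fun b => q b z).prod) (reg K ρ ψ 1) := fun L => by
      induction L using Multiset.induction with
      | empty => simp
      | cons b L ih =>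
        intro hL
        simp only [Multiset.map_cons, Multiset.prod_cons]
        exact (hqd b (hL b (Multiset.mem_cons_self b L))).mul
          (ih fun b' hb' => hL b' (Multiset.mem_cons_of_mem hb'))
    exact this _ hZ'
  have hmul : ∀ z ∈ reg K ρ ψ 1, ‖h z‖ * ‖szegoQuotient a S M z‖ =
      ((a ::ₘ Z).map fun b => ‖P z - P b‖ / ‖1 - conj (P b) * P z‖).prod := fun z hz => by
    have h1 : h z * szegoQuotient a S M z =
        ((a ::ₘ Z).map fun b => (P z - P b) / (1 - conj (P b) * P z)).prod := by
      have hD := hC.garabedian_ne_zero hσ hw hp ha hz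
      have h2 : (fun b => (P z - P b) / (1 - conj (P b) * P z)) = fun b => (z - b) * q b z := by
        funext b
        rw [hq, ← sub_smul_dslope P b z]
        simp only [smul_eq_mul]
        ring
      rw [h2, Multiset.prod_map_mul, Multiset.map_cons (fun b => z - b), Multiset.prod_cons, hh,
        szegoQuotient, hSu z (hs hz)]
      field_simp [hu0 z hz]
    have h3 := map_multiset_prod (normHom : ℂ →*₀ ℝ)
      ((a ::ₘ Z).map fun b => (P z - P b) / (1 - conj (P b) * P z))
    rw [← h1] at h3
    simpa using h3
  have hle1 : ∀ z ∈ reg K ρ ψ 1, ‖h z‖ * ‖szegoQuotient a S M z‖ ≤ 1 := fun z hz => by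
    rw [hmul z hz]
    refine Multiset.prod_induction_nonempty (fun x : ℝ => x ≤ 1 ∧ 0 ≤ x) 
      (fun x y hx hy => ⟨mul_le_one₀ hx.1 hy.2 hy.1, mul_nonneg hx.2 hy.2⟩) (by simp)
      (fun x hx => ?_) |>.1
    obtain ⟨b, hb, rfl⟩ := Multiset.mem_map.1 hx
    exact ⟨div_le_one_of_le₀ (norm_sub_le_norm_one_sub_conj_mul (hP1 b (hZ' b hb)).le
      (hP1 z hz).le) (norm_nonneg _), by positivity⟩
  have hbd : ‖h z‖ ≤ 1 := by
    have : ∀ c : ℝ, 0 < c → c < 1 → c * ‖h z‖ ≤ 1 := fun c hc hc1 => by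
      obtain ⟨t, ht, ht1, htc⟩ := hC.exists_le_norm_szegoQuotient hσ hw hp ha hc1
      rw [mul_comm, ← le_div_iff₀ hc]
      refine hC.norm_le_of_eventually_le hhd ht1 (fun j w h1 h2 => ?_) hz
      rw [le_div_iff₀ hc]
      exact (mul_le_mul_of_nonneg_left (htc j w h1 h2) (norm_nonneg _)).trans
        (hle1 _ (mem_reg_of_mem (ht.trans h1) h2))
    by_contra! hlt
    obtain ⟨c, hc1, hc2⟩ := exists_between (inv_lt_one_of_one_lt₀ hlt)
    have h5 := this c ((inv_pos.2 (one_pos.trans hlt)).trans hc1) hc2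
    rw [inv_lt_iff_one_lt_mul₀ (one_pos.trans hlt)] at hc1
    linarith
  have h6 := hprod (fun c => ‖P z - c‖ / ‖1 - conj c * P z‖) (by
    have := norm_pos_iff.2 (hne (c := 1) (by simp) z hz)
    rw [map_one, one_mul] at this ⊢
    rw [norm_sub_rev, div_self this.ne'])
  rw [Finset.prod_div_distrib, Multiset.map_map] at h6
  rw [← div_le_iff₀ (Finset.prod_pos fun l _ => norm_pos_iff.2 (hne (hζ1 l) z hz)), h6]
  exact (hmul z hz).symm.le.trans (mul_le_of_le_one_left (norm_nonneg _) hbd)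

end Collared

theorem isOpen_image_of_deriv_ne_zero {f : ℂ → ℂ} {W : Set ℂ} (hW : IsOpen W)
    (hf : DifferentiableOn ℂ f W) (h : ∀ w ∈ W, deriv f w ≠ 0) : IsOpen (f '' W) := by
  rw [isOpen_iff_mem_nhds]
  rintro _ ⟨w, hw, rfl⟩
  have hs : HasStrictDerivAt f (deriv f w) w :=
    (hf.analyticOnNhd hW w hw).hasStrictDerivAt
  rw [← hs.map_nhds_eq (h w hw)]
  exact image_mem_map (hW.mem_nhds hw)

namespace ProperDisc

variable {Ω : Set ℂ} {p : ℂ → ℂ} (hp : ProperDisc Ω p)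
include hp

/-- A proper map is a covering over the complement of its critical values. -/
theorem isCoveringMapOn :
    IsCoveringMapOn (fun z : Ω => (⟨p z, hp.maps z z.2⟩ : ball (0 : ℂ) 1))
      {ζ | (ζ : ℂ) ∉ critVals Ω p} := by
  have hcont : Continuous fun z : Ω => (⟨p z, hp.maps z z.2⟩ : ball (0 : ℂ) 1) :=
    (continuousOn_iff_continuous_domRestrict.1 hp.diff.continuousOn).subtype_mk _
  refine IsClosedMap.isCoveringMapOn_of_isLocalHomeomorphOn ?_ ?_ ?_
  · have : WeaklyLocallyCompactSpace (ball (0 : ℂ) 1) := by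
      have := (isOpen_ball (x := (0 : ℂ)) (ε := 1)).locallyCompactSpace
      infer_instance
    refine IsProperMap.isClosedMap (isProperMap_iff_isCompact_preimage.2 ⟨hcont, fun L hL => ?_⟩)
    rw [Topology.IsEmbedding.subtypeVal.isCompact_iff]
    convert! hp.proper (Subtype.val '' L) (by
      rintro _ ⟨x, -, rfl⟩
      exact x.2) (hL.image continuous_subtype_val) using 1
    ext z
    constructor
    · rintro ⟨z, hz, rfl⟩
      exact ⟨z.2, _, hz, rfl⟩
    · rintro ⟨hz, ⟨ζ, hζ, h⟩⟩
      refine ⟨⟨z, hz⟩, ?_, rfl⟩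
      rwa [mem_preimage, show (⟨p z, hp.maps z hz⟩ : ball (0 : ℂ) 1) = ζ from Subtype.ext h.symm]
  · intro ζ hζ
    refine ((hp.finite_fibre ζ.2).preimage Subtype.val_injective.injOn).subset ?_
    rintro z hz
    exact ⟨z.2, congrArg Subtype.val hz⟩
  · refine IsLocalHomeomorphOn.of_comp_left (g := Subtype.val) ?_
      (isOpen_ball.isOpenEmbedding_subtypeVal.isLocalHomeomorph.isLocalHomeomorphOn)
      fun z _ => hcont.continuousAt
    have h1 : IsLocalHomeomorphOn p (Ω \ {z | deriv p z = 0}) := by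
      refine IsLocalHomeomorphOn.mk _ _ fun z hz => ?_
      have hcd : ContDiffAt ℂ 1 p z := (hp.diff.analyticOnNhd hp.isOpen z hz.1).contDiffAt
      have hs := (hcd.hasStrictDerivAt (by norm_num)).hasStrictFDerivAt_equiv hz.2
      exact ⟨hs.toOpenPartialHomeomorph p, hs.mem_toOpenPartialHomeomorph_source, fun _ _ => rfl⟩
    refine h1.comp (hp.isOpen.isOpenEmbedding_subtypeVal.isLocalHomeomorph.isLocalHomeomorphOn)
      fun z hz => ⟨z.2, fun h => hz ⟨z, ⟨z.2, h⟩, rfl⟩⟩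

/-- Holomorphic maps of convex open sets avoiding the critical values lift along `p`. -/
theorem exists_lift {T : Set ℂ} (hT : Convex ℝ T) (hTo : IsOpen T) {E : ℂ → ℂ}
    (hE : DifferentiableOn ℂ E T) (hE1 : ∀ u ∈ T, E u ∈ ball (0 : ℂ) 1 \ critVals Ω p) {u₀ z₀ : ℂ}
    (hu₀ : u₀ ∈ T) (hz₀ : z₀ ∈ Ω) (h : p z₀ = E u₀) :
    ∃ φ : ℂ → ℂ, DifferentiableOn ℂ φ T ∧ φ u₀ = z₀ ∧ ∀ u ∈ T, φ u ∈ Ω ∧ p (φ u) = E u := by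
  have := hT.contractibleSpace ⟨u₀, hu₀⟩
  have := hTo.locallyPathConnectedSpace
  obtain ⟨F, ⟨hF0, hF⟩, -⟩ := hp.isCoveringMapOn.existsUnique_continuousMap_lifts
    ⟨fun u : T => (⟨E u, (hE1 u u.2).1⟩ : ball (0 : ℂ) 1),
      (continuousOn_iff_continuous_domRestrict.1 hE.continuousOn).subtype_mk _⟩
    (a₀ := ⟨u₀, hu₀⟩) (e₀ := ⟨z₀, hz₀⟩) (Subtype.ext h) fun u => (hE1 u u.2).2
  classical
  set φ : ℂ → ℂ := fun u => if hu : u ∈ T then F ⟨u, hu⟩ else 0 with hφ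
  have hφT : ∀ u (hu : u ∈ T), φ u = F ⟨u, hu⟩ := fun u hu => dif_pos hu
  have hφ1 : ∀ u ∈ T, φ u ∈ Ω ∧ p (φ u) = E u := fun u hu => by
    rw [hφT u hu]
    exact ⟨(F ⟨u, hu⟩).2, congrArg Subtype.val (congrFun hF ⟨u, hu⟩)⟩
  have hc : ContinuousOn φ T := by
    rw [continuousOn_iff_continuous_domRestrict]
    refine (continuous_subtype_val.comp F.continuous).congr fun u => ?_
    exact (hφT u u.2).symm
  refine ⟨φ, fun u hu => ?_, by rw [hφT u₀ hu₀, hF0], hφ1⟩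
  obtain ⟨w, -, -, hw1, hw2⟩ := hp.exists_localInverse (hφ1 u hu).1 fun h0 =>
    (hE1 u hu).2 ⟨φ u, ⟨(hφ1 u hu).1, h0⟩, (hφ1 u hu).2⟩
  have hca : ContinuousAt φ u := hc.continuousAt (hTo.mem_nhds hu)
  have hd : DifferentiableAt ℂ (fun v => w (E v)) u := by
    refine DifferentiableAt.fun_comp' u ?_ (hE.differentiableAt (hTo.mem_nhds hu))
    rw [← (hφ1 u hu).2]
    exact hw1.self_of_nhds.1
  refine (hd.congr_of_eventuallyEq ?_).differentiableWithinAt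
  filter_upwards [hca.eventually hw2, hTo.mem_nhds hu] with v hv hvT
  rw [← (hφ1 v hvT).2, hv]

theorem lift_unique {T : Set ℂ} (hT : IsPreconnected T) (hTo : IsOpen T) {φ φ' : ℂ → ℂ}
    (hφ : DifferentiableOn ℂ φ T) (hφ' : DifferentiableOn ℂ φ' T) (hφΩ : ∀ u ∈ T, φ u ∈ Ω)
    (hcrit : ∀ u ∈ T, p (φ u) ∉ critVals Ω p)
    (h : ∀ u ∈ T, p (φ u) = p (φ' u)) {u₀ : ℂ} (hu₀ : u₀ ∈ T) (h0 : φ u₀ = φ' u₀) :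
    EqOn φ φ' T := by
  refine (hφ.analyticOnNhd hTo).eqOn_of_preconnected_of_eventuallyEq (hφ'.analyticOnNhd hTo) hT
    hu₀ ?_
  obtain ⟨w, -, -, hw1, hw2⟩ := hp.exists_localInverse (hφΩ u₀ hu₀) fun h0 =>
    hcrit u₀ hu₀ ⟨φ u₀, ⟨hφΩ u₀ hu₀, h0⟩, rfl⟩
  have hca := (hφ.differentiableAt (hTo.mem_nhds hu₀)).continuousAt
  have hca' := (hφ'.differentiableAt (hTo.mem_nhds hu₀)).continuousAt
  have h1 := hca.eventually hw2
  have h2 : ∀ᶠ v in 𝓝 u₀, w (p (φ' v)) = φ' v := hca'.eventually (by rw [← h0]; exact hw2)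
  filter_upwards [h1, h2, hTo.mem_nhds hu₀] with v a b hv
  rw [← a, ← b, h v hv]

theorem exists_isPreconnected_sublevel :
    ∃ s₀ < 1, ∀ R, s₀ < R → IsPreconnected {z ∈ Ω | ‖p z‖ < R} := by
  classical
  obtain ⟨z₀, hz₀, hpz₀⟩ := hp.surj 0 (by simp)
  have hconn : IsConnected Ω := ⟨⟨z₀, hz₀⟩, hp.preconn⟩
  have hpath : IsPathConnected Ω := hp.isOpen.isConnected_iff_isPathConnected.1 hconn
  have hZ := hp.finite_fibre (ζ := 0) (by simp)
  have hγ : ∀ z ∈ fibre Ω p 0, JoinedIn Ω z₀ z := fun z hz => hpath.joinedIn z₀ hz₀ z hz.1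
  set L : Set ℂ := ⋃ z ∈ fibre Ω p 0, if hz : JoinedIn Ω z₀ z then range hz.somePath else ∅ with hL
  have hmemL : ∀ z (hz : z ∈ fibre Ω p 0) (x : unitInterval), (hγ z hz).somePath x ∈ L :=
    fun z hz x => by
    rw [hL]
    refine mem_biUnion hz ?_
    rw [dif_pos (hγ z hz)]
    exact mem_range_self x
  have hLc : IsCompact L := by
    refine hZ.isCompact_biUnion fun z hz => ?_
    rw [dif_pos (hγ z hz)]
    exact isCompact_range (hγ z hz).somePath.continuous
  have hLΩ : L ⊆ Ω := by
    refine iUnion₂_subset fun z hz => ?_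
    rw [dif_pos (hγ z hz)]
    rintro _ ⟨x, rfl⟩
    exact (hγ z hz).somePath_mem x
  have hLne : L.Nonempty := ⟨_, hmemL z₀ ⟨hz₀, hpz₀⟩ 0⟩
  obtain ⟨y, hy, hmax⟩ := hLc.exists_isMaxOn hLne (hp.diff.continuousOn.mono hLΩ).norm
  refine ⟨‖p y‖, mem_ball_zero_iff.1 (hp.maps y (hLΩ hy)), fun R hR => ?_⟩
  have hXo : IsOpen {z ∈ Ω | ‖p z‖ < R} :=
    hp.diff.continuousOn.norm.isOpen_inter_preimage hp.isOpen isOpen_Iio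
  have hLX : L ⊆ {z ∈ Ω | ‖p z‖ < R} := fun z hz => ⟨hLΩ hz, (hmax hz).trans_lt hR⟩
  refine isPreconnected_of_forall_constant fun f hf => ?_
  suffices h : ∀ x ∈ {z ∈ Ω | ‖p z‖ < R}, f x = f z₀ from fun x hx y hy => (h x hx).trans (h y hy).symm
  have hfZ : ∀ z ∈ fibre Ω p 0, f z = f z₀ := fun z hz => by
    have h1 : IsPreconnected (range (hγ z hz).somePath) :=
      isPreconnected_range (hγ z hz).somePath.continuous
    have h2 : ContinuousOn f (range (hγ z hz).somePath) := hf.mono fun x hx => by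
      obtain ⟨x, rfl⟩ := hx
      exact hLX (hmemL z hz x)
    have := h1.constant h2 (x := (hγ z hz).somePath 1) (y := (hγ z hz).somePath 0)
      (mem_range_self _) (mem_range_self _)
    simpa using this
  intro x hx
  by_contra hne
  set U : Set ℂ := {z ∈ Ω | ‖p z‖ < R} ∩ f ⁻¹' {f x} with hU
  have hUo : IsOpen U := hf.isOpen_inter_preimage hXo (isOpen_discrete _)
  have hKc : IsCompact (Ω ∩ p ⁻¹' closedBall 0 ‖p x‖) :=
    hp.proper _ (closedBall_subset_ball (mem_ball_zero_iff.1 (hp.maps x hx.1)))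
      (isCompact_closedBall _ _)
  have hKX : Ω ∩ p ⁻¹' closedBall 0 ‖p x‖ ⊆ {z ∈ Ω | ‖p z‖ < R} := fun z hz =>
    ⟨hz.1, (mem_closedBall_zero_iff.1 hz.2).trans_lt hx.2⟩
  have hKU : IsCompact (Ω ∩ p ⁻¹' closedBall 0 ‖p x‖ ∩ f ⁻¹' {f x}) :=
    hKc.of_isClosed_subset
      ((hf.mono hKX).preimage_isClosed_of_isClosed hKc.isClosed isClosed_singleton) inter_subset_left
  obtain ⟨y, hy, hmin⟩ := hKU.exists_isMinOn ⟨x, ⟨hx.1, by simp⟩, rfl⟩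
    (hp.diff.continuousOn.mono (inter_subset_left.trans inter_subset_left)).norm
  have hyU : y ∈ U := ⟨hKX hy.1, hy.2⟩
  have hloc : IsLocalMin (norm ∘ p) y := by
    filter_upwards [hUo.mem_nhds hyU] with z hz
    by_cases h : ‖p z‖ ≤ ‖p x‖
    · exact hmin ⟨⟨hz.1.1, mem_closedBall_zero_iff.2 h⟩, hz.2⟩
    · exact (mem_closedBall_zero_iff.1 hy.1.2).trans (not_le.1 h).le
  have hd : ∀ᶠ z in 𝓝 y, DifferentiableAt ℂ p z := by
    filter_upwards [hp.isOpen.mem_nhds hy.1.1] with z hz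
    exact hp.diff.differentiableAt (hp.isOpen.mem_nhds hz)
  rcases eventually_eq_or_eq_zero_of_isLocalMin_norm hd hloc with h | h
  · have h1 := eventually_ne_zero_of_differentiableOn hp.isOpen hp.preconn
      (hp.diff.sub_const (p y)) (hp.exists_sub_ne_zero _) hy.1.1
    obtain ⟨z, hz1, hz2⟩ := (h1.and (nhdsWithin_le_nhds h)).exists
    exact hz1 (sub_eq_zero.2 hz2)
  · have h1 : f y = f x := hy.2
    exact hne (h1.symm.trans (hfZ y ⟨hy.1.1, h⟩))

end ProperDisc

/-- Representatives of the cycles of a permutation, with their lengths. -/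
theorem exists_cycle_representatives {ι : Type} [Fintype ι] (τ : Equiv.Perm ι) :
    ∃ (J : Type) (_ : Fintype J) (rep : J → ι) (k : J → ℕ), (∀ j, 0 < k j) ∧
      (∀ j (n : ℤ), (τ ^ n) (rep j) = rep j ↔ (k j : ℤ) ∣ n) ∧
      (∀ i j (n : ℤ), (τ ^ n) (rep i) = rep j → i = j) ∧
      (∀ x, ∃ j, ∃ n : ℕ, (τ ^ n) (rep j) = x) ∧ Fintype.card J ≤ Fintype.card ι ∧
      ∀ G : ι → ℂ, ∑ j, ∑ n ∈ Finset.range (k j), G ((τ ^ n) (rep j)) = ∑ i, G i := by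
  classical
  set k : ι → ℕ := fun x => Function.minimalPeriod (τ • ·) x with hk
  have hkpos : ∀ x, 0 < k x := fun x =>
    Function.minimalPeriod_pos_of_mem_periodicPts
      (Function.Injective.mem_periodicPts (f := (τ • · : ι → ι)) τ.injective x)
  have hdvd : ∀ x (n : ℤ), (τ ^ n) x = x ↔ (k x : ℤ) ∣ n := fun x n =>
    MulAction.zpow_smul_eq_iff_minimalPeriod_dvd (a := τ) (b := x) (n := n)
  let st := Equiv.Perm.SameCycle.setoid τ
  have hrep : ∀ x, ∃ n : ℤ, (τ ^ n) (Quotient.mk st x).out = x := fun x =>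
    (Quotient.exact (Quotient.out_eq (Quotient.mk st x)) : τ.SameCycle _ _)
  have hinj : ∀ (i j : Quotient st) (n : ℤ), (τ ^ n) i.out = j.out → i = j := fun i j n h => by
    rw [← Quotient.out_eq i, ← Quotient.out_eq j]
    exact Quotient.sound (show τ.SameCycle _ _ from ⟨n, h⟩)
  have hsurj : ∀ x, ∃ j : Quotient st, ∃ n : ℕ, n < k j.out ∧ (τ ^ n) j.out = x := fun x => by
    obtain ⟨n, hn⟩ := hrep x
    set y := (Quotient.mk st x).out with hy
    have hky : (0 : ℤ) < k y := by exact_mod_cast hkpos y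
    refine ⟨Quotient.mk st x, (n % k y).toNat, ?_, ?_⟩
    · have := Int.emod_lt_of_pos n hky
      have := Int.emod_nonneg n hky.ne'
      change _ < k y
      omega
    · rw [← zpow_natCast, Int.toNat_of_nonneg (Int.emod_nonneg n hky.ne')]
      refine Eq.trans ?_ hn
      have h1 : (τ ^ (k y * (n / k y) : ℤ)) y = y := (hdvd y _).2 (dvd_mul_right _ _)
      change (τ ^ (n % (k y : ℤ))) y = _
      conv_rhs => rw [← Int.emod_add_mul_ediv n (k y), zpow_add, Equiv.Perm.mul_apply, h1]
  refine ⟨Quotient st, inferInstance, Quotient.out, fun j => k j.out, fun j => hkpos _,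
    fun j n => hdvd _ n, hinj, fun x => ?_, ?_, fun G => ?_⟩
  · obtain ⟨j, n, -, h⟩ := hsurj x
    exact ⟨j, n, h⟩
  · exact Fintype.card_le_of_surjective _ Quotient.mk_surjective
  · rw [Finset.sum_sigma']
    refine Finset.sum_bij (fun x _ => (τ ^ x.2) x.1.out) (fun _ _ => Finset.mem_univ _) ?_ ?_
      fun _ _ => rfl
    · rintro ⟨i, n⟩ hn ⟨j, n'⟩ hn' h
      simp only [Finset.mem_sigma, Finset.mem_univ, true_and, Finset.mem_range] at hn hn' h
      have h1 : (τ ^ ((n : ℤ) - n')) i.out = j.out := by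
        rw [sub_eq_neg_add, zpow_add, Equiv.Perm.mul_apply, zpow_natCast, h, zpow_neg, zpow_natCast]
        exact (τ ^ n').symm_apply_apply _
      obtain rfl := hinj i j _ h1
      have h2 := (hdvd _ _).1 h1
      have h3 : (n : ℤ) - n' = 0 := Int.eq_zero_of_abs_lt_dvd h2 (by
        rw [abs_lt]
        omega)
      obtain rfl : n = n' := by omega
      rfl
    · intro x _
      obtain ⟨j, n, h1, h2⟩ := hsurj x
      exact ⟨⟨j, n⟩, by simpa using h1, h2⟩

/-- A decomposition of the part of `Ω` above the annulus `r < ‖ζ‖ < R` into annuli on which `p` is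
a power map. -/
structure Cylinders {J : Type*} (Ω : Set ℂ) (p : ℂ → ℂ) (r s R : ℝ) (k : J → ℕ) (ψ : J → ℂ → ℂ) :
    Prop where
  pos : ∀ j, 0 < k j
  nonneg : 0 ≤ r
  lt_s : r < s
  s_lt : s < R
  le_one : R ≤ 1
  notMem_critVals : ∀ ζ ∈ annulus r R, ζ ∉ critVals Ω p
  diff : ∀ j, DifferentiableOn ℂ (ψ j) {w | r < s * ‖w‖ ^ k j ∧ s * ‖w‖ ^ k j < R}
  maps : ∀ j w, r < s * ‖w‖ ^ k j → s * ‖w‖ ^ k j < R → ψ j w ∈ Ω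
  apply_eq : ∀ j w, r < s * ‖w‖ ^ k j → s * ‖w‖ ^ k j < R → p (ψ j w) = s * w ^ k j
  inj : ∀ i j w w', r < s * ‖w‖ ^ k i → s * ‖w‖ ^ k i < R → r < s * ‖w'‖ ^ k j →
    s * ‖w'‖ ^ k j < R → ψ i w = ψ j w' → i = j ∧ w = w'
  surj : ∀ z ∈ Ω, r < ‖p z‖ → ‖p z‖ < R → ∃ j w, ψ j w = z ∧ ‖p z‖ = s * ‖w‖ ^ k j

theorem ProperDisc.exists_cylinders {Ω : Set ℂ} {p : ℂ → ℂ} (hp : ProperDisc Ω p) {r s R : ℝ}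
    (hr : 0 ≤ r) (hrs : r < s) (hsR : s < R) (hR : R ≤ 1)
    (hcrit : ∀ ζ ∈ annulus r R, ζ ∉ critVals Ω p) :
    ∃ (J : Type) (_ : Fintype J) (k : J → ℕ) (ψ : J → ℂ → ℂ), Cylinders Ω p r s R k ψ ∧
      Fintype.card J ≤ hp.degree := by
  have hs0 : 0 < s := hr.trans_lt hrs
  set T : Set ℂ := re ⁻¹' (Real.exp ⁻¹' Ioo r R) with hTdef
  have hT : Convex ℝ T := convex_preimage_exp_re ordConnected_Ioo
  have hTo : IsOpen T := (isOpen_Ioo.preimage Real.continuous_exp).preimage continuous_re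
  have hTmem : ∀ u, u ∈ T ↔ r < Real.exp u.re ∧ Real.exp u.re < R := fun u => Iff.rfl
  have hexpT : ∀ u ∈ T, exp u ∈ annulus r R := fun u hu => by
    simpa [annulus, norm_exp] using (hTmem u).1 hu
  have hexpB : ∀ u ∈ T, exp u ∈ ball (0 : ℂ) 1 \ critVals Ω p := fun u hu =>
    ⟨mem_ball_zero_iff.2 ((hexpT u hu).2.trans_le hR), hcrit _ (hexpT u hu)⟩
  set u₀ : ℂ := (Real.log s : ℂ) with hu₀def
  have hexpu₀ : exp u₀ = s := by rw [hu₀def, ← ofReal_exp, Real.exp_log hs0]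
  have hu₀ : u₀ ∈ T := by
    rw [hTmem, hu₀def, ofReal_re, Real.exp_log hs0]
    exact ⟨hrs, hsR⟩
  have hsh : ∀ u ∈ T, ∀ n : ℤ, u + n * (2 * π * I) ∈ T := fun u hu n => by
    rw [hTmem] at hu ⊢
    simpa using hu
  have hexpn : ∀ u (n : ℤ), exp (u + n * (2 * π * I)) = exp u := fun u n => by
    rw [exp_add, exp_int_mul_two_pi_mul_I, mul_one]
  have hsball : (s : ℂ) ∈ ball (0 : ℂ) 1 \ critVals Ω p := hexpu₀ ▸ hexpB u₀ hu₀
  have hfin := hp.finite_fibre hsball.1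
  have : Fintype (fibre Ω p (s : ℂ)) := hfin.fintype
  have hlift : ∀ i : fibre Ω p (s : ℂ), ∃ φ : ℂ → ℂ, DifferentiableOn ℂ φ T ∧ φ u₀ = i ∧
      ∀ u ∈ T, φ u ∈ Ω ∧ p (φ u) = exp u := fun i =>
    hp.exists_lift hT hTo differentiable_exp.differentiableOn hexpB hu₀ i.2.1
      (by rw [hexpu₀]; exact i.2.2)
  choose φ hφd hφ₀ hφ using hlift
  have huniq : ∀ (f g : ℂ → ℂ), DifferentiableOn ℂ f T → DifferentiableOn ℂ g T →
      (∀ u ∈ T, f u ∈ Ω ∧ p (f u) = exp u) → (∀ u ∈ T, g u ∈ Ω ∧ p (g u) = exp u) →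
      ∀ u ∈ T, f u = g u → EqOn f g T := fun f g hf hg hf1 hg1 u hu h =>
    hp.lift_unique hT.isPreconnected hTo hf hg (fun v hv => (hf1 v hv).1)
      (fun v hv => by rw [(hf1 v hv).2]; exact (hexpB v hv).2)
      (fun v hv => by rw [(hf1 v hv).2, (hg1 v hv).2]) hu h
  have hU : ∀ i j u, u ∈ T → φ i u = φ j u → i = j := fun i j u hu h => by
    have := huniq _ _ (hφd i) (hφd j) (hφ i) (hφ j) u hu h hu₀
    rw [hφ₀, hφ₀] at this
    exact Subtype.ext this
  have hex : ∀ f : ℂ → ℂ, DifferentiableOn ℂ f T → (∀ u ∈ T, f u ∈ Ω ∧ p (f u) = exp u) →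
      ∃ i, EqOn f (φ i) T := fun f hf hf1 => by
    have h1 := hf1 u₀ hu₀
    rw [hexpu₀] at h1
    exact ⟨⟨f u₀, h1.1, h1.2⟩, huniq _ _ hf (hφd _) hf1 (hφ _) u₀ hu₀
      (hφ₀ ⟨f u₀, h1.1, h1.2⟩).symm⟩
  have hτ : ∀ i, ∃ j, ∀ u ∈ T, φ i (u + 2 * π * I) = φ j u := fun i => by
    have hsh1 : ∀ u ∈ T, u + 2 * π * I ∈ T := fun u hu => by simpa using hsh u hu 1
    refine hex (fun u => φ i (u + 2 * π * I))
      ((hφd i).comp (by fun_prop) hsh1) fun u hu => ⟨(hφ i _ (hsh1 u hu)).1, ?_⟩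
    rw [(hφ i _ (hsh1 u hu)).2, exp_periodic]
  choose τ₀ hτ₀ using hτ
  have hτinj : Function.Injective τ₀ := fun i j h => by
    refine hU i j (u₀ + 2 * π * I) (by simpa using hsh u₀ hu₀ 1) ?_
    rw [hτ₀ i _ hu₀, hτ₀ j _ hu₀, h]
  set τ : Equiv.Perm (fibre Ω p (s : ℂ)) :=
    Equiv.ofBijective τ₀ (Finite.injective_iff_bijective.1 hτinj) with hτdef
  have hshn : ∀ n : ℕ, ∀ i, ∀ u ∈ T, φ i (u + n * (2 * π * I)) = φ ((τ ^ n) i) u := by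
    intro n
    induction n with
    | zero => intro i u _; simp
    | succ n ih =>
      intro i u hu
      have h1 := hτ₀ i (u + n * (2 * π * I)) (by simpa using hsh u hu n)
      rw [pow_succ, Equiv.Perm.mul_apply, ← ih _ u hu]
      change _ = φ (τ₀ i) _
      rw [← h1]
      congr 1
      push_cast
      ring
  have hshz : ∀ n : ℤ, ∀ i, ∀ u ∈ T, φ i (u + n * (2 * π * I)) = φ ((τ ^ n) i) u := by
    intro n i u hu
    obtain ⟨m, rfl | rfl⟩ := n.eq_nat_or_neg
    · simpa using hshn m i u hu
    · have h1 := hshn m ((τ ^ (-(m : ℤ))) i) (u + (-(m : ℤ) : ℤ) * (2 * π * I)) (hsh u hu _)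
      rw [← Equiv.Perm.mul_apply, ← zpow_natCast, ← zpow_add, add_neg_cancel, zpow_zero,
        Equiv.Perm.one_apply] at h1
      rw [← h1]
      congr 1
      push_cast
      ring
  obtain ⟨J, _, rep, k, hk, hdvd, hrinj, hrsurj, hcard, -⟩ := exists_cycle_representatives τ
  have hAne : ∀ j (w : ℂ), r < s * ‖w‖ ^ k j → w ≠ 0 := by
    rintro j w h rfl
    rw [norm_zero, zero_pow (hk j).ne', mul_zero] at h
    exact absurd h hr.not_gt
  have hTA : ∀ j (v : ℂ), u₀ + k j * v ∈ T ↔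
      r < s * ‖exp v‖ ^ k j ∧ s * ‖exp v‖ ^ k j < R := fun j v => by
    have : Real.exp (u₀ + k j * v).re = s * ‖exp v‖ ^ k j := by
      rw [← norm_exp, exp_add, hexpu₀, norm_mul, exp_nat_mul, norm_pow, norm_real,
        Real.norm_of_nonneg hs0.le]
    rw [hTmem, this]
  set ψ : J → ℂ → ℂ := fun j w => φ (rep j) (u₀ + k j * log w) with hψ
  have hB : ∀ j v, u₀ + k j * v ∈ T → ψ j (exp v) = φ (rep j) (u₀ + k j * v) := fun j v hv => by
    obtain ⟨n, hn⟩ := exp_eq_exp_iff_exists_int.1 (exp_log (exp_ne_zero v))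
    have h1 := hshz (k j * n) (rep j) (u₀ + k j * v) hv
    rw [(hdvd j _).2 (dvd_mul_right _ _)] at h1
    rw [hψ, ← h1]
    simp only
    rw [hn]
    congr 1
    push_cast
    ring
  refine ⟨J, inferInstance, k, ψ, ⟨hk, hr, hrs, hsR, hR, hcrit, fun j w₀ hw₀ => ?_, ?_, ?_, ?_, ?_⟩,
    ?_⟩
  · have h0 := hAne j w₀ hw₀.1
    set l : ℂ → ℂ := fun w => log (w / w₀) + log w₀ with hl
    have hl1 : ∀ w, w ≠ 0 → exp (l w) = w := fun w hw => by
      rw [hl]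
      simp only
      rw [exp_add, exp_log (div_ne_zero hw h0), exp_log h0, div_mul_cancel₀ _ h0]
    have hld : DifferentiableAt ℂ l w₀ := by
      refine DifferentiableAt.add_const _ (DifferentiableAt.clog (by fun_prop) ?_)
      rw [div_self h0]
      exact one_mem_slitPlane
    have hmem : ∀ w, r < s * ‖w‖ ^ k j ∧ s * ‖w‖ ^ k j < R → u₀ + k j * l w ∈ T := fun w hw => by
      rw [hTA, hl1 w (hAne j w hw.1)]
      exact hw
    have hd : DifferentiableAt ℂ (fun w => φ (rep j) (u₀ + k j * l w)) w₀ :=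
      ((hφd (rep j)).differentiableAt (hTo.mem_nhds (hmem w₀ hw₀))).fun_comp' w₀
        ((hld.const_mul _).const_add _)
    refine (hd.differentiableWithinAt).congr (fun w hw => ?_) ?_
    · rw [← hB j _ (hmem w hw), hl1 w (hAne j w hw.1)]
    · rw [← hB j _ (hmem w₀ hw₀), hl1 w₀ h0]
  · intro j w h1 h2
    refine (hφ _ _ ?_).1
    rw [hTA, exp_log (hAne j w h1)]
    exact ⟨h1, h2⟩
  · intro j w h1 h2
    rw [hψ]
    simp only
    rw [(hφ _ _ ?_).2, exp_add, hexpu₀, exp_nat_mul, exp_log (hAne j w h1)]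
    rw [hTA, exp_log (hAne j w h1)]
    exact ⟨h1, h2⟩
  · intro i j w w' h1 h2 h1' h2' h
    have hm : u₀ + k i * log w ∈ T := by
      rw [hTA, exp_log (hAne i w h1)]
      exact ⟨h1, h2⟩
    have hm' : u₀ + k j * log w' ∈ T := by
      rw [hTA, exp_log (hAne j w' h1')]
      exact ⟨h1', h2'⟩
    have hpe : exp (u₀ + k i * log w) = exp (u₀ + k j * log w') := by
      rw [← (hφ (rep i) _ hm).2, ← (hφ (rep j) _ hm').2]
      exact congrArg p h
    obtain ⟨n, hn⟩ := exp_eq_exp_iff_exists_int.1 hpe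
    have h3 := hshz n (rep i) _ hm'
    rw [← hn] at h3
    have h4 : (τ ^ n) (rep i) = rep j := hU _ _ _ hm' (h3.symm.trans h)
    obtain rfl := hrinj i j n h4
    refine ⟨rfl, ?_⟩
    obtain ⟨m, rfl⟩ := (hdvd i n).1 h4
    have hk0 : (k i : ℂ) ≠ 0 := by exact_mod_cast (hk i).ne'
    rw [← exp_log (hAne i w h1), ← exp_log (hAne i w' h1'), exp_eq_exp_iff_exists_int]
    refine ⟨m, mul_left_cancel₀ hk0 ?_⟩
    push_cast at hn
    linear_combination hn
  · intro z hz h1 h2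
    have hpz0 : p z ≠ 0 := fun h => by
      rw [h, norm_zero] at h1
      exact absurd h1 hr.not_gt
    have hu : log (p z) ∈ T := by
      rw [hTmem, ← norm_exp, exp_log hpz0]
      exact ⟨h1, h2⟩
    obtain ⟨f, hfd, hf0, hf⟩ := hp.exists_lift hT hTo differentiable_exp.differentiableOn hexpB hu hz
      (exp_log hpz0).symm
    obtain ⟨i, hi⟩ := hex f hfd hf
    obtain ⟨j, n, rfl⟩ := hrsurj i
    have hk0 : (k j : ℂ) ≠ 0 := by exact_mod_cast (hk j).ne'
    set v : ℂ := (log (p z) + n * (2 * π * I) - u₀) / k j with hv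
    have hv1 : u₀ + k j * v = log (p z) + n * (2 * π * I) := by
      rw [hv]
      field_simp
      ring
    have hvT : u₀ + k j * v ∈ T := by
      rw [hv1]
      simpa using hsh _ hu n
    refine ⟨j, exp v, ?_, ?_⟩
    · rw [hB j v hvT, hv1, hshn n _ _ hu, ← hi hu, hf0]
    · rw [← norm_pow, ← exp_nat_mul, ← Real.norm_of_nonneg hs0.le, ← norm_real, ← norm_mul,
        ← hexpu₀, ← exp_add, hv1, exp_add, exp_log hpz0, ← Int.cast_natCast,
        exp_int_mul_two_pi_mul_I, mul_one]
  · rw [← hp.ncard_fibre hsball, Set.ncard_eq_toFinset_card' , Set.toFinset_card]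
    exact hcard

/-- Substitution along a power map in a circle integral. -/
theorem circleIntegral_mul_pow_eq_sum {H : ℂ → ℂ} {τ : ℝ} (hτ : 0 < τ) {k : ℕ} (hk : 0 < k)
    (hH : ContinuousOn H (sphere 0 τ)) (s : ℂ) :
    (∮ w in C(0, τ), H w * (s * (k * w ^ (k - 1)))) =
      ∑ n ∈ Finset.range k, ∫ α in (0 : ℝ)..2 * π,
        H (circleMap 0 τ ((α + n * (2 * π)) / k)) *
          (s * τ ^ k * (exp (α * I) * I)) := by
  have hk0 : (k : ℝ) ≠ 0 := by exact_mod_cast hk.ne'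
  have hk0' : (k : ℂ) ≠ 0 := by exact_mod_cast hk.ne'
  set f : ℝ → ℂ := fun x => H (circleMap 0 τ (x / k)) * (s * τ ^ k * (exp (x * I) * I)) with hf
  have hcm : ∀ θ : ℝ, circleMap 0 τ θ ∈ sphere (0 : ℂ) τ := fun θ => circleMap_mem_sphere 0 hτ.le θ
  have hfc : Continuous f := by
    refine Continuous.mul (hH.comp_continuous ?_ fun x => hcm _) (by fun_prop)
    exact (continuous_circleMap 0 τ).comp (by fun_prop)
  have h1 : (∮ w in C(0, τ), H w * (s * (k * w ^ (k - 1)))) =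
      ∫ θ in (0 : ℝ)..2 * π, (k : ℝ) • f (k * θ) := by
    refine intervalIntegral.integral_congr fun θ _ => ?_
    rw [hf]
    simp only [deriv_circleMap, smul_eq_mul, real_smul]
    rw [mul_div_cancel_left₀ _ hk0]
    have h2 : circleMap 0 τ θ ^ k = τ ^ k * exp (((k * θ : ℝ) : ℂ) * I) := by
      rw [circleMap, zero_add, mul_pow, ← exp_nat_mul]
      push_cast
      ring_nf
    obtain ⟨m, rfl⟩ := Nat.exists_eq_add_of_le' hk
    rw [pow_succ] at h2
    rw [Nat.add_sub_cancel]
    push_cast at h2 ⊢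
    linear_combination (I * H (circleMap 0 τ θ) * s * ((m : ℂ) + 1)) * h2
  rw [h1, intervalIntegral.integral_smul, intervalIntegral.smul_integral_comp_mul_left, mul_zero]
  have h3 := intervalIntegral.sum_integral_adjacent_intervals (f := f) (μ := volume)
    (a := fun n : ℕ => (n : ℝ) * (2 * π)) (n := k)
    fun n _ => hfc.intervalIntegrable _ _
  simp only [Nat.cast_zero, zero_mul] at h3
  rw [← h3]
  refine Finset.sum_congr rfl fun n _ => ?_
  have h4 := intervalIntegral.integral_comp_add_right (a := 0) (b := 2 * π) f
    ((n : ℝ) * (2 * π))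
  rw [zero_add, show 2 * π + (n : ℝ) * (2 * π) = ((n + 1 : ℕ) : ℝ) * (2 * π) by
    push_cast; ring] at h4
  rw [← h4]
  refine intervalIntegral.integral_congr fun α _ => ?_
  rw [hf]
  simp only
  congr 3
  have := exp_int_mul_two_pi_mul_I n
  push_cast at this ⊢
  rw [add_mul, exp_add, mul_assoc (n : ℂ), this, mul_one]

theorem isOpen_setOf_mul_norm_pow (r s R : ℝ) (k : ℕ) :
    IsOpen {w : ℂ | r < s * ‖w‖ ^ k ∧ s * ‖w‖ ^ k < R} :=
  isOpen_Ioo.preimage (f := fun w : ℂ => s * ‖w‖ ^ k) (by fun_prop)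

/-- The part of the sublevel set `‖p‖ ≤ s` outside the collars. -/
def core {J : Type*} (Ω : Set ℂ) (p : ℂ → ℂ) (s ρ : ℝ) (ψ : J → ℂ → ℂ) : Set ℂ :=
  {z ∈ Ω | ‖p z‖ ≤ s} \ ⋃ j, ψ j '' annulus ρ ρ⁻¹

theorem le_mul_pow_of_le {s ρ x : ℝ} (hs : 0 ≤ s) (hρ : 0 < ρ) (hρ1 : ρ < 1) {k m : ℕ} (hkm : k ≤ m)
    (hx : ρ ≤ x) : s * ρ ^ m ≤ s * x ^ k :=
  mul_le_mul_of_nonneg_left ((pow_le_pow_of_le_one hρ.le hρ1.le hkm).trans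
    (pow_le_pow_left₀ hρ.le hx k)) hs

theorem mul_pow_le_of_le {s ρ x : ℝ} (hs : 0 ≤ s) (hρ : 0 < ρ) (hρ1 : ρ < 1) {k m : ℕ} (hkm : k ≤ m)
    (hx0 : 0 ≤ x) (hx : x ≤ ρ⁻¹) : s * x ^ k ≤ s * ρ⁻¹ ^ m :=
  mul_le_mul_of_nonneg_left ((pow_le_pow_left₀ hx0 hx k).trans
    (pow_le_pow_right₀ ((one_lt_inv₀ hρ).2 hρ1).le hkm)) hs

theorem exists_mul_pow_eq {s q : ℝ} (hs : 0 < s) (hq : 0 ≤ q) {k : ℕ} (hk : 0 < k) :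
    ∃ τ : ℝ, 0 ≤ τ ∧ s * τ ^ k = q := by
  refine ⟨(q / s) ^ ((k : ℝ)⁻¹), Real.rpow_nonneg (div_nonneg hq hs.le) _, ?_⟩
  rw [Real.rpow_inv_natCast_pow (div_nonneg hq hs.le) hk.ne', mul_div_cancel₀ _ hs.ne']

namespace Cylinders

variable {J : Type*} {Ω : Set ℂ} {p : ℂ → ℂ} {r s R ρ : ℝ} {k : J → ℕ} {ψ : J → ℂ → ℂ}
  (hc : Cylinders Ω p r s R k ψ)

include hc

theorem s_pos : 0 < s := hc.nonneg.trans_lt hc.lt_s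

theorem deriv_mul_deriv (hp : ProperDisc Ω p) {j : J} {w : ℂ} (h1 : r < s * ‖w‖ ^ k j)
    (h2 : s * ‖w‖ ^ k j < R) :
    deriv p (ψ j w) * deriv (ψ j) w = s * (k j * w ^ (k j - 1)) ∧ deriv p (ψ j w) ≠ 0 := by
  have hmem : w ∈ {w : ℂ | r < s * ‖w‖ ^ k j ∧ s * ‖w‖ ^ k j < R} := ⟨h1, h2⟩
  have hψ := (hc.diff j).differentiableAt ((isOpen_setOf_mul_norm_pow r s R (k j)).mem_nhds hmem)
  have hz := hc.maps j w h1 h2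
  have hpd := hp.diff.differentiableAt (hp.isOpen.mem_nhds hz)
  have h3 : HasDerivAt (fun w => (s : ℂ) * w ^ k j) (deriv p (ψ j w) * deriv (ψ j) w) w := by
    refine (HasDerivAt.comp w hpd.hasDerivAt hψ.hasDerivAt).congr_of_eventuallyEq ?_
    filter_upwards [(isOpen_setOf_mul_norm_pow r s R (k j)).mem_nhds hmem] with x hx
    exact (hc.apply_eq j x hx.1 hx.2).symm
  refine ⟨h3.unique ((hasDerivAt_pow _ _).const_mul _), fun h => ?_⟩
  refine hc.notMem_critVals (p (ψ j w)) ?_ ⟨_, ⟨hz, h⟩, rfl⟩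
  rw [hc.apply_eq j w h1 h2, annulus, Set.mem_ofPred_eq, norm_mul, norm_pow, norm_real,
    Real.norm_of_nonneg hc.s_pos.le]
  exact ⟨h1, h2⟩

theorem norm_apply {j : J} {w : ℂ} (h1 : r < s * ‖w‖ ^ k j) (h2 : s * ‖w‖ ^ k j < R) :
    ‖p (ψ j w)‖ = s * ‖w‖ ^ k j := by
  rw [hc.apply_eq j w h1 h2, norm_mul, norm_pow, norm_real, Real.norm_of_nonneg hc.s_pos.le]

variable [Fintype J]

theorem trace_circleMap (hp : ProperDisc Ω p) {q : ℝ} (h1 : r < q) (h2 : q < R) {τ : J → ℝ}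
    (hτ0 : ∀ j, 0 < τ j) (hτ : ∀ j, s * τ j ^ k j = q) (F : ℂ → ℂ) (α : ℝ) :
    trace Ω p F (circleMap 0 q α) =
      ∑ j, ∑ n ∈ Finset.range (k j), F (ψ j (circleMap 0 (τ j) ((α + n * (2 * π)) / k j))) := by
  have hq0 : 0 < q := hc.nonneg.trans_lt h1
  have hζ : circleMap 0 q α ∈ ball (0 : ℂ) 1 := by
    rw [mem_ball_zero_iff, norm_circleMap_zero, abs_of_pos hq0]
    exact h2.trans_le hc.le_one
  have hnorm : ∀ j (x : ℝ), s * ‖circleMap 0 (τ j) x‖ ^ k j = q := fun j x => by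
    rw [norm_circleMap_zero, abs_of_pos (hτ0 j), hτ]
  have hn1 : ∀ j (x : ℝ), r < s * ‖circleMap 0 (τ j) x‖ ^ k j := fun j x => (hnorm j x).symm ▸ h1
  have hn2 : ∀ j (x : ℝ), s * ‖circleMap 0 (τ j) x‖ ^ k j < R := fun j x => (hnorm j x).symm ▸ h2
  have hk0 : ∀ j, (k j : ℂ) ≠ 0 := fun j => by exact_mod_cast (hc.pos j).ne'
  have hω := fun j => isPrimitiveRoot_exp (k j) (hc.pos j).ne'
  have hcm : ∀ j (n : ℕ), circleMap 0 (τ j) ((α + n * (2 * π)) / k j) =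
      circleMap 0 (τ j) (α / k j) * exp (2 * π * I / k j) ^ n := fun j n => by
    rw [circleMap, circleMap, zero_add, zero_add, mul_assoc, ← exp_nat_mul, ← exp_add]
    congr 2
    push_cast
    field_simp
  have hpow : ∀ j (n : ℕ), (s : ℂ) * circleMap 0 (τ j) ((α + n * (2 * π)) / k j) ^ k j =
      circleMap 0 q α := fun j n => by
    rw [hcm, mul_pow, ← pow_mul, mul_comm n, pow_mul, (hω j).pow_eq_one, one_pow, mul_one,
      circleMap, circleMap, zero_add, zero_add, mul_pow, ← exp_nat_mul, ← hτ j]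
    push_cast
    rw [mul_assoc]
    have h3 : (k j : ℂ) * (((α : ℂ) / k j) * I) = α * I := by
      have := hk0 j
      field_simp
    rw [h3]
  have hcm0 : ∀ j (x : ℝ), circleMap 0 (τ j) x ≠ 0 := fun j x => circleMap_ne_center (hτ0 j).ne'
  rw [hp.trace_eq_sum hζ, Finset.sum_sigma']
  symm
  refine Finset.sum_bij
    (fun x _ => ψ x.1 (circleMap 0 (τ x.1) ((α + x.2 * (2 * π)) / k x.1))) ?_ ?_ ?_
    fun _ _ => rfl
  · rintro ⟨j, n⟩ -
    rw [Set.Finite.mem_toFinset]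
    exact ⟨hc.maps j _ (hn1 _ _) (hn2 _ _), by
      rw [mem_preimage, mem_singleton_iff, hc.apply_eq j _ (hn1 _ _) (hn2 _ _), hpow]⟩
  · rintro ⟨i, n⟩ hn ⟨j, n'⟩ hn' h
    simp only [Finset.mem_sigma, Finset.mem_univ, true_and, Finset.mem_range] at hn hn' h
    obtain ⟨rfl, hw⟩ := hc.inj _ _ _ _ (hn1 _ _) (hn2 _ _) (hn1 _ _) (hn2 _ _) h
    rw [hcm, hcm] at hw
    obtain rfl := (hω i).pow_inj hn hn' (mul_left_cancel₀ (hcm0 _ _) hw)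
    rfl
  · intro z hz
    rw [Set.Finite.mem_toFinset] at hz
    have hz2 : p z = circleMap 0 q α := hz.2
    have hpz : ‖p z‖ = q := by rw [hz2, norm_circleMap_zero, abs_of_pos hq0]
    obtain ⟨j, w, rfl, hw⟩ := hc.surj z hz.1 (hpz ▸ h1) (hpz ▸ h2)
    have hw1 : r < s * ‖w‖ ^ k j := by rw [← hw, hpz]; exact h1
    have hw2 : s * ‖w‖ ^ k j < R := by rw [← hw, hpz]; exact h2
    have h3 : (w / circleMap 0 (τ j) (α / k j)) ^ k j = 1 := by
      have h4 := hpow j 0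
      rw [Nat.cast_zero, zero_mul, add_zero, ← hz2, hc.apply_eq j w hw1 hw2] at h4
      rw [div_pow, ← mul_left_cancel₀ (by exact_mod_cast hc.s_pos.ne') h4]
      exact div_self (pow_ne_zero _ (hcm0 _ _))
    have : NeZero (k j) := ⟨(hc.pos j).ne'⟩
    obtain ⟨n, hn, hn'⟩ := (hω j).eq_pow_of_pow_eq_one h3
    refine ⟨⟨j, n⟩, by simpa using hn, ?_⟩
    simp only
    rw [hcm, hn', mul_div_cancel₀ _ (hcm0 _ _)]

theorem sum_circleIntegral (hp : ProperDisc Ω p) {q : ℝ} (h1 : r < q) (h2 : q < R) {τ : J → ℝ}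
    (hτ0 : ∀ j, 0 < τ j) (hτ : ∀ j, s * τ j ^ k j = q) {G : ℂ → ℂ}
    (hG : ContinuousOn G {z ∈ Ω | ‖p z‖ = q}) :
    (∑ j, ∮ w in C(0, τ j), G (ψ j w) * deriv (ψ j) w) =
      ∮ ζ in C(0, q), trace Ω p (fun z => G z / deriv p z) ζ := by
  have hnorm : ∀ j, ∀ w ∈ sphere (0 : ℂ) (τ j), s * ‖w‖ ^ k j = q := fun j w hw => by
    rw [mem_sphere_zero_iff_norm.1 hw, hτ]
  have hn1 : ∀ j, ∀ w ∈ sphere (0 : ℂ) (τ j), r < s * ‖w‖ ^ k j := fun j x hx =>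
    (hnorm j x hx).symm ▸ h1
  have hn2 : ∀ j, ∀ w ∈ sphere (0 : ℂ) (τ j), s * ‖w‖ ^ k j < R := fun j x hx =>
    (hnorm j x hx).symm ▸ h2
  have hpd : ContinuousOn (deriv p) Ω := (hp.diff.deriv hp.isOpen).continuousOn
  have hH : ∀ j, ContinuousOn (fun w => G (ψ j w) / deriv p (ψ j w)) (sphere 0 (τ j)) := fun j => by
    have hψ : ContinuousOn (ψ j) (sphere 0 (τ j)) :=
      (hc.diff j).continuousOn.mono fun w hw => ⟨hn1 j w hw, hn2 j w hw⟩
    refine ContinuousOn.div (hG.comp hψ fun w hw => ?_) (hpd.comp hψ fun w hw => ?_) fun w hw => ?_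
    · exact ⟨hc.maps j w (hn1 j w hw) (hn2 j w hw), by
        rw [hc.norm_apply (hn1 j w hw) (hn2 j w hw), hnorm j w hw]⟩
    · exact hc.maps j w (hn1 j w hw) (hn2 j w hw)
    · exact (hc.deriv_mul_deriv hp (hn1 j w hw) (hn2 j w hw)).2
  have hstep : ∀ j, (∮ w in C(0, τ j), G (ψ j w) * deriv (ψ j) w) =
      ∑ n ∈ Finset.range (k j), ∫ α in (0 : ℝ)..2 * π,
        G (ψ j (circleMap 0 (τ j) ((α + n * (2 * π)) / k j))) /
          deriv p (ψ j (circleMap 0 (τ j) ((α + n * (2 * π)) / k j))) *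
          ((q : ℂ) * (exp (α * I) * I)) := fun j => by
    have h3 := circleIntegral_mul_pow_eq_sum (hτ0 j) (hc.pos j) (hH j) s
    have h4 : (s : ℂ) * τ j ^ k j = q := by
      rw [← hτ j]
      push_cast
      rfl
    rw [h4] at h3
    rw [← h3]
    refine circleIntegral.integral_congr (hτ0 j).le fun w hw => ?_
    obtain ⟨h5, h6⟩ := hc.deriv_mul_deriv hp (hn1 j w hw) (hn2 j w hw)
    rw [← h5]
    field_simp
  have hInt : ∀ j (n : ℕ), IntervalIntegrable (fun α : ℝ =>
        G (ψ j (circleMap 0 (τ j) ((α + n * (2 * π)) / k j))) /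
          deriv p (ψ j (circleMap 0 (τ j) ((α + n * (2 * π)) / k j))) *
          ((q : ℂ) * (exp (α * I) * I))) volume 0 (2 * π) := fun j n => by
    refine Continuous.intervalIntegrable ?_ _ _
    refine Continuous.mul ((hH j).comp_continuous ((continuous_circleMap 0 (τ j)).comp
      (by fun_prop)) fun x => circleMap_mem_sphere 0 (hτ0 j).le _) (by fun_prop)
  rw [Finset.sum_congr rfl fun j _ => hstep j]
  simp_rw [← intervalIntegral.integral_finsetSum fun n _ => hInt _ n]
  rw [← intervalIntegral.integral_finsetSum fun j _ => by
    simpa only [Finset.sum_fn] using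
      (IntervalIntegrable.sum (Finset.range (k j)) fun n _ => hInt j n)]
  refine intervalIntegral.integral_congr fun α _ => ?_
  simp only [deriv_circleMap, smul_eq_mul]
  rw [hc.trace_circleMap hp h1 h2 hτ0 hτ, Finset.mul_sum]
  refine Finset.sum_congr rfl fun j _ => ?_
  rw [Finset.mul_sum]
  refine Finset.sum_congr rfl fun n _ => ?_
  rw [show circleMap 0 q α = q * exp (α * I) by rw [circleMap, zero_add]]
  ring

variable {m : ℕ} (hρ : 0 < ρ) (hρ1 : ρ < 1) (hkm : ∀ j, k j ≤ m)
  (hrρ : r < s * ρ ^ m) (hρR : s * ρ⁻¹ ^ m < R)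

include hρ hρ1 hkm hrρ hρR

omit [Fintype J] in
theorem mem_domain {j : J} {w : ℂ} (h1 : ρ ≤ ‖w‖) (h2 : ‖w‖ ≤ ρ⁻¹) :
    r < s * ‖w‖ ^ k j ∧ s * ‖w‖ ^ k j < R :=
  ⟨hrρ.trans_le (le_mul_pow_of_le hc.s_pos.le hρ hρ1 (hkm j) h1),
    (mul_pow_le_of_le hc.s_pos.le hρ hρ1 (hkm j) (norm_nonneg w) h2).trans_lt hρR⟩

theorem mem_core_union_iff {S : Set ℝ} (hS : S ⊆ Ioo ρ ρ⁻¹) {z : ℂ} :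
    z ∈ core Ω p s ρ ψ ∪ ⋃ j, ψ j '' {w | ‖w‖ ∈ S} ↔ z ∈ Ω ∧ ‖p z‖ < R ∧
      ∀ j w, r < s * ‖w‖ ^ k j → s * ‖w‖ ^ k j < R → ψ j w = z → ρ < ‖w‖ → ‖w‖ ∈ S := by
  have hdom : ∀ j (w : ℂ), ρ ≤ ‖w‖ → ‖w‖ ≤ ρ⁻¹ → r < s * ‖w‖ ^ k j ∧ s * ‖w‖ ^ k j < R :=
    fun j w => hc.mem_domain hρ hρ1 hkm hrρ hρR
  constructor
  · rintro (⟨⟨hz, hzs⟩, hn⟩ | h)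
    · refine ⟨hz, hzs.trans_lt hc.s_lt, fun j w h1 h2 h3 h4 => absurd ?_ hn⟩
      subst h3
      rw [hc.norm_apply h1 h2] at hzs
      have h5 : ‖w‖ ≤ 1 := by
        by_contra! h
        have := one_lt_pow₀ h (hc.pos j).ne'
        nlinarith [hc.s_pos]
      exact mem_iUnion.2 ⟨j, w, ⟨h4, h5.trans_lt ((one_lt_inv₀ hρ).2 hρ1)⟩, rfl⟩
    · obtain ⟨i, w₀, hw₀, rfl⟩ := mem_iUnion.1 h
      obtain ⟨h1, h2⟩ := hdom i w₀ (hS hw₀).1.le (hS hw₀).2.le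
      refine ⟨hc.maps _ _ h1 h2, by rwa [hc.norm_apply h1 h2], fun j w h3 h4 h5 _ => ?_⟩
      obtain ⟨rfl, rfl⟩ := hc.inj _ _ _ _ h3 h4 h1 h2 h5
      exact hw₀
  · rintro ⟨hz, hzR, h⟩
    have hcore : ‖p z‖ ≤ s → (∀ j w, r < s * ‖w‖ ^ k j → s * ‖w‖ ^ k j < R → ψ j w = z →
        ‖w‖ ≤ ρ) → z ∈ core Ω p s ρ ψ := fun h1 h2 => by
      refine ⟨⟨hz, h1⟩, fun h3 => ?_⟩
      obtain ⟨j, w, hw, h4⟩ := mem_iUnion.1 h3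
      obtain ⟨h5, h6⟩ := hdom j w hw.1.le hw.2.le
      exact (h2 j w h5 h6 h4).not_gt hw.1
    by_cases hr : r < ‖p z‖
    · obtain ⟨j, w, rfl, hw⟩ := hc.surj z hz hr hzR
      rw [hw] at hr hzR
      by_cases hρw : ρ < ‖w‖
      · exact Or.inr (mem_iUnion.2 ⟨j, w, h j w hr hzR rfl hρw, rfl⟩)
      · refine Or.inl (hcore ?_ fun i w' h1 h2 h3 => ?_)
        · rw [hw]
          exact mul_le_of_le_one_right hc.s_pos.le
            (pow_le_one₀ (norm_nonneg w) ((not_lt.1 hρw).trans hρ1.le))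
        · obtain ⟨rfl, rfl⟩ := hc.inj _ _ _ _ h1 h2 hr hzR h3
          exact not_lt.1 hρw
    · refine Or.inl (hcore ((not_lt.1 hr).trans hc.lt_s.le) fun i w' h1 h2 h3 => absurd ?_ hr)
      rw [← h3, hc.norm_apply h1 h2]
      exact h1

theorem mem_reg_iff {t : ℝ} (hρt : ρ < t) (ht : t ≤ ρ⁻¹) {z : ℂ} :
    z ∈ reg (core Ω p s ρ ψ) ρ ψ t ↔ z ∈ Ω ∧ ‖p z‖ < R ∧
      ∀ j w, r < s * ‖w‖ ^ k j → s * ‖w‖ ^ k j < R → ψ j w = z → ‖w‖ < t := by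
  refine (hc.mem_core_union_iff hρ hρ1 hkm hrρ hρR (S := Ioo ρ t)
    (Ioo_subset_Ioo_right ht)).trans ?_
  refine and_congr_right fun _ => and_congr_right fun _ => forall₂_congr fun j w =>
    forall₃_congr fun _ _ _ => ⟨fun h => ?_, fun h h' => ⟨h', h⟩⟩
  by_cases hw : ρ < ‖w‖
  · exact (h hw).2
  · exact (not_lt.1 hw).trans_lt hρt

omit [Fintype J] hρ hρ1 hkm hrρ hρR in
theorem isOpen_image {j : J} {W : Set ℂ} (hW : IsOpen W)
    (h : ∀ w ∈ W, r < s * ‖w‖ ^ k j ∧ s * ‖w‖ ^ k j < R) (hp : ProperDisc Ω p) :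
    IsOpen (ψ j '' W) := by
  refine isOpen_image_of_deriv_ne_zero hW ((hc.diff j).mono h) fun w hw h0 => ?_
  have h1 := (hc.deriv_mul_deriv hp (h w hw).1 (h w hw).2).1
  rw [h0, mul_zero] at h1
  have hw0 : w ≠ 0 := by
    rintro rfl
    have := (h 0 hw).1
    rw [norm_zero, zero_pow (hc.pos j).ne', mul_zero] at this
    exact hc.nonneg.not_gt this
  refine mul_ne_zero (by exact_mod_cast hc.s_pos.ne') (mul_ne_zero
    (by exact_mod_cast (hc.pos j).ne') (pow_ne_zero _ hw0)) h1.symm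

theorem isCompact_core_union (hp : ProperDisc Ω p) {t : ℝ} (ht : t < ρ⁻¹) :
    IsCompact (core Ω p s ρ ψ ∪ ⋃ j, ψ j '' {w | ρ < ‖w‖ ∧ ‖w‖ ≤ t}) := by
  have hB : IsCompact (Ω ∩ p ⁻¹' closedBall 0 (s * ρ⁻¹ ^ m)) :=
    hp.proper _ (closedBall_subset_ball (hρR.trans_le hc.le_one)) (isCompact_closedBall _ _)
  have hsB : s ≤ s * ρ⁻¹ ^ m :=
    le_mul_of_one_le_right hc.s_pos.le (one_le_pow₀ ((one_lt_inv₀ hρ).2 hρ1).le)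
  have hO : IsOpen (⋃ j, ψ j '' {w : ℂ | (r < s * ‖w‖ ^ k j ∧ s * ‖w‖ ^ k j < R) ∧
      ‖w‖ ∈ Ioi (max ρ t)}) := isOpen_iUnion fun j => hc.isOpen_image
    ((isOpen_setOf_mul_norm_pow r s R (k j)).inter (isOpen_Ioi.preimage continuous_norm))
      (fun w hw => hw.1) hp
  convert! hB.diff hO using 1
  ext z
  refine (hc.mem_core_union_iff hρ hρ1 hkm hrρ hρR (S := Ioc ρ t)
    (fun x hx => ⟨hx.1, hx.2.trans_lt ht⟩)).trans ?_
  constructor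
  · rintro ⟨hz, hzR, h⟩
    refine ⟨⟨hz, ?_⟩, fun h3 => ?_⟩
    · rw [mem_preimage, mem_closedBall_zero_iff]
      by_cases hr : r < ‖p z‖
      · obtain ⟨j, w, rfl, hw⟩ := hc.surj z hz hr hzR
        rw [hw] at hr hzR ⊢
        refine mul_pow_le_of_le hc.s_pos.le hρ hρ1 (hkm j) (norm_nonneg w) ?_
        by_cases hρw : ρ < ‖w‖
        · exact (h j w hr hzR rfl hρw).2.trans ht.le
        · exact (not_lt.1 hρw).trans (hρ1.le.trans ((one_lt_inv₀ hρ).2 hρ1).le)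
      · exact (not_lt.1 hr).trans (hc.lt_s.le.trans hsB)
    · obtain ⟨j, w, ⟨hw1, hw2⟩, rfl⟩ := mem_iUnion.1 h3
      have hw3 : max ρ t < ‖w‖ := hw2
      exact ((h j w hw1.1 hw1.2 rfl ((le_max_left _ _).trans_lt hw3)).2).not_gt
        ((le_max_right _ _).trans_lt hw3)
  · rintro ⟨⟨hz, hzB⟩, h⟩
    refine ⟨hz, (mem_closedBall_zero_iff.1 hzB).trans_lt hρR, fun j w h1 h2 h3 h4 => ⟨h4, ?_⟩⟩
    by_contra! h5
    exact h (mem_iUnion.2 ⟨j, w, ⟨⟨h1, h2⟩, max_lt h4 h5⟩, h3⟩)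

theorem isOpen_reg (hp : ProperDisc Ω p) {t : ℝ} (hρt : ρ < t) (ht : t ≤ ρ⁻¹) :
    IsOpen (reg (core Ω p s ρ ψ) ρ ψ t) := by
  have h1 : IsOpen (Ω ∩ (fun z => ‖p z‖) ⁻¹' Iio (s * ρ ^ m)) :=
    hp.diff.continuousOn.norm.isOpen_inter_preimage hp.isOpen isOpen_Iio
  have h2 : IsOpen (⋃ j, ψ j '' {w : ℂ | (r < s * ‖w‖ ^ k j ∧ s * ‖w‖ ^ k j < R) ∧
      ‖w‖ ∈ Iio t}) := isOpen_iUnion fun j => hc.isOpen_image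
    ((isOpen_setOf_mul_norm_pow r s R (k j)).inter (isOpen_Iio.preimage continuous_norm))
      (fun w hw => hw.1) hp
  convert! h1.union h2 using 1
  ext z
  rw [hc.mem_reg_iff hρ hρ1 hkm hrρ hρR hρt ht]
  constructor
  · rintro ⟨hz, hzR, h⟩
    by_cases hr : r < ‖p z‖
    · obtain ⟨j, w, rfl, hw⟩ := hc.surj z hz hr hzR
      rw [hw] at hr hzR
      exact Or.inr (mem_iUnion.2 ⟨j, w, ⟨⟨hr, hzR⟩, h j w hr hzR rfl⟩, rfl⟩)
    · exact Or.inl ⟨hz, (not_lt.1 hr).trans_lt hrρ⟩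
  · rintro (⟨hz, hz2⟩ | h)
    · have hz3 : ‖p z‖ < s * ρ ^ m := hz2
      have h4 : s * ρ ^ m < s := mul_lt_of_lt_one_right hc.s_pos <|
        pow_lt_one₀ hρ.le hρ1 (by
          rintro rfl
          simp only [pow_zero, mul_one] at hrρ hz3 hρR ⊢
          obtain ⟨z', hz', hpz'⟩ := hp.surj s
            (by simpa [abs_of_pos hc.s_pos] using hc.s_lt.trans_le hc.le_one)
          have hn : ‖p z'‖ = s := by rw [hpz', norm_real, Real.norm_of_nonneg hc.s_pos.le]
          obtain ⟨j, -⟩ := hc.surj z' hz' (hn ▸ hc.lt_s) (hn ▸ hc.s_lt)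
          exact absurd (hkm j) (hc.pos j).not_ge)
      refine ⟨hz, (hz3.trans h4).trans hc.s_lt, fun j w h1 h2 h3 => ?_⟩
      by_contra! h5
      have h6 := le_mul_pow_of_le hc.s_pos.le hρ hρ1 (hkm j) (hρt.le.trans h5)
      rw [← hc.norm_apply h1 h2, h3] at h6
      exact h6.not_gt hz3
    · obtain ⟨j, w, ⟨hw1, hw2⟩, rfl⟩ := mem_iUnion.1 h
      refine ⟨hc.maps _ _ hw1.1 hw1.2, (hc.norm_apply hw1.1 hw1.2).trans_lt hw1.2,
        fun i w' h1 h2 h3 => ?_⟩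
      obtain ⟨rfl, rfl⟩ := hc.inj _ _ _ _ h1 h2 hw1.1 hw1.2 h3
      exact hw2

theorem isPreconnected_reg (hp : ProperDisc Ω p)
    (hX : IsPreconnected {z ∈ Ω | ‖p z‖ < R}) {t : ℝ} (hρt : ρ < t) (ht : t ≤ ρ⁻¹) :
    IsPreconnected (reg (core Ω p s ρ ψ) ρ ψ t) := by
  classical
  have hmem := fun {z : ℂ} => hc.mem_reg_iff hρ hρ1 hkm hrρ hρR hρt ht (z := z)
  have hopen := hc.isOpen_reg hρ hρ1 hkm hrρ hρR hp hρt ht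
  refine isPreconnected_of_forall_constant fun f hf => ?_
  set E : J → Set ℂ := fun j => ψ j '' {w : ℂ | r < s * ‖w‖ ^ k j ∧ s * ‖w‖ ^ k j < R} with hE
  have hEo : ∀ j, IsOpen (E j) := fun j => hc.isOpen_image
    (isOpen_setOf_mul_norm_pow r s R (k j)) (fun w hw => hw) hp
  have hdisj : ∀ i j z, z ∈ E i → z ∈ E j → i = j := by
    rintro i j z ⟨w, hw, rfl⟩ ⟨w', hw', h⟩
    exact (hc.inj _ _ _ _ hw'.1 hw'.2 hw.1 hw.2 h).1.symm
  have hρn : ‖(ρ : ℂ)‖ = ρ := by rw [norm_real, Real.norm_of_nonneg hρ.le]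
  have hconst : ∀ j, ∀ z ∈ E j, z ∈ reg (core Ω p s ρ ψ) ρ ψ t → f z = f (ψ j ρ) := by
    rintro j _ ⟨w, hw, rfl⟩ hz
    have hsub : ψ j '' ((fun w : ℂ => ‖w‖) ⁻¹' {x | (0 < x ∧ x < t) ∧ r < s * x ^ k j ∧
        s * x ^ k j < R}) ⊆ reg (core Ω p s ρ ψ) ρ ψ t := by
      rintro _ ⟨x, ⟨⟨-, hxt⟩, hx1, hx2⟩, rfl⟩
      refine hmem.2 ⟨hc.maps _ _ hx1 hx2, (hc.norm_apply hx1 hx2).trans_lt hx2,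
        fun i w' h1 h2 h3 => ?_⟩
      obtain ⟨rfl, rfl⟩ := hc.inj _ _ _ _ h1 h2 hx1 hx2 h3
      exact hxt
    have hpre : IsPreconnected (ψ j '' ((fun w : ℂ => ‖w‖) ⁻¹' {x | (0 < x ∧ x < t) ∧
        r < s * x ^ k j ∧ s * x ^ k j < R})) := by
      refine IsPreconnected.image (isPreconnected_preimage_norm ⟨?_⟩ fun x hx => hx.1.1) _
        ((hc.diff j).continuousOn.mono fun w hw => hw.2)
      rintro x ⟨⟨hx0, hx1⟩, hx2, hx3⟩ y ⟨⟨hy0, hy1⟩, hy2, hy3⟩ v ⟨hv1, hv2⟩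
      have hs := hc.s_pos
      refine ⟨⟨hx0.trans_le hv1, hv2.trans_lt hy1⟩, hx2.trans_le ?_, lt_of_le_of_lt ?_ hy3⟩
      · gcongr
      · have := hx0.le.trans hv1
        gcongr
    have hw0 : 0 < ‖w‖ := by
      rcases (norm_nonneg w).eq_or_lt with h | h
      · have := hw.1
        rw [← h, zero_pow (hc.pos j).ne', mul_zero] at this
        exact absurd this hc.nonneg.not_gt
      · exact h
    refine hpre.constant (hf.mono hsub) ⟨w, ⟨⟨hw0, ?_⟩, hw⟩, rfl⟩ ⟨ρ, ?_, rfl⟩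
    · exact (hmem.1 hz).2.2 j w hw.1 hw.2 rfl
    · rw [mem_preimage, hρn]
      have := hc.mem_domain hρ hρ1 hkm hrρ hρR (j := j) (w := ρ) hρn.ge
        (hρn.trans_le (hρ1.le.trans ((one_lt_inv₀ hρ).2 hρ1).le))
      rw [hρn] at this
      exact ⟨⟨hρ, hρt⟩, this⟩
  set g : ℂ → Bool := fun z => if z ∈ reg (core Ω p s ρ ψ) ρ ψ t then f z else
    if h : ∃ j, z ∈ E j then f (ψ h.choose ρ) else false with hg
  have hgE : ∀ j, ∀ z ∈ E j, g z = f (ψ j ρ) := fun j z hz => by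
    by_cases h : z ∈ reg (core Ω p s ρ ψ) ρ ψ t
    · rw [hg]
      simp only
      rw [if_pos h, hconst j z hz h]
    · have h1 : ∃ j, z ∈ E j := ⟨j, hz⟩
      rw [hg]
      simp only
      rw [if_neg h, dif_pos h1, hdisj _ _ z h1.choose_spec hz]
  have hgr : ∀ z ∈ reg (core Ω p s ρ ψ) ρ ψ t, g z = f z := fun z hz => if_pos hz
  have hgc : ContinuousOn g {z ∈ Ω | ‖p z‖ < R} := by
    rintro z ⟨hz, hzR⟩
    refine ContinuousAt.continuousWithinAt ?_
    by_cases h : z ∈ reg (core Ω p s ρ ψ) ρ ψ t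
    · refine (hf.continuousAt (hopen.mem_nhds h)).congr ?_
      filter_upwards [hopen.mem_nhds h] with x hx using (hgr x hx).symm
    · have h1 : ∃ j, z ∈ E j := by
        by_cases hr : r < ‖p z‖
        · obtain ⟨j, w, rfl, hw⟩ := hc.surj z hz hr hzR
          exact ⟨j, w, ⟨hw ▸ hr, hw ▸ hzR⟩, rfl⟩
        · refine absurd (hmem.2 ⟨hz, hzR, fun j w h1 h2 h3 => absurd ?_ hr⟩) h
          rw [← h3, hc.norm_apply h1 h2]
          exact h1
      obtain ⟨j, hj⟩ := h1
      refine (continuousAt_const (y := f (ψ j ρ))).congr ?_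
      filter_upwards [(hEo j).mem_nhds hj] with x hx using (hgE j x hx).symm
  intro x hx y hy
  rw [← hgr x hx, ← hgr y hy]
  exact hX.constant hgc ⟨(hmem.1 hx).1, (hmem.1 hx).2.1⟩ ⟨(hmem.1 hy).1, (hmem.1 hy).2.1⟩

theorem sum_circleIntegral_eq_zero (hp : ProperDisc Ω p) {t t' : ℝ} (hρt : ρ < t) (htt : t < t')
    (ht' : t' ≤ ρ⁻¹) {F : ℂ → ℂ} (hF : DifferentiableOn ℂ F (reg (core Ω p s ρ ψ) ρ ψ t')) :
    ∑ j, ∮ w in C(0, t), F (ψ j w) * deriv (ψ j) w = 0 := by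
  have hs := hc.s_pos
  have hmem := fun {z : ℂ} => hc.mem_reg_iff hρ hρ1 hkm hrρ hρR (hρt.trans htt) ht' (z := z)
  obtain ⟨q, hq1, hq2⟩ := exists_between hrρ
  have hq0 : 0 < q := hc.nonneg.trans_lt hq1
  have hqR : q < R := hq2.trans ((mul_le_mul_of_nonneg_left (pow_le_pow_left₀ hρ.le
    (hρ1.le.trans ((one_lt_inv₀ hρ).2 hρ1).le) m) hs.le).trans_lt hρR)
  choose τ hτ0 hτ using fun j => exists_mul_pow_eq hs hq0.le (hc.pos j)
  choose σ hσ0 hσ using fun j => exists_mul_pow_eq hs hc.nonneg (hc.pos j)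
  have hτpos : ∀ j, 0 < τ j := fun j => (hτ0 j).lt_of_ne fun h => by
    have := hτ j
    rw [← h, zero_pow (hc.pos j).ne', mul_zero] at this
    exact hq0.ne this
  have hτρ : ∀ j, τ j < ρ := fun j => by
    by_contra! h
    have := le_mul_pow_of_le hs.le hρ hρ1 (hkm j) h
    rw [hτ j] at this
    exact this.not_gt hq2
  have hστ : ∀ j, σ j < τ j := fun j => by
    by_contra! h
    have := mul_le_mul_of_nonneg_left (pow_le_pow_left₀ (hτ0 j) h (k j)) hs.le
    rw [hτ, hσ] at this
    exact this.not_gt hq1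
  have hann : ∀ j, ∀ w ∈ annulus (σ j) t', (r < s * ‖w‖ ^ k j ∧ s * ‖w‖ ^ k j < R) ∧
      ψ j w ∈ reg (core Ω p s ρ ψ) ρ ψ t' := fun j w hw => by
    have h1 : r < s * ‖w‖ ^ k j := by
      rw [← hσ j]
      exact mul_lt_mul_of_pos_left (pow_lt_pow_left₀ hw.1 (hσ0 j) (hc.pos j).ne') hs
    have h2 : s * ‖w‖ ^ k j < R :=
      (mul_pow_le_of_le hs.le hρ hρ1 (hkm j) (norm_nonneg w) (hw.2.le.trans ht')).trans_lt hρR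
    refine ⟨⟨h1, h2⟩, hmem.2 ⟨hc.maps j w h1 h2, (hc.norm_apply h1 h2).trans_lt h2,
      fun i w' h3 h4 h5 => ?_⟩⟩
    obtain ⟨rfl, rfl⟩ := hc.inj _ _ _ _ h3 h4 h1 h2 h5
    exact hw.2
  have hd : ∀ j, DifferentiableOn ℂ (fun w => F (ψ j w) * deriv (ψ j) w) (annulus (σ j) t') :=
    fun j => (hF.comp ((hc.diff j).mono fun w hw => (hann j w hw).1) fun w hw =>
      (hann j w hw).2).mul (((hc.diff j).deriv (isOpen_setOf_mul_norm_pow r s R (k j))).mono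
        fun w hw => (hann j w hw).1)
  rw [Finset.sum_congr rfl fun j _ => circleIntegral_eq_of_differentiableOn_annulus (hσ0 j) (hd j)
    (((hστ j).trans (hτρ j)).trans hρt) htt (hστ j) ((hτρ j).trans (hρt.trans htt))]
  have hsub : Ω ∩ p ⁻¹' ball 0 (s * ρ ^ m) ⊆ reg (core Ω p s ρ ψ) ρ ψ t' := fun z hz => by
    have hz2 : ‖p z‖ < s * ρ ^ m := mem_ball_zero_iff.1 hz.2
    refine hmem.2 ⟨hz.1, ?_, fun j w h1 h2 h3 => ?_⟩
    · exact hz2.trans ((mul_le_mul_of_nonneg_left (pow_le_pow_left₀ hρ.le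
        (hρ1.le.trans ((one_lt_inv₀ hρ).2 hρ1).le) m) hs.le).trans_lt hρR)
    · by_contra! h
      have := le_mul_pow_of_le hs.le hρ hρ1 (hkm j) ((hρt.trans htt).le.trans h)
      rw [← hc.norm_apply h1 h2, h3] at this
      exact this.not_gt hz2
  have hFc : ContinuousOn F {z ∈ Ω | ‖p z‖ = q} := hF.continuousOn.mono fun z hz =>
    hsub ⟨hz.1, mem_ball_zero_iff.2 (hz.2.trans_lt hq2)⟩
  rw [hc.sum_circleIntegral hp hq1 hqR hτpos hτ hFc]
  have hlt1 : s * ρ ^ m ≤ 1 := by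
    have h1 : s * ρ ^ m ≤ s := mul_le_of_le_one_right hs.le (pow_le_one₀ hρ.le hρ1.le)
    linarith [hc.s_lt, hc.le_one]
  obtain ⟨T, hT, hTe⟩ := hp.exists_trace_div_deriv_extension (F := F) isOpen_ball
    (ball_subset_ball hlt1) (hF.mono hsub)
  have h1 : (∮ ζ in C(0, q), trace Ω p (fun z => F z / deriv p z) ζ) = ∮ ζ in C(0, q), T ζ := by
    refine circleIntegral.integral_congr hq0.le fun ζ hζ => (hTe ⟨?_, ?_⟩).symm
    · rw [mem_ball_zero_iff, mem_sphere_zero_iff_norm.1 hζ]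
      exact hq2
    · refine hc.notMem_critVals ζ ?_
      rw [annulus, Set.mem_ofPred_eq, mem_sphere_zero_iff_norm.1 hζ]
      exact ⟨hq1, hqR⟩
  rw [h1]
  have h2 : closedBall (0 : ℂ) q ⊆ ball 0 (s * ρ ^ m) := closedBall_subset_ball hq2
  refine circleIntegral_eq_zero_of_differentiable_on_off_countable hq0.le countable_empty
    (hT.continuousOn.mono h2) fun ζ hζ => ?_
  exact hT.differentiableAt (isOpen_ball.mem_nhds (h2 (ball_subset_closedBall hζ.1)))

theorem sum_circleIntegral_div_sub_eq (hp : ProperDisc Ω p) {t : ℝ} (hρt : ρ < t) (ht : t < ρ⁻¹)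
    {z₀ : ℂ} (hz₀ : z₀ ∈ reg (core Ω p s ρ ψ) ρ ψ t) (hcrit : p z₀ ∉ critVals Ω p) :
    ∑ j, ∮ w in C(0, t), deriv (ψ j) w / (ψ j w - z₀) = 2 * π * I := by
  have hs := hc.s_pos
  obtain ⟨hzΩ, hzR, hzt⟩ := (hc.mem_reg_iff hρ hρ1 hkm hrρ hρR hρt ht.le).1 hz₀
  obtain ⟨t₁, ht₁0, ht₁, hz₁⟩ : ∃ t₁, ρ ≤ t₁ ∧ t₁ < t ∧ ∀ j w, r < s * ‖w‖ ^ k j →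
      s * ‖w‖ ^ k j < R → ψ j w = z₀ → ‖w‖ ≤ t₁ := by
    by_cases h : ∃ i w₀, r < s * ‖w₀‖ ^ k i ∧ s * ‖w₀‖ ^ k i < R ∧ ψ i w₀ = z₀
    · obtain ⟨i, w₀, h1, h2, h3⟩ := h
      refine ⟨max ρ ‖w₀‖, le_max_left _ _, max_lt hρt (hzt i w₀ h1 h2 h3), fun j w h4 h5 h6 => ?_⟩
      obtain ⟨rfl, rfl⟩ := hc.inj _ _ _ _ h4 h5 h1 h2 (h6.trans h3.symm)
      exact le_max_right _ _
    · exact ⟨ρ, le_rfl, hρt, fun j w h4 h5 h6 => absurd ⟨j, w, h4, h5, h6⟩ h⟩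
  obtain ⟨q, hq1, hq2⟩ := exists_between hρR
  have hrq : r < q := (hrρ.trans_le (mul_le_mul_of_nonneg_left (pow_le_pow_left₀ hρ.le
    (hρ1.le.trans ((one_lt_inv₀ hρ).2 hρ1).le) m) hs.le)).trans hq1
  have hq0 : 0 < q := hc.nonneg.trans_lt hrq
  have hRpos : 0 < R := hq0.trans hq2
  choose τ hτ0 hτ using fun j => exists_mul_pow_eq hs hq0.le (hc.pos j)
  choose σ hσ0 hσ using fun j => exists_mul_pow_eq hs hRpos.le (hc.pos j)
  have hτρ : ∀ j, ρ⁻¹ < τ j := fun j => by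
    by_contra! h
    have := mul_pow_le_of_le hs.le hρ hρ1 (hkm j) (hτ0 j) h
    rw [hτ j] at this
    exact this.not_gt hq1
  have hτpos : ∀ j, 0 < τ j := fun j => (inv_pos.2 hρ).trans (hτρ j)
  have hτσ : ∀ j, τ j < σ j := fun j => by
    by_contra! h
    have := mul_le_mul_of_nonneg_left (pow_le_pow_left₀ (hσ0 j) h (k j)) hs.le
    rw [hτ, hσ] at this
    exact this.not_gt hq2
  have ht₁pos : 0 ≤ t₁ := hρ.le.trans ht₁0
  have hann : ∀ j, ∀ w ∈ annulus t₁ (σ j), (r < s * ‖w‖ ^ k j ∧ s * ‖w‖ ^ k j < R) ∧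
      ψ j w ≠ z₀ := fun j w hw => by
    have h1 : r < s * ‖w‖ ^ k j :=
      hrρ.trans_le (le_mul_pow_of_le hs.le hρ hρ1 (hkm j) (ht₁0.trans hw.1.le))
    have h2 : s * ‖w‖ ^ k j < R := by
      rw [← hσ j]
      exact mul_lt_mul_of_pos_left (pow_lt_pow_left₀ hw.2 (norm_nonneg w) (hc.pos j).ne') hs
    exact ⟨⟨h1, h2⟩, fun h => (hz₁ j w h1 h2 h).not_gt hw.1⟩
  have hd : ∀ j, DifferentiableOn ℂ (fun w => deriv (ψ j) w / (ψ j w - z₀)) (annulus t₁ (σ j)) :=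
    fun j => (((hc.diff j).deriv (isOpen_setOf_mul_norm_pow r s R (k j))).mono
        fun w hw => (hann j w hw).1).div (((hc.diff j).mono fun w hw => (hann j w hw).1).sub_const _)
      fun w hw => sub_ne_zero.2 (hann j w hw).2
  rw [Finset.sum_congr rfl fun j _ => circleIntegral_eq_of_differentiableOn_annulus ht₁pos (hd j)
    ht₁ (ht.trans ((hτρ j).trans (hτσ j))) ((ht₁.trans ht).trans (hτρ j)) (hτσ j)]
  have hp₀ : ‖p z₀‖ < q := by
    by_cases hr : r < ‖p z₀‖
    · obtain ⟨j, w, rfl, hw⟩ := hc.surj z₀ hzΩ hr hzR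
      rw [hw] at hr hzR ⊢
      exact (mul_pow_le_of_le hs.le hρ hρ1 (hkm j) (norm_nonneg w)
        ((hzt j w hr hzR rfl).le.trans ht.le)).trans_lt hq1
    · exact (not_lt.1 hr).trans_lt hrq
  have hne : ∀ z, ‖p z‖ = q → z - z₀ ≠ 0 := fun z hz h => by
    rw [sub_eq_zero.1 h] at hz
    exact hp₀.ne hz
  have hGc : ContinuousOn (fun z => (z - z₀)⁻¹) {z ∈ Ω | ‖p z‖ = q} :=
    ContinuousOn.inv₀ (by fun_prop) fun z hz => hne z hz.2
  have hlev := hc.sum_circleIntegral hp hrq hq2 hτpos hτ hGc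
  have h0 : ∀ j, (∮ w in C(0, τ j), deriv (ψ j) w / (ψ j w - z₀)) =
      ∮ w in C(0, τ j), (ψ j w - z₀)⁻¹ * deriv (ψ j) w := fun j => by
    congr 1
    ext w
    rw [div_eq_inv_mul]
  rw [Finset.sum_congr rfl fun j _ => h0 j, hlev]
  obtain ⟨H, hH, hHe⟩ := hp.exists_trace_div_deriv_extension (F := dslope p z₀)
    (V := ball 0 1) isOpen_ball le_rfl
    ((differentiableOn_dslope_of_isOpen hp.isOpen hp.diff hzΩ).mono inter_subset_left)
  have hq1' : q < 1 := hq2.trans_le hc.le_one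
  have h1 : (∮ ζ in C(0, q), trace Ω p (fun z => (z - z₀)⁻¹ / deriv p z) ζ) =
      ∮ ζ in C(0, q), (ζ - p z₀)⁻¹ • H ζ := by
    refine circleIntegral.integral_congr hq0.le fun ζ hζ => ?_
    have hζq : ‖ζ‖ = q := mem_sphere_zero_iff_norm.1 hζ
    have hζb : ζ ∈ ball (0 : ℂ) 1 := mem_ball_zero_iff.2 (hζq ▸ hq1')
    rw [hHe ⟨hζb, hc.notMem_critVals ζ ⟨hζq ▸ hrq, hζq ▸ hq2⟩⟩, hp.trace_eq_sum hζb,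
      hp.trace_eq_sum hζb, smul_eq_mul, Finset.mul_sum]
    refine Finset.sum_congr rfl fun z hz => ?_
    rw [Set.Finite.mem_toFinset] at hz
    have hpz : p z = ζ := hz.2
    have h2 := hne z (hpz ▸ hζq)
    have h3 : p z - p z₀ = (z - z₀) * dslope p z₀ z := by
      rw [← smul_eq_mul, sub_smul_dslope]
    have h4 : ζ - p z₀ ≠ 0 := fun h => by
      rw [sub_eq_zero.1 h] at hζq
      exact hp₀.ne hζq
    rw [← hpz] at h4 ⊢
    rw [h3] at h4 ⊢
    have h5 := right_ne_zero_of_mul h4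
    field_simp
  rw [h1, (hH.mono (closedBall_subset_ball hq1')).circleIntegral_sub_inv_smul
    (mem_ball_zero_iff.2 hp₀)]
  have hζ₀ := hp.maps z₀ hzΩ
  have h2 : H (p z₀) = 1 := by
    rw [hHe ⟨hζ₀, hcrit⟩, hp.trace_eq_sum hζ₀]
    rw [Finset.sum_eq_single z₀]
    · rw [dslope_same]
      exact div_self fun h => hcrit ⟨z₀, ⟨hzΩ, h⟩, rfl⟩
    · intro z hz hzz
      rw [Set.Finite.mem_toFinset] at hz
      have hpz : p z = p z₀ := hz.2
      rw [dslope_of_ne _ hzz, slope_def_field, hpz, sub_self, zero_div, zero_div]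
    · intro h
      exact absurd ((hp.finite_fibre hζ₀).mem_toFinset.2 ⟨hzΩ, rfl⟩) h
  rw [h2, smul_eq_mul, mul_one]

theorem sum_circleIntegral_div_sub (hp : ProperDisc Ω p) {t : ℝ} (hρt : ρ < t) (ht : t < ρ⁻¹)
    {z₀ : ℂ} (hz₀ : z₀ ∈ reg (core Ω p s ρ ψ) ρ ψ t) :
    ∑ j, ∮ w in C(0, t), deriv (ψ j) w / (ψ j w - z₀) = 2 * π * I := by
  have ht0 : 0 < t := hρ.trans hρt
  have hopen := hc.isOpen_reg hρ hρ1 hkm hrρ hρR hp hρt ht.le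
  have hmem := fun {z : ℂ} => hc.mem_reg_iff hρ hρ1 hkm hrρ hρR hρt ht.le (z := z)
  have hdom : ∀ j, ∀ w ∈ sphere (0 : ℂ) t, r < s * ‖w‖ ^ k j ∧ s * ‖w‖ ^ k j < R := fun j w hw => by
    rw [mem_sphere_zero_iff_norm] at hw
    exact hc.mem_domain hρ hρ1 hkm hrρ hρR (hw ▸ hρt.le) (hw ▸ ht.le)
  have hcont : ContinuousOn (fun z => ∑ j, ∮ w in C(0, t), deriv (ψ j) w / (ψ j w - z))
      (reg (core Ω p s ρ ψ) ρ ψ t) := by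
    refine continuousOn_finsetSum _ fun j _ => continuousOn_circleIntegral ht0.le ?_
    have h1 : ContinuousOn (ψ j) (sphere 0 t) := (hc.diff j).continuousOn.mono (hdom j)
    have h2 : ContinuousOn (deriv (ψ j)) (sphere 0 t) :=
      ((hc.diff j).deriv (isOpen_setOf_mul_norm_pow r s R (k j))).continuousOn.mono (hdom j)
    refine ContinuousOn.div (h2.comp continuousOn_snd fun x hx => hx.2)
      ((h1.comp continuousOn_snd fun x hx => hx.2).sub continuousOn_fst) ?_
    rintro ⟨z, w⟩ ⟨hz, hw⟩ h0
    obtain ⟨h3, h4⟩ := hdom j w hw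
    have := (hmem.1 hz).2.2 j w h3 h4 (sub_eq_zero.1 h0)
    rw [mem_sphere_zero_iff_norm.1 hw] at this
    exact lt_irrefl _ this
  have hdense : z₀ ∈ closure (reg (core Ω p s ρ ψ) ρ ψ t \ p ⁻¹' critVals Ω p) :=
    diff_dense_of_discrete hopen (fun z hz => hp.discrete_preimage_critVals z (hmem.1 hz).1) hz₀
  have h1 := (hcont z₀ hz₀).mono (sdiff_subset (t := p ⁻¹' critVals Ω p))
  have h2 := mem_closure_iff_nhdsWithin_neBot.1 hdense
  refine tendsto_nhds_unique h1 (tendsto_const_nhds.congr' ?_)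
  filter_upwards [self_mem_nhdsWithin] with z hz
  exact (hc.sum_circleIntegral_div_sub_eq hρ hρ1 hkm hrρ hρR hp hρt ht hz.1
    hz.2).symm

theorem collared (hp : ProperDisc Ω p) (hX : IsPreconnected {z ∈ Ω | ‖p z‖ < R}) :
    Collared (core Ω p s ρ ψ) ρ ψ where
  pos := hρ
  lt_one := hρ1
  diff j := (hc.diff j).mono fun w hw => hc.mem_domain hρ hρ1 hkm hrρ hρR hw.1.le hw.2.le
  deriv_ne j w hw h := by
    obtain ⟨h1, h2⟩ := hc.mem_domain hρ hρ1 hkm hrρ hρR (j := j) hw.1.le hw.2.le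
    have h3 := (hc.deriv_mul_deriv hp h1 h2).1
    rw [h, mul_zero] at h3
    exact mul_ne_zero (by exact_mod_cast hc.s_pos.ne') (mul_ne_zero
      (by exact_mod_cast (hc.pos j).ne') (pow_ne_zero _ (norm_pos_iff.1 (hρ.trans hw.1)))) h3.symm
  inj i j w hw w' hw' h := by
    obtain ⟨h1, h2⟩ := hc.mem_domain hρ hρ1 hkm hrρ hρR (j := i) hw.1.le hw.2.le
    obtain ⟨h3, h4⟩ := hc.mem_domain hρ hρ1 hkm hrρ hρR (j := j) hw'.1.le hw'.2.le
    exact hc.inj _ _ _ _ h1 h2 h3 h4 h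
  notMem j w hw h := h.2 (mem_iUnion.2 ⟨j, w, hw, rfl⟩)
  isCompact t _ ht := hc.isCompact_core_union hρ hρ1 hkm hrρ hρR hp ht
  isOpen t h1 h2 := hc.isOpen_reg hρ hρ1 hkm hrρ hρR hp h1 h2
  preconn t h1 h2 := hc.isPreconnected_reg hρ hρ1 hkm hrρ hρR hp hX h1 h2
  cauchy t t' h1 h2 h3 F hF := hc.sum_circleIntegral_eq_zero hρ hρ1 hkm hrρ hρR hp h1 h2 h3 hF
  index t h1 h2 z hz := hc.sum_circleIntegral_div_sub hρ hρ1 hkm hrρ hρR hp h1 h2 hz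

end Cylinders

/-- Sublevel sets of a proper map are exhausted by collared regions. -/
theorem ProperDisc.exists_collared {Ω : Set ℂ} {p : ℂ → ℂ} (hp : ProperDisc Ω p) {s₁ : ℝ}
    (hs₁ : s₁ < 1) : ∃ (J : Type) (_ : Fintype J) (K : Set ℂ) (ρ : ℝ) (ψ : J → ℂ → ℂ),
      Collared K ρ ψ ∧ Fintype.card J ≤ hp.degree ∧ {z ∈ Ω | ‖p z‖ ≤ s₁} ⊆ K ∧
      reg K ρ ψ ρ⁻¹ ⊆ Ω := by
  obtain ⟨s₀, hs₀, hconn⟩ := hp.exists_isPreconnected_sublevel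
  obtain ⟨c, hc, hc1⟩ := exists_between (max_lt (max_lt hs₁ hs₀) (zero_lt_one (α := ℝ)))
  obtain ⟨c', hcc', hc'1⟩ := exists_between hc1
  have hc0 : 0 ≤ c := (le_max_right _ _).trans hc.le
  have hfin := (hp.finite_critVals (isCompact_closedBall 0 c')
    (closedBall_subset_ball hc'1)).image norm
  obtain ⟨R, ⟨hcR, hRc⟩, hR⟩ : ∃ R, R ∈ Ioo c c' ∧
      ∀ x ∈ norm '' (closedBall 0 c' ∩ critVals Ω p), c < x → R ≤ x := by
    have hopen : ∀ᶠ R in 𝓝[>] c, ∀ x ∈ norm '' (closedBall 0 c' ∩ critVals Ω p), c < x → R ≤ x := by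
      refine (Set.Finite.eventually_all hfin).2 fun x _ => ?_
      by_cases h : c < x
      · filter_upwards [nhdsWithin_le_nhds (Iic_mem_nhds h)] with R hR _ using hR
      · exact Eventually.of_forall fun R h' => absurd h' h
    exact ((show ∀ᶠ R in 𝓝[>] c, R ∈ Ioo c c' from Ioo_mem_nhdsGT hcc').and hopen).exists
  obtain ⟨s, hcs, hsR⟩ := exists_between hcR
  have hcrit : ∀ ζ ∈ annulus c R, ζ ∉ critVals Ω p := fun ζ hζ h =>
    (hR ‖ζ‖ ⟨ζ, ⟨mem_closedBall_zero_iff.2 (hζ.2.le.trans hRc.le), h⟩, rfl⟩ hζ.1).not_gt hζ.2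
  obtain ⟨J, _, k, ψ, hcyl, hcard⟩ := hp.exists_cylinders hc0 hcs hsR (hRc.trans hc'1).le hcrit
  obtain ⟨m, hm⟩ : ∃ m, ∀ j, k j ≤ m :=
    ⟨∑ j, k j, fun j => Finset.single_le_sum (fun _ _ => Nat.zero_le _) (Finset.mem_univ j)⟩
  have ht1 : Tendsto (fun ρ : ℝ => s * ρ ^ m) (𝓝[<] 1) (𝓝 s) := by
    have : Continuous fun ρ : ℝ => s * ρ ^ m := by fun_prop
    simpa using (this.tendsto 1).mono_left nhdsWithin_le_nhds
  have ht2 : Tendsto (fun ρ : ℝ => s * ρ⁻¹ ^ m) (𝓝[<] 1) (𝓝 s) := by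
    have : ContinuousAt (fun ρ : ℝ => s * ρ⁻¹ ^ m) 1 := by fun_prop (disch := norm_num)
    simpa using this.tendsto.mono_left nhdsWithin_le_nhds
  obtain ⟨ρ, ⟨⟨h1, h2⟩, hρ0⟩, hρ1⟩ := ((((ht1.eventually (lt_mem_nhds hcs)).and
    (ht2.eventually (gt_mem_nhds hsR))).and (nhdsWithin_le_nhds (lt_mem_nhds zero_lt_one))).and
      self_mem_nhdsWithin).exists
  have hs₀R : s₀ < R := ((le_max_right _ _).trans (le_max_left _ _)).trans_lt (hc.trans hcR)
  have hcol := hcyl.collared hρ0 hρ1 hm h1 h2 hp (hconn R hs₀R)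
  have hs₁c : s₁ < c := ((le_max_left _ _).trans (le_max_left _ _)).trans_lt hc
  refine ⟨J, inferInstance, _, ρ, ψ, hcol, hcard, fun z hz => ?_, fun z hz => ?_⟩
  · have hzc : ‖p z‖ < c := lt_of_le_of_lt hz.2 hs₁c
    refine ⟨⟨hz.1, hzc.le.trans hcs.le⟩, fun h => ?_⟩
    obtain ⟨j, w, hw, rfl⟩ := mem_iUnion.1 h
    obtain ⟨h3, h4⟩ := hcyl.mem_domain hρ0 hρ1 hm h1 h2 (j := j) hw.1.le hw.2.le
    rw [hcyl.norm_apply h3 h4] at hzc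
    exact h3.not_gt hzc
  · exact ((hcyl.mem_reg_iff hρ0 hρ1 hm h1 h2 (hρ1.trans ((one_lt_inv₀ hρ0).2 hρ1)) le_rfl).1 hz).1

theorem Ultrafilter.exists_tendsto_of_norm_le {ι : Type*} (l : Ultrafilter ι) {u : ι → ℂ} {C : ℝ}
    (h : ∀ᶠ n in l, ‖u n‖ ≤ C) : ∃ x, ‖x‖ ≤ C ∧ Tendsto u l (𝓝 x) := by
  obtain ⟨x, hx, hl⟩ := (isCompact_closedBall (0 : ℂ) C).ultrafilter_le_nhds (l.map u)
    (le_principal_iff.2 (h.mono fun n hn => mem_closedBall_zero_iff.2 hn))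
  exact ⟨x, mem_closedBall_zero_iff.1 hx, hl⟩

theorem norm_sub_le_of_norm_le_on_ball {F : ℂ → ℂ} {z : ℂ} {r C : ℝ} (hr : 0 < r)
    (hF : DifferentiableOn ℂ F (ball z r)) (hC : ∀ w ∈ ball z r, ‖F w‖ ≤ C) {x y : ℂ}
    (hx : x ∈ ball z (r / 2)) (hy : y ∈ ball z (r / 2)) : ‖F y - F x‖ ≤ C / (r / 4) * ‖y - x‖ := by
  have hsub : ∀ w ∈ ball z (r / 2), closedBall w (r / 4) ⊆ ball z r := fun w hw =>
    closedBall_subset_ball' (by have := mem_ball.1 hw; linarith)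
  refine (convex_ball z (r / 2)).norm_image_sub_le_of_norm_deriv_le
    (fun w hw => hF.differentiableAt (isOpen_ball.mem_nhds (ball_subset_ball (by linarith) hw)))
    (fun w hw => ?_) hx hy
  exact Complex.norm_deriv_le_of_forall_mem_sphere_norm_le (by positivity)
    (hF.diffContOnCl_ball (hsub w hw)) fun v hv => hC v (hsub w hw (sphere_subset_closedBall hv))

/-- A locally bounded pointwise convergent family of holomorphic functions converges locally
uniformly, together with its derivatives. -/
theorem tendstoLocallyUniformlyOn_of_locally_bounded {ι : Type*} {l : Filter ι} [l.NeBot]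
    {Ω : Set ℂ} {F : ι → ℂ → ℂ} {f : ℂ → ℂ} (hb : ∀ z ∈ Ω, ∃ C, ∃ r > 0, ∀ᶠ n in l,
      DifferentiableOn ℂ (F n) (ball z r) ∧ ∀ w ∈ ball z r, ‖F n w‖ ≤ C)
    (hΩ : IsOpen Ω) (hf : ∀ z ∈ Ω, Tendsto (fun n => F n z) l (𝓝 (f z))) :
    DifferentiableOn ℂ f Ω ∧ TendstoLocallyUniformlyOn F f l Ω ∧
      ∀ z ∈ Ω, Tendsto (fun n => deriv (F n) z) l (𝓝 (deriv f z)) := by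
  have key : ∀ z ∈ Ω, ∃ r > 0, (∀ᶠ n in l, DifferentiableOn ℂ (F n) (ball z r)) ∧
      TendstoUniformlyOn F f l (ball z r) := by
    intro z hz
    obtain ⟨C, r₁, hr₁, h₁⟩ := hb z hz
    obtain ⟨r₂, hr₂, h₂⟩ := Metric.isOpen_iff.1 hΩ z hz
    set r := min r₁ r₂
    have hr : 0 < r := lt_min hr₁ hr₂
    have h : ∀ᶠ n in l, DifferentiableOn ℂ (F n) (ball z r) ∧ ∀ w ∈ ball z r, ‖F n w‖ ≤ C :=
      h₁.mono fun n hn => ⟨hn.1.mono (ball_subset_ball (min_le_left _ _)), fun w hw =>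
        hn.2 w (ball_subset_ball (min_le_left _ _) hw)⟩
    have hΩr : ball z r ⊆ Ω := (ball_subset_ball (min_le_right _ _)).trans h₂
    have hhalf : ball z (r / 2) ⊆ ball z r := ball_subset_ball (by linarith)
    have hC0 : 0 ≤ C := by
      obtain ⟨n, hn⟩ := h.exists
      exact (norm_nonneg _).trans (hn.2 z (mem_ball_self hr))
    set L := C / (r / 4)
    have hL : 0 ≤ L := by positivity
    have hlip : ∀ x ∈ ball z (r / 2), ∀ y ∈ ball z (r / 2), ‖f y - f x‖ ≤ L * ‖y - x‖ :=
      fun x hx y hy => le_of_tendsto ((hf y (hΩr (hhalf hy))).sub (hf x (hΩr (hhalf hx)))).norm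
        (h.mono fun n hn => norm_sub_le_of_norm_le_on_ball hr hn.1 hn.2 hx hy)
    refine ⟨r / 2, by positivity, h.mono fun n hn => hn.1.mono hhalf, ?_⟩
    refine Metric.tendstoUniformlyOn_iff.2 fun ε hε => ?_
    obtain ⟨t, hts, htf, htc⟩ := Metric.finite_approx_of_totallyBounded
      ((isCompact_closedBall z (r / 2)).totallyBounded.subset ball_subset_closedBall)
      (ε / (3 * (L + 1))) (by positivity)
    have hev : ∀ᶠ n in l, ∀ x ∈ t, ‖F n x - f x‖ < ε / 3 := (eventually_all_finite htf).2
      fun x hx => (tendsto_iff_norm_sub_tendsto_zero.1 (hf x (hΩr (hhalf (hts hx))))).eventually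
        (gt_mem_nhds (by positivity))
    filter_upwards [h, hev] with n hn hn' y hy
    obtain ⟨x, hx, hyx⟩ := mem_iUnion₂.1 (htc hy)
    have h0 : L * ‖y - x‖ < ε / 3 := calc
      L * ‖y - x‖ ≤ (L + 1) * ‖y - x‖ := by gcongr; linarith
      _ < (L + 1) * (ε / (3 * (L + 1))) := by
        gcongr
        rwa [mem_ball, dist_eq_norm] at hyx
      _ = ε / 3 := by field_simp
    have h1 := hlip x (hts hx) y hy
    have h2 : ‖F n y - F n x‖ ≤ L * ‖y - x‖ := norm_sub_le_of_norm_le_on_ball hr hn.1 hn.2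
      (hts hx) hy
    have h3 := hn' x hx
    rw [dist_eq_norm, show f y - F n y = (f y - f x) - (F n y - F n x) - (F n x - f x) by ring]
    refine ((norm_sub_le _ _).trans (add_le_add_left (norm_sub_le _ _) _)).trans_lt ?_
    linarith
  refine ⟨fun z hz => ?_, fun u hu z hz => ?_, fun z hz => ?_⟩
  · obtain ⟨r, hr, hd, ht⟩ := key z hz
    exact ((ht.tendstoLocallyUniformlyOn.differentiableOn hd isOpen_ball).differentiableAt
      (ball_mem_nhds z hr)).differentiableWithinAt
  · obtain ⟨r, hr, -, ht⟩ := key z hz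
    exact ⟨ball z r, mem_nhdsWithin_of_mem_nhds (ball_mem_nhds z hr), ht u hu⟩
  · obtain ⟨r, hr, hd, ht⟩ := key z hz
    exact (ht.tendstoLocallyUniformlyOn.deriv hd isOpen_ball).tendsto_at (mem_ball_self hr)

/-- The Szegő kernel `S`, the denominators `D` and the quotients `f` of a subdomain `Ω'` of `Ω`,
for base points in `A`. -/
structure SzegoLevel (Ω A Ω' : Set ℂ) (p : ℂ → ℂ) (m : ℕ) (S D f : ℂ → ℂ → ℂ) : Prop where
  isOpen : IsOpen Ω'
  sub : A ⊆ Ω'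
  subset : Ω' ⊆ Ω
  diff : ∀ a ∈ A, DifferentiableOn ℂ (S a) Ω'
  diff_denom : ∀ a ∈ A, DifferentiableOn ℂ (D a) Ω'
  mul_denom : ∀ a ∈ A, ∀ z ∈ Ω', f a z * D a z = (z - a) * S a z
  diff_quot : ∀ a ∈ A, DifferentiableOn ℂ (f a) Ω'
  norm_quot_lt : ∀ a ∈ A, ∀ z ∈ Ω', ‖f a z‖ < 1
  quot_self : ∀ a ∈ A, f a a = 0
  deriv_quot : ∀ a ∈ A, deriv (f a) a = S a a
  im_self : ∀ a ∈ A, (S a a).im = 0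
  extremal : ∀ a ∈ A, ∀ g : ℂ → ℂ, DifferentiableOn ℂ g Ω → (∀ z ∈ Ω, ‖g z‖ ≤ 1) → g a = 0 →
    ‖deriv g a‖ ≤ (S a a).re
  symm : ∀ a ∈ A, ∀ b ∈ A, S a b = conj (S b a)
  norm_sq_le : ∀ a ∈ A, ∀ b ∈ A, ‖S a b‖ ^ 2 ≤ (S a a).re * (S b b).re
  blaschke : ∀ a ∈ A, ∃ ζ : Fin m → ℂ, (∀ l, ‖ζ l‖ ≤ 1) ∧ ∀ z ∈ Ω',
    ∏ l, ‖p z - ζ l‖ ≤ ‖f a z‖ * ∏ l, ‖1 - conj (ζ l) * p z‖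

theorem ProperDisc.exists_szegoLevel {Ω : Set ℂ} {p : ℂ → ℂ} (hp : ProperDisc Ω p) {s : ℝ}
    (hs : s < 1) : ∃ Ω' S D f, SzegoLevel Ω {z ∈ Ω | ‖p z‖ ≤ s} Ω' p hp.degree S D f := by
  obtain ⟨J, _, K, ρ, ψ, hC, hcard, hK, hreg⟩ := hp.exists_collared hs
  obtain hA | hA := {z ∈ Ω | ‖p z‖ ≤ s}.eq_empty_or_nonempty
  · refine ⟨∅, fun _ _ => 0, fun _ _ => 0, fun _ _ => 0, ?_⟩
    rw [hA]
    constructor <;> simp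
  obtain ⟨σ, hσ, hw⟩ := hC.exists_halfDensity (hA.mono hK)
  have hex : ∀ a, ∃ R S M, a ∈ K → IsSzegoPair K ρ ψ σ a R S M := fun a => by
    by_cases ha : a ∈ K
    · obtain ⟨R, S, M, h⟩ := hC.exists_isSzegoPair hσ ha
      exact ⟨R, S, M, fun _ => h⟩
    · exact ⟨0, 0, 0, fun h => absurd h ha⟩
  choose R S M hp' using hex
  have hpair := fun a ha => hp' a (hK ha)
  have h1 : ∀ a ∈ {z ∈ Ω | ‖p z‖ ≤ s}, reg K ρ ψ 1 ⊆ reg K ρ ψ (R a) := fun a ha =>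
    reg_mono K ρ ψ (hpair a ha).one_lt.le
  have hsub : reg K ρ ψ 1 ⊆ Ω := (reg_mono K ρ ψ hC.one_lt.le).trans hreg
  refine ⟨reg K ρ ψ 1, S, fun a z => 1 + (z - a) * M a z, fun a => szegoQuotient a (S a) (M a),
    hC.isOpen 1 hC.lt_one hC.one_lt.le, fun z hz => Or.inl (hK hz), hsub,
    fun a ha => (hpair a ha).diff.mono (h1 a ha), fun a ha => ?_, fun a ha z hz => ?_,
    fun a ha => hC.differentiableOn_szegoQuotient hσ hw (hpair a ha) (hK ha),
    fun a ha z hz => hC.norm_szegoQuotient_lt hσ hw (hpair a ha) (hK ha) hz,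
    fun a _ => by simp [szegoQuotient],
    fun a ha => hC.deriv_szegoQuotient (hpair a ha) (hK ha),
    fun a ha => hC.szego_im hσ (hpair a ha) (hK ha),
    fun a ha g hg hg1 hga => hC.norm_deriv_le_szego hσ (hpair a ha) (hK ha) hC.one_lt le_rfl
      (hg.mono hreg) (fun z hz => hg1 z (hreg hz)) hga,
    fun a ha b hb => hC.szego_symm hσ (hpair a ha) (hK ha) (hpair b hb) (hK hb),
    fun a ha b hb => hC.norm_szego_sq_le hσ (hpair a ha) (hK ha) (hpair b hb) (hK hb),
    fun a ha => hC.exists_blaschke_le hσ hw (hpair a ha) (hK ha) (hp.diff.mono hsub)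
      (fun z hz => mem_ball_zero_iff.1 (hp.maps z (hsub hz))) hcard⟩
  · exact (differentiableOn_const 1).add ((differentiableOn_id.sub (differentiableOn_const a)).mul
      ((hpair a ha).diff'.mono (h1 a ha)))
  · exact div_mul_cancel₀ _ (hC.garabedian_ne_zero hσ hw (hpair a ha) (hK ha) hz)

/-- Ahlfors maps `f a` and a Szegő kernel `S a z` of `Ω`. -/
structure AhlforsSystem (Ω : Set ℂ) (S f : ℂ → ℂ → ℂ) : Prop where
  diff : ∀ a ∈ Ω, DifferentiableOn ℂ (S a) Ω
  bounded : ∀ a ∈ Ω, ∀ b ∈ Ω, ∃ C, ∃ r > 0, ∀ x ∈ ball a r, ∀ y ∈ ball b r, ‖S x y‖ ≤ C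
  symm : ∀ a ∈ Ω, ∀ b ∈ Ω, S a b = conj (S b a)
  self_ne_zero : ∀ a ∈ Ω, S a a ≠ 0
  diff_map : ∀ a ∈ Ω, DifferentiableOn ℂ (f a) Ω
  norm_map_lt : ∀ a ∈ Ω, ∀ z ∈ Ω, ‖f a z‖ < 1
  map_self : ∀ a ∈ Ω, f a a = 0
  im_deriv : ∀ a ∈ Ω, (deriv (f a) a).im = 0
  re_deriv_pos : ∀ a ∈ Ω, 0 < (deriv (f a) a).re
  extremal : ∀ a ∈ Ω, ∀ g : ℂ → ℂ, DifferentiableOn ℂ g Ω → (∀ z ∈ Ω, ‖g z‖ < 1) →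
    ‖deriv g a‖ ≤ (deriv (f a) a).re
  zero : ∀ a ∈ Ω, ∀ z ∈ Ω, z ≠ a → f a z = 0 → S a z = 0
  proper : ∀ a ∈ Ω, ProperDisc Ω (f a)

theorem one_sub_conj_mul_ne_zero {c w : ℂ} (hc : ‖c‖ ≤ 1) (hw : ‖w‖ < 1) :
    1 - conj c * w ≠ 0 := fun h => by
  have h1 : ‖conj c * w‖ = 1 := by rw [← sub_eq_zero.1 h, norm_one]
  rw [norm_mul, RCLike.norm_conj] at h1
  nlinarith [norm_nonneg c, norm_nonneg w]

theorem norm_one_sub_conj_mul_of_norm_eq_one {c w : ℂ} (hc : ‖c‖ = 1) :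
    ‖1 - conj c * w‖ = ‖w - c‖ := by
  have h : conj c * (c - w) = 1 - conj c * w := by
    rw [mul_sub, conj_mul', hc, ofReal_one, one_pow]
  rw [← h, norm_mul, RCLike.norm_conj, hc, one_mul, norm_sub_rev]

theorem bdryUnimodular_blaschke {Ω : Set ℂ} {p : ℂ → ℂ} (hp : ∀ z ∈ Ω, ‖p z‖ < 1) {ζ : ℂ}
    (hζ : ‖ζ‖ ≤ 1) : BdryUnimodular Ω p fun z => (p z - ζ) / (1 - conj ζ * p z) := by
  intro ε hε
  obtain h1 | h1 := hζ.lt_or_eq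
  · obtain ⟨r, hr, h⟩ := eventually_norm_of_forall_sphere
      (p := fun w => 1 - ε < ‖(w - ζ) / (1 - conj ζ * w)‖) fun w hw => by
        rw [mem_sphere_zero_iff_norm] at hw
        have h2 : ‖1 - conj ζ * w‖ = ‖w - ζ‖ := by
          rw [← RCLike.norm_conj, map_sub, map_one, map_mul, Complex.conj_conj, mul_comm,
            norm_one_sub_conj_mul_of_norm_eq_one hw, norm_sub_rev]
        have h3 : ‖w - ζ‖ ≠ 0 := norm_ne_zero_iff.2 fun h => by
          rw [← sub_eq_zero.1 h] at h1; linarith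
        have h4 : 1 - conj ζ * w ≠ 0 := norm_ne_zero_iff.1 (h2 ▸ h3)
        have h5 : ContinuousAt (fun w => ‖(w - ζ) / (1 - conj ζ * w)‖) w := by
          fun_prop (disch := exact h4)
        refine h5.eventually_const_lt ?_
        simp only [norm_div, h2, div_self h3]
        linarith
    exact ⟨r, hr, fun z hz hrz => h _ hrz (hp z hz)⟩
  · refine ⟨0, one_pos, fun z hz _ => ?_⟩
    rw [norm_div, ← norm_one_sub_conj_mul_of_norm_eq_one h1,
      div_self (norm_ne_zero_iff.2 (one_sub_conj_mul_ne_zero hζ (hp z hz)))]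
    linarith

theorem bdryUnimodular_of_prod_le {Ω : Set ℂ} {p F : ℂ → ℂ} (hp : ∀ z ∈ Ω, ‖p z‖ < 1) {m : ℕ}
    {ζ : Fin m → ℂ} (hζ : ∀ l, ‖ζ l‖ ≤ 1) (h : ∀ z ∈ Ω, ∏ l, ‖p z - ζ l‖ ≤
      ‖F z‖ * ∏ l, ‖1 - conj (ζ l) * p z‖) : BdryUnimodular Ω p F := by
  have hprod : ∀ s : Finset (Fin m), BdryUnimodular Ω p fun z =>
      ∏ l ∈ s, (p z - ζ l) / (1 - conj (ζ l) * p z) := fun s => by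
    classical
    induction s using Finset.induction_on with
    | empty => simpa using BdryUnimodular.one
    | insert i s hi ih =>
      simp only [Finset.prod_insert hi]
      exact (bdryUnimodular_blaschke hp (hζ i)).mul ih
  intro ε hε
  obtain ⟨r, hr, hB⟩ := hprod Finset.univ ε hε
  refine ⟨r, hr, fun z hz hrz => (hB z hz hrz).trans_le ?_⟩
  have hpos : 0 < ∏ l, ‖1 - conj (ζ l) * p z‖ := Finset.prod_pos fun l _ =>
    norm_pos_iff.2 (one_sub_conj_mul_ne_zero (hζ l) (hp z hz))
  simp only [Finset.prod_div_distrib]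
  rw [norm_div, norm_prod, norm_prod, div_le_iff₀ hpos]
  exact h z hz

theorem ProperDisc.of_bdryUnimodular {Ω : Set ℂ} {p F : ℂ → ℂ} (hp : ProperDisc Ω p)
    (hF : DifferentiableOn ℂ F Ω) (hF1 : ∀ z ∈ Ω, ‖F z‖ < 1) (hu : BdryUnimodular Ω p F) {a : ℂ}
    (ha : a ∈ Ω) (hd : deriv F a ≠ 0) : ProperDisc Ω F := by
  have hcomp : ∀ c < 1, IsCompact (Ω ∩ F ⁻¹' closedBall 0 c) := fun c hc => by
    obtain ⟨r, hr, h⟩ := hu (1 - c) (by linarith)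
    have hK := hp.proper (closedBall 0 r) (closedBall_subset_ball hr) (isCompact_closedBall 0 r)
    have heq : Ω ∩ F ⁻¹' closedBall 0 c = (Ω ∩ p ⁻¹' closedBall 0 r) ∩ F ⁻¹' closedBall 0 c := by
      ext z
      refine ⟨fun hz => ⟨⟨hz.1, ?_⟩, hz.2⟩, fun hz => ⟨hz.1.1, hz.2⟩⟩
      rw [mem_preimage, mem_closedBall_zero_iff]
      by_contra! hrz
      have h1 := h z hz.1 hrz
      have h2 := mem_closedBall_zero_iff.1 hz.2
      linarith
    rw [heq]
    exact hK.of_isClosed_subset ((hF.continuousOn.mono inter_subset_left)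
      |>.preimage_isClosed_of_isClosed hK.isClosed isClosed_closedBall) inter_subset_left
  have hmaps : ∀ z ∈ Ω, F z ∈ ball (0 : ℂ) 1 := fun z hz => mem_ball_zero_iff.2 (hF1 z hz)
  have hopen : IsOpen (F '' Ω) := by
    obtain ⟨w, hw⟩ | h := (hF.analyticOnNhd hp.isOpen).is_constant_or_isOpen hp.preconn
    · refine absurd ?_ hd
      have he : F =ᶠ[𝓝 a] fun _ => w := (hp.isOpen.eventually_mem ha).mono fun z hz => hw z hz
      rw [he.deriv_eq, deriv_const]
    · exact h Ω subset_rfl hp.isOpen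
  have hsub : ball (0 : ℂ) 1 ⊆ F '' Ω := by
    refine (convex_ball 0 1).isPreconnected.subset_of_closure_inter_subset hopen
      ⟨F a, hmaps a ha, mem_image_of_mem F ha⟩ fun ζ hζ => ?_
    obtain ⟨c, hc, hc1⟩ := exists_between (mem_ball_zero_iff.1 hζ.2)
    have h1 : ζ ∈ closure (F '' (Ω ∩ F ⁻¹' closedBall 0 c)) := by
      refine closure_mono ?_ (isOpen_ball.inter_closure ⟨mem_ball_zero_iff.2 hc, hζ.1⟩)
      rintro _ ⟨hx, z, hz, rfl⟩
      exact ⟨z, ⟨hz, ball_subset_closedBall hx⟩, rfl⟩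
    rw [((hcomp c hc1).image_of_continuousOn
      (hF.continuousOn.mono inter_subset_left)).isClosed.closure_eq] at h1
    exact image_mono inter_subset_left h1
  refine ⟨hp.isOpen, hp.preconn, hF, hmaps, fun ζ hζ => hsub hζ, fun L hL hLc => ?_⟩
  obtain ⟨c, hc, hLc'⟩ := exists_lt_subset_ball hLc.isClosed hL
  replace hLc' := hLc'.trans ball_subset_closedBall
  rw [← inter_eq_self_of_subset_right hLc', preimage_inter, ← inter_assoc]
  exact (hcomp c hc).of_isClosed_subset ((hF.continuousOn.mono inter_subset_left)
    |>.preimage_isClosed_of_isClosed (hcomp c hc).isClosed hLc.isClosed) inter_subset_left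

namespace SzegoLevel

variable {Ω A Ω' : Set ℂ} {p : ℂ → ℂ} {m : ℕ} {S D f : ℂ → ℂ → ℂ}
  (hL : SzegoLevel Ω A Ω' p m S D f)
include hL

theorem re_nonneg {a : ℂ} (ha : a ∈ A) : 0 ≤ (S a a).re := by
  simpa using hL.extremal a ha (fun _ => 0) (differentiableOn_const 0) (by simp) rfl

theorem norm_self {a : ℂ} (ha : a ∈ A) : ‖S a a‖ = (S a a).re := by
  rw [← abs_of_nonneg (hL.re_nonneg ha)]
  exact (abs_re_eq_norm.2 (hL.im_self a ha)).symm

theorem re_self_le {z w : ℂ} {r : ℝ} (hr : 0 < r) (hA : ball z r ⊆ A) (hw : w ∈ ball z (r / 2)) :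
    (S w w).re ≤ 4 / r := by
  have hwA : w ∈ A := hA (ball_subset_ball (by linarith) hw)
  have hsub : closedBall w (r / 4) ⊆ ball z r :=
    closedBall_subset_ball' (by have := mem_ball.1 hw; linarith)
  rw [← hL.norm_self hwA, ← hL.deriv_quot w hwA]
  refine (Complex.norm_deriv_le_of_forall_mem_sphere_norm_le (R := r / 4) (by positivity)
    ((hL.diff_quot w hwA).mono (hA.trans hL.sub) |>.diffContOnCl_ball hsub) (C := 1)
    fun v hv => (hL.norm_quot_lt w hwA v
      (hL.sub (hA (hsub (sphere_subset_closedBall hv))))).le).trans_eq ?_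
  field_simp

theorem norm_le {a b : ℂ} (ha : a ∈ A) (hb : b ∈ A) : ‖S a b‖ ≤ (S a a).re + (S b b).re := by
  have h1 := hL.re_nonneg ha
  have h2 := hL.re_nonneg hb
  exact le_of_sq_le_sq ((hL.norm_sq_le a ha b hb).trans (by nlinarith)) (by positivity)

end SzegoLevel

theorem norm_mobius_le {c w : ℂ} (hc : ‖c‖ < 1) (hw : ‖w‖ < 1) :
    ‖(w - c) / (1 - conj c * w)‖ ≤ 1 := by
  rw [norm_div]
  exact div_le_one_of_le₀ (norm_sub_le_norm_one_sub_conj_mul hc.le hw.le) (norm_nonneg _)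

/-- Competitors in the extremal problem may be assumed to vanish at the base point. -/
theorem norm_deriv_le_of_forall_map_self {Ω : Set ℂ} (hΩ : IsOpen Ω) {a : ℂ} (ha : a ∈ Ω) {C : ℝ}
    (h : ∀ g : ℂ → ℂ, DifferentiableOn ℂ g Ω → (∀ z ∈ Ω, ‖g z‖ ≤ 1) → g a = 0 → ‖deriv g a‖ ≤ C)
    {g : ℂ → ℂ} (hg : DifferentiableOn ℂ g Ω) (hg1 : ∀ z ∈ Ω, ‖g z‖ < 1) : ‖deriv g a‖ ≤ C := by
  have hne := fun z hz => one_sub_conj_mul_ne_zero (hg1 a ha).le (hg1 z hz)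
  have hd := (hg.differentiableAt (hΩ.mem_nhds ha)).hasDerivAt
  have hd' := (hd.sub_const (g a)).div ((hd.const_mul (conj (g a))).const_sub 1) (hne a ha)
  refine le_trans ?_ (h (fun z => (g z - g a) / (1 - conj (g a) * g z))
    ((hg.sub_const _).fun_div ((differentiableOn_const 1).sub (hg.const_mul _)) hne)
    (fun z hz => norm_mobius_le (hg1 a ha) (hg1 z hz)) (by simp))
  have he : deriv (fun z => (g z - g a) / (1 - conj (g a) * g z)) a =
      deriv g a / (1 - conj (g a) * g a) := by
    refine hd'.deriv.trans ?_
    have := hne a ha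
    field_simp
    ring
  rw [he, norm_div]
  refine le_div_self (norm_nonneg _) (norm_pos_iff.2 (hne a ha)) ?_
  rw [conj_mul', ← ofReal_pow, ← ofReal_one, ← ofReal_sub, norm_real, Real.norm_eq_abs, abs_le]
  constructor <;> nlinarith [hg1 a ha, norm_nonneg (g a)]

theorem ProperDisc.exists_deriv_ne_zero_of_bounded {Ω : Set ℂ} {p : ℂ → ℂ} (hp : ProperDisc Ω p)
    {a : ℂ} (ha : a ∈ Ω) : ∃ g : ℂ → ℂ, DifferentiableOn ℂ g Ω ∧ (∀ z ∈ Ω, ‖g z‖ ≤ 1) ∧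
      g a = 0 ∧ deriv g a ≠ 0 := by
  obtain ⟨k, u, hu, hua, hpu⟩ := exists_factor_at hp.isOpen hp.preconn (hp.diff.sub_const (p a))
    (hp.exists_sub_ne_zero (p a)) ha
  obtain ⟨δ, hδ, hball⟩ := Metric.nhds_basis_closedBall.mem_iff.1 (hp.isOpen.mem_nhds ha)
  have hGd : DifferentiableOn ℂ (fun z => (z - a) * u z) Ω :=
    (differentiableOn_id.sub_const a).mul hu
  obtain ⟨C, hC⟩ := (isCompact_closedBall a δ).exists_bound_of_continuousOn
    (hGd.continuousOn.mono hball)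
  set B := max C (2 / δ ^ (k - 1)) with hB
  have hk : k ≠ 0 := by
    rintro rfl
    have := hpu a ha
    rw [sub_self, pow_zero, one_mul] at this
    exact hua this.symm
  have hbd : ∀ z ∈ Ω, ‖(z - a) * u z‖ ≤ B := fun z hz => by
    obtain h | h := le_or_gt (dist z a) δ
    · exact (hC z h).trans (le_max_left _ _)
    · refine le_trans ?_ (le_max_right _ _)
      have h1 : ‖p z - p a‖ ≤ 2 := (norm_sub_le _ _).trans (by
        linarith [mem_ball_zero_iff.1 (hp.maps z hz), mem_ball_zero_iff.1 (hp.maps a ha)])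
      rw [hpu z hz, ← Nat.succ_pred_eq_of_ne_zero hk, pow_succ, mul_assoc, norm_mul, norm_pow,
        ← dist_eq_norm] at h1
      rw [le_div_iff₀' (by positivity)]
      exact (mul_le_mul_of_nonneg_right (pow_le_pow_left₀ hδ.le h.le _) (norm_nonneg _)).trans h1
  have hB0 : 0 < B := (by positivity : 0 < 2 / δ ^ (k - 1)).trans_le (le_max_right _ _)
  have hne : (B : ℂ) ≠ 0 := ofReal_ne_zero.2 hB0.ne'
  refine ⟨fun z => (z - a) * u z / B, hGd.div_const _, fun z hz => ?_, by simp, ?_⟩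
  · rw [norm_div, norm_real, Real.norm_of_nonneg hB0.le]
    exact div_le_one_of_le₀ (hbd z hz) hB0.le
  · have h1 := (((hasDerivAt_id a).sub_const a).mul
      (hu.differentiableAt (hp.isOpen.mem_nhds ha)).hasDerivAt).div_const (B : ℂ)
    have : deriv (fun z => (z - a) * u z / (B : ℂ)) a = u a / B := h1.deriv.trans (by simp)
    rw [this]
    exact div_ne_zero hua hne

section Limit

variable {ι : Type*} {l : Ultrafilter ι} {Ω : Set ℂ} {p : ℂ → ℂ} {m : ℕ} {A Ω' : ι → Set ℂ}
  {S D f : ι → ℂ → ℂ → ℂ} (hL : ∀ n, SzegoLevel Ω (A n) (Ω' n) p m (S n) (D n) (f n))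
  (hA : ∀ z ∈ Ω, ∃ r > 0, ∀ᶠ n in l, ball z r ⊆ A n)
include hL hA

theorem eventually_szego_bounded {a b : ℂ} (ha : a ∈ Ω) (hb : b ∈ Ω) : ∃ C, ∃ r > 0,
    ∀ᶠ n in l, ball a r ⊆ A n ∧ ball b r ⊆ A n ∧
      ∀ x ∈ ball a r, ∀ y ∈ ball b r, ‖S n x y‖ ≤ C := by
  obtain ⟨r₁, hr₁, h₁⟩ := hA a ha
  obtain ⟨r₂, hr₂, h₂⟩ := hA b hb
  have hl : min r₁ r₂ / 2 ≤ r₁ / 2 := by gcongr; exact min_le_left _ _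
  have hr : min r₁ r₂ / 2 ≤ r₂ / 2 := by gcongr; exact min_le_right _ _
  refine ⟨4 / r₁ + 4 / r₂, min r₁ r₂ / 2, by positivity, ?_⟩
  filter_upwards [h₁, h₂] with n h1 h2
  have hs1 : ball a (min r₁ r₂ / 2) ⊆ A n := (ball_subset_ball (by linarith)).trans h1
  have hs2 : ball b (min r₁ r₂ / 2) ⊆ A n := (ball_subset_ball (by linarith)).trans h2
  exact ⟨hs1, hs2, fun x hx y hy => ((hL n).norm_le (hs1 hx) (hs2 hy)).trans (add_le_add
    ((hL n).re_self_le hr₁ h1 (ball_subset_ball hl hx))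
    ((hL n).re_self_le hr₂ h2 (ball_subset_ball hr hy)))⟩

omit hL in
theorem eventually_mem_base {a : ℂ} (ha : a ∈ Ω) : ∀ᶠ n in l, a ∈ A n := by
  obtain ⟨r, hr, h⟩ := hA a ha
  exact h.mono fun n hn => hn (mem_ball_self hr)

theorem locally_bounded_szego {a z : ℂ} (ha : a ∈ Ω) (hz : z ∈ Ω) : ∃ C, ∃ r > 0, ∀ᶠ n in l,
    DifferentiableOn ℂ (S n a) (ball z r) ∧ ∀ w ∈ ball z r, ‖S n a w‖ ≤ C := by
  obtain ⟨C, r, hr, h⟩ := eventually_szego_bounded hL hA ha hz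
  refine ⟨C, r, hr, h.mono fun n hn => ⟨?_, hn.2.2 a (mem_ball_self hr)⟩⟩
  exact ((hL n).diff a (hn.1 (mem_ball_self hr))).mono (hn.2.1.trans (hL n).sub)

theorem locally_bounded_quot {a z : ℂ} (ha : a ∈ Ω) (hz : z ∈ Ω) : ∃ C, ∃ r > 0, ∀ᶠ n in l,
    DifferentiableOn ℂ (f n a) (ball z r) ∧ ∀ w ∈ ball z r, ‖f n a w‖ ≤ C := by
  obtain ⟨r, hr, h⟩ := hA z hz
  refine ⟨1, r, hr, (h.and (eventually_mem_base hA ha)).mono fun n hn => ?_⟩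
  have hs := hn.1.trans (hL n).sub
  exact ⟨((hL n).diff_quot a hn.2).mono hs, fun w hw => ((hL n).norm_quot_lt a hn.2 w (hs hw)).le⟩

theorem szego_limit_eq_zero {a z : ℂ} (hΩ : IsOpen Ω) (hc : IsPreconnected Ω) (ha : a ∈ Ω)
    (hz : z ∈ Ω) (hza : z ≠ a) {s F : ℂ → ℂ}
    (hs : Tendsto (fun n => S n a z) l (𝓝 (s z)))
    (hF : ∀ z ∈ Ω, Tendsto (fun n => f n a z) l (𝓝 (F z))) (hne : ∃ z ∈ Ω, F z ≠ 0)
    (h0 : F z = 0) : s z = 0 := by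
  obtain ⟨hFd, hFu, -⟩ := tendstoLocallyUniformlyOn_of_locally_bounded
    (fun z hz => locally_bounded_quot hL hA ha hz) hΩ hF
  obtain ⟨C, r₁, hr₁, h₁⟩ := locally_bounded_szego hL hA ha hz
  obtain ⟨r₂, hr₂, h₂⟩ := hA z hz
  obtain ⟨r₃, hr₃, h₃⟩ := Metric.mem_nhdsWithin_iff.1
    (eventually_ne_zero_of_differentiableOn hΩ hc hFd hne hz)
  obtain ⟨r₄, hr₄, h₄⟩ := Metric.isOpen_iff.1 hΩ z hz
  obtain ⟨r, hr, hrlt⟩ : ∃ r, 0 < r ∧ r < min (min r₁ r₂) (min r₃ r₄) :=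
    exists_between (by positivity)
  simp only [lt_min_iff] at hrlt
  obtain ⟨⟨hr1, hr2⟩, hr3, hr4⟩ := hrlt
  have hsph : sphere z r ⊆ Ω := sphere_subset_ball hr4 |>.trans h₄
  have hFne : ∀ w ∈ sphere z r, F w ≠ 0 := fun w hw => h₃ ⟨sphere_subset_ball hr3 hw, fun h => by
    rw [mem_singleton_iff.1 h, mem_sphere, dist_self] at hw
    exact hr.ne hw⟩
  have hcpt := isCompact_sphere z r
  have hnon : (sphere z r).Nonempty := NormedSpace.sphere_nonempty.2 hr.le
  obtain ⟨w₀, hw₀, hmin⟩ := hcpt.exists_isMinOn hnon (hFd.continuousOn.mono hsph).norm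
  set c := ‖F w₀‖
  have hc0 : 0 < c := norm_pos_iff.2 (hFne w₀ hw₀)
  have hunif := (tendstoLocallyUniformlyOn_iff_tendstoUniformlyOn_of_compact hcpt).1
    (hFu.mono hsph)
  set B := (r + ‖z - a‖) * C / (c / 2)
  have hD : ∀ᶠ n in l, ‖D n a z‖ ≤ B ∧ ‖(z - a) * S n a z‖ ≤ ‖f n a z‖ * B := by
    filter_upwards [Metric.tendstoUniformlyOn_iff.1 hunif (c / 2) (by positivity), h₁, h₂,
      eventually_mem_base hA ha] with n hn hn1 hn2 han
    have hΩ' : ball z r₂ ⊆ Ω' n := hn2.trans (hL n).sub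
    have hcb : closedBall z r ⊆ ball z r₂ := closedBall_subset_ball hr2
    have hC0 : 0 ≤ C := (norm_nonneg _).trans (hn1.2 z (mem_ball_self hr₁))
    have hDz : ‖D n a z‖ ≤ B := by
      refine Complex.norm_le_of_forall_mem_frontier_norm_le isBounded_ball
        (((hL n).diff_denom a han).mono hΩ' |>.diffContOnCl_ball hcb) (fun w hw => ?_)
        (subset_closure (mem_ball_self hr))
      rw [frontier_ball z hr.ne'] at hw
      have h1 := hn w hw
      have h2 : c ≤ ‖F w‖ := hmin hw
      have h3 : c / 2 ≤ ‖f n a w‖ := by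
        rw [dist_eq_norm] at h1
        have := norm_sub_norm_le (F w) (f n a w)
        linarith
      have h4 := congrArg norm ((hL n).mul_denom a han w (hΩ' (hcb (sphere_subset_closedBall hw))))
      rw [norm_mul, norm_mul] at h4
      rw [le_div_iff₀' (by positivity)]
      refine (mul_le_mul_of_nonneg_right h3 (norm_nonneg _)).trans (h4.le.trans ?_)
      have h5 : ‖w - a‖ ≤ r + ‖z - a‖ := by
        have := norm_add_le (w - z) (z - a)
        rw [sub_add_sub_cancel] at this
        rwa [← dist_eq_norm w z, mem_sphere.1 hw] at this
      exact mul_le_mul h5 (hn1.2 w (sphere_subset_ball hr1 hw)) (norm_nonneg _) (by positivity)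
    refine ⟨hDz, ?_⟩
    rw [← (hL n).mul_denom a han z (hΩ' (mem_ball_self hr₂)), norm_mul]
    gcongr
  have hlim : Tendsto (fun n => ‖f n a z‖ * B) l (𝓝 0) := by
    have := (hF z hz).norm.mul_const B
    rwa [h0, norm_zero, zero_mul] at this
  have h6 := le_of_tendsto_of_tendsto ((hs.const_mul (z - a)).norm) hlim (hD.mono fun n hn => hn.2)
  have h7 := norm_le_zero_iff.1 h6
  exact (mul_eq_zero.1 h7).resolve_left (sub_ne_zero.2 hza)

theorem exists_blaschke_limit {a : ℂ} (ha : a ∈ Ω) {F : ℂ → ℂ}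
    (hF : ∀ z ∈ Ω, Tendsto (fun n => f n a z) l (𝓝 (F z))) :
    ∃ ζ : Fin m → ℂ, (∀ i, ‖ζ i‖ ≤ 1) ∧ ∀ z ∈ Ω,
      ∏ i, ‖p z - ζ i‖ ≤ ‖F z‖ * ∏ i, ‖1 - conj (ζ i) * p z‖ := by
  have hex : ∀ n, ∃ ζ : Fin m → ℂ, a ∈ A n → (∀ i, ‖ζ i‖ ≤ 1) ∧ ∀ z ∈ Ω' n,
      ∏ i, ‖p z - ζ i‖ ≤ ‖f n a z‖ * ∏ i, ‖1 - conj (ζ i) * p z‖ := fun n => by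
    by_cases h : a ∈ A n
    · obtain ⟨ζ, hζ⟩ := (hL n).blaschke a h
      exact ⟨ζ, fun _ => hζ⟩
    · exact ⟨0, fun h' => absurd h' h⟩
  choose Z hZ using hex
  have haA := eventually_mem_base hA ha
  choose ζ hζ hlim using fun i => l.exists_tendsto_of_norm_le (u := fun n => Z n i) (C := 1)
    (haA.mono fun n hn => (hZ n hn).1 i)
  refine ⟨ζ, hζ, fun z hz => ?_⟩
  refine le_of_tendsto_of_tendsto
    (tendsto_finsetProd Finset.univ fun i _ => ((hlim i).const_sub (p z)).norm)
    ((hF z hz).norm.mul (tendsto_finsetProd Finset.univ fun i _ =>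
      ((((continuous_conj.tendsto _).comp (hlim i)).mul_const (p z)).const_sub 1).norm)) ?_
  filter_upwards [haA, eventually_mem_base hA hz] with n hn hzn
  exact (hZ n hn).2 z ((hL n).sub hzn)

theorem exists_ahlforsSystem_of_szegoLevel (hp : ProperDisc Ω p) :
    ∃ S f, AhlforsSystem Ω S f := by
  have hSex : ∀ a z, ∃ x, a ∈ Ω → z ∈ Ω → Tendsto (fun n => S n a z) l (𝓝 x) := fun a z => by
    by_cases h : a ∈ Ω ∧ z ∈ Ω
    · obtain ⟨C, r, hr, h1⟩ := locally_bounded_szego hL hA h.1 h.2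
      obtain ⟨x, -, hx⟩ := l.exists_tendsto_of_norm_le
        (h1.mono fun n hn => hn.2 z (mem_ball_self hr))
      exact ⟨x, fun _ _ => hx⟩
    · exact ⟨0, fun h1 h2 => absurd ⟨h1, h2⟩ h⟩
  have hfex : ∀ a z, ∃ x, a ∈ Ω → z ∈ Ω → ‖x‖ ≤ 1 ∧ Tendsto (fun n => f n a z) l (𝓝 x) :=
    fun a z => by
    by_cases h : a ∈ Ω ∧ z ∈ Ω
    · obtain ⟨x, hx1, hx⟩ := l.exists_tendsto_of_norm_le (u := fun n => f n a z) (C := 1)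
        (((eventually_mem_base hA h.1).and (eventually_mem_base hA h.2)).mono fun n hn =>
          ((hL n).norm_quot_lt a hn.1 z ((hL n).sub hn.2)).le)
      exact ⟨x, fun _ _ => ⟨hx1, hx⟩⟩
    · exact ⟨0, fun h1 h2 => absurd ⟨h1, h2⟩ h⟩
  choose T hT using hSex
  choose F hF using hfex
  have hTd := fun a ha => tendstoLocallyUniformlyOn_of_locally_bounded
    (fun z hz => locally_bounded_szego hL hA ha hz) hp.isOpen (hT a · ha)
  have hFd := fun a ha => tendstoLocallyUniformlyOn_of_locally_bounded
    (fun z hz => locally_bounded_quot hL hA ha hz) hp.isOpen (fun z hz => (hF a z ha hz).2)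
  have hself : ∀ a ∈ Ω, F a a = 0 := fun a ha =>
    tendsto_nhds_unique (hF a a ha ha).2 (tendsto_const_nhds.congr'
      ((eventually_mem_base hA ha).mono fun n hn => ((hL n).quot_self a hn).symm))
  have hderiv : ∀ a ∈ Ω, deriv (F a) a = T a a := fun a ha =>
    tendsto_nhds_unique ((hFd a ha).2.2 a ha) ((hT a a ha ha).congr'
      ((eventually_mem_base hA ha).mono fun n hn => ((hL n).deriv_quot a hn).symm))
  have hre : ∀ a ∈ Ω, Tendsto (fun n => (S n a a).re) l (𝓝 (T a a).re) := fun a ha =>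
    (continuous_re.tendsto _).comp (hT a a ha ha)
  have him : ∀ a ∈ Ω, (T a a).im = 0 := fun a ha =>
    tendsto_nhds_unique ((continuous_im.tendsto _).comp (hT a a ha ha)) (tendsto_const_nhds.congr'
      ((eventually_mem_base hA ha).mono fun n hn => ((hL n).im_self a hn).symm))
  have hext0 : ∀ a ∈ Ω, ∀ g : ℂ → ℂ, DifferentiableOn ℂ g Ω → (∀ z ∈ Ω, ‖g z‖ ≤ 1) → g a = 0 →
      ‖deriv g a‖ ≤ (T a a).re := fun a ha g hg hg1 hga => ge_of_tendsto (hre a ha)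
    ((eventually_mem_base hA ha).mono fun n hn => (hL n).extremal a hn g hg hg1 hga)
  have hpos : ∀ a ∈ Ω, 0 < (T a a).re := fun a ha => by
    obtain ⟨g, hg, hg1, hga, hne⟩ := hp.exists_deriv_ne_zero_of_bounded ha
    exact (norm_pos_iff.2 hne).trans_le (hext0 a ha g hg hg1 hga)
  have hTne : ∀ a ∈ Ω, T a a ≠ 0 := fun a ha h => by
    have := hpos a ha
    simp [h] at this
  have hlt : ∀ a ∈ Ω, ∀ z ∈ Ω, ‖F a z‖ < 1 := fun a ha z hz => by
    refine (hF a z ha hz).1.lt_of_ne fun h1 => ?_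
    have := Complex.norm_eqOn_of_isPreconnected_of_isMaxOn hp.preconn hp.isOpen (hFd a ha).1 hz
      (fun w hw => by
        rw [mem_ofPred_eq, Function.comp, Function.comp, h1]; exact (hF a w ha hw).1) ha
    simp [hself a ha, h1] at this
  refine ⟨T, F, fun a ha => (hTd a ha).1, fun a ha b hb => ?_, fun a ha b hb => ?_, hTne,
    fun a ha => (hFd a ha).1, hlt, hself, fun a ha => by rw [hderiv a ha, him a ha],
    fun a ha => by rw [hderiv a ha]; exact hpos a ha, fun a ha g hg hg1 => ?_,
    fun a ha z hz hza h0 => ?_, fun a ha => ?_⟩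
  · obtain ⟨C, r, hr, h⟩ := eventually_szego_bounded hL hA ha hb
    obtain ⟨r₁, hr₁, h₁⟩ := Metric.isOpen_iff.1 hp.isOpen a ha
    obtain ⟨r₂, hr₂, h₂⟩ := Metric.isOpen_iff.1 hp.isOpen b hb
    refine ⟨C, min r (min r₁ r₂), by positivity, fun x hx y hy => ?_⟩
    have hx1 := ball_subset_ball (min_le_left _ _) hx
    have hy1 := ball_subset_ball (min_le_left _ _) hy
    have hx2 := h₁ (ball_subset_ball ((min_le_right _ _).trans (min_le_left _ _)) hx)
    have hy2 := h₂ (ball_subset_ball ((min_le_right _ _).trans (min_le_right _ _)) hy)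
    exact le_of_tendsto (hT x y hx2 hy2).norm (h.mono fun n hn => hn.2.2 x hx1 y hy1)
  · refine tendsto_nhds_unique (hT a b ha hb)
      (((continuous_conj.tendsto _).comp (hT b a hb ha)).congr' ?_)
    filter_upwards [eventually_mem_base hA ha, eventually_mem_base hA hb] with n h1 h2
    exact ((hL n).symm a h1 b h2).symm
  · rw [hderiv a ha]
    exact norm_deriv_le_of_forall_map_self hp.isOpen ha (hext0 a ha) hg hg1
  · refine szego_limit_eq_zero hL hA hp.isOpen hp.preconn ha hz hza (hT a z ha hz)
      (fun w hw => (hF a w ha hw).2) ?_ h0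
    by_contra! h
    apply hTne a ha
    have he : F a =ᶠ[𝓝 a] fun _ => 0 := (hp.isOpen.eventually_mem ha).mono h
    rw [← hderiv a ha, he.deriv_eq, deriv_const]
  · obtain ⟨ζ, hζ, hle⟩ := exists_blaschke_limit hL hA ha (fun w hw => (hF a w ha hw).2)
    refine hp.of_bdryUnimodular (hFd a ha).1 (hlt a ha) (bdryUnimodular_of_prod_le (fun z hz =>
      mem_ball_zero_iff.1 (hp.maps z hz)) hζ hle) ha ?_
    rw [hderiv a ha]
    exact hTne a ha

end Limit

theorem ProperDisc.exists_ahlforsSystem {Ω : Set ℂ} {p : ℂ → ℂ} (hp : ProperDisc Ω p) :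
    ∃ S f, AhlforsSystem Ω S f := by
  choose Ω' S D f hL using fun n : ℕ => hp.exists_szegoLevel (s := 1 - 1 / ((n : ℝ) + 1))
    (by have : 0 < 1 / ((n : ℝ) + 1) := by positivity
        linarith)
  refine exists_ahlforsSystem_of_szegoLevel (l := hyperfilter ℕ) hL (fun z hz => ?_) hp
  obtain ⟨c, hc, hc1⟩ := exists_between (mem_ball_zero_iff.1 (hp.maps z hz))
  have hz' := hp.isOpen.mem_nhds hz
  obtain ⟨r, hr, h⟩ := Metric.mem_nhds_iff.1 (inter_mem hz'
    (((hp.diff.differentiableAt hz').continuousAt.norm).eventually (gt_mem_nhds hc)))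
  refine ⟨r, hr, Nat.hyperfilter_le_atTop ?_⟩
  have hlim : Tendsto (fun n : ℕ => 1 - 1 / ((n : ℝ) + 1)) atTop (𝓝 (1 - 0)) :=
    tendsto_one_div_add_atTop_nhds_zero_nat.const_sub 1
  rw [sub_zero] at hlim
  filter_upwards [hlim.eventually (lt_mem_nhds hc1)] with n hn w hw
  exact ⟨(h hw).1, ((h hw).2.trans hn).le⟩

theorem ContinuousAt.tendsto_nhdsNE_of_rightInverse {g w : ℂ → ℂ} {ζ : ℂ} (hw : ContinuousAt w ζ)
    (h : ∀ᶠ x in 𝓝 ζ, g (w x) = x) : Tendsto w (𝓝[≠] ζ) (𝓝[≠] (w ζ)) := by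
  refine tendsto_nhdsWithin_iff.2 ⟨hw.mono_left nhdsWithin_le_nhds, ?_⟩
  filter_upwards [nhdsWithin_le_nhds h, self_mem_nhdsWithin] with x h1 h2 h3
  exact h2 (h1 ▸ congrArg g (mem_singleton_iff.1 h3) ▸ h.self_of_nhds)

/-- Either `F` separates some regular fibre of `g`, or it separates no point of a regular fibre
from the rest of the fibre. -/
theorem ProperDisc.exists_injOn_fibre_or {Ω : Set ℂ} {g F : ℂ → ℂ} (hg : ProperDisc Ω g)
    (hF : DifferentiableOn ℂ F Ω) : (∃ ζ ∈ ball (0 : ℂ) 1 \ critVals Ω g, InjOn F (fibre Ω g ζ)) ∨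
      ∀ z ∈ Ω \ g ⁻¹' critVals Ω g, ∃ w ∈ Ω, w ≠ z ∧ g w = g z ∧ F w = F z := by
  set V := Ω \ g ⁻¹' critVals Ω g
  have hreg : ∀ z ∈ V, g z ∈ ball (0 : ℂ) 1 \ critVals Ω g := fun z hz => ⟨hg.maps z hz.1, hz.2⟩
  set P : ℂ → Prop := fun z => ∃ w ∈ Ω, w ≠ z ∧ g w = g z ∧ F w = F z
  have hVo : IsOpen V := isOpen_diff_of_discrete hg.isOpen hg.discrete_preimage_critVals
  have hloc : ∀ z ∈ V, (∀ᶠ x in 𝓝 z, P x) ∨ ∀ᶠ x in 𝓝[≠] z, ¬ P x := fun z₀ hz₀ => by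
    obtain ⟨ε, hε, -, w, hw, hfib⟩ := hg.exists_branches (hreg z₀ hz₀)
    have hz₀f : z₀ ∈ fibre Ω g (g z₀) := ⟨hz₀.1, rfl⟩
    have hnhds := hg.isOpen.mem_nhds hz₀.1
    have hga := hg.diff.analyticAt hnhds
    have hgt := hga.continuousAt.eventually (ball_mem_nhds (g z₀) hε)
    obtain ⟨v, hv1, -, -, hv⟩ := hg.exists_localInverse hz₀.1 fun h => hz₀.2 ⟨z₀, ⟨hz₀.1, h⟩, rfl⟩
    have hself : ∀ᶠ x in 𝓝 z₀, w z₀ (g x) = x := by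
      have hwt : Tendsto (fun x => w z₀ (g x)) (𝓝 z₀) (𝓝 z₀) := by
        have h1 := ((hw z₀ hz₀f).1.differentiableAt (ball_mem_nhds (g z₀) hε)).continuousAt
        have h2 := h1.tendsto.comp hga.continuousAt
        rwa [(hw z₀ hz₀f).2.1] at h2
      filter_upwards [hv, hwt.eventually hv, hgt] with x h1 h2 h3
      rw [← h2, ((hw z₀ hz₀f).2.2 _ h3).2, h1]
    have han : ∀ j ∈ fibre Ω g (g z₀), AnalyticAt ℂ (fun x => F (w j (g x)) - F x) z₀ :=
      fun j hj => by
      have h1 := (hw j hj).1.analyticAt (ball_mem_nhds (g z₀) hε)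
      refine ((AnalyticAt.fun_comp ?_ (h1.fun_comp hga))).sub (hF.analyticAt hnhds)
      rw [(hw j hj).2.1]
      exact hF.analyticAt (hg.isOpen.mem_nhds hj.1)
    by_cases hex : ∃ j ∈ fibre Ω g (g z₀), j ≠ z₀ ∧ ∀ᶠ x in 𝓝 z₀, F (w j (g x)) - F x = 0
    · obtain ⟨j, hj, hne, hj0⟩ := hex
      left
      filter_upwards [hj0, hself, hgt] with x h1 h2 h3
      refine ⟨w j (g x), ((hw j hj).2.2 _ h3).1, fun h => hne ?_, ((hw j hj).2.2 _ h3).2,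
        sub_eq_zero.1 h1⟩
      exact (hfib _ h3).1 hj hz₀f (h.trans h2.symm)
    · right
      have hall : ∀ᶠ x in 𝓝[≠] z₀, ∀ j ∈ fibre Ω g (g z₀), j ≠ z₀ → F (w j (g x)) - F x ≠ 0 :=
        (eventually_all_finite (hg.finite_fibre (hreg z₀ hz₀).1)).2 fun j hj => by
          by_cases hne : j = z₀
          · exact Eventually.of_forall fun x h => absurd hne h
          · exact (((han j hj).eventually_eq_zero_or_eventually_ne_zero).resolve_left fun h =>
              hex ⟨j, hj, hne, h⟩).mono fun x hx _ => hx
      filter_upwards [hall, nhdsWithin_le_nhds hself, nhdsWithin_le_nhds hgt] with x h1 h2 h3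
      rintro ⟨y, hy, hyx, hgy, hFy⟩
      have : y ∈ fibre Ω g (g x) := ⟨hy, hgy⟩
      rw [(hfib _ h3).2] at this
      obtain ⟨j, hj, rfl⟩ := this
      refine h1 j hj (fun h => hyx ?_) (sub_eq_zero.2 hFy)
      rw [h]
      exact h2
  set U := {z | ∀ᶠ x in 𝓝 z, P x}
  have hU : IsOpen U := isOpen_iff_eventually.2 fun z hz => eventually_eventually_nhds.2 hz
  obtain hne | hne := (V ∩ U).eq_empty_or_nonempty
  · left
    obtain ⟨z₀, hz₀⟩ : V.Nonempty := by
      obtain ⟨z, hz, -⟩ := hg.surj 0 (by simp)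
      exact closure_nonempty_iff.1 ⟨z, diff_dense_of_discrete hg.isOpen
        hg.discrete_preimage_critVals hz⟩
    obtain ⟨ε, hε, hεs, w, hw, hfib⟩ := hg.exists_branches (hreg z₀ hz₀)
    have hall : ∀ᶠ ζ in 𝓝[≠] (g z₀), ∀ j ∈ fibre Ω g (g z₀), ¬ P (w j ζ) :=
      (eventually_all_finite (hg.finite_fibre (hreg z₀ hz₀).1)).2 fun j hj => by
        have hjV : j ∈ V := ⟨hj.1, by rw [mem_preimage, hj.2]; exact hz₀.2⟩
        have h1 : ∀ᶠ x in 𝓝[≠] j, ¬ P x := (hloc j hjV).resolve_left fun h =>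
          (hne ▸ (⟨hjV, h⟩ : j ∈ V ∩ U) : j ∈ (∅ : Set ℂ))
        have hb := ball_mem_nhds (g z₀) hε
        have := ((hw j hj).1.differentiableAt hb).continuousAt.tendsto_nhdsNE_of_rightInverse
          (mem_of_superset hb fun ζ hζ => ((hw j hj).2.2 ζ hζ).2)
        rw [(hw j hj).2.1] at this
        exact this.eventually h1
    obtain ⟨ζ, h1, h2⟩ := (hall.and (nhdsWithin_le_nhds (ball_mem_nhds (g z₀) hε))).exists
    refine ⟨ζ, hεs h2, fun x hx y hy hxy => ?_⟩
    by_contra hne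
    obtain ⟨j, hj, rfl⟩ := (hfib ζ h2).2 ▸ hx
    exact h1 j hj ⟨y, hy.1, fun h => hne h.symm, hy.2.trans hx.2.symm, hxy.symm⟩
  · right
    have hsub : V ⊆ U := (isPreconnected_diff_of_discrete hg.isOpen hg.preconn
      hg.discrete_preimage_critVals).subset_of_closure_inter_subset hU hne fun z hz => by
      refine (hloc z hz.2).resolve_right fun h => ?_
      have h1 := eventually_nhdsWithin_iff.1 h
      obtain ⟨y, hyU, hy⟩ := ((mem_closure_iff_frequently.1 hz.1).and_eventually h1).exists
      by_cases hyz : y = z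
      · subst hyz
        obtain ⟨x, hx1, hx2⟩ := (h.and (nhdsWithin_le_nhds hyU)).exists
        exact hx1 hx2
      · exact hy hyz hyU.self_of_nhds
    exact fun z hz => (hsub hz).self_of_nhds

/-- A function that is separately holomorphic and bounded on a bidisc is holomorphic along
holomorphic curves. -/
theorem differentiableOn_comp₂_of_bounded {H : ℂ → ℂ → ℂ} {r C : ℝ} (hr : 0 < r)
    (h₁ : ∀ y ∈ ball (0 : ℂ) r, DifferentiableOn ℂ (fun x => H x y) (ball 0 r))
    (h₂ : ∀ x ∈ ball (0 : ℂ) r, DifferentiableOn ℂ (H x) (ball 0 r))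
    (hC : ∀ x ∈ ball (0 : ℂ) r, ∀ y ∈ ball (0 : ℂ) r, ‖H x y‖ ≤ C) {U : Set ℂ} (hU : IsOpen U)
    {A B : ℂ → ℂ} (hA : DifferentiableOn ℂ A U) (hB : DifferentiableOn ℂ B U)
    (hAr : ∀ t ∈ U, A t ∈ ball 0 (r / 4)) (hBr : ∀ t ∈ U, B t ∈ ball 0 (r / 4)) :
    DifferentiableOn ℂ (fun t => H (A t) (B t)) U := by
  have hsub : ∀ {s}, s ≤ r → ball (0 : ℂ) s ⊆ ball 0 r := fun h => ball_subset_ball h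
  have hsph : sphere (0 : ℂ) (r / 3) ⊆ ball 0 (r / 2) := fun w hw => by
    rw [mem_sphere_zero_iff_norm] at hw
    rw [mem_ball_zero_iff]
    linarith
  have hC0 : 0 ≤ C := (norm_nonneg _).trans (hC 0 (mem_ball_self hr) 0 (mem_ball_self hr))
  have hcont : ContinuousOn (Function.uncurry H) (ball 0 (r / 2) ×ˢ ball 0 (r / 2)) := by
    refine LipschitzOnWith.continuousOn (K := (⟨C / (r / 4) * 2, by positivity⟩ : NNReal))
      (LipschitzOnWith.of_dist_le_mul ?_)
    rintro ⟨x, y⟩ ⟨hx, hy⟩ ⟨x', y'⟩ ⟨hx', hy'⟩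
    dsimp only at hx hy hx' hy'
    have e1 := norm_sub_le_of_norm_le_on_ball hr (h₁ y (hsub (by linarith) hy))
      (fun w hw => hC w hw y (hsub (by linarith) hy)) hx' hx
    have e2 := norm_sub_le_of_norm_le_on_ball hr (h₂ x' (hsub (by linarith) hx'))
      (fun w hw => hC x' (hsub (by linarith) hx') w hw) hy' hy
    have e3 := norm_add_le (H x y - H x' y) (H x' y - H x' y')
    rw [sub_add_sub_cancel] at e3
    have e4 : ‖x - x'‖ ≤ dist (x, y) (x', y') := by
      rw [← dist_eq_norm]; exact le_max_left _ _
    have e5 : ‖y - y'‖ ≤ dist (x, y) (x', y') := by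
      rw [← dist_eq_norm]; exact le_max_right _ _
    have e6 : 0 ≤ C / (r / 4) := by positivity
    rw [Function.uncurry, Function.uncurry, dist_eq_norm]
    change ‖H x y - H x' y'‖ ≤ C / (r / 4) * 2 * _
    nlinarith [mul_le_mul_of_nonneg_left e4 e6, mul_le_mul_of_nonneg_left e5 e6]
  have hBw : ∀ t ∈ U, ∀ w ∈ sphere (0 : ℂ) (r / 3), w - B t ≠ 0 := fun t ht w hw h => by
    have h1 := mem_ball_zero_iff.1 (hBr t ht)
    rw [← sub_eq_zero.1 h, mem_sphere_zero_iff_norm.1 hw] at h1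
    linarith
  have key : DifferentiableOn ℂ (fun t => ∮ w in C(0, r / 3), (w - B t)⁻¹ • H (A t) w) U := by
    refine differentiableOn_circleIntegral hU (by positivity)
      (F := fun t w => (w - B t)⁻¹ • H (A t) w) ?_ fun w hw => ?_
    · refine ContinuousOn.smul (ContinuousOn.inv₀ (continuousOn_snd.sub
        (hB.continuousOn.comp continuousOn_fst fun x hx => hx.1)) fun x hx => hBw _ hx.1 _ hx.2) ?_
      refine hcont.comp ((hA.continuousOn.comp continuousOn_fst fun x hx => hx.1).prodMk
        continuousOn_snd) fun x hx => ⟨?_, hsph hx.2⟩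
      exact ball_subset_ball (by linarith) (hAr _ hx.1)
    · refine DifferentiableOn.smul (((differentiableOn_const w).sub hB).inv
        fun t ht => hBw t ht w hw) ?_
      exact (h₁ w (hsub (by linarith) (hsph hw))).comp hA fun t ht => hsub (by linarith) (hAr t ht)
  refine (key.const_smul ((2 * π * I : ℂ)⁻¹)).congr fun t ht => ?_
  refine (DiffContOnCl.two_pi_i_inv_smul_circleIntegral_sub_inv_smul ?_ ?_).symm
  · refine (h₂ (A t) (hsub (by linarith) (hAr t ht))).diffContOnCl_ball fun w hw => ?_
    rw [mem_closedBall_zero_iff] at hw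
    rw [mem_ball_zero_iff]
    linarith
  · exact ball_subset_ball (by linarith) (hBr t ht)

theorem eqOn_zero_of_forall_real {φ : ℂ → ℂ} {r : ℝ} (hr : 0 < r)
    (hφ : DifferentiableOn ℂ φ (ball 0 r)) (h : ∀ t : ℝ, |t| < r → φ t = 0) :
    EqOn φ 0 (ball 0 r) := by
  refine (hφ.analyticOnNhd isOpen_ball).eqOn_zero_of_preconnected_of_frequently_eq_zero
    (convex_ball 0 r).isPreconnected (mem_ball_self hr) ?_
  have ht : Tendsto (fun t : ℝ => (t : ℂ)) (𝓝[>] 0) (𝓝[≠] 0) := by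
    refine tendsto_nhdsWithin_iff.2 ⟨?_, ?_⟩
    · exact (continuous_ofReal.tendsto' 0 0 ofReal_zero).mono_left nhdsWithin_le_nhds
    · filter_upwards [self_mem_nhdsWithin] with t ht
      exact ofReal_ne_zero.2 (ne_of_gt ht)
  refine ht.frequently (Eventually.frequently ?_)
  filter_upwards [Ioo_mem_nhdsGT hr] with t ht
  exact h t (abs_lt.2 ⟨by linarith [ht.1], ht.2⟩)

/-- Polarization: a separately holomorphic function vanishing on the antidiagonal vanishes. -/
theorem eventually_eq_zero_of_forall_conj {H : ℂ → ℂ → ℂ} {r C : ℝ} (hr : 0 < r)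
    (h₁ : ∀ y ∈ ball (0 : ℂ) r, DifferentiableOn ℂ (fun x => H x y) (ball 0 r))
    (h₂ : ∀ x ∈ ball (0 : ℂ) r, DifferentiableOn ℂ (H x) (ball 0 r))
    (hC : ∀ x ∈ ball (0 : ℂ) r, ∀ y ∈ ball (0 : ℂ) r, ‖H x y‖ ≤ C)
    (h : ∀ x ∈ ball (0 : ℂ) r, H x (conj x) = 0) : ∀ᶠ x in 𝓝 0, H x 0 = 0 := by
  have hr8 : 0 < r / 8 := by positivity
  have hb : ∀ x ∈ ball (0 : ℂ) (r / 8), ∀ y ∈ ball (0 : ℂ) (r / 8), ∀ s : ℂ, ‖s‖ = 1 →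
      x + y * s ∈ ball (0 : ℂ) (r / 4) := fun x hx y hy s hs => by
    rw [mem_ball_zero_iff] at *
    have := norm_add_le x (y * s)
    rw [norm_mul, hs] at this
    linarith
  have hnI : ‖(-I : ℂ)‖ = 1 := by simp
  have hre : ∀ x y : ℝ, |x| < r / 8 → |y| < r / 8 → H (x + y * I) (x + y * -I) = 0 :=
    fun x y hx hy => by
      have := h (x + y * I) (ball_subset_ball (by linarith)
        (hb x (by simpa using hx) y (by simpa using hy) I norm_I))
      simpa using this
  have h1 : ∀ y : ℝ, |y| < r / 8 → ∀ x ∈ ball (0 : ℂ) (r / 8),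
      H (x + y * I) (x + y * -I) = 0 := fun y hy => by
    have hy' : (y : ℂ) ∈ ball (0 : ℂ) (r / 8) := by simpa using hy
    refine eqOn_zero_of_forall_real hr8 ?_ fun x hx => hre x y hx hy
    exact differentiableOn_comp₂_of_bounded hr h₁ h₂ hC isOpen_ball (by fun_prop) (by fun_prop)
      (fun x hx => hb x hx y hy' I norm_I) fun x hx => hb x hx y hy' _ hnI
  have h2 : ∀ x ∈ ball (0 : ℂ) (r / 8), ∀ y ∈ ball (0 : ℂ) (r / 8),
      H (x + y * I) (x + y * -I) = 0 := fun x hx => by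
    refine eqOn_zero_of_forall_real hr8 ?_ fun y hy => h1 y hy x hx
    exact differentiableOn_comp₂_of_bounded hr h₁ h₂ hC isOpen_ball (by fun_prop) (by fun_prop)
      (fun y hy => hb x hx y hy I norm_I) fun y hy => hb x hx y hy _ hnI
  filter_upwards [ball_mem_nhds (0 : ℂ) hr8] with x hx
  have hx' := mem_ball_zero_iff.1 hx
  have hx2 : ∀ s : ℂ, ‖s‖ = 1 → x / 2 * s ∈ ball (0 : ℂ) (r / 8) := fun s hs => by
    rw [mem_ball_zero_iff, norm_mul, hs, norm_div]
    norm_num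
    linarith
  have := h2 (x / 2) (by simpa using hx2 1 norm_one) (x / 2 * -I) (hx2 _ hnI)
  have e1 : x / 2 + x / 2 * -I * I = x := by linear_combination (-x / 2) * I_sq
  have e2 : x / 2 + x / 2 * -I * -I = 0 := by linear_combination (x / 2) * I_sq
  rwa [e1, e2] at this

/-- Some Ahlfors map separates the points of some regular fibre of a given one. -/
theorem AhlforsSystem.exists_injOn_fibre {Ω : Set ℂ} {S f : ℂ → ℂ → ℂ}
    (hs : AhlforsSystem Ω S f) {a : ℂ} (ha : a ∈ Ω) :
    ∃ b ∈ Ω, ∃ ζ ∈ ball (0 : ℂ) 1 \ critVals Ω (f a), InjOn (f b) (fibre Ω (f a) ζ) := by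
  classical
  by_contra! hcon
  have hg := hs.proper a ha
  set g := f a
  have hzero : ∀ b ∈ Ω \ g ⁻¹' critVals Ω g, ∃ w ∈ Ω, w ≠ b ∧ g w = g b ∧ S b w = 0 :=
    fun b hb => by
      obtain ⟨ζ, hζ, h⟩ | h := hg.exists_injOn_fibre_or (hs.diff_map b hb.1)
      · exact absurd h (hcon b hb.1 ζ hζ)
      · obtain ⟨w, hw, hne, h1, h2⟩ := h b hb
        exact ⟨w, hw, hne, h1, hs.zero b hb.1 w hw hne (h2.trans (hs.map_self b hb.1))⟩
  obtain ⟨b, hb⟩ : (Ω \ g ⁻¹' critVals Ω g).Nonempty :=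
    closure_nonempty_iff.1 ⟨a, diff_dense_of_discrete hg.isOpen hg.discrete_preimage_critVals ha⟩
  have hζ : g b ∈ ball (0 : ℂ) 1 \ critVals Ω g := ⟨hg.maps b hb.1, hb.2⟩
  obtain ⟨ε, hε, hεs, w, hw, hfib⟩ := hg.exists_branches hζ
  have hbf : b ∈ fibre Ω g (g b) := ⟨hb.1, rfl⟩
  have hfin := hg.finite_fibre hζ.1
  set J := hfin.toFinset.erase b
  have hJ : ∀ j ∈ J, j ∈ fibre Ω g (g b) ∧ j ≠ b := fun j hj => by
    rw [Finset.mem_erase, Finite.mem_toFinset] at hj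
    exact hj.symm
  have hbε := ball_mem_nhds (g b) hε
  have hwt : ∀ j ∈ fibre Ω g (g b), Tendsto (w j) (𝓝 (g b)) (𝓝 j) := fun j hj => by
    have := ((hw j hj).1.differentiableAt hbε).continuousAt
    rwa [ContinuousAt, (hw j hj).2.1] at this
  obtain ⟨r, hr, hrε, hbd⟩ : ∃ r > 0, r ≤ ε ∧ ∀ j ∈ J, ∃ C, ∀ x ∈ ball (g b) r,
      ∀ y ∈ ball (g b) r, ‖S (w b x) (w j y)‖ ≤ C := by
    have h1 : ∀ j ∈ J, ∃ C, ∀ᶠ r in 𝓝[>] (0 : ℝ), ∀ x ∈ ball (g b) r, ∀ y ∈ ball (g b) r,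
        ‖S (w b x) (w j y)‖ ≤ C := fun j hj => by
      obtain ⟨C, s, hs', hC⟩ := hs.bounded b hb.1 j (hJ j hj).1.1
      obtain ⟨t, ht, hts⟩ := Metric.eventually_nhds_iff_ball.1
        (((hwt b hbf).eventually (ball_mem_nhds b hs')).and
          ((hwt j (hJ j hj).1).eventually (ball_mem_nhds j hs')))
      refine ⟨C, ?_⟩
      filter_upwards [Ioo_mem_nhdsGT ht] with r hr x hx y hy
      exact hC _ (hts x (ball_subset_ball hr.2.le hx)).1 _ (hts y (ball_subset_ball hr.2.le hy)).2
    choose! C hC using h1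
    obtain ⟨r, h2, h3⟩ := (((Finset.eventually_all J).2 hC).and (Ioo_mem_nhdsGT hε)).exists
    exact ⟨r, h3.1, h3.2.le, fun j hj => ⟨C j, h2 j hj⟩⟩
  choose! C hC using hbd
  set H : ℂ → ℂ → ℂ := fun x y => ∏ j ∈ J, S (w b (g b + conj y)) (w j (g b + x))
  have hmem : ∀ x ∈ ball (0 : ℂ) r, g b + x ∈ ball (g b) r := fun x hx => by simpa using hx
  have hconj : ∀ x ∈ ball (0 : ℂ) r, conj x ∈ ball (0 : ℂ) r := fun x hx => by simpa using hx
  have hwd : ∀ j ∈ fibre Ω g (g b), DifferentiableOn ℂ (fun x => w j (g b + x)) (ball 0 r) :=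
    fun j hj => (hw j hj).1.comp (by fun_prop) fun x hx => ball_subset_ball hrε (hmem x hx)
  have hwΩ : ∀ j ∈ fibre Ω g (g b), ∀ x ∈ ball (0 : ℂ) r, w j (g b + x) ∈ Ω :=
    fun j hj x hx => ((hw j hj).2.2 _ (ball_subset_ball hrε (hmem x hx))).1
  have hH := eventually_eq_zero_of_forall_conj (H := H) (C := ∏ j ∈ J, C j) hr
    (fun y hy => DifferentiableOn.fun_finsetProd fun j hj =>
      (hs.diff _ (hwΩ b hbf _ (hconj y hy))).comp (hwd j (hJ j hj).1) (hwΩ j (hJ j hj).1))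
    (fun x hx => DifferentiableOn.fun_finsetProd fun j hj => by
      have h1 := (hs.diff _ (hwΩ j (hJ j hj).1 x hx)).comp (hwd b hbf) (hwΩ b hbf)
      intro y hy
      have h2 := (h1.differentiableAt (isOpen_ball.mem_nhds (hconj y hy))).conj_conj
      rw [Complex.conj_conj] at h2
      refine DifferentiableAt.differentiableWithinAt (h2.congr_of_eventuallyEq ?_)
      filter_upwards [isOpen_ball.mem_nhds hy] with z hz
      exact hs.symm _ (hwΩ b hbf _ (hconj z hz)) _ (hwΩ j (hJ j hj).1 x hx))
    (fun x hx y hy => by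
      rw [norm_prod]
      exact Finset.prod_le_prod (fun _ _ => norm_nonneg _) fun j hj =>
        hC j hj _ (hmem _ (hconj y hy)) _ (hmem x hx))
    fun x hx => by
      have hx' := ball_subset_ball hrε (hmem x hx)
      obtain ⟨h1, h2⟩ := (hw b hbf).2.2 _ hx'
      obtain ⟨z, hz, hne, hgz, hS⟩ := hzero (w b (g b + x)) ⟨h1, by
        rw [mem_preimage, h2]; exact (hεs hx').2⟩
      have hz' : z ∈ fibre Ω g (g b + x) := ⟨hz, hgz.trans h2⟩
      rw [(hfib _ hx').2] at hz'
      obtain ⟨j, hj, rfl⟩ := hz'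
      refine Finset.prod_eq_zero (i := j) ?_ (by simpa using hS)
      rw [Finset.mem_erase, Finite.mem_toFinset]
      exact ⟨fun h => hne (by rw [h]), hj⟩
  have hne : ∀ᶠ ζ in 𝓝[≠] (g b), ∀ j ∈ J, S b (w j ζ) ≠ 0 := by
    refine (Finset.eventually_all J).2 fun j hj => ?_
    have hj' := (hJ j hj).1
    have := ((hw j hj').1.differentiableAt hbε).continuousAt.tendsto_nhdsNE_of_rightInverse
      (mem_of_superset hbε fun ζ hζ => ((hw j hj').2.2 ζ hζ).2)
    rw [(hw j hj').2.1] at this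
    exact this.eventually (eventually_ne_zero_of_differentiableOn
      hg.isOpen hg.preconn (hs.diff b hb.1) ⟨b, hb.1, hs.self_ne_zero b hb.1⟩ hj'.1)
  have hH' : ∀ᶠ ζ in 𝓝[≠] (g b), H (ζ - g b) 0 = 0 := by
    refine nhdsWithin_le_nhds (Tendsto.eventually ?_ hH)
    exact (continuous_sub_right (g b)).tendsto' _ _ (sub_self _)
  obtain ⟨ζ, h1, h2⟩ := (hne.and hH').exists
  obtain ⟨j, hj, h3⟩ := Finset.prod_eq_zero_iff.1 h2
  simp only [map_zero, add_zero, add_sub_cancel, (hw b hbf).2.1] at h3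
  exact h1 j hj h3

theorem integrable_indicator_norm_inv :
    Integrable ((ball (0 : ℂ) 1).indicator fun w => ‖w‖⁻¹) := by
  rw [integrable_indicator_iff measurableSet_ball]
  refine integrableOn_ball_of_norm_le_rpow (C := 1) (α := 1) (by simp) (by simp)
    (Eventually.of_forall fun w => ?_) (by fun_prop)
  simp [Real.rpow_neg_one]

/-- The Cauchy transform of a set of finite area. -/
def areaCauchyTransform (E : Set ℂ) (z : ℂ) : ℂ := ∫ w in E, (w - z)⁻¹

theorem norm_inv_sub_le (z w : ℂ) :
    ‖(w - z)⁻¹‖ ≤ 1 + (ball (0 : ℂ) 1).indicator (fun w => ‖w‖⁻¹) (w - z) := by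
  rw [norm_inv]
  by_cases h : w - z ∈ ball (0 : ℂ) 1
  · rw [indicator_of_mem h]
    linarith
  · rw [indicator_of_notMem h, add_zero]
    exact inv_le_one_of_one_le₀ (by simpa using h)

theorem integrableOn_dominating {E : Set ℂ} (hE : volume E < ⊤) (z : ℂ) : IntegrableOn
    (fun w => 1 + (ball (0 : ℂ) 1).indicator (fun w => ‖w‖⁻¹) (w - z)) E :=
  (integrableOn_const hE.ne).add (integrable_indicator_norm_inv.comp_sub_right z).integrableOn

theorem norm_areaCauchyTransform_le {E : Set ℂ} (hE : volume E < ⊤) (z : ℂ) :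
    ‖areaCauchyTransform E z‖ ≤
      volume.real E + ∫ w, (ball (0 : ℂ) 1).indicator (fun w => ‖w‖⁻¹) w := by
  refine (norm_integral_le_of_norm_le (integrableOn_dominating hE z)
    (Eventually.of_forall (norm_inv_sub_le z))).trans ?_
  rw [integral_add (integrableOn_const hE.ne).integrable
    (integrable_indicator_norm_inv.comp_sub_right z).integrableOn, setIntegral_const, smul_eq_mul,
    mul_one,
    ← integral_sub_right_eq_self (μ := volume) ((ball (0 : ℂ) 1).indicator fun w => ‖w‖⁻¹) z]
  refine add_le_add le_rfl ?_
  exact setIntegral_le_integral (integrable_indicator_norm_inv.comp_sub_right z)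
    (Eventually.of_forall fun w => indicator_nonneg (fun _ _ => by positivity) _)

theorem hasDerivAt_areaCauchyTransform {E : Set ℂ} (hE : volume E < ⊤) (hm : MeasurableSet E) {z : ℂ}
    {r : ℝ} (hr : 0 < r) (h : Disjoint (ball z r) E) :
    IntegrableOn (fun w => ((w - z) ^ 2)⁻¹) E ∧
      HasDerivAt (areaCauchyTransform E) (∫ w in E, ((w - z) ^ 2)⁻¹) z := by
  have hdist : ∀ w ∈ E, ∀ x ∈ ball z (r / 2), r / 2 ≤ ‖w - x‖ := fun w hw x hx => by
    have h1 : r ≤ ‖w - z‖ := by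
      simpa [dist_eq_norm] using disjoint_right.1 h hw
    have h2 := mem_ball_iff_norm.1 hx
    have h3 := norm_sub_le_norm_sub_add_norm_sub w x z
    linarith
  refine hasDerivAt_integral_of_dominated_loc_of_deriv_le (ball_mem_nhds z (half_pos hr))
    (F' := fun x w => ((w - x) ^ 2)⁻¹) (bound := fun _ => ((r / 2) ^ 2)⁻¹)
    (Eventually.of_forall fun x => by fun_prop) ?_ (by fun_prop) ?_ (integrableOn_const hE.ne) ?_
  · exact (integrableOn_dominating hE z).mono' (by fun_prop)
      (Eventually.of_forall (norm_inv_sub_le z))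
  · filter_upwards [ae_restrict_mem hm] with w hw x hx
    rw [norm_inv, norm_pow]
    gcongr
    exact hdist w hw x hx
  · filter_upwards [ae_restrict_mem hm] with w hw x hx
    have hne : w - x ≠ 0 := norm_pos_iff.1 ((half_pos hr).trans_le (hdist w hw x hx))
    refine (((hasDerivAt_id x).const_sub w).inv hne).congr_deriv ?_
    rw [neg_neg, one_div, id]

/-- A domain of finite area carries bounded holomorphic functions with nonzero derivative. -/
theorem exists_bounded_deriv_ne_zero {Ω : Set ℂ} (hΩ : IsOpen Ω) (hA : volume Ω < ⊤) {a : ℂ}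
    (ha : a ∈ Ω) : ∃ C, ∃ g : ℂ → ℂ, DifferentiableOn ℂ g Ω ∧ (∀ z ∈ Ω, ‖g z‖ ≤ C) ∧
      deriv g a ≠ 0 := by
  obtain ⟨R, hR, hRΩ⟩ : ∃ R : ℝ, 0 < R ∧ volume Ω < volume (ball (a + 4 * R : ℂ) R) := by
    refine ⟨(volume Ω).toReal + 1, by positivity, ?_⟩
    have h0 : 0 ≤ (volume Ω).toReal := ENNReal.toReal_nonneg
    rw [Complex.volume_ball, ← ENNReal.ofReal_toReal hA.ne, ← ENNReal.ofReal_pow (by simp; positivity),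
      ← ENNReal.ofReal_coe_nnreal, ← ENNReal.ofReal_mul (by positivity), NNReal.coe_real_pi,
      ENNReal.ofReal_lt_ofReal_iff (by positivity),
      ENNReal.toReal_ofReal h0]
    nlinarith [Real.pi_gt_three]
  set B := ball (a + 4 * R : ℂ) R
  have hB : volume B < ⊤ := measure_ball_lt_top
  have hE : volume (B \ Ω) < ⊤ := (measure_mono sdiff_subset).trans_lt hB
  have hpos : 0 < volume (B \ Ω) := by
    rw [pos_iff_ne_zero]
    intro h
    have := measure_mono_ae (μ := volume) (ae_le_set.2 h)
    exact absurd hRΩ this.not_gt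
  have hm : MeasurableSet (B \ Ω) := measurableSet_ball.diff hΩ.measurableSet
  have hd : ∀ z ∈ Ω, IntegrableOn (fun w => ((w - z) ^ 2)⁻¹) (B \ Ω) ∧
      HasDerivAt (areaCauchyTransform (B \ Ω)) (∫ w in B \ Ω, ((w - z) ^ 2)⁻¹) z := fun z hz => by
    obtain ⟨r, hr, hs⟩ := Metric.isOpen_iff.1 hΩ z hz
    exact hasDerivAt_areaCauchyTransform hE hm hr (disjoint_left.2 fun w h1 h2 => h2.2 (hs h1))
  refine ⟨_, areaCauchyTransform (B \ Ω), fun z hz =>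
    (hd z hz).2.differentiableAt.differentiableWithinAt, fun z _ => norm_areaCauchyTransform_le hE z, ?_⟩
  obtain ⟨hi, hda⟩ := hd a ha
  rw [hda.deriv]
  have hre : ∀ w ∈ B \ Ω, 0 < (((w - a) ^ 2)⁻¹).re := fun w hw => by
    have h1 := mem_ball_iff_norm.1 hw.1
    have h2 := abs_lt.1 ((abs_re_le_norm _).trans_lt h1)
    have h3 := abs_lt.1 ((abs_im_le_norm _).trans_lt h1)
    simp at h2 h3
    have h4 : 0 < ((w - a) ^ 2).re := by
      simp only [pow_two, mul_re, sub_re, sub_im]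
      nlinarith
    rw [inv_re]
    exact div_pos h4 (normSq_pos.2 fun h => by simp [h] at h4)
  intro h0
  have h1 : ∫ w in B \ Ω, (((w - a) ^ 2)⁻¹).re = 0 := by
    have := integral_re hi
    simp only [RCLike.re_eq_complex_re] at this
    rw [this, h0, zero_re]
  have h2 := (setIntegral_eq_zero_iff_of_nonneg_ae
    ((ae_restrict_mem hm).mono fun w hw => (hre w hw).le) hi.re).1 h1
  have h3 : ∀ᵐ w ∂volume.restrict (B \ Ω), False := by
    filter_upwards [h2, ae_restrict_mem hm] with w h3 h4
    exact (hre w h4).ne' h3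
  rw [eventually_false_iff_eq_bot, ae_eq_bot, Measure.restrict_eq_zero] at h3
  exact hpos.ne' h3

/-- The Ahlfors extremal problem has a solution on a domain with enough bounded functions. -/
theorem exists_extremal_map {Ω : Set ℂ} (hΩ : IsOpen Ω) (hc : IsPreconnected Ω) {a : ℂ}
    (ha : a ∈ Ω) {C : ℝ} {g : ℂ → ℂ} (hg : DifferentiableOn ℂ g Ω) (hgC : ∀ z ∈ Ω, ‖g z‖ ≤ C)
    (hga : deriv g a ≠ 0) : ∃ f : ℂ → ℂ, DifferentiableOn ℂ f Ω ∧ (∀ z ∈ Ω, ‖f z‖ < 1) ∧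
      (deriv f a).im = 0 ∧ 0 < (deriv f a).re ∧ ∀ g : ℂ → ℂ, DifferentiableOn ℂ g Ω →
        (∀ z ∈ Ω, ‖g z‖ < 1) → ‖deriv g a‖ ≤ (deriv f a).re := by
  set K := {t | ∃ g : ℂ → ℂ, DifferentiableOn ℂ g Ω ∧ (∀ z ∈ Ω, ‖g z‖ ≤ 1) ∧ ‖deriv g a‖ = t}
  have hnhds := hΩ.mem_nhds ha
  have hK : BddAbove K := by
    obtain ⟨r, hr, hs⟩ := Metric.nhds_basis_closedBall.mem_iff.1 hnhds
    refine ⟨1 / r, ?_⟩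
    rintro _ ⟨g, hg, hg1, rfl⟩
    exact Complex.norm_deriv_le_of_forall_mem_sphere_norm_le hr (hg.diffContOnCl_ball hs)
      fun z hz => hg1 z (hs (sphere_subset_closedBall hz))
  have hmem : ‖deriv (fun z => ((|C| + 1 : ℝ) : ℂ)⁻¹ * g z) a‖ ∈ K := by
    refine ⟨_, hg.const_mul _, fun z hz => ?_, rfl⟩
    rw [norm_mul, norm_inv, norm_real, Real.norm_of_nonneg (by positivity), inv_mul_le_one₀
      (by positivity)]
    exact (hgC z hz).trans ((le_abs_self C).trans (by linarith))
  have hM : 0 < sSup K := by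
    refine lt_of_lt_of_le ?_ (le_csSup hK hmem)
    rw [deriv_const_mul _ (hg.differentiableAt hnhds), norm_pos_iff]
    refine mul_ne_zero (inv_ne_zero (ofReal_ne_zero.2 (by positivity))) hga
  obtain ⟨u, -, hu, huK⟩ := exists_seq_tendsto_sSup ⟨_, hmem⟩ hK
  choose G hGd hG1 hGu using huK
  set l : Ultrafilter ℕ := hyperfilter ℕ
  have hlim : ∀ z, ∃ x, z ∈ Ω → ‖x‖ ≤ 1 ∧ Tendsto (fun n => G n z) l (𝓝 x) := fun z => by
    by_cases hz : z ∈ Ω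
    · obtain ⟨x, hx⟩ := l.exists_tendsto_of_norm_le (Eventually.of_forall fun n => hG1 n z hz)
      exact ⟨x, fun _ => hx⟩
    · exact ⟨0, fun h => absurd h hz⟩
  choose F hF using hlim
  obtain ⟨hFd, -, hFa⟩ := tendstoLocallyUniformlyOn_of_locally_bounded (l := (l : Filter ℕ))
    (F := G) (f := F) (fun z hz => by
      obtain ⟨r, hr, hs⟩ := Metric.isOpen_iff.1 hΩ z hz
      exact ⟨1, r, hr, Eventually.of_forall fun n => ⟨(hGd n).mono hs, fun w hw => hG1 n w (hs hw)⟩⟩)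
    hΩ fun z hz => (hF z hz).2
  have hd : ‖deriv F a‖ = sSup K := by
    refine tendsto_nhds_unique (hFa a ha).norm ?_
    simp only [hGu]
    exact hu.mono_left Nat.hyperfilter_le_atTop
  have hda := (hFd.differentiableAt hnhds)
  have hd0 : (‖deriv F a‖ : ℂ) ≠ 0 := ofReal_ne_zero.2 (hd ▸ hM.ne')
  set c : ℂ := conj (deriv F a) / ‖deriv F a‖
  have hc1 : ‖c‖ = 1 := by
    rw [norm_div, RCLike.norm_conj, norm_real, norm_norm, div_self (hd ▸ hM.ne')]
  have hcd : deriv (fun z => c * F z) a = (sSup K : ℝ) := by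
    rw [deriv_const_mul _ hda, ← hd, div_mul_eq_mul_div, conj_mul', pow_two, mul_div_cancel_right₀ _
      hd0]
  have hle : ∀ z ∈ Ω, ‖c * F z‖ ≤ 1 := fun z hz => by
    rw [norm_mul, hc1, one_mul]
    exact (hF z hz).1
  refine ⟨fun z => c * F z, hFd.const_mul c, fun z hz => (hle z hz).lt_of_ne fun h => ?_, ?_, ?_,
    fun g hg hg1 => ?_⟩
  · have hconst := Complex.eqOn_of_isPreconnected_of_isMaxOn_norm hc hΩ (hFd.const_mul c) hz
      fun w hw => (hle w hw).trans h.ge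
    have h0 := (hconst.eventuallyEq_of_mem hnhds).deriv_eq
    rw [hcd, show deriv (Function.const ℂ (c * F z)) a = 0 from deriv_const _ _] at h0
    exact hM.ne' (ofReal_eq_zero.1 h0)
  · rw [hcd, ofReal_im]
  · rwa [hcd, ofReal_re]
  · rw [hcd, ofReal_re]
    exact le_csSup hK ⟨g, hg, fun z hz => (hg1 z hz).le, rfl⟩

theorem ProperDisc.bdryUnimodular {Ω : Set ℂ} {F g : ℂ → ℂ} (hF : ProperDisc Ω F)
    (hg : DifferentiableOn ℂ g Ω) (hg1 : ∀ z ∈ Ω, ‖g z‖ < 1) : BdryUnimodular Ω g F := by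
  intro ε hε
  have hK := hF.proper (closedBall 0 (1 - ε)) (closedBall_subset_ball (by linarith))
    (isCompact_closedBall 0 (1 - ε))
  obtain hne | hne := (Ω ∩ F ⁻¹' closedBall 0 (1 - ε)).eq_empty_or_nonempty
  · refine ⟨0, one_pos, fun z hz _ => ?_⟩
    by_contra! h
    exact hne.le ⟨hz, mem_closedBall_zero_iff.2 h⟩
  · obtain ⟨x, hx, hmax⟩ := hK.exists_isMaxOn hne (hg.continuousOn.norm.mono inter_subset_left)
    refine ⟨‖g x‖, hg1 x hx.1, fun z hz hr => ?_⟩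
    by_contra! h
    exact absurd (hmax ⟨hz, mem_closedBall_zero_iff.2 h⟩) (not_le.2 hr)

/-- for a quadrature domain of finite area there are two Ahlfors maps `fa`, `fb`
such that every proper holomorphic map of `Ω` onto the unit disc is a rational combination of
`fa` and `fb`. -/
theorem stmt_4 (Ω : Set ℂ) (hΩ : IsFinConnDomain Ω) (hA : volume Ω < ⊤)
    (hq : IsQuadratureDomain Ω) :
    ∃ a ∈ Ω, ∃ b ∈ Ω, ∃ fa fb : ℂ → ℂ,
      IsAhlforsMap Ω a fa ∧ IsAhlforsMap Ω b fb ∧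
      ∀ f : ℂ → ℂ, IsProperOntoDisc Ω f →
        ∃ P Q : MvPolynomial (Fin 2) ℂ,
          (∃ z ∈ Ω, MvPolynomial.eval ![fa z, fb z] Q ≠ 0) ∧
          ∀ z ∈ Ω,
            f z * MvPolynomial.eval ![fa z, fb z] Q = MvPolynomial.eval ![fa z, fb z] P := by
  have ho := hΩ.1
  have hc := hΩ.2.1.isPreconnected
  obtain ⟨a, ha⟩ := hΩ.2.1.nonempty
  by_cases hp : ∃ p, IsProperOntoDisc Ω p
  · have htr : ∀ p, IsProperOntoDisc Ω p → ProperDisc Ω p := fun p hp =>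
      ⟨ho, hc, hp.1, fun z hz => hp.2.1 ▸ mem_image_of_mem p hz,
        fun ζ hζ => (hp.2.1.symm ▸ hζ : ζ ∈ p '' Ω), hp.2.2⟩
    obtain ⟨p, hp⟩ := hp
    obtain ⟨S, f, hs⟩ := (htr p hp).exists_ahlforsSystem
    obtain ⟨b, hb, hsep⟩ := hs.exists_injOn_fibre ha
    have hahl : ∀ x ∈ Ω, IsAhlforsMap Ω x (f x) := fun x hx => ⟨hs.diff_map x hx,
      hs.norm_map_lt x hx, hs.im_deriv x hx, hs.re_deriv_pos x hx, hs.extremal x hx⟩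
    have hu : ∀ F, ProperDisc Ω F → BdryUnimodular Ω (f a) F := fun F hF =>
      hF.bdryUnimodular (hs.diff_map a ha) (hs.norm_map_lt a ha)
    exact ⟨a, ha, b, hb, f a, f b, hahl a ha, hahl b hb, fun F hF =>
      (hs.proper a ha).exists_rational_combination (hs.diff_map b hb)
        (fun z hz => (hs.norm_map_lt b hb z hz).le) (hu _ (hs.proper b hb)) hF.1
        (fun z hz => (mem_ball_zero_iff.1 ((htr F hF).maps z hz)).le) (hu F (htr F hF)) hsep⟩
  · obtain ⟨C, g, hg, hgC, hga⟩ := exists_bounded_deriv_ne_zero ho hA ha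
    obtain ⟨f, hf⟩ := exists_extremal_map ho hc ha hg hgC hga
    exact ⟨a, ha, a, ha, f, f, hf, hf, fun F hF => absurd ⟨F, hF⟩ hp⟩
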